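/- Let n ≥ 2 and let μ : NC_n → ℂ satisfy Σ_{π∈NC_n} μ_π = 1 and the stationarity system, and assume μ is the unique such vector (i.e., every v : NC_n → ℂ with Σ_π v_π = 1 satisfying the stationarity system equals μ). Then Σ_{π∈NC_n : π(1)=2 and π(3)=4} μ_π = (1/8) · (97n⁶ + 82n⁴ − 107n² − 792) / ((4n²−1)²(4n²−9)). -/

import Mathlib

open scoped BigOperators

open MvPolynomial

attribute [local instance 10] Classical.propDecidable

/-- A noncrossing matching of order `n`, on the points `0, …, 2n-1`
(representing the 1-indexed points `1, …, 2n`): a fixed-point-free involution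
with no crossing `a < b < c < d`, `f a = c`, `f b = d`. -/
structure NCM (n : ℕ) where
  f : Fin (2 * n) → Fin (2 * n)
  invol : ∀ k, f (f k) = k
  nofix : ∀ k, f k ≠ k
  noncross : ∀ a b c d : Fin (2 * n), a < b → b < c → c < d → f a = c → f b = d → False

theorem NCM.ext' {n : ℕ} {π σ : NCM n} (h : π.f = σ.f) : π = σ := by
  cases π; cases σ; simpa using h

noncomputable instance {n : ℕ} : Fintype (NCM n) :=
  Fintype.ofInjective NCM.f fun _ _ h => NCM.ext' h

/-- `q = e^{2πi/3}`. -/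
noncomputable def q : ℂ := Complex.exp (2 * Real.pi * Complex.I / 3)

/-- A wheel polynomial of order `n`: homogeneous of total degree `n(n-1)` and
vanishing under every substitution `z_j := q² z_i`, `z_k := q⁴ z_i` for `i < j < k`. -/
def IsWheel (n : ℕ) (p : MvPolynomial (Fin (2 * n)) ℂ) : Prop :=
  p.IsHomogeneous (n * (n - 1)) ∧
  ∀ i j k : Fin (2 * n), i < j → j < k →
    (aeval fun l : Fin (2 * n) =>
      if l = j then C (q ^ 2) * X i
      else if l = k then C (q ^ 4) * X i
      else (X l : MvPolynomial (Fin (2 * n)) ℂ)) p = 0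

/-- The `π`-evaluation `p(π) = p(q^{-π_1}, …, q^{-π_{2n}})`, where the `k`-th coordinate
is `q⁻¹` if `π` matches `k` to the right and `q` if it matches `k` to the left. -/
noncomputable def evalNC {n : ℕ} (p : MvPolynomial (Fin (2 * n)) ℂ) (π : NCM n) : ℂ :=
  eval (fun k => if k < π.f k then q⁻¹ else q) p

/-- Evaluation of a polynomial with all variables set to `1`. -/
noncomputable def evalOne {n : ℕ} (p : MvPolynomial (Fin (2 * n)) ℂ) : ℂ :=
  eval (fun _ => (1 : ℂ)) p

/-- The alternating sign matrix numbers `ASM(n) = ∏_{j=0}^{n-1} (3j+1)!/(n+j)!`. -/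
noncomputable def ASM (n : ℕ) : ℂ :=
  ∏ j ∈ Finset.range n, ((3 * j + 1).factorial : ℂ) / ((n + j).factorial : ℂ)

/-- Cyclic successor on `Fin m`. -/
def fsucc {m : ℕ} (k : Fin m) : Fin m := ⟨((k : ℕ) + 1) % m, Nat.mod_lt _ k.pos⟩

/-- The Temperley–Lieb operator `e_k` (underlying function on points): if `π` matches
`k` with `k+1` it is `π`; otherwise it matches `k ↔ k+1`, `π(k) ↔ π(k+1)` and agrees
with `π` elsewhere (indices cyclic modulo `2n`). -/
def eRaw {n : ℕ} (k : Fin (2 * n)) (π : NCM n) : Fin (2 * n) → Fin (2 * n) :=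
  if π.f k = fsucc k then π.f
  else fun m =>
    if m = k then fsucc k
    else if m = fsucc k then k
    else if m = π.f k then π.f (fsucc k)
    else if m = π.f (fsucc k) then π.f k
    else π.f m

/-- The stationarity linear system `2n·v_π = Σ_{k=1}^{2n} Σ_{π' : e_k(π') = π} v_{π'}`. -/
def Stationary {n : ℕ} (v : NCM n → ℂ) : Prop :=
  ∀ π : NCM n, ((2 * n : ℕ) : ℂ) * v π =
    ∑ k : Fin (2 * n), ∑ π' : NCM n, if eRaw k π' = π.f then v π' else 0

namespace LP

/-! ### Part A: uniqueness theorem for the linear relations -/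

noncomputable def Eo (p : ℝ) : List Bool → (List Bool → ℝ) → ℝ
  | [], _ => 0
  | true :: J, K => p⁻¹ * Eo p J (fun w => K (true :: w))
  | false :: J, K => p * Eo p J (fun w => K (false :: w)) + K (true :: J)

noncomputable def Er (p : ℝ) : ℕ → (List Bool → ℝ) → List Bool → ℝ
  | 0, K => K
  | r + 1, K => fun w => Eo p w (Er p r K)

noncomputable def cc (p : ℝ) : ℕ → ℝ
  | 0 => 0
  | r + 1 => p * cc p r + (p⁻¹) ^ r

lemma cc_pos {p : ℝ} (hp : 0 < p) (r : ℕ) : 0 < cc p (r + 1) := by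
  induction r with
  | zero => simp [cc]
  | succ r ih => rw [cc]; positivity

lemma Eo_lin (p : ℝ) (a b : ℝ) (J : List Bool) : ∀ (K L : List Bool → ℝ),
    Eo p J (fun w => a * K w + b * L w) = a * Eo p J K + b * Eo p J L := by
  induction J with
  | nil => intros; simp [Eo]
  | cons c J ih =>
    intro K L
    cases c <;> simp only [Eo, ih] <;> ring

lemma Eo_smul (p : ℝ) (a : ℝ) (J : List Bool) (K : List Bool → ℝ) :
    Eo p J (fun w => a * K w) = a * Eo p J K := by
  have := Eo_lin p a 0 J K K
  simpa using this

lemma Er_up (p : ℝ) (r : ℕ) (K : List Bool → ℝ) (J : List Bool) :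
    Er p r K (true :: J) = (p⁻¹) ^ r * Er p r (fun w => K (true :: w)) J := by
  induction r generalizing J with
  | zero => simp [Er]
  | succ r ih =>
    simp only [Er, Eo, ih, Eo_smul]; ring

lemma Er_dn (p : ℝ) (r : ℕ) (K : List Bool → ℝ) (J : List Bool) :
    Er p (r + 1) K (false :: J) = p ^ (r + 1) * Er p (r + 1) (fun w => K (false :: w)) J
      + cc p (r + 1) * Er p r (fun w => K (true :: w)) J := by
  induction r generalizing J with
  | zero => simp [Er, Eo, cc]
  | succ r ih =>
    show Eo p (false :: J) (Er p (r + 1) K) = _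
    rw [Eo]
    simp only [ih, Er_up, Eo_lin]
    rw [show cc p (r + 1 + 1) = p * cc p (r + 1) + (p⁻¹) ^ (r + 1) from rfl]
    simp only [Er]
    ring

lemma Eo_supp (p : ℝ) (w : List Bool) : ∀ (K : List Bool → ℝ),
    (∀ v : List Bool, v.length = w.length → v.count true = w.count true + 1 → K v = 0) →
    Eo p w K = 0 := by
  induction w with
  | nil => intros; simp [Eo]
  | cons c J ih =>
    intro K h
    cases c with
    | false =>
      rw [Eo, ih, h]
      · simp
      · simp
      · simp
      · intro v h1 h2
        apply h <;> simp [h1, h2]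
    | true =>
      rw [Eo, ih]
      · simp
      · intro v h1 h2
        apply h <;> simp [h1, h2]

lemma Eo_congr (p : ℝ) (w : List Bool) (K L : List Bool → ℝ)
    (h : ∀ v : List Bool, v.length = w.length → v.count true = w.count true + 1 → K v = L v) :
    Eo p w K = Eo p w L := by
  have := Eo_lin p 1 (-1) w K L
  rw [Eo_supp] at this
  · linarith
  · intro v h1 h2
    rw [h v h1 h2]; ring

lemma Er_supp (p : ℝ) (r : ℕ) (K : List Bool → ℝ) : ∀ (w : List Bool),
    (∀ v : List Bool, v.length = w.length → v.count true = w.count true + r → K v = 0) →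
    Er p r K w = 0 := by
  induction r with
  | zero => intro w h; exact h w rfl rfl
  | succ r ih =>
    intro w h
    rw [Er]
    apply Eo_supp
    intro v h1 h2
    apply ih
    intro v' h3 h4
    apply h <;> omega

lemma lemP {p : ℝ} (hp : 0 < p) (N : ℕ) : ∀ (K : List Bool → ℝ) (u : ℕ), N ≤ 2 * u → u ≤ N →
    (∀ w : List Bool, w.length = N → w.count true + u = N → Er p (2 * u - N) K w = 0) →
    ∀ w : List Bool, w.length = N → w.count true = u → K w = 0 := by
  induction N with
  | zero =>
    intro K u _ hu h w hw hc
    obtain rfl : u = 0 := by omega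
    obtain rfl : w = [] := by simpa using hw
    simpa [Er] using h [] rfl rfl
  | succ N ih =>
    intro K u h1 h2 h w hw hc
    by_cases h3 : 2 * u = N + 1
    · have := h w hw (by omega)
      rwa [h3, Nat.sub_self, Er] at this
    obtain ⟨k, hk⟩ : ∃ k, 2 * u - (N + 1) = k + 1 := ⟨2 * u - (N + 1) - 1, by omega⟩
    rw [hk] at h
    have hU : ∀ J : List Bool, J.length = N → J.count true + 1 + u = N + 1 →
        Er p (k + 1) (fun w => K (true :: w)) J = 0 := by
      intro J hJ hJc
      have := h (true :: J) (by simp [hJ]) (by simpa using hJc)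
      rw [Er_up] at this
      have h5 : (p⁻¹) ^ (k + 1) ≠ 0 := by positivity
      exact (mul_eq_zero.1 this).resolve_left h5
    have hD : ∀ J : List Bool, J.length = N → J.count true + u = N + 1 →
        p ^ (k + 1) * Er p (k + 1) (fun w => K (false :: w)) J
          + cc p (k + 1) * Er p k (fun w => K (true :: w)) J = 0 := by
      intro J hJ hJc
      have := h (false :: J) (by simp [hJ]) (by simpa using hJc)
      rwa [Er_dn] at this
    have hp' : p ^ (k + 1) ≠ 0 := by positivity
    have hK : ∀ v : List Bool, v.length = N → v.count true = u → K (false :: v) = 0 := by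
      intro v hv hvc
      have hul : u ≤ N := by rw [← hv, ← hvc]; exact List.count_le_length
      refine ih (fun w => K (false :: w)) u (by omega) hul ?_ v hv hvc
      intro J hJ hJc
      rw [show 2 * u - N = (k + 1) + 1 by omega]
      show Eo p J (Er p (k + 1) _) = 0
      rw [Eo_congr p J _ (fun w => (-(cc p (k + 1) / p ^ (k + 1))) *
        Er p k (fun w => K (true :: w)) w), Eo_smul]
      · have := hU J hJ (by omega)
        change Eo p J (Er p k _) = 0 at this
        rw [this]; simp
      · intro v h5 h6
        have := hD v (by omega) (by omega)
        field_simp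
        linarith
    have hK2 : ∀ J : List Bool, J.length = N → J.count true + u = N + 1 →
        Er p k (fun w => K (true :: w)) J = 0 := by
      intro J hJ hJc
      have h6 := hD J hJ hJc
      rw [Er_supp p (k + 1) (fun w => K (false :: w)) J] at h6
      · have := cc_pos hp k
        rw [mul_zero, zero_add] at h6
        exact (mul_eq_zero.1 h6).resolve_left this.ne'
      · intro v h7 h8
        exact hK v (by omega) (by omega)
    cases w with
    | nil => simp at hw
    | cons c J =>
      cases c with
      | false => exact hK J (by simpa using hw) (by simpa using hc)
      | true =>
        have hc' : J.count true + 1 = u := by simpa using hc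
        refine ih (fun w => K (true :: w)) (u - 1) (by omega) (by omega) ?_ J (by simpa using hw)
          (by omega)
        intro w hw hwc
        rw [show 2 * (u - 1) - N = k by omega]
        exact hK2 w hw (by omega)

def good (w : List Bool) : Prop := ∀ s : List Bool, s <:+ w → 2 * s.count true ≤ s.length

lemma good_cons {c : Bool} {w : List Bool} (h : good w)
    (h2 : 2 * (c :: w).count true ≤ (c :: w).length) : good (c :: w) := by
  intro s hs
  rcases List.suffix_cons_iff.1 hs with rfl | hs
  · exact h2
  · exact h s hs

lemma lemMain {p : ℝ} (hp : 0 < p) (N : ℕ) : ∀ (K : List Bool → ℝ) (u : ℕ), 2 * u ≤ N →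
    (∀ w : List Bool, w.length = N → w.count true + 1 = u → Eo p w K = 0) →
    (∀ w : List Bool, w.length = N → w.count true = u → good w → K w = 0) →
    ∀ w : List Bool, w.length = N → w.count true = u → K w = 0 := by
  induction N with
  | zero =>
    intro K u _ _ h w hw hc
    obtain rfl : w = [] := by simpa using hw
    refine h [] rfl hc ?_
    intro s hs
    obtain rfl : s = [] := by simpa using hs
    simp
  | succ N ih =>
    intro K u h1 h2 h w hw hc
    have hU : ∀ J : List Bool, J.length = N → J.count true + 1 = u → K (true :: J) = 0 := by
      intro J hJ hJc
      refine ih (fun w => K (true :: w)) (u - 1) (by omega) ?_ ?_ J hJ (by omega)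
      · intro w hw hwc
        have := h2 (true :: w) (by simp [hw]) (by simp; omega)
        rw [Eo] at this
        have h5 : p⁻¹ ≠ 0 := by positivity
        exact (mul_eq_zero.1 this).resolve_left h5
      · intro w hw hwc hg
        refine h (true :: w) (by simp [hw]) (by simp; omega) (good_cons hg ?_)
        simp; omega
    have hE : ∀ J : List Bool, J.length = N → J.count true + 1 = u →
        Eo p J (fun w => K (false :: w)) = 0 := by
      intro J hJ hJc
      have := h2 (false :: J) (by simp [hJ]) (by simpa using hJc)
      rw [Eo, hU J hJ hJc, add_zero] at this
      exact (mul_eq_zero.1 this).resolve_left hp.ne'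
    cases w with
    | nil => simp at hw
    | cons c J =>
      have hJ : J.length = N := by simpa using hw
      cases c with
      | true => exact hU J hJ (by simpa using hc)
      | false =>
        have hJc : J.count true = u := by simpa using hc
        by_cases h3 : 2 * u = N + 1
        · refine lemP hp N (fun w => K (false :: w)) u (by omega) (by omega) ?_ J hJ hJc
          intro w hw hwc
          rw [show 2 * u - N = 0 + 1 by omega, Er, Er]
          exact hE w hw (by omega)
        · refine ih (fun w => K (false :: w)) u (by omega) hE ?_ J hJ hJc
          intro w hw hwc hg
          refine h (false :: w) (by simp [hw]) (by simpa using hwc) (good_cons hg ?_)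
          simp; omega

def Bo (q : ℝ) : ℤ → List Bool → (List ℤ → ℝ) → ℝ
  | _, [], K => K []
  | x, false :: w, K => Bo q (x + 1) w K
  | x, true :: w, K => Bo q (x + 1) w (fun l => q * K (x :: l) + K ((x - 1) :: l))

lemma Bo_lin (q : ℝ) (a b : ℝ) (w : List Bool) : ∀ (x : ℤ) (K L : List ℤ → ℝ),
    Bo q x w (fun l => a * K l + b * L l) = a * Bo q x w K + b * Bo q x w L := by
  induction w with
  | nil => intros; simp [Bo]
  | cons c J ih =>
    intro x K L
    cases c
    · simp only [Bo, ih]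
    · simp only [Bo]
      rw [← ih]
      congr 1
      funext l
      ring

/-- the local relation -/
def Rel {R : Type*} [CommRing R] (τ : R) (K : List ℤ → R) : Prop :=
  ∀ (pre : List ℤ) (x : ℤ) (suf : List ℤ), K (pre ++ x :: x :: suf)
    + τ * K (pre ++ (x - 1) :: x :: suf) + K (pre ++ (x - 1) :: (x - 1) :: suf) = 0

lemma EB {p : ℝ} (hp : 0 < p) (w : List Bool) : ∀ (x : ℤ) (K : List ℤ → ℝ),
    Rel (-(p + p⁻¹)) K → (∀ pre, K (pre ++ [x - 1 + w.length]) = 0) →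
    Eo p w (fun v => Bo (-p) x v K) = Bo (-p) x w (fun l => K ((x - 1) :: l)) := by
  induction w with
  | nil =>
    intro x K _ h
    have := h []
    simp only [List.length_nil, List.nil_append] at this
    simp [Eo, Bo] at this ⊢
    try exact this.symm
  | cons c J ih =>
    intro x K hR h
    have hlen : x - 1 + ((c :: J).length : ℤ) = (x + 1) - 1 + J.length := by simp
    rw [hlen] at h
    cases c
    · simp only [Eo, Bo]
      rw [ih (x + 1) K hR h]
      have := Bo_lin (-p) (-p) 1 J (x + 1) (fun l => K (x :: l)) (fun l => K ((x - 1) :: l))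
      simp only [one_mul] at this
      rw [this, show x + 1 - 1 = x by ring]
      ring
    · simp only [Eo, Bo]
      rw [ih (x + 1) (fun l => -p * K (x :: l) + K ((x - 1) :: l))]
      · have h1 := Bo_lin (-p) (p⁻¹) 0 J (x + 1)
          (fun l => -p * K (x :: (x + 1 - 1) :: l) + K ((x - 1) :: (x + 1 - 1) :: l)) (fun _ => 0)
        simp only [zero_mul, add_zero] at h1
        rw [← h1]
        congr 1
        funext l
        have h2 := hR [] x l
        simp only [List.nil_append] at h2
        rw [show x + 1 - 1 = x by ring]
        field_simp at h2 ⊢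
        linarith
      · intro pre y suf
        have h1 := hR (x :: pre) y suf
        have h2 := hR ((x - 1) :: pre) y suf
        simp only [List.cons_append] at h1 h2
        linear_combination (-p) * h1 + h2
      · intro pre
        have h1 := h (x :: pre)
        have h2 := h ((x - 1) :: pre)
        simp only [List.cons_append] at h1 h2
        rw [h1, h2]; simp

def pos : ℤ → List Bool → List ℤ
  | _, [] => []
  | x, false :: w => pos (x + 1) w
  | x, true :: w => x :: pos (x + 1) w

lemma pos_length (w : List Bool) : ∀ x, (pos x w).length = w.count true := by
  induction w with
  | nil => intro; simp [pos]
  | cons c w ih => intro x; cases c <;> simp [pos, ih]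

lemma pos_ge (w : List Bool) : ∀ x, ∀ y ∈ pos x w, x ≤ y := by
  induction w with
  | nil => intro; simp [pos]
  | cons c w ih =>
    intro x y hy
    cases c
    · have := ih (x + 1) y hy; omega
    · simp only [pos, List.mem_cons] at hy
      rcases hy with rfl | hy
      · rfl
      · have := ih (x + 1) y hy; omega

lemma pos_strict (w : List Bool) : ∀ x, (pos x w).Pairwise (· < ·) := by
  induction w with
  | nil => intro; simp [pos]
  | cons c w ih =>
    intro x
    cases c
    · exact ih _
    · simp only [pos, List.pairwise_cons]
      exact ⟨fun y hy => by have := pos_ge w _ y hy; omega, ih _⟩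

lemma exists_pos (m : ℕ) : ∀ (x : ℤ) (l : List ℤ), l.Pairwise (· < ·) →
    (∀ y ∈ l, x ≤ y ∧ y < x + m) → ∃ w : List Bool, w.length = m ∧ pos x w = l := by
  induction m with
  | zero =>
    intro x l _ h
    cases l with
    | nil => exact ⟨[], rfl, rfl⟩
    | cons a l => have := h a (by simp); simp at this; omega
  | succ m ih =>
    intro x l hl h
    by_cases hx : ∃ l', l = x :: l'
    · obtain ⟨l', rfl⟩ := hx
      rw [List.pairwise_cons] at hl
      obtain ⟨w, h1, h2⟩ := ih (x + 1) l' hl.2 (by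
        intro y hy
        have h3 := h y (by simp [hy])
        have h4 := hl.1 y hy
        push_cast at h3
        omega)
      exact ⟨true :: w, by simp [h1], by simp [pos, h2]⟩
    · obtain ⟨w, h1, h2⟩ := ih (x + 1) l hl (by
        intro y hy
        have h3 := h y hy
        push_cast at h3
        have : x ≠ y := by
          rintro rfl
          cases l with
          | nil => simp at hy
          | cons a l =>
            rw [List.pairwise_cons] at hl
            have h5 := h a (by simp)
            rcases List.mem_cons.1 hy with h6 | hy
            · exact hx ⟨l, by rw [h6]⟩
            · have := hl.1 _ hy; omega
        omega)
      exact ⟨false :: w, by simp [h1], by simp [pos, h2]⟩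

def nearb (y a : ℤ) : Prop := y = a ∨ y = a - 1

lemma Bo_eval (q : ℝ) (w : List Bool) : ∀ (x : ℤ) (K : List ℤ → ℝ),
    (∀ l, List.Forall₂ nearb l (pos x w) → l ≠ pos x w → K l = 0) →
    Bo q x w K = q ^ (w.count true) * K (pos x w) := by
  induction w with
  | nil => intros; simp [Bo, pos]
  | cons c w ih =>
    intro x K h
    cases c
    · simp only [Bo, pos]
      rw [ih _ K h]; simp
    · simp only [Bo, pos] at h ⊢
      rw [ih]
      · rw [h ((x - 1) :: pos (x + 1) w)]
        · simp [pow_succ]; ring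
        · refine List.Forall₂.cons (Or.inr rfl) ?_
          exact List.forall₂_same.2 fun _ _ => Or.inl rfl
        · simp
      · intro l h1 h2
        rw [h (x :: l) (List.Forall₂.cons (Or.inl rfl) h1) (by simpa using h2),
          h ((x - 1) :: l) (List.Forall₂.cons (Or.inr rfl) h1) (by simp)]
        simp

def Dy : ℤ → List ℤ → Prop
  | _, [] => True
  | m, x :: l => x ≤ m ∧ Dy (m + 2) l

lemma Dy_mono {l l' : List ℤ} (h : List.Forall₂ (· ≤ ·) l l') : ∀ m, Dy m l' → Dy m l := by
  induction h with
  | nil => intro m _; trivial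
  | cons h1 _ ih => intro m hm; exact ⟨h1.trans hm.1, ih _ hm.2⟩

lemma Dy_pos (w : List Bool) : ∀ (x : ℤ) (k n : ℤ), good w → x + w.length = 2 * n →
    k + w.count true = n → Dy (2 * k) (pos x w) := by
  induction w with
  | nil => intros; trivial
  | cons c w ih =>
    intro x k n hg h1 h2
    have hg' : good w := fun s hs => hg s (hs.trans (List.suffix_cons _ _))
    have h3 := hg _ (List.suffix_refl _)
    cases c
    · simp at h1 h2 h3
      exact ih (x + 1) k n hg' (by omega) h2
    · simp at h1 h2 h3
      refine ⟨by omega, ?_⟩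
      rw [show 2 * k + 2 = 2 * (k + 1) by ring]
      exact ih (x + 1) (k + 1) n hg' (by omega) (by omega)

lemma near_pairwise {l l' : List ℤ} (h : List.Forall₂ nearb l l') :
    l'.Pairwise (· < ·) → l.Pairwise (· ≤ ·) := by
  induction h with
  | nil => simp
  | @cons a b l l' h1 h2 ih =>
    intro hl
    rw [List.pairwise_cons] at hl ⊢
    refine ⟨?_, ih hl.2⟩
    intro y hy
    obtain ⟨z, hz, hyz⟩ : ∃ z ∈ l', nearb y z := by
      clear ih hl h1
      induction h2 with
      | nil => simp at hy
      | cons h3 _ ih =>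
        rcases List.mem_cons.1 hy with rfl | hy
        · exact ⟨_, by simp, h3⟩
        · obtain ⟨z, hz, h⟩ := ih hy
          exact ⟨z, by simp [hz], h⟩
    have := hl.1 z hz
    unfold nearb at *
    omega

lemma near_le {l l' : List ℤ} (h : List.Forall₂ nearb l l') : List.Forall₂ (· ≤ ·) l l' :=
  h.imp fun a b h => by unfold nearb at h; omega

lemma sum_le_of_forall2 {l l' : List ℤ} (h : List.Forall₂ (· ≤ ·) l l') :
    l.sum ≤ l'.sum ∧ (l ≠ l' → l.sum < l'.sum) := by
  induction h with
  | nil => simp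
  | @cons a b l l' h1 h2 ih =>
    simp only [List.sum_cons]
    refine ⟨by omega, fun h => ?_⟩
    by_cases hab : a = b
    · subst hab
      have := ih.2 (by simpa using h)
      omega
    · omega

/-- first repeated pair -/
lemma exists_rep (l : List ℤ) (h1 : l.Pairwise (· ≤ ·)) (h2 : ¬ l.Pairwise (· < ·)) :
    ∃ pre x suf, l = pre ++ x :: x :: suf ∧ ∀ y ∈ pre, y < x := by
  induction l with
  | nil => simp at h2
  | cons a l ih =>
    rw [List.pairwise_cons] at h1
    by_cases h3 : ∃ suf, l = a :: suf
    · obtain ⟨suf, rfl⟩ := h3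
      exact ⟨[], a, suf, rfl, by simp⟩
    have h4 : ∀ y ∈ l, a < y := by
      intro y hy
      cases l with
      | nil => simp at hy
      | cons b l =>
        have hab := h1.1 b (by simp)
        have : a ≠ b := fun h => h3 ⟨l, by rw [h]⟩
        rcases List.mem_cons.1 hy with rfl | hy
        · omega
        · have := (List.pairwise_cons.1 h1.2).1 y hy
          omega
    obtain ⟨pre, x, suf, rfl, h5⟩ := ih h1.2 (fun h => h2 (List.pairwise_cons.2 ⟨h4, h⟩))
    refine ⟨a :: pre, x, suf, rfl, ?_⟩
    intro y hy
    rcases List.mem_cons.1 hy with rfl | hy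
    · exact h4 x (by simp)
    · exact h5 y hy

lemma rep_sorted {pre suf : List ℤ} {x : ℤ} (h1 : (pre ++ x :: x :: suf).Pairwise (· ≤ ·))
    (h2 : ∀ y ∈ pre, y < x) : (pre ++ (x - 1) :: x :: suf).Pairwise (· ≤ ·) ∧
    (pre ++ (x - 1) :: (x - 1) :: suf).Pairwise (· ≤ ·) := by
  simp only [List.pairwise_append, List.pairwise_cons, List.mem_cons] at h1 ⊢
  obtain ⟨ha, ⟨hb, hc, hd⟩, he⟩ := h1
  refine ⟨⟨ha, ⟨?_, hc, hd⟩, ?_⟩, ha, ⟨?_, ?_, hd⟩, ?_⟩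
  · rintro y (rfl | hy)
    · omega
    · have := hc y hy; omega
  · rintro y hy z (rfl | rfl | hz)
    · have := h2 y hy; omega
    · have := h2 y hy; omega
    · exact he y hy z (by simp [hz])
  · rintro y (rfl | hy)
    · omega
    · have := hc y hy; omega
  · intro y hy
    have := hc y hy; omega
  · rintro y hy z (rfl | rfl | hz)
    · have := h2 y hy; omega
    · have := h2 y hy; omega
    · exact he y hy z (by simp [hz])

lemma rep_le (pre suf : List ℤ) (x : ℤ) :
    List.Forall₂ (· ≤ ·) (pre ++ (x - 1) :: x :: suf) (pre ++ x :: x :: suf) ∧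
    List.Forall₂ (· ≤ ·) (pre ++ (x - 1) :: (x - 1) :: suf) (pre ++ x :: x :: suf) := by
  induction pre with
  | nil =>
    have : List.Forall₂ (· ≤ ·) suf suf := List.forall₂_same.2 fun _ _ => le_refl _
    exact ⟨.cons (by omega) (.cons le_rfl this), .cons (by omega) (.cons (by omega) this)⟩
  | cons a l ih => exact ⟨.cons le_rfl ih.1, .cons le_rfl ih.2⟩

theorem uniq_real {p : ℝ} (hp : 0 < p) (n : ℕ) (K : List ℤ → ℝ) (hR : Rel (-(p + p⁻¹)) K)
    (hlen : ∀ l, l.length ≠ n → K l = 0)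
    (hbd : ∀ l, (∃ x ∈ l, x < 0 ∨ 2 * (n : ℤ) - 1 ≤ x) → K l = 0)
    (hD : ∀ l : List ℤ, l.Pairwise (· < ·) → Dy 0 l → l.length = n → (∀ x ∈ l, 0 ≤ x) → K l = 0) :
    ∀ l : List ℤ, l.Pairwise (· ≤ ·) → K l = 0 := by
  have step1 : ∀ (N : ℕ) (l : List ℤ), l.sum < N → l.Pairwise (· ≤ ·) → Dy 0 l → K l = 0 := by
    intro N
    induction N with
    | zero =>
      intro l hl _ _
      by_cases h : ∃ x ∈ l, x < 0
      · obtain ⟨x, h1, h2⟩ := h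
        exact hbd l ⟨x, h1, Or.inl h2⟩
      · push Not at h
        have := List.sum_nonneg h
        simp at hl; omega
    | succ N ih =>
      intro l hl hs hd
      by_cases hn : l.length = n
      swap
      · exact hlen l hn
      by_cases h : ∃ x ∈ l, x < 0
      · obtain ⟨x, h1, h2⟩ := h
        exact hbd l ⟨x, h1, Or.inl h2⟩
      push Not at h
      by_cases hst : l.Pairwise (· < ·)
      · exact hD l hst hd hn h
      obtain ⟨pre, x, suf, rfl, hpre⟩ := exists_rep l hs hst
      have h1 := rep_sorted hs hpre
      have h2 := rep_le pre suf x
      have h3 := hR pre x suf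
      rw [ih _ _ h1.1 (Dy_mono h2.1 _ hd), ih _ _ h1.2 (Dy_mono h2.2 _ hd)] at h3
      · simpa using h3
      · have := (sum_le_of_forall2 h2.2).2 (by simp)
        push_cast at hl; omega
      · have := (sum_le_of_forall2 h2.1).2 (by simp)
        push_cast at hl; omega
  have step1' : ∀ l : List ℤ, l.Pairwise (· ≤ ·) → Dy 0 l → K l = 0 := by
    intro l
    exact step1 (l.sum.toNat + 1) l (by push_cast; omega)
  have step2 : ∀ w : List Bool, w.length = 2 * n → w.count true = n → Bo (-p) 0 w K = 0 := by
    refine lemMain hp (2 * n) (fun w => Bo (-p) 0 w K) n le_rfl ?_ ?_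
    · intro w hw _
      rw [EB hp w 0 K hR]
      · have : (fun l => K ((0 - 1) :: l)) = fun l => 0 * K l + 0 * K l := by
          funext l
          rw [hbd]
          · ring
          · exact ⟨0 - 1, by simp, by norm_num⟩
        rw [this, Bo_lin]
        ring
      · intro pre
        apply hbd
        refine ⟨0 - 1 + (w.length : ℤ), by simp, Or.inr ?_⟩
        rw [hw]; push_cast; omega
    · intro w hw hwc hg
      have hdy := Dy_pos w 0 0 n hg (by rw [hw]; push_cast; ring) (by rw [hwc]; ring)
      have : ∀ l, List.Forall₂ nearb l (pos 0 w) → K l = 0 := by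
        intro l hl
        exact step1' l (near_pairwise hl (pos_strict w 0)) (Dy_mono (near_le hl) _ hdy)
      show Bo (-p) 0 w K = 0
      rw [Bo_eval]
      · rw [this _ (List.forall₂_same.2 fun _ _ => Or.inl rfl)]; simp
      · intro l h _
        exact this l h
  have step3 : ∀ (N : ℕ) (l : List ℤ), l.sum < N → l.Pairwise (· ≤ ·) → K l = 0 := by
    intro N
    induction N with
    | zero =>
      intro l hl _
      by_cases h : ∃ x ∈ l, x < 0
      · obtain ⟨x, h1, h2⟩ := h
        exact hbd l ⟨x, h1, Or.inl h2⟩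
      · push Not at h
        have := List.sum_nonneg h
        simp at hl; omega
    | succ N ih =>
      intro l hl hs
      by_cases hn : l.length = n
      swap
      · exact hlen l hn
      by_cases h : ∃ x ∈ l, x < 0 ∨ 2 * (n : ℤ) - 1 ≤ x
      · exact hbd l h
      push Not at h
      by_cases hst : l.Pairwise (· < ·)
      · obtain ⟨w, hw1, hw2⟩ := exists_pos (2 * n) 0 l hst (by
          intro y hy
          have := h y hy
          push_cast; omega)
        have hc : w.count true = n := by rw [← pos_length w 0, hw2, hn]
        have h4 := step2 w hw1 hc
        rw [Bo_eval, hw2] at h4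
        · have : (-p) ^ (w.count true) ≠ 0 := pow_ne_zero _ (by linarith)
          exact (mul_eq_zero.1 h4).resolve_left this
        · intro l' h5 h6
          rw [hw2] at h5 h6
          apply ih
          · have := (sum_le_of_forall2 (near_le h5)).2 h6
            push_cast at hl; omega
          · exact near_pairwise h5 hst
      obtain ⟨pre, x, suf, rfl, hpre⟩ := exists_rep l hs hst
      have h1 := rep_sorted hs hpre
      have h2 := rep_le pre suf x
      have h3 := hR pre x suf
      rw [ih _ _ h1.1, ih _ _ h1.2] at h3
      · simpa using h3
      · have := (sum_le_of_forall2 h2.2).2 (by simp)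
        push_cast at hl; omega
      · have := (sum_le_of_forall2 h2.1).2 (by simp)
        push_cast at hl; omega
  intro l
  exact step3 (l.sum.toNat + 1) l (by push_cast; omega)

open Polynomial in
/-- polynomial version with `τ = X` -/
theorem uniq_poly (n : ℕ) (K : List ℤ → ℝ[X]) (hR : Rel (Polynomial.X : ℝ[X]) K)
    (hlen : ∀ l, l.length ≠ n → K l = 0)
    (hbd : ∀ l, (∃ x ∈ l, x < 0 ∨ 2 * (n : ℤ) - 1 ≤ x) → K l = 0)
    (hD : ∀ l : List ℤ, l.Pairwise (· < ·) → Dy 0 l → l.length = n → (∀ x ∈ l, 0 ≤ x) → K l = 0) :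
    ∀ l : List ℤ, l.Pairwise (· ≤ ·) → K l = 0 := by
  intro l hl
  have key : ∀ p : ℝ, 0 < p → (K l).eval (-(p + p⁻¹)) = 0 := by
    intro p hp
    refine uniq_real hp n (fun l => (K l).eval (-(p + p⁻¹))) ?_ ?_ ?_ ?_ l hl
    · intro pre x suf
      have := congrArg (Polynomial.eval (-(p + p⁻¹))) (hR pre x suf)
      simpa using this
    · intro l h; simp [hlen l h]
    · intro l h; simp [hbd l h]
    · intro l h1 h2 h3 h4; simp [hD l h1 h2 h3 h4]
  apply Polynomial.eq_zero_of_infinite_isRoot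
  refine Set.infinite_of_injective_forall_mem (f := fun m : ℕ => -(((m : ℝ) + 1) + ((m : ℝ) + 1)⁻¹)) ?_ ?_
  · intro a b hab
    have ha : (0 : ℝ) < (a : ℝ) + 1 := by positivity
    have hb : (0 : ℝ) < (b : ℝ) + 1 := by positivity
    simp only [neg_inj] at hab
    field_simp at hab
    have h2 : ((a : ℝ) - b) * (((a : ℝ) + 1) * (b + 1) - 1) = 0 := by linear_combination hab
    rcases mul_eq_zero.1 h2 with h | h
    · have : (a : ℝ) = b := by linarith
      exact_mod_cast this
    · have h3 : (a : ℝ) * b + a + b = 0 := by linear_combination h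
      have h4 : a * b + a + b = 0 := by exact_mod_cast h3
      have : a = 0 := by
        by_contra h; have : 0 < a := Nat.pos_of_ne_zero h
        have : 0 ≤ a * b := Nat.zero_le _
        omega
      subst this
      omega
  · intro m
    exact key _ (by positivity)

end LP

namespace LP

/-! ### Part B: combinatorics of noncrossing matchings -/

/-- number of letters of `l` in `[a,b)` -/
def cnt (l : List ℤ) (a b : ℤ) : ℤ := (l.map (fun x => if a ≤ x ∧ x < b then (1 : ℤ) else 0)).sum

@[simp] lemma cnt_nil (a b : ℤ) : cnt [] a b = 0 := by simp [cnt]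
@[simp] lemma cnt_cons (x : ℤ) (l : List ℤ) (a b : ℤ) :
    cnt (x :: l) a b = (if a ≤ x ∧ x < b then 1 else 0) + cnt l a b := by simp [cnt]
@[simp] lemma cnt_append (l l' : List ℤ) (a b : ℤ) :
    cnt (l ++ l') a b = cnt l a b + cnt l' a b := by simp [cnt]

lemma cnt_add (l : List ℤ) {a b c : ℤ} (h1 : a ≤ b) (h2 : b ≤ c) :
    cnt l a b + cnt l b c = cnt l a c := by
  induction l with
  | nil => simp
  | cons x l ih =>
    simp only [cnt_cons]
    split_ifs <;> omega

lemma cnt_nonneg (l : List ℤ) (a b : ℤ) : 0 ≤ cnt l a b := by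
  induction l with
  | nil => simp
  | cons x l ih =>
    simp only [cnt_cons]
    split_ifs <;> omega

lemma cnt_empty (l : List ℤ) {a b : ℤ} (h : b ≤ a) : cnt l a b = 0 := by
  induction l with
  | nil => simp
  | cons x l ih =>
    simp only [cnt_cons]
    split_ifs <;> omega

lemma cnt_mono (l : List ℤ) {a b a' b' : ℤ} (h1 : a' ≤ a) (h2 : b ≤ b') :
    cnt l a b ≤ cnt l a' b' := by
  induction l with
  | nil => simp
  | cons x l ih =>
    simp only [cnt_cons]
    split_ifs <;> omega

lemma cnt_le_length (l : List ℤ) (a b : ℤ) : cnt l a b ≤ l.length := by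
  induction l with
  | nil => simp
  | cons x l ih =>
    simp only [cnt_cons, List.length_cons]
    push_cast
    split_ifs <;> omega

lemma cnt_lt_length (l : List ℤ) (a b : ℤ) (h : ∃ x ∈ l, x < a ∨ b ≤ x) :
    cnt l a b < l.length := by
  induction l with
  | nil => simp at h
  | cons x l ih =>
    simp only [cnt_cons, List.length_cons]
    push_cast
    have := cnt_le_length l a b
    simp only [List.mem_cons, exists_eq_or_imp] at h
    rcases h with h | h
    · rw [if_neg (by omega)]; omega
    · have := ih h
      split_ifs <;> omega

lemma cnt_all (l : List ℤ) (a b : ℤ) (h : ∀ x ∈ l, a ≤ x ∧ x < b) :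
    cnt l a b = l.length := by
  induction l with
  | nil => simp
  | cons x l ih =>
    simp only [cnt_cons, List.length_cons]
    push_cast
    simp only [List.mem_cons, forall_eq_or_imp] at h
    rw [if_pos h.1, ih h.2]; ring

lemma cnt_none (l : List ℤ) (a b : ℤ) (h : ∀ x ∈ l, ¬ (a ≤ x ∧ x < b)) :
    cnt l a b = 0 := by
  induction l with
  | nil => simp
  | cons x l ih =>
    simp only [cnt_cons]
    simp only [List.mem_cons, forall_eq_or_imp] at h
    rw [if_neg h.1, ih h.2]; ring

lemma cnt_single (l : List ℤ) (hl : l.Nodup) (a : ℤ) :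
    cnt l a (a + 1) = if a ∈ l then 1 else 0 := by
  induction l with
  | nil => simp
  | cons x l ih =>
    rw [List.nodup_cons] at hl
    simp only [cnt_cons, ih hl.2, List.mem_cons]
    by_cases h : a = x
    · subst h
      rw [if_pos (by omega), if_neg hl.1]; simp
    · rw [if_neg (by omega)]; simp [h]

/-- noncrossing matching as a function on naturals -/
structure IsM (n : ℕ) (g : ℕ → ℕ) : Prop where
  lt : ∀ k, k < 2 * n → g k < 2 * n
  inv : ∀ k, k < 2 * n → g (g k) = k
  nofix : ∀ k, k < 2 * n → g k ≠ k
  nc : ∀ a b c d, a < b → b < c → c < d → d < 2 * n → g a = c → g b = d → False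

lemma IsM.inside {n : ℕ} {g : ℕ → ℕ} (h : IsM n g) {a k : ℕ} (ha : a < 2 * n) (h1 : a < k)
    (h2 : k < g a) : a < g k ∧ g k < g a := by
  have hga := h.lt a ha
  have hk : k < 2 * n := by omega
  have h3 : g k ≠ a := fun e => by have := h.inv k hk; rw [e] at this; omega
  have h4 : g k ≠ g a := fun e => by
    have h5 := h.inv k hk; rw [e, h.inv a ha] at h5; omega
  have h5 := h.lt k hk
  constructor
  · by_contra hc
    exact h.nc (g k) a k (g a) (by omega) h1 h2 hga (h.inv k hk) rfl
  · by_contra hc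
    exact h.nc a k (g a) (g k) h1 h2 (by omega) h5 rfl rfl

/-- word of openers -/
def opw (n : ℕ) (g : ℕ → ℕ) : List ℤ :=
  ((List.range (2 * n)).filter (fun k => k < g k)).map (fun k : ℕ => (k : ℤ))

lemma opw_mem (n : ℕ) (g : ℕ → ℕ) (x : ℤ) : x ∈ opw n g ↔ ∃ k : ℕ, k < 2 * n ∧ k < g k ∧ (k : ℤ) = x := by
  simp [opw, and_assoc]

lemma opw_sorted (n : ℕ) (g : ℕ → ℕ) : (opw n g).Pairwise (· < ·) := by
  unfold opw
  rw [List.pairwise_map]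
  refine List.Pairwise.filter _ ?_
  refine List.Pairwise.imp ?_ (List.pairwise_lt_range (n := 2 * n))
  intro a b h
  exact_mod_cast h

lemma opw_single (n : ℕ) (g : ℕ → ℕ) (k : ℕ) (hk : k < 2 * n) :
    cnt (opw n g) k (k + 1) = if k < g k then 1 else 0 := by
  rw [cnt_single _ ((opw_sorted n g).imp (fun h => ne_of_lt h))]
  refine if_congr ?_ rfl rfl
  rw [opw_mem]
  simp only [Nat.cast_inj]
  constructor
  · rintro ⟨j, h1, h2, rfl⟩; exact h2
  · intro h; exact ⟨k, hk, h, rfl⟩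

/-- closed interval induction -/
lemma closed_op {n : ℕ} {g : ℕ → ℕ} (h : IsM n g) (L : ℕ) : ∀ x y : ℕ, y ≤ x + L → x ≤ y → y ≤ 2 * n →
    (∀ k, x ≤ k → k < y → x ≤ g k ∧ g k < y) → 2 * cnt (opw n g) x y = y - x := by
  induction L with
  | zero =>
    intro x y h1 h2 _ _
    have : x = y := by omega
    subst this
    rw [cnt_empty _ le_rfl]; simp
  | succ L ih =>
    intro x y h1 h2 h3 hc
    by_cases hxy : x = y
    · subst hxy
      rw [cnt_empty _ le_rfl]; simp
    have hx : x < 2 * n := by omega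
    have h4 := hc x le_rfl (by omega)
    have h5 := h.nofix x hx
    have e1 := ih (x + 1) (g x) (by omega) (by omega) (by omega) (by
      intro k hk1 hk2
      have := h.inside hx (by omega) hk2
      omega)
    have e2 := ih (g x + 1) y (by omega) (by omega) (by omega) (by
      intro k hk1 hk2
      have h6 := hc k (by omega) hk2
      refine ⟨?_, h6.2⟩
      by_contra h7
      have h8 := h.inv k (by omega)
      have h9 := h.inv x hx
      by_cases h10 : g k = g x
      · rw [h10, h9] at h8; omega
      by_cases h11 : g k = x
      · rw [h11] at h8; omega
      have := h.inside hx (k := g k) (by omega) (by omega)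
      omega)
    have s1 := opw_single n g x hx
    have s2 := opw_single n g (g x) (by omega)
    rw [if_pos (by omega)] at s1
    rw [h.inv x hx, if_neg (by omega)] at s2
    have a1 := cnt_add (opw n g) (a := x) (b := (x:ℤ) + 1) (c := g x) (by omega) (by omega)
    have a2 := cnt_add (opw n g) (a := x) (b := g x) (c := (g x : ℤ) + 1) (by omega) (by omega)
    have a3 := cnt_add (opw n g) (a := x) (b := (g x : ℤ) + 1) (c := y) (by omega) (by omega)
    push_cast at e1 e2
    omega

lemma arc_op {n : ℕ} {g : ℕ → ℕ} (h : IsM n g) {x : ℕ} (hx : x < 2 * n) (hg : x < g x) :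
    2 * cnt (opw n g) x (g x) = g x - x + 1 := by
  have h1 := h.lt x hx
  have e1 := closed_op h (2 * n) (x + 1) (g x) (by omega) (by omega) (by omega) (by
      intro k hk1 hk2
      have := h.inside hx (by omega) hk2
      omega)
  have s1 := opw_single n g x hx
  rw [if_pos (by omega)] at s1
  have a1 := cnt_add (opw n g) (a := x) (b := (x:ℤ) + 1) (c := g x) (by omega) (by omega)
  push_cast at e1
  omega

lemma opw_length {n : ℕ} {g : ℕ → ℕ} (h : IsM n g) : (opw n g).length = n := by
  have h1 := closed_op h (2 * n) 0 (2 * n) (by omega) (by omega) (by omega) (by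
    intro k _ hk; exact ⟨by omega, h.lt k hk⟩)
  rw [cnt_all] at h1
  · push_cast at h1; omega
  · intro x hx
    rw [opw_mem] at hx
    obtain ⟨k, h2, h3, rfl⟩ := hx
    push_cast; omega

/-- the exponent of an arc -/
def se (l : List ℤ) (g : ℕ → ℕ) (k : ℕ) : ℤ := cnt l k (g k) - ((g k : ℤ) - k + 1) / 2

lemma se_eq {n : ℕ} {g : ℕ → ℕ} (h : IsM n g) (l : List ℤ) {x : ℕ} (hx : x < 2 * n) (hg : x < g x) :
    2 * se l g x = 2 * cnt l x (g x) - (g x - x + 1) := by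
  have := arc_op h hx hg
  unfold se; omega

/-- Lemma L -/
lemma lemL {n : ℕ} {g : ℕ → ℕ} (h : IsM n g) (l : List ℤ)
    (hs : ∀ k, k < 2 * n → k < g k → se l g k ≠ -1) (L : ℕ) : ∀ x y : ℕ, y ≤ x + L → x ≤ y → y ≤ 2 * n →
    (∀ k, x ≤ k → k < y → k < g k → g k < y) → cnt (opw n g) x y ≤ cnt l x (y - 1) := by
  induction L with
  | zero =>
    intro x y h1 h2 _ _
    rw [cnt_empty _ (by omega)]; exact cnt_nonneg _ _ _
  | succ L ih =>
    intro x y h1 h2 h3 hc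
    by_cases hxy : x = y
    · subst hxy
      rw [cnt_empty _ (by omega)]; exact cnt_nonneg _ _ _
    have hx : x < 2 * n := by omega
    have h5 := h.nofix x hx
    by_cases hop : x < g x
    · have h4 := hc x le_rfl (by omega) hop
      have e1 := ih (x + 1) (g x) (by omega) (by omega) (by omega) (by
        intro k hk1 hk2 _
        have := h.inside hx (by omega) hk2
        omega)
      have e2 := ih (g x + 1) y (by omega) (by omega) (by omega) (by
        intro k hk1 hk2 hk3
        exact hc k (by omega) hk2 hk3)
      have s1 := opw_single n g x hx
      have s2 := opw_single n g (g x) (by omega)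
      rw [if_pos (by omega)] at s1
      rw [h.inv x hx, if_neg (by omega)] at s2
      have a1 := cnt_add (opw n g) (a := x) (b := (x:ℤ) + 1) (c := g x) (by omega) (by omega)
      have a2 := cnt_add (opw n g) (a := x) (b := g x) (c := (g x : ℤ) + 1) (by omega) (by omega)
      have a3 := cnt_add (opw n g) (a := x) (b := (g x : ℤ) + 1) (c := y) (by omega) (by omega)
      have hse := se_eq h l hx hop
      have hne := hs x hx hop
      have hop := arc_op h hx hop
      have m1 := cnt_mono l (a := (x:ℤ)+1) (b := (g x : ℤ) - 1) (a' := x) (b' := g x) (by omega) (by omega)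
      have m2 : cnt l x (g x) + cnt l ((g x : ℤ) + 1) (y - 1) ≤ cnt l x (y - 1) := by
        rw [← cnt_add l (a := x) (b := g x) (c := y - 1) (by omega) (by omega)]
        have := cnt_mono l (a := (g x:ℤ)+1) (b := (y : ℤ) - 1) (a' := g x) (b' := y - 1) (by omega) (by omega)
        omega
      push_cast at e1 e2
      omega
    · have e1 := ih (x + 1) y (by omega) (by omega) (by omega) (by
        intro k hk1 hk2 hk3
        exact hc k (by omega) hk2 hk3)
      have s1 := opw_single n g x hx
      rw [if_neg (by omega)] at s1
      have a1 := cnt_add (opw n g) (a := x) (b := (x:ℤ) + 1) (c := y) (by omega) (by omega)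
      have m1 := cnt_mono l (a := (x:ℤ)+1) (b := (y : ℤ) - 1) (a' := x) (b' := y - 1) (by omega) (by omega)
      push_cast at e1
      omega

lemma lemL_se {n : ℕ} {g : ℕ → ℕ} (h : IsM n g) (l : List ℤ)
    (hs : ∀ k, k < 2 * n → k < g k → se l g k ≠ -1) {x : ℕ} (hx : x < 2 * n) (hg : x < g x) :
    0 ≤ se l g x := by
  have h1 := h.lt x hx
  have := lemL h l hs (2 * n) x (g x + 1) (by omega) (by omega) (by omega) (by
    intro k hk1 hk2 hk3
    by_cases hk : k = x
    · subst hk; omega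
    by_cases hk : k = g x
    · subst hk; rw [h.inv x hx] at hk3; omega
    have := h.inside hx (by omega) (k := k) (by omega)
    omega)
  have h2 := se_eq h l hx hg
  have h3 := arc_op h hx hg
  have h4 := cnt_mono (opw n g) (a := x) (b := g x) (a' := x) (b' := g x + 1) (by omega) (by omega)
  push_cast at this
  simp only [add_sub_cancel_right] at this
  omega

lemma lemL_prefix {n : ℕ} {g : ℕ → ℕ} (h : IsM n g) (l : List ℤ) (hl : l.length = n)
    (hs : ∀ k, k < 2 * n → k < g k → se l g k ≠ -1) :
    (∀ x ∈ l, 0 ≤ x ∧ x < 2 * (n : ℤ) - 1) ∧ ∀ x : ℕ, x ≤ 2 * n → cnt l 0 x ≤ cnt (opw n g) 0 x := by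
  have key := fun x hx => lemL h l hs (2 * n) x (2 * n) (by omega) hx (by omega) (by
    intro k _ hk _; exact h.lt k hk)
  have hop := opw_length h
  have hall : cnt (opw n g) 0 (2 * n) = n := by
    rw [cnt_all, hop]
    intro x hx
    rw [opw_mem] at hx
    obtain ⟨k, h2, h3, rfl⟩ := hx
    omega
  constructor
  · by_contra hc
    push Not at hc
    obtain ⟨x, hx1, hx2⟩ := hc
    have h1 := cnt_lt_length l 0 (2 * n - 1) ⟨x, hx1, by by_contra; omega⟩
    have h2 := key 0 (by omega)
    push_cast at h2
    omega
  · intro x hx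
    have h1 := key x hx
    have h2 := cnt_le_length l 0 (2 * n)
    have h3 := cnt_add l (a := 0) (b := x) (c := 2 * n) (by omega) (by omega)
    have h4 := cnt_add (opw n g) (a := 0) (b := x) (c := 2 * n) (by omega) (by omega)
    have h5 := cnt_mono l (a := x) (b := 2 * (n:ℤ) - 1) (a' := x) (b' := 2 * n) (by omega) (by omega)
    push_cast at h1
    omega

lemma op_inj {n : ℕ} {g g' : ℕ → ℕ} (h : IsM n g) (h' : IsM n g')
    (he : ∀ k, k < 2 * n → (k < g k ↔ k < g' k)) : ∀ L x, x < 2 * n → x < g x → g x ≤ x + L → g' x = g x := by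
  intro L
  induction L using Nat.strong_induction_on with
  | _ L ih =>
    intro x hx hg hL
    have hin : ∀ k, x < k → k < g x → g' k = g k := by
      intro k hk1 hk2
      have h1 := h.inside hx hk1 hk2
      have hgx := h.lt x hx
      have hkk := h.nofix k (by omega)
      by_cases hk : k < g k
      · exact ih (g k - k) (by omega) k (by omega) hk (by omega)
      · have h2 := h.inv k (by omega)
        have h3 := ih (k - g k) (by omega) (g k) (by omega) (by omega) (by omega)
        rw [h2] at h3
        have h4 := h'.inv (g k) (by omega)
        rw [h3] at h4
        exact h4
    by_contra hne
    have hgx := h.lt x hx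
    have h1 := (he x hx).1 hg
    have h2 : ¬ g x < g' (g x) := by
      rw [← he _ hgx, h.inv x hx]; omega
    have h3 := h'.nofix _ hgx
    have h4 := h'.inv _ hgx
    have h5 := h'.inv _ hx
    have hx' := h'.lt x hx
    have h6 : g x < g' x := by
      by_contra h7
      have h8 := hin (g' x) h1 (by omega)
      rw [h5] at h8
      have := h.inv (g' x) hx'
      rw [← h8] at this; omega
    have h7 : g' (g x) < x := by
      by_contra h7
      by_cases h9 : g' (g x) = x
      · rw [h9] at h4; omega
      have h8 := hin (g' (g x)) (by omega) (by omega)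
      rw [h4] at h8
      have h10 := h.inv (g' (g x)) (by omega)
      rw [← h8, h.inv x hx] at h10; omega
    exact h'.nc (g' (g x)) x (g x) (g' x) h7 hg h6 hx' h4 rfl

lemma op_inj' {n : ℕ} {g g' : ℕ → ℕ} (h : IsM n g) (h' : IsM n g')
    (he : ∀ k, k < 2 * n → (k < g k ↔ k < g' k)) : ∀ x, x < 2 * n → g' x = g x := by
  intro x hx
  have h1 := h.nofix x hx
  by_cases hg : x < g x
  · exact op_inj h h' he (2 * n) x hx hg (by have := h.lt x hx; omega)
  · have hgx := h.lt x hx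
    have h2 := op_inj h h' he (2 * n) (g x) hgx (by rw [h.inv x hx]; omega) (by rw [h.inv x hx]; omega)
    rw [h.inv x hx] at h2
    have h3 := h'.inv (g x) hgx
    rw [h2] at h3; exact h3

end LP

namespace LP

/-! ### Part C: Dyck words are opener words -/

lemma match_of_height (n : ℕ) (H : ℕ → ℤ) (hst : ∀ k, k < 2 * n → H (k + 1) = H k + 1 ∨ H (k + 1) = H k - 1)
    (h0 : H 0 = 0) (hN : H (2 * n) = 0) (hpos : ∀ k, k ≤ 2 * n → 0 ≤ H k) :
    ∃ g, IsM n g ∧ ∀ k, k < 2 * n → (k < g k ↔ H (k + 1) = H k + 1) := by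
  set R : ℕ → ℕ → Prop := fun x y => x < y ∧ y < 2 * n ∧ H (y + 1) = H x ∧ ∀ z, x < z → z ≤ y → H x < H z with hR
  have R1 : ∀ x y y', R x y → R x y' → y = y' := by
    intro x y y' ⟨a1, a2, a3, a4⟩ ⟨b1, b2, b3, b4⟩
    rcases lt_trichotomy y y' with h | h | h
    · have := b4 (y + 1) (by omega) (by omega); omega
    · exact h
    · have := a4 (y' + 1) (by omega) (by omega); omega
  have R2 : ∀ x x' y, R x y → R x' y → x = x' := by
    intro x x' y ⟨a1, a2, a3, a4⟩ ⟨b1, b2, b3, b4⟩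
    rcases lt_trichotomy x x' with h | h | h
    · have := a4 x' (by omega) (by omega); omega
    · exact h
    · have := b4 x (by omega) (by omega); omega
  have R3 : ∀ x y, R x y → H (x + 1) = H x + 1 ∧ H (y + 1) = H y - 1 := by
    intro x y ⟨a1, a2, a3, a4⟩
    have e1 := a4 (x + 1) (by omega) (by omega)
    have e2 := a4 y (by omega) (by omega)
    have e3 := hst x (by omega)
    have e4 := hst y (by omega)
    omega
  have ex : ∀ k, k < 2 * n → ∃ j, j < 2 * n ∧ (R k j ∨ R j k) := by
    intro k hk
    rcases hst k hk with h | h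
    · have hex : ∃ w, k < w ∧ H w ≤ H k := ⟨2 * n, hk, by rw [hN]; exact hpos k hk.le⟩
      classical
      have hs := Nat.find_spec hex
      have hm : ∀ m, m < Nat.find hex → ¬ (k < m ∧ H m ≤ H k) := fun m hm => Nat.find_min hex hm
      have hle : Nat.find hex ≤ 2 * n := Nat.find_min' hex ⟨hk, by rw [hN]; exact hpos k hk.le⟩
      generalize Nat.find hex = w at hs hm hle
      have h1 : w ≠ k + 1 := by rintro rfl; omega
      obtain ⟨y, rfl⟩ : ∃ y, w = y + 1 := ⟨w - 1, by omega⟩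
      refine ⟨y, by omega, Or.inl ⟨by omega, by omega, ?_, ?_⟩⟩
      · have := hm y (by omega)
        have h2 := hst y (by omega)
        have h3 : ¬ H y ≤ H k := fun h => this ⟨by omega, h⟩
        omega
      · intro z hz1 hz2
        have := hm z (by omega)
        by_contra h4
        exact this ⟨hz1, by omega⟩
    · have key : ∀ d, d ≤ k → (∀ z, k - d < z → z ≤ k → H (k + 1) < H z) ∨ ∃ j, R j k := by
        intro d
        induction d with
        | zero => intro _; left; intro z hz1 hz2; omega
        | succ d ih =>
          intro hd
          rcases ih (by omega) with h1 | h1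
          · by_cases h2 : H (k + 1) < H (k - d)
            · left
              intro z hz1 hz2
              by_cases h3 : z = k - d
              · rw [h3]; exact h2
              · exact h1 z (by omega) hz2
            · right
              have hd0 : d ≠ 0 := by
                rintro rfl
                simp at h2; omega
              have h3 := h1 (k - d + 1) (by omega) (by omega)
              have h4 := hst (k - d) (by omega)
              have h5 : H (k + 1) = H (k - d) := by omega
              refine ⟨k - d, by omega, hk, h5, ?_⟩
              intro z hz1 hz2
              rw [← h5]
              exact h1 z hz1 hz2
          · right; exact h1
      rcases key k le_rfl with h1 | ⟨j, hj⟩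
      · refine ⟨0, by omega, Or.inr ?_⟩
        have h2 := hpos (k + 1) (by omega)
        have hk0 : k ≠ 0 := by
          rintro rfl
          rw [h0] at h; omega
        have h3 := h1 1 (by omega) (by omega)
        have h4 := hst 0 (by omega)
        have h5 : H (k + 1) = H 0 := by simp only [zero_add] at h4; omega
        refine ⟨by omega, hk, h5, ?_⟩
        intro z hz1 hz2
        rw [← h5]
        exact h1 z (by omega) hz2
      · exact ⟨j, by have := hj.1; omega, Or.inr hj⟩
  choose! g hg1 hg2 using ex
  refine ⟨g, ⟨hg1, ?_, ?_, ?_⟩, ?_⟩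
  · intro k hk
    have a := hg2 k hk
    have b := hg2 (g k) (hg1 k hk)
    rcases a with a | a <;> rcases b with b | b
    · have := R3 _ _ a; have := R3 _ _ b; omega
    · exact R2 _ _ _ b a
    · exact R1 _ _ _ b a
    · have := R3 _ _ a; have := R3 _ _ b; omega
  · intro k hk
    rcases hg2 k hk with a | a
    · have := a.1; omega
    · have := a.1; omega
  · intro a b c d hab hbc hcd hd hga hgb
    have h1 := hg2 a (by omega)
    have h2 := hg2 b (by omega)
    rw [hga] at h1
    rw [hgb] at h2
    rcases h1 with h1 | h1
    · rcases h2 with h2 | h2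
      · obtain ⟨a1, a2, a3, a4⟩ := h1
        obtain ⟨b1, b2, b3, b4⟩ := h2
        have := a4 b hab (by omega)
        have := b4 (c + 1) (by omega) (by omega)
        omega
      · have := h2.1; omega
    · have := h1.1; omega
  · intro k hk
    rcases hg2 k hk with a | a
    · have := R3 _ _ a; have := a.1; omega
    · have := R3 _ _ a; have := a.1; omega

lemma Dy_cnt (l : List ℤ) : ∀ m : ℤ, Dy m l → (∀ x ∈ l, 0 ≤ x) → ∀ k : ℤ, k ≤ m + 2 * l.length →
    k - m ≤ 2 * cnt l 0 k := by
  induction l with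
  | nil => intro m _ _ k hk; simp at hk ⊢; exact hk
  | cons x l ih =>
    intro m hD h k hk
    simp only [List.mem_cons, forall_eq_or_imp] at h
    have h1 := ih (m + 2) hD.2 h.2 k (by simp at hk; omega)
    have h2 := hD.1
    have h3 := cnt_nonneg l 0 k
    simp only [cnt_cons]
    split_ifs <;> omega

lemma sorted_ext {l l' : List ℤ} (h : l.Pairwise (· < ·)) (h' : l'.Pairwise (· < ·))
    (he : ∀ x, x ∈ l ↔ x ∈ l') : l = l' := by
  refine List.Perm.eq_of_pairwise (le := (· < ·)) ?_ h h' ?_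
  · intro a b _ _ h1 h2; exact absurd h1 (lt_asymm h2)
  · rw [List.perm_ext_iff_of_nodup (h.imp (fun h => ne_of_lt h)) (h'.imp (fun h => ne_of_lt h))]
    exact he

lemma exists_match (n : ℕ) (l : List ℤ) (hs : l.Pairwise (· < ·)) (hD : Dy 0 l) (hl : l.length = n)
    (hp : ∀ x ∈ l, 0 ≤ x) : ∃ g, IsM n g ∧ opw n g = l := by
  have hnd : l.Nodup := hs.imp (fun h => ne_of_lt h)
  have hstep : ∀ k : ℕ, cnt l 0 ((k + 1 : ℕ) : ℤ) = cnt l 0 k + if (k : ℤ) ∈ l then 1 else 0 := by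
    intro k
    rw [← cnt_single l hnd]
    push_cast
    rw [cnt_add l (by omega) (by omega)]
  have hpos : ∀ k : ℕ, k ≤ 2 * n → (0:ℤ) ≤ 2 * cnt l 0 k - k := by
    intro k hk
    have := Dy_cnt l 0 hD hp k (by rw [hl]; omega)
    omega
  have h2n : cnt l 0 ((2 * n : ℕ) : ℤ) = n := by
    have := hpos (2 * n) le_rfl
    have := cnt_le_length l 0 ((2 * n : ℕ) : ℤ)
    rw [hl] at this
    push_cast at *
    omega
  obtain ⟨g, hg, hg2⟩ := match_of_height n (fun k => 2 * cnt l 0 k - k) (by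
    intro k _
    simp only [hstep]
    push_cast
    split_ifs <;> omega) (by simp [cnt_empty]) (by simp only [h2n]; push_cast; ring) hpos
  refine ⟨g, hg, ?_⟩
  apply sorted_ext (opw_sorted n g) hs
  intro x
  rw [opw_mem]
  have hiff : ∀ k, k < 2 * n → (k < g k ↔ (k : ℤ) ∈ l) := by
    intro k hk
    rw [hg2 k hk, hstep]
    push_cast
    split_ifs with h
    · simp [h]; ring
    · simp [h]; omega
  constructor
  · rintro ⟨k, h1, h2, rfl⟩
    exact (hiff k h1).1 h2
  · intro hx
    have h0 := hp x hx
    have h3 : x < 2 * n := by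
      by_contra hc
      have := cnt_lt_length l 0 ((2 * n : ℕ) : ℤ) ⟨x, hx, Or.inr (by push_cast; omega)⟩
      omega
    refine ⟨x.toNat, by omega, ?_, by omega⟩
    rw [hiff _ (by omega)]
    rwa [Int.toNat_of_nonneg h0]

end LP

namespace LP

/-! ### Part D: the weights and the expansion -/

structure UW {R : Type*} [CommRing R] (τ : R) (U : ℤ → R) : Prop where
  zero : U 0 = 1
  neg : U (-1) = 0
  rc : ∀ s, U (s + 2) + τ * U (s + 1) + U s = 0

section
variable {R : Type*} [CommRing R]

def Cw (U : ℤ → R) (n : ℕ) (g : ℕ → ℕ) (l : List ℤ) : R :=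
  ∏ k ∈ Finset.range (2 * n), if k < g k then U (se l g k) else 1

lemma Cw_ne {τ : R} {U : ℤ → R} (hU : UW τ U) {n : ℕ} {g : ℕ → ℕ} {l : List ℤ} (h : Cw U n g l ≠ 0) :
    ∀ k, k < 2 * n → k < g k → se l g k ≠ -1 := by
  intro k hk hg he
  apply h
  apply Finset.prod_eq_zero (Finset.mem_range.2 hk)
  rw [if_pos hg, he, hU.neg]

lemma Cw_bd {τ : R} {U : ℤ → R} (hU : UW τ U) {n : ℕ} {g : ℕ → ℕ} (hg : IsM n g) {l : List ℤ}
    (hl : l.length = n) (h : ∃ x ∈ l, x < 0 ∨ 2 * (n : ℤ) - 1 ≤ x) : Cw U n g l = 0 := by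
  by_contra hc
  obtain ⟨x, hx, h1⟩ := h
  have := (lemL_prefix hg l hl (Cw_ne hU hc)).1 x hx
  omega

lemma Cw_op {τ : R} {U : ℤ → R} (hU : UW τ U) {n : ℕ} {g : ℕ → ℕ} (hg : IsM n g) :
    Cw U n g (opw n g) = 1 := by
  apply Finset.prod_eq_one
  intro k hk
  rw [Finset.mem_range] at hk
  split_ifs with h
  · have := arc_op hg hk h
    have h2 := se_eq hg (opw n g) hk h
    rw [show se (opw n g) g k = 0 by omega, hU.zero]
  · rfl

def CK (U : ℤ → R) (n : ℕ) (g : ℕ → ℕ) (l : List ℤ) : R := if l.length = n then Cw U n g l else 0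

lemma se_append_cons (pre : List ℤ) (x y : ℤ) (suf : List ℤ) (g : ℕ → ℕ) (k : ℕ) :
    se (pre ++ x :: y :: suf) g k = se (pre ++ suf) g k + (if (k : ℤ) ≤ x ∧ x < g k then 1 else 0)
      + (if (k : ℤ) ≤ y ∧ y < g k then 1 else 0) := by
  unfold se; simp only [cnt_append, cnt_cons]; ring

lemma CK_rel {τ : R} {U : ℤ → R} (hU : UW τ U) {n : ℕ} {g : ℕ → ℕ} (hg : IsM n g) :
    Rel τ (CK U n g) := by
  intro pre x suf
  unfold CK
  simp only [List.length_append, List.length_cons]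
  split_ifs with hl
  swap
  · simp
  by_cases hx : 0 ≤ x ∧ x < 2 * n
  swap
  · rw [Cw_bd hU hg, Cw_bd hU hg, Cw_bd hU hg]
    · simp
    · simpa using hl
    · exact ⟨x - 1, by simp, by omega⟩
    · simpa using hl
    · exact ⟨x, by simp, by omega⟩
    · simpa using hl
    · exact ⟨x, by simp, by omega⟩
  obtain ⟨m, rfl⟩ : ∃ m : ℕ, x = m := ⟨x.toNat, by omega⟩
  have hm : m < 2 * n := by omega
  have hgm := hg.lt m hm
  have hiv := hg.inv m hm
  have hnf := hg.nofix m hm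
  set a := min m (g m) with ha
  have haR : a ∈ Finset.range (2 * n) := by rw [Finset.mem_range]; omega
  have hoth : ∀ k ∈ (Finset.range (2 * n)).erase a, k < g k → (m : ℤ) ≠ k ∧ (m : ℤ) ≠ g k := by
    intro k hk hkg
    rw [Finset.mem_erase, Finset.mem_range] at hk
    constructor
    · intro h
      have : m = k := by omega
      subst this; omega
    · intro h
      have : m = g k := by omega
      have h2 := hg.inv k hk.2
      rw [← this] at h2; omega
  have hprod : ∀ y z : ℤ, (y = m ∨ y = m - 1) → (z = m ∨ z = m - 1) →
      Cw U n g (pre ++ y :: z :: suf) =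
      (U (se (pre ++ y :: z :: suf) g a)) * ∏ k ∈ (Finset.range (2 * n)).erase a,
        if k < g k then U (se (pre ++ (m : ℤ) :: (m : ℤ) :: suf) g k) else 1 := by
    intro y z hy hz
    unfold Cw
    rw [← Finset.mul_prod_erase _ _ haR]
    congr 1
    · rw [if_pos]
      rcases le_total m (g m) with h | h
      · rw [ha, min_eq_left h]; omega
      · rw [ha, min_eq_right h, hiv]; omega
    · apply Finset.prod_congr rfl
      intro k hk
      split_ifs with h
      swap
      · rfl
      congr 1
      rw [se_append_cons, se_append_cons]
      have := hoth k hk h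
      have e1 : ((k : ℤ) ≤ y ∧ y < g k) = ((k : ℤ) ≤ m ∧ (m : ℤ) < g k) := by
        apply propext; rcases hy with rfl | rfl <;> omega
      have e2 : ((k : ℤ) ≤ z ∧ z < g k) = ((k : ℤ) ≤ m ∧ (m : ℤ) < g k) := by
        apply propext; rcases hz with rfl | rfl <;> omega
      simp only [e1, e2]
  rw [hprod _ _ (Or.inl rfl) (Or.inl rfl), hprod _ _ (Or.inr rfl) (Or.inl rfl),
    hprod _ _ (Or.inr rfl) (Or.inr rfl)]
  generalize (∏ k ∈ (Finset.range (2 * n)).erase a,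
    if k < g k then U (se (pre ++ (m : ℤ) :: (m : ℤ) :: suf) g k) else 1) = Q
  simp only [se_append_cons]
  generalize se (pre ++ suf) g a = s
  rcases lt_or_gt_of_ne hnf with h | h
  · rw [ha, min_eq_right h.le, hiv]
    rw [if_neg (by omega), if_pos (by omega)]
    have := hU.rc s
    simp only [add_zero]
    rw [show s + 1 + 1 = s + 2 by ring]
    linear_combination Q * this
  · rw [ha, min_eq_left h.le]
    rw [if_neg (by omega : ¬ ((m : ℤ) ≤ m - 1 ∧ (m : ℤ) - 1 < g m)), if_pos (by omega)]
    have := hU.rc s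
    simp only [add_zero]
    rw [show s + 1 + 1 = s + 2 by ring]
    linear_combination Q * this

/-- triangular systems -/
lemma tri_solve {ι : Type*} [Fintype ι] (h : ι → ℕ) (M : ι → ι → R) (h1 : ∀ i, M i i = 1)
    (h2 : ∀ i j, M i j ≠ 0 → i = j ∨ h i < h j) (A : ι → R) :
    ∃ v : ι → R, ∀ i, ∑ j, M i j * v j = A i := by
  classical
  obtain ⟨B, hB⟩ : ∃ B, ∀ i, h i < B := ⟨(∑ i, h i) + 1, fun i => Nat.lt_succ_of_le
    (Finset.single_le_sum (f := h) (fun _ _ => Nat.zero_le _) (Finset.mem_univ i))⟩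
  have key : ∀ k, ∃ v : ι → R, ∀ i, B ≤ h i + k → ∑ j, M i j * v j = A i := by
    intro k
    induction k with
    | zero => exact ⟨0, fun i hi => absurd (hB i) (by omega)⟩
    | succ k ih =>
      obtain ⟨v, hv⟩ := ih
      refine ⟨fun i => if B = h i + (k + 1) then v i + (A i - ∑ j, M i j * v j) else v i, ?_⟩
      intro i hi
      by_cases hi2 : B = h i + (k + 1)
      · have : ∀ j ∈ Finset.univ, M i j * (if B = h j + (k + 1) then v j + (A j - ∑ j', M j j' * v j') else v j)
          = M i j * v j + if j = i then (A i - ∑ j, M i j * v j) else 0 := by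
          intro j _
          by_cases hj : j = i
          · subst hj; rw [if_pos hi2, if_pos rfl, h1]; ring
          · rw [if_neg hj]
            by_cases hM : M i j = 0
            · rw [hM]; ring
            · have := (h2 i j hM).resolve_left (fun e => hj e.symm)
              rw [if_neg (by omega)]; ring
        rw [Finset.sum_congr rfl this, Finset.sum_add_distrib]
        simp
      · rw [← hv i (by omega)]
        apply Finset.sum_congr rfl
        intro j _
        by_cases hM : M i j = 0
        · rw [hM]; ring
        · rcases h2 i j hM with rfl | h3
          · simp only [if_neg hi2]
          · dsimp only
            rw [if_neg (by omega)]
  obtain ⟨v, hv⟩ := key B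
  exact ⟨v, fun i => hv i (by omega)⟩

lemma tri_inj {ι : Type*} [Fintype ι] (h : ι → ℕ) (M : ι → ι → R) (h1 : ∀ i, M i i = 1)
    (h2 : ∀ i j, M i j ≠ 0 → i = j ∨ h i < h j) (v : ι → R) (hv : ∀ i, ∑ j, M i j * v j = 0) : v = 0 := by
  classical
  obtain ⟨B, hB⟩ : ∃ B, ∀ i, h i < B := ⟨(∑ i, h i) + 1, fun i => Nat.lt_succ_of_le
    (Finset.single_le_sum (f := h) (fun _ _ => Nat.zero_le _) (Finset.mem_univ i))⟩
  have key : ∀ k, ∀ i, B ≤ h i + k → v i = 0 := by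
    intro k
    induction k with
    | zero => exact fun i hi => absurd (hB i) (by omega)
    | succ k ih =>
      intro i hi
      have := hv i
      rw [Finset.sum_eq_single i] at this
      · rwa [h1, one_mul] at this
      · intro j _ hj
        by_cases hM : M i j = 0
        · rw [hM, zero_mul]
        · have := (h2 i j hM).resolve_left (fun e => hj e.symm)
          rw [ih j (by omega), mul_zero]
      · simp
  funext i
  exact key B i (by omega)

end

/-- the matching as a function on naturals -/
def NG {n : ℕ} (π : NCM n) (k : ℕ) : ℕ := if h : k < 2 * n then (π.f ⟨k, h⟩ : ℕ) else 0

lemma NG_fin {n : ℕ} (π : NCM n) (k : Fin (2 * n)) : NG π k = π.f k := by simp [NG]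

lemma NG_isM {n : ℕ} (π : NCM n) : IsM n (NG π) := by
  have e : ∀ k (hk : k < 2 * n), NG π k = π.f ⟨k, hk⟩ := fun k hk => by simp [NG, hk]
  refine ⟨?_, ?_, ?_, ?_⟩
  · intro k hk; rw [e k hk]; exact Fin.is_lt _
  · intro k hk; rw [e k hk, NG_fin, π.invol]
  · intro k hk h
    rw [e k hk] at h
    exact π.nofix ⟨k, hk⟩ (Fin.ext h)
  · intro a b c d hab hbc hcd hd h1 h2
    rw [e a (by omega)] at h1
    rw [e b (by omega)] at h2
    exact π.noncross ⟨a, by omega⟩ ⟨b, by omega⟩ ⟨c, by omega⟩ ⟨d, hd⟩ hab hbc hcd (Fin.ext h1) (Fin.ext h2)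

def ofM {n : ℕ} (g : ℕ → ℕ) (hg : IsM n g) : NCM n where
  f k := ⟨g k, hg.lt k k.2⟩
  invol k := Fin.ext (hg.inv k k.2)
  nofix k h := hg.nofix k k.2 (congrArg Fin.val h)
  noncross a b c d h1 h2 h3 h4 h5 := hg.nc a b c d h1 h2 h3 d.2 (congrArg Fin.val h4) (congrArg Fin.val h5)

lemma NG_ofM {n : ℕ} (g : ℕ → ℕ) (hg : IsM n g) (k : ℕ) (hk : k < 2 * n) : NG (ofM g hg) k = g k := by
  simp [NG, ofM, hk]

lemma NG_ext {n : ℕ} {π σ : NCM n} (h : ∀ k, k < 2 * n → NG π k = NG σ k) : π = σ := by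
  apply NCM.ext'
  funext k
  apply Fin.ext
  rw [← NG_fin, ← NG_fin]; exact h k k.2

section
variable {R : Type*} [CommRing R]

lemma Cw_congr (U : ℤ → R) {n : ℕ} {g g' : ℕ → ℕ} (h : ∀ k, k < 2 * n → g k = g' k) (l : List ℤ) :
    Cw U n g l = Cw U n g' l := by
  apply Finset.prod_congr rfl
  intro k hk
  rw [Finset.mem_range] at hk
  unfold se
  rw [h k hk]

lemma opw_congr {n : ℕ} {g g' : ℕ → ℕ} (h : ∀ k, k < 2 * n → g k = g' k) : opw n g = opw n g' := by
  unfold opw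
  congr 1
  apply List.filter_congr
  intro k hk
  rw [List.mem_range] at hk
  rw [h k hk]

def hgt {n : ℕ} (π : NCM n) : ℕ := ∑ x ∈ Finset.range (2 * n + 1), (cnt (opw n (NG π)) 0 x).toNat

lemma Cw_tri {τ : R} {U : ℤ → R} (hU : UW τ U) {n : ℕ} (σ π : NCM n)
    (h : Cw U n (NG π) (opw n (NG σ)) ≠ 0) : σ = π ∨ hgt σ < hgt π := by
  have h1 := (lemL_prefix (NG_isM π) (opw n (NG σ)) (opw_length (NG_isM σ)) (Cw_ne hU h)).2
  by_cases he : ∀ x : ℕ, x ≤ 2 * n → cnt (opw n (NG σ)) 0 x = cnt (opw n (NG π)) 0 x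
  · left
    apply NG_ext
    apply op_inj' (NG_isM π) (NG_isM σ)
    intro k hk
    have e1 := he k (by omega)
    have e2 := he (k + 1) (by omega)
    have s1 := opw_single n (NG σ) k hk
    have s2 := opw_single n (NG π) k hk
    have a1 := cnt_add (opw n (NG σ)) (a := 0) (b := k) (c := (k : ℤ) + 1) (by omega) (by omega)
    have a2 := cnt_add (opw n (NG π)) (a := 0) (b := k) (c := (k : ℤ) + 1) (by omega) (by omega)
    push_cast at e2
    by_cases h3 : k < NG σ k <;> by_cases h4 : k < NG π k <;> simp only [h3, h4, if_true, if_false] at s1 s2 ⊢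
    · omega
    · omega
  · right
    push Not at he
    obtain ⟨x, hx, hne⟩ := he
    apply Finset.sum_lt_sum
    · intro i hi
      rw [Finset.mem_range] at hi
      have := h1 i (by omega)
      omega
    · refine ⟨x, Finset.mem_range.2 (by omega), ?_⟩
      have := h1 x hx
      have := cnt_nonneg (opw n (NG σ)) 0 x
      omega

theorem C_inj {τ : R} {U : ℤ → R} (hU : UW τ U) {n : ℕ} (v : NCM n → R)
    (h : ∀ σ : NCM n, ∑ π, Cw U n (NG π) (opw n (NG σ)) * v π = 0) : v = 0 :=
  tri_inj hgt (fun σ π => Cw U n (NG π) (opw n (NG σ))) (fun σ => Cw_op hU (NG_isM σ))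
    (fun σ π h => Cw_tri hU σ π h) v h

end

noncomputable def UX (s : ℤ) : Polynomial ℝ := (Polynomial.Chebyshev.S ℝ s).comp (-Polynomial.X)

lemma UX_UW : UW (Polynomial.X : Polynomial ℝ) UX := by
  refine ⟨?_, ?_, ?_⟩
  · simp [UX]
  · simp [UX]
  · intro s
    unfold UX
    rw [Polynomial.Chebyshev.S_add_two]
    simp only [Polynomial.sub_comp, Polynomial.mul_comp, Polynomial.X_comp]
    ring

/-- expansion theorem -/
theorem exists_psi (n : ℕ) (A : List ℤ → Polynomial ℝ) (hR : Rel (Polynomial.X : Polynomial ℝ) A)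
    (hlen : ∀ l, l.length ≠ n → A l = 0)
    (hbd : ∀ l, (∃ x ∈ l, x < 0 ∨ 2 * (n : ℤ) - 1 ≤ x) → A l = 0) :
    ∃ ψ : NCM n → Polynomial ℝ, ∀ l : List ℤ, l.Pairwise (· ≤ ·) → l.length = n →
      A l = ∑ π, Cw UX n (NG π) l * ψ π := by
  obtain ⟨ψ, hψ⟩ := tri_solve hgt (fun σ π : NCM n => Cw UX n (NG π) (opw n (NG σ)))
    (fun σ => Cw_op UX_UW (NG_isM σ)) (fun σ π h => Cw_tri UX_UW σ π h) (fun σ => A (opw n (NG σ)))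
  refine ⟨ψ, ?_⟩
  intro l hl hn
  have := uniq_poly n (fun l => A l - ∑ π, CK UX n (NG π) l * ψ π) ?_ ?_ ?_ ?_ l hl
  · simp only [CK, hn, if_true] at this
    exact sub_eq_zero.1 this
  · intro pre x suf
    have h1 := hR pre x suf
    have h2 : ∑ π, (CK UX n (NG π) (pre ++ x :: x :: suf) + Polynomial.X * CK UX n (NG π) (pre ++ (x - 1) :: x :: suf)
        + CK UX n (NG π) (pre ++ (x - 1) :: (x - 1) :: suf)) * ψ π = 0 := by
      apply Finset.sum_eq_zero
      intro π _
      rw [CK_rel UX_UW (NG_isM π) pre x suf, zero_mul]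
    simp only [add_mul, Finset.sum_add_distrib, mul_assoc, ← Finset.mul_sum] at h2
    linear_combination h1 - h2
  · intro l h
    simp [hlen l h, CK, h]
  · intro l h
    rw [hbd l h, zero_sub, neg_eq_zero]
    apply Finset.sum_eq_zero
    intro π _
    unfold CK
    split_ifs with h5
    · rw [Cw_bd UX_UW (NG_isM π) h5 h, zero_mul]
    · rw [zero_mul]
  · intro l h1 h2 h3 h4
    obtain ⟨g, hg, rfl⟩ := exists_match n l h1 h2 h3 h4
    have h5 := hψ (ofM g hg)
    rw [opw_congr (NG_ofM g hg)] at h5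
    simp only [CK, h3, if_true]
    rw [h5, sub_self]

end LP

namespace LP

/-! ### Part E: the coefficients -/

/-- product over pairs `i < j` -/
def pp {M : Type*} [CommMonoid M] (n : ℕ) (F : Fin n → Fin n → M) : M :=
  ∏ i, ∏ j, if i < j then F i j else 1

lemma pp_succ {M : Type*} [CommMonoid M] (n : ℕ) (F : Fin (n + 1) → Fin (n + 1) → M) :
    pp (n + 1) F = (∏ j : Fin n, F 0 j.succ) * pp n (fun i j => F i.succ j.succ) := by
  unfold pp
  rw [Fin.prod_univ_succ]
  congr 1
  · rw [Fin.prod_univ_succ]; simp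
  · apply Finset.prod_congr rfl
    intro i _
    rw [Fin.prod_univ_succ]; simp

lemma pp_map {M N : Type*} [CommSemiring M] [CommSemiring N] (φ : M →+* N) (n : ℕ) (F : Fin n → Fin n → M) :
    φ (pp n F) = pp n (fun i j => φ (F i j)) := by
  unfold pp
  simp only [map_prod, apply_ite φ, map_one]

lemma pp_rev {M : Type*} [CommMonoid M] (n : ℕ) (F : Fin n → Fin n → M) :
    pp n (fun i j => F j.rev i.rev) = pp n F := by
  unfold pp
  rw [Finset.prod_comm]
  rw [← Equiv.prod_comp Fin.revPerm]
  apply Finset.prod_congr rfl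
  intro i _
  rw [← Equiv.prod_comp Fin.revPerm]
  apply Finset.prod_congr rfl
  intro j _
  simp

lemma pp_mul {M : Type*} [CommMonoid M] (n : ℕ) (F G : Fin n → Fin n → M) :
    pp n (fun i j => F i j * G i j) = pp n F * pp n G := by
  unfold pp
  rw [← Finset.prod_mul_distrib]
  apply Finset.prod_congr rfl
  intro i _
  rw [← Finset.prod_mul_distrib]
  apply Finset.prod_congr rfl
  intro j _
  split_ifs <;> simp

lemma pp_pair {M : Type*} [CommMonoid M] (n : ℕ) (F : Fin n → Fin n → M) :
    pp n F = ∏ p : Fin n × Fin n with p.1 < p.2, F p.1 p.2 := by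
  unfold pp
  rw [Finset.prod_filter, Fintype.prod_prod_type]

lemma pp_swap {M : Type*} [CommMonoid M] (n : ℕ) (F : Fin n → Fin n → M) (i j : Fin n) (hij : (j : ℕ) = i + 1) :
    ∃ E, pp n (fun a b => F (Equiv.swap i j a) (Equiv.swap i j b)) = F j i * E ∧ pp n F = F i j * E := by
  rw [pp_pair, pp_pair]
  have hmem : (i, j) ∈ (Finset.univ : Finset (Fin n × Fin n)).filter (fun p => p.1 < p.2) := by
    rw [Finset.mem_filter]
    exact ⟨Finset.mem_univ _, by show i < j; rw [Fin.lt_def]; omega⟩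
  rw [← Finset.mul_prod_erase _ _ hmem, ← Finset.mul_prod_erase _ (fun p => F p.1 p.2) hmem]
  simp only [Equiv.swap_apply_left, Equiv.swap_apply_right]
  have : ∏ x ∈ ((Finset.univ : Finset (Fin n × Fin n)).filter (fun p => p.1 < p.2)).erase (i, j),
      F (Equiv.swap i j x.1) (Equiv.swap i j x.2) =
      ∏ x ∈ ((Finset.univ : Finset (Fin n × Fin n)).filter (fun p => p.1 < p.2)).erase (i, j), F x.1 x.2 := by
    have hm : ∀ p ∈ ((Finset.univ : Finset (Fin n × Fin n)).filter (fun p => p.1 < p.2)).erase (i, j),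
      (Equiv.swap i j p.1, Equiv.swap i j p.2) ∈
        ((Finset.univ : Finset (Fin n × Fin n)).filter (fun p => p.1 < p.2)).erase (i, j) := by
      rintro ⟨a, b⟩ hp
      simp only [Finset.mem_erase, Finset.mem_filter, Finset.mem_univ, true_and, ne_eq, Prod.mk.injEq] at hp ⊢
      simp only [Equiv.swap_apply_def]
      simp only [Fin.lt_def, Fin.ext_iff] at *
      split_ifs <;> omega
    refine Finset.prod_bij' (fun p _ => (Equiv.swap i j p.1, Equiv.swap i j p.2))
      (fun p _ => (Equiv.swap i j p.1, Equiv.swap i j p.2)) hm hm ?_ ?_ ?_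
    · intro p _; simp
    · intro p _; simp
    · intro p _; simp
  rw [this]
  exact ⟨_, rfl, rfl⟩

section
variable {R : Type*} [CommRing R]

/-- exponent vector -/
noncomputable def fe {k : ℕ} (e : Fin k → ℤ) : Fin k →₀ ℕ := Finsupp.equivFunOnFinite.symm (fun i => (e i).toNat)

@[simp] lemma fe_apply {k : ℕ} (e : Fin k → ℤ) (i : Fin k) : fe e i = (e i).toNat := rfl

/-- coefficient with integer exponents -/
noncomputable def cz {k : ℕ} (e : Fin k → ℤ) (P : MvPolynomial (Fin k) R) : R :=
  if ∀ i, 0 ≤ e i then P.coeff (fe e) else 0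

lemma cz_add {k : ℕ} (e : Fin k → ℤ) (P Q : MvPolynomial (Fin k) R) : cz e (P + Q) = cz e P + cz e Q := by
  unfold cz; split_ifs <;> simp

lemma cz_neg {k : ℕ} (e : Fin k → ℤ) (P : MvPolynomial (Fin k) R) : cz e (-P) = - cz e P := by
  unfold cz; split_ifs <;> simp

lemma cz_sub {k : ℕ} (e : Fin k → ℤ) (P Q : MvPolynomial (Fin k) R) : cz e (P - Q) = cz e P - cz e Q := by
  unfold cz; split_ifs <;> simp

lemma cz_zero {k : ℕ} (e : Fin k → ℤ) : cz e (0 : MvPolynomial (Fin k) R) = 0 := by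
  unfold cz; split_ifs <;> simp

lemma cz_sum {k : ℕ} (e : Fin k → ℤ) {ι : Type*} (s : Finset ι) (P : ι → MvPolynomial (Fin k) R) :
    cz e (∑ i ∈ s, P i) = ∑ i ∈ s, cz e (P i) := by
  unfold cz; split_ifs
  · simp [MvPolynomial.coeff_sum]
  · simp

lemma cz_C_mul {k : ℕ} (e : Fin k → ℤ) (a : R) (P : MvPolynomial (Fin k) R) :
    cz e (C a * P) = a * cz e P := by
  unfold cz; split_ifs
  · simp [coeff_C_mul]
  · simp

lemma cz_X_mul {k : ℕ} (e : Fin k → ℤ) (i : Fin k) (P : MvPolynomial (Fin k) R) :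
    cz e (X i * P) = cz (Function.update e i (e i - 1)) P := by
  classical
  unfold cz
  by_cases h : ∀ j, 0 ≤ e j
  · rw [if_pos h, coeff_X_mul']
    by_cases h2 : e i = 0
    · rw [if_neg (by simp [h2]), if_neg]
      intro h3
      have := h3 i
      simp [h2] at this
    · have h4 := h i
      rw [if_pos (by simp; omega), if_pos]
      · congr 1
        ext j
        by_cases hj : j = i
        · subst hj; simp
        · simp [hj, Ne.symm hj]
      · intro j
        by_cases hj : j = i
        · subst hj; simp; omega
        · simp [hj, h j]
  · rw [if_neg h, if_neg]
    intro h3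
    apply h
    intro j
    have := h3 j
    by_cases hj : j = i
    · subst hj; simp at this; omega
    · simpa [hj] using this

lemma cz_rename {k : ℕ} (e : Fin k → ℤ) (s : Equiv.Perm (Fin k)) (P : MvPolynomial (Fin k) R) :
    cz e (rename s P) = cz (e ∘ s) P := by
  unfold cz
  have : (∀ i, 0 ≤ e i) ↔ ∀ i, 0 ≤ (e ∘ s) i :=
    ⟨fun h i => h _, fun h i => by have := h (s.symm i); simpa using this⟩
  by_cases h : ∀ i, 0 ≤ e i
  · rw [if_pos h, if_pos (this.1 h)]
    rw [← coeff_rename_mapDomain s s.injective P]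
    congr 1
    ext i
    obtain ⟨j, rfl⟩ := s.surjective i
    rw [Finsupp.mapDomain_apply s.injective]
    simp
  · rw [if_neg h, if_neg (fun h2 => h (this.2 h2))]

lemma cz_cons {k : ℕ} (x : ℕ) (e : Fin k → ℤ) (P : MvPolynomial (Fin (k + 1)) R) :
    cz (Fin.cons (x : ℤ) e) P = cz e ((finSuccEquiv R k P).coeff x) := by
  unfold cz
  have : (∀ i, 0 ≤ (Fin.cons (x : ℤ) e : Fin (k + 1) → ℤ) i) ↔ ∀ i, 0 ≤ e i := by
    rw [Fin.forall_fin_succ]; simp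
  by_cases h : ∀ i, 0 ≤ e i
  · rw [if_pos h, if_pos (this.2 h), finSuccEquiv_coeff_coeff]
    congr 1
    ext i
    refine Fin.cases ?_ (fun i => ?_) i <;> simp
  · rw [if_neg h, if_neg (fun h2 => h (this.1 h2))]

lemma cz_prodX {k : ℕ} (e : Fin k → ℤ) (P : MvPolynomial (Fin k) R) :
    cz e ((∏ i, X i) * P) = cz (fun i => e i - 1) P := by
  classical
  have : ∀ s : Finset (Fin k), ∀ e : Fin k → ℤ,
      cz e ((∏ i ∈ s, X i) * P) = cz (fun i => if i ∈ s then e i - 1 else e i) P := by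
    intro s
    induction s using Finset.induction_on with
    | empty => intro e; simp
    | insert a s ha ih =>
      intro e
      rw [Finset.prod_insert ha, mul_assoc, cz_X_mul, ih]
      congr 1
      funext i
      by_cases hi : i = a
      · subst hi; simp [ha]
      · simp [hi]
  rw [this]; simp

end

end LP

namespace LP

/-! ### Part F: the polynomial -/

section
variable {R : Type*} [CommRing R]

noncomputable def PP (τ : R) (n : ℕ) : MvPolynomial (Fin n) R :=
  pp n (fun i j => (X j - X i) * (1 + C τ * X j + X i * X j))

/-- reversed version -/
noncomputable def PQ (τ : R) (n : ℕ) : MvPolynomial (Fin n) R :=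
  pp n (fun i j => (X i - X j) * (1 + C τ * X i + X i * X j))

lemma PP_rev (τ : R) (n : ℕ) : rename Fin.rev (PP τ n) = PQ τ n := by
  unfold PP PQ
  rw [← pp_rev]
  have := pp_map (rename (R := R) (Fin.rev : Fin n → Fin n)).toRingHom n
    (fun i j => (X i.rev - X j.rev) * (1 + C τ * X i.rev + X j.rev * X i.rev))
  refine this.trans ?_
  congr 1
  funext i j
  simp [mul_comm]

lemma cz_PP_rev (τ : R) (n : ℕ) (e : Fin n → ℤ) : cz e (PP τ n) = cz (e ∘ Fin.rev) (PQ τ n) := by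
  rw [← PP_rev]
  have := cz_rename (e ∘ Fin.rev) Fin.revPerm (PP τ n)
  have h2 : (e ∘ Fin.rev) ∘ Fin.revPerm = e := by funext i; simp
  rw [h2] at this
  rw [← this]
  rfl

lemma PP_swap (τ : R) (n : ℕ) (i j : Fin n) (hij : (j : ℕ) = i + 1) :
    rename (Equiv.swap i j) (PP τ n * (1 + C τ * X i + X i * X j)) = -(PP τ n * (1 + C τ * X i + X i * X j)) := by
  unfold PP
  rw [map_mul]
  have h1 := pp_map (rename (R := R) (Equiv.swap i j)).toRingHom n
    (fun i j => (X j - X i) * (1 + C τ * X j + X i * X j))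
  obtain ⟨E, e1, e2⟩ := pp_swap n (fun i j => (X j - X i : MvPolynomial (Fin n) R) * (1 + C τ * X j + X i * X j)) i j hij
  rw [e2]
  have h3 : rename (R := R) (Equiv.swap i j) (pp n (fun i j => (X j - X i) * (1 + C τ * X j + X i * X j))) =
      (X i - X j) * (1 + C τ * X i + X j * X i) * E := by
    rw [← e1]
    refine h1.trans ?_
    congr 1
    funext a b
    simp
  rw [e2] at h3
  rw [h3]
  simp
  ring

noncomputable def AA (τ : R) (n : ℕ) (l : List ℤ) : R :=
  if l.length = n then cz (fun i : Fin n => l.getD i 0) (PP τ n) else 0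

lemma getD_update (pre : List ℤ) (x y : ℤ) (suf : List ℤ) (n : ℕ) (hp : pre.length < n) :
    (fun i : Fin n => (pre ++ y :: suf).getD i 0) =
      Function.update (fun i : Fin n => (pre ++ x :: suf).getD i 0) ⟨pre.length, hp⟩ y := by
  funext i
  by_cases hi : i = ⟨pre.length, hp⟩
  · subst hi; simp
  · rw [Function.update_of_ne hi]
    have : (i : ℕ) ≠ pre.length := fun h => hi (Fin.ext h)
    rcases lt_or_gt_of_ne this with h | h
    · simp [List.getElem?_append_left h]
    · obtain ⟨d, hd⟩ : ∃ d, (i : ℕ) = pre.length + (d + 1) := ⟨i - pre.length - 1, by omega⟩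
      simp only [hd, List.getD_eq_getElem?_getD]
      rw [List.getElem?_append_right (by omega), List.getElem?_append_right (by omega)]
      simp

lemma AA_rel (h2 : ∀ a : R, a + a = 0 → a = 0) (τ : R) (n : ℕ) : Rel τ (AA τ n) := by
  intro pre x suf
  unfold AA
  simp only [List.length_append, List.length_cons]
  split_ifs with hl
  swap
  · simp
  set i : Fin n := ⟨pre.length, by omega⟩ with hi
  set j : Fin n := ⟨pre.length + 1, by omega⟩ with hj
  have hij : i ≠ j := by intro h; simp [hi, hj] at h
  set e : Fin n → ℤ := fun i => (pre ++ x :: x :: suf).getD i 0 with he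
  have ei : e i = x := by simp [he, hi]
  have ej : e j = x := by
    simp only [he, hj, List.getD_eq_getElem?_getD]
    rw [List.getElem?_append_right (by omega)]; simp
  have e1 : (fun i : Fin n => (pre ++ (x - 1) :: x :: suf).getD i 0) = Function.update e i (x - 1) :=
    getD_update pre x (x - 1) (x :: suf) n (by omega)
  have e2 : (fun i : Fin n => (pre ++ (x - 1) :: (x - 1) :: suf).getD i 0) =
      Function.update (Function.update e i (x - 1)) j (x - 1) := by
    rw [← e1]
    have := getD_update (pre ++ [x - 1]) x (x - 1) suf n (by simp; omega)
    simp only [List.append_assoc, List.singleton_append] at this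
    rw [this]
    congr 1
    simp [hj]
  rw [e1, e2]
  have hsw := PP_swap τ n i j (by simp [hi, hj])
  have h3 := congrArg (cz e) hsw
  rw [cz_rename, cz_neg] at h3
  have h4 : e ∘ (Equiv.swap i j) = e := by
    funext k
    simp only [Function.comp, Equiv.swap_apply_def]
    split_ifs with h5 h6
    · rw [h5, ei, ej]
    · rw [h6, ei, ej]
    · rfl
  rw [h4] at h3
  have h5 := h2 _ (by linear_combination h3 : cz e (PP τ n * (1 + C τ * X i + X i * X j)) +
    cz e (PP τ n * (1 + C τ * X i + X i * X j)) = 0)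
  rw [show PP τ n * (1 + C τ * X i + X i * X j) = PP τ n + C τ * (X i * PP τ n) + X i * (X j * PP τ n) by ring,
    cz_add, cz_add, cz_C_mul, cz_X_mul, cz_X_mul, cz_X_mul, ei, Function.update_of_ne hij.symm, ej] at h5
  exact h5

lemma PP_deg [Nontrivial R] (τ : R) (n : ℕ) (i : Fin n) : degreeOf i (PP τ n) ≤ 2 * (n - 1) := by
  classical
  unfold PP
  rw [pp_pair]
  refine (degreeOf_prod_le _ _ _).trans ?_
  have key : ∀ p ∈ (Finset.univ : Finset (Fin n × Fin n)).filter (fun p => p.1 < p.2),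
      degreeOf i ((X p.2 - X p.1) * (1 + C τ * X p.2 + X p.1 * X p.2)) ≤
        (if p.1 = i then 2 else 0) + (if p.2 = i then 2 else 0) := by
    rintro ⟨a, b⟩ hp
    have hab : a < b := by simpa using hp
    have hd : ∀ c : Fin n, degreeOf i (X c : MvPolynomial (Fin n) R) = if i = c then 1 else 0 := fun c => degreeOf_X i c
    have h1 : degreeOf i (X b - X a : MvPolynomial (Fin n) R) ≤ max (if i = b then 1 else 0) (if i = a then 1 else 0) := by
      refine (degreeOf_sub_le _ _ _).trans ?_
      rw [hd, hd]
    have h2 : degreeOf i (C τ * X b : MvPolynomial (Fin n) R) ≤ (if i = b then 1 else 0) := by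
      refine (degreeOf_mul_le _ _ _).trans ?_
      rw [hd, degreeOf_C]; simp
    have h3 : degreeOf i (X a * X b : MvPolynomial (Fin n) R) ≤ (if i = a then 1 else 0) + (if i = b then 1 else 0) := by
      refine (degreeOf_mul_le _ _ _).trans ?_
      rw [hd, hd]
    have h0 : degreeOf i (1 : MvPolynomial (Fin n) R) = 0 := degreeOf_C 1 i
    have h4 : degreeOf i (1 + C τ * X b + X a * X b : MvPolynomial (Fin n) R) ≤ (if i = a then 1 else 0) + (if i = b then 1 else 0) := by
      refine (degreeOf_add_le _ _ _).trans (max_le ((degreeOf_add_le _ _ _).trans (max_le ?_ ?_)) h3)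
      · rw [h0]; exact Nat.zero_le _
      · exact h2.trans (Nat.le_add_left _ _)
    refine (degreeOf_mul_le _ _ _).trans ((add_le_add h1 h4).trans ?_)
    simp only [Fin.ext_iff, Fin.lt_def] at *
    split_ifs <;> omega
  refine (Finset.sum_le_sum key).trans ?_
  rw [Finset.sum_filter, Fintype.sum_prod_type]
  have : ∀ x y : Fin n, (if x < y then (if x = i then 2 else 0) + (if y = i then 2 else 0) else 0) =
      (if x = i then (if i < y then 2 else 0) else 0) + (if y = i then (if x < i then 2 else 0) else 0) := by
    intro x y
    by_cases h1 : x = i <;> by_cases h2 : y = i <;> simp [h1, h2]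
  simp only [this, Finset.sum_add_distrib]
  rw [Finset.sum_comm]
  simp only [Finset.sum_ite_eq', Finset.mem_univ, if_true]
  rw [← Finset.sum_filter, ← Finset.sum_filter]
  simp only [Finset.sum_const, smul_eq_mul]
  have e1 : (Finset.univ.filter (fun x : Fin n => i < x)).card = n - 1 - i := by
    rw [Finset.filter_lt_eq_Ioi, Fin.card_Ioi]
  have e2 : (Finset.univ.filter (fun x : Fin n => x < i)).card = i := by
    rw [Finset.filter_gt_eq_Iio, Fin.card_Iio]
  rw [e1, e2]
  omega

lemma AA_bd [Nontrivial R] (τ : R) (n : ℕ) (l : List ℤ) (h : ∃ x ∈ l, x < 0 ∨ 2 * (n : ℤ) - 1 ≤ x) : AA τ n l = 0 := by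
  unfold AA
  split_ifs with hl
  swap
  · rfl
  obtain ⟨x, hx, hx2⟩ := h
  obtain ⟨i, hi, rfl⟩ := List.getElem_of_mem hx
  unfold cz
  split_ifs with h0
  swap
  · rfl
  have h1 := h0 ⟨i, by omega⟩
  simp only [List.getD_eq_getElem?_getD, List.getElem?_eq_getElem hi, Option.getD_some] at h1
  by_contra hc
  have h3 := monomial_le_degreeOf ⟨i, by omega⟩ (mem_support_iff.2 hc)
  have h4 := PP_deg τ n ⟨i, by omega⟩
  rw [fe_apply] at h3
  simp only [List.getD_eq_getElem?_getD, List.getElem?_eq_getElem hi, Option.getD_some] at h3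
  omega

end

end LP

namespace LP

/-! ### Part G: first and last variable -/

section
variable {S : Type*} [CommRing S]

noncomputable def qd (a b c : S) : Polynomial S := Polynomial.C a + Polynomial.C b * Polynomial.X + Polynomial.C c * Polynomial.X ^ 2

lemma qd_mul_coeff (a b c : S) (q : Polynomial S) (d : ℕ) :
    (qd a b c * q).coeff d = a * q.coeff d + b * (Polynomial.X * q).coeff d
      + c * (Polynomial.X * (Polynomial.X * q)).coeff d := by
  unfold qd
  rw [show (Polynomial.C a + Polynomial.C b * Polynomial.X + Polynomial.C c * Polynomial.X ^ 2) * q =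
    Polynomial.C a * q + Polynomial.C b * (Polynomial.X * q) + Polynomial.C c * (Polynomial.X * (Polynomial.X * q)) by ring]
  simp only [Polynomial.coeff_add, Polynomial.coeff_C_mul]

/-- sum over positions of the product with one factor replaced -/
noncomputable def sd {ι : Type*} (s : Finset ι) (b c : ι → S) : S := ∑ j ∈ s, ∏ i ∈ s, if i = j then b i else c i

lemma sd_insert {ι : Type*} (s : Finset ι) (x : ι) (hx : x ∉ s) (b c : ι → S) :
    sd (insert x s) b c = b x * ∏ i ∈ s, c i + c x * sd s b c := by
  classical
  unfold sd
  rw [Finset.sum_insert hx]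
  congr 1
  · rw [Finset.prod_insert hx, if_pos rfl]
    congr 1
    apply Finset.prod_congr rfl
    intro i hi
    rw [if_neg (by rintro rfl; exact hx hi)]
  · rw [Finset.mul_sum]
    apply Finset.sum_congr rfl
    intro j hj
    rw [Finset.prod_insert hx, if_neg (by rintro rfl; exact hx hj)]

lemma qd_prod {ι : Type*} (s : Finset ι) (a b c : ι → S) :
    (∏ i ∈ s, qd (a i) (b i) (c i)).coeff 0 = ∏ i ∈ s, a i ∧
    (∏ i ∈ s, qd (a i) (b i) (c i)).coeff 1 = sd s b a ∧
    (∀ d, 2 * s.card < d → (∏ i ∈ s, qd (a i) (b i) (c i)).coeff d = 0) ∧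
    (∏ i ∈ s, qd (a i) (b i) (c i)).coeff (2 * s.card) = ∏ i ∈ s, c i ∧
    (Polynomial.X * ∏ i ∈ s, qd (a i) (b i) (c i)).coeff (2 * s.card) = sd s b c := by
  classical
  induction s using Finset.induction_on with
  | empty =>
    simp [sd, Polynomial.coeff_one]
    omega
  | insert x s hx ih =>
    obtain ⟨h1, h2, h3, h4, h5⟩ := ih
    rw [sd_insert s x hx, sd_insert s x hx, Finset.prod_insert hx, Finset.prod_insert hx, Finset.prod_insert hx,
      Finset.card_insert_of_notMem hx]
    refine ⟨?_, ?_, ?_, ?_, ?_⟩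
    · rw [qd_mul_coeff]
      simp [h1]
    · rw [qd_mul_coeff, Polynomial.coeff_X_mul]
      rw [show (1 : ℕ) = 0 + 1 from rfl, Polynomial.coeff_X_mul, zero_add, h2, h1]
      simp; ring
    · intro d hd
      obtain ⟨d, rfl⟩ : ∃ d', d = d' + 2 := ⟨d - 2, by omega⟩
      rw [qd_mul_coeff, Polynomial.coeff_X_mul, Polynomial.coeff_X_mul, Polynomial.coeff_X_mul, h3 _ (by omega), h3 _ (by omega), h3 _ (by omega)]
      ring
    · rw [qd_mul_coeff, show 2 * (s.card + 1) = 2 * s.card + 1 + 1 by ring, Polynomial.coeff_X_mul,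
        Polynomial.coeff_X_mul, Polynomial.coeff_X_mul, h3 _ (by omega), h3 _ (by omega), h4]
      ring
    · rw [show 2 * (s.card + 1) = 2 * s.card + 1 + 1 by ring, Polynomial.coeff_X_mul, qd_mul_coeff,
        Polynomial.coeff_X_mul, Polynomial.coeff_X_mul, h3 _ (by omega), h4, h5]
      ring

end

section
variable {R : Type*} [CommRing R]

lemma fse_PP (n : ℕ) : finSuccEquiv R n (PP 1 (n + 1)) =
    (∏ j : Fin n, qd (X j * (1 + X j)) (X j * X j - 1 - X j) (-X j)) * Polynomial.C (PP 1 n) := by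
  unfold PP
  have h1 := pp_map (finSuccEquiv R n).toRingEquiv.toRingHom (n + 1)
    (fun i j => (X j - X i) * (1 + C 1 * X j + X i * X j))
  refine h1.trans ?_
  rw [pp_succ]
  congr 1
  · apply Finset.prod_congr rfl
    intro j _
    simp [qd, finSuccEquiv_X_zero, finSuccEquiv_X_succ]
    ring
  · rw [pp_map]
    congr 1
    funext i j
    simp [finSuccEquiv_X_succ]

lemma fse_PQ (n : ℕ) : finSuccEquiv R n (PQ 1 (n + 1)) =
    (∏ j : Fin n, qd (-X j) (1 - X j * (1 + X j)) (1 + X j)) * Polynomial.C (PQ 1 n) := by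
  unfold PQ
  have h1 := pp_map (finSuccEquiv R n).toRingEquiv.toRingHom (n + 1)
    (fun i j => (X i - X j) * (1 + C 1 * X i + X i * X j))
  refine h1.trans ?_
  rw [pp_succ]
  congr 1
  · apply Finset.prod_congr rfl
    intro j _
    simp [qd, finSuccEquiv_X_zero, finSuccEquiv_X_succ]
    ring
  · rw [pp_map]
    congr 1
    funext i j
    simp [finSuccEquiv_X_succ]

lemma PP_cons0 (n : ℕ) (v : Fin n → ℤ) : cz (Fin.cons 0 v) (PP (1 : R) (n + 1)) =
    cz v ((∏ j, X j * (1 + X j)) * PP 1 n) := by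
  have := cz_cons 0 v (PP (1 : R) (n + 1))
  rw [Nat.cast_zero] at this
  rw [this, fse_PP, Polynomial.coeff_mul_C, (qd_prod _ _ _ _).1]

lemma PP_cons1 (n : ℕ) (v : Fin n → ℤ) : cz (Fin.cons 1 v) (PP (1 : R) (n + 1)) =
    cz v (sd Finset.univ (fun j => X j * X j - 1 - X j) (fun j => X j * (1 + X j)) * PP 1 n) := by
  have := cz_cons 1 v (PP (1 : R) (n + 1))
  rw [Nat.cast_one] at this
  rw [this, fse_PP, Polynomial.coeff_mul_C, (qd_prod _ _ _ _).2.1]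

lemma snoc_rev (n : ℕ) (v : Fin n → ℤ) (x : ℤ) : (Fin.snoc v x : Fin (n + 1) → ℤ) ∘ Fin.rev = Fin.cons x (v ∘ Fin.rev) := by
  funext i
  refine Fin.cases ?_ (fun i => ?_) i
  · simp [Fin.rev_zero]
  · simp [Fin.rev_succ]

lemma cz_rev (n : ℕ) (v : Fin n → ℤ) (P Q : MvPolynomial (Fin n) R) (h : rename Fin.rev P = Q) :
    cz (v ∘ Fin.rev) Q = cz v P := by
  rw [← h]
  have := cz_rename (v ∘ Fin.rev) Fin.revPerm P
  have h2 : (v ∘ Fin.rev) ∘ Fin.revPerm = v := by funext i; simp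
  rw [h2] at this
  rw [← this]; rfl

lemma PP_snoc (n : ℕ) (v : Fin n → ℤ) : cz (Fin.snoc v (2 * n)) (PP (1 : R) (n + 1)) =
    cz v ((∏ j, (1 + X j)) * PP 1 n) := by
  rw [cz_PP_rev, snoc_rev]
  have := cz_cons (2 * n) (v ∘ Fin.rev) (PQ (1 : R) (n + 1))
  push_cast at this
  have h4 := (qd_prod (S := MvPolynomial (Fin n) R) Finset.univ (fun j => -X j) (fun j => 1 - X j * (1 + X j)) (fun j => 1 + X j)).2.2.2.1
  rw [Finset.card_univ, Fintype.card_fin] at h4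
  rw [this, fse_PQ, Polynomial.coeff_mul_C, h4]
  apply cz_rev
  rw [map_mul, PP_rev]
  congr 1
  rw [map_prod]
  rw [← Equiv.prod_comp Fin.revPerm]
  simp

lemma PP_snoc' (n : ℕ) (hn : 0 < n) (v : Fin n → ℤ) : cz (Fin.snoc v (2 * n - 1)) (PP (1 : R) (n + 1)) =
    cz v (sd Finset.univ (fun j => 1 - X j * (1 + X j)) (fun j => (1 + X j)) * PP 1 n) := by
  rw [cz_PP_rev, snoc_rev]
  have := cz_cons (2 * n - 1) (v ∘ Fin.rev) (PQ (1 : R) (n + 1))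
  rw [show ((2 * n - 1 : ℕ) : ℤ) = 2 * (n : ℤ) - 1 by omega] at this
  have h4 := (qd_prod (S := MvPolynomial (Fin n) R) Finset.univ (fun j => -X j) (fun j => 1 - X j * (1 + X j)) (fun j => 1 + X j)).2.2.2.2
  rw [Finset.card_univ, Fintype.card_fin, show 2 * n = 2 * n - 1 + 1 by omega, Polynomial.coeff_X_mul] at h4
  rw [this, fse_PQ, Polynomial.coeff_mul_C, h4]
  apply cz_rev
  rw [map_mul, PP_rev]
  congr 1
  unfold sd
  rw [map_sum]
  rw [← Equiv.sum_comp Fin.revPerm]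
  apply Finset.sum_congr rfl
  intro j _
  rw [map_prod]
  rw [← Equiv.prod_comp Fin.revPerm]
  apply Finset.prod_congr rfl
  intro i _
  simp only [Fin.revPerm_apply, Fin.rev_inj]
  split_ifs <;> simp

lemma PP_rot (n : ℕ) (v : Fin n → ℤ) : cz (Fin.cons 0 v) (PP (1 : R) (n + 1)) =
    cz (Fin.snoc (fun i => v i - 1) (2 * n)) (PP (1 : R) (n + 1)) := by
  rw [PP_cons0, PP_snoc, Finset.prod_mul_distrib, mul_assoc, cz_prodX]

lemma PP_stat (n : ℕ) (hn : 0 < n) (v : Fin n → ℤ) :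
    cz (Fin.cons 1 v) (PP (1 : R) (n + 1))
    + ∑ l, (cz (Fin.cons 0 (Function.update v l (v l + 1))) (PP (1 : R) (n + 1))
      + cz (Fin.cons 0 (Function.update v l (v l - 1))) (PP (1 : R) (n + 1)))
    + cz (Fin.snoc (fun i => v i - 1) (2 * n - 1)) (PP (1 : R) (n + 1))
    = n * cz (Fin.cons 0 v) (PP (1 : R) (n + 1)) := by
  set T : MvPolynomial (Fin n) R := ∏ j, X j * (1 + X j) with hT
  have hE : ∀ l : Fin n, ∀ c : MvPolynomial (Fin n) R,
      (∏ i, if i = l then c else X i * (1 + X i)) = c * ∏ i ∈ Finset.univ.erase l, (X i * (1 + X i)) := by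
    intro l c
    rw [← Finset.mul_prod_erase _ _ (Finset.mem_univ l), if_pos rfl]
    congr 1
    apply Finset.prod_congr rfl
    intro i hi
    rw [if_neg (Finset.ne_of_mem_erase hi)]
  have hTl : ∀ l : Fin n, T = X l * (1 + X l) * ∏ i ∈ Finset.univ.erase l, (X i * (1 + X i)) := by
    intro l
    rw [hT, ← Finset.mul_prod_erase _ _ (Finset.mem_univ l)]
  have hsd : ∀ b : Fin n → MvPolynomial (Fin n) R, sd Finset.univ b (fun j => X j * (1 + X j)) =
      ∑ l, b l * ∏ i ∈ Finset.univ.erase l, (X i * (1 + X i)) := by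
    intro b
    unfold sd
    apply Finset.sum_congr rfl
    intro l _
    rw [← hE l (b l)]
    apply Finset.prod_congr rfl
    intro i _
    split_ifs with h
    · rw [h]
    · rfl
  rw [PP_cons1, PP_snoc' n hn, hsd]
  have e3 : cz (fun i => v i - 1) (sd Finset.univ (fun j => 1 - X j * (1 + X j)) (fun j => (1 + X j)) * PP (1 : R) n)
      = cz v (sd Finset.univ (fun j => X j * (1 - X j * (1 + X j))) (fun j => X j * (1 + X j)) * PP 1 n) := by
    rw [← cz_prodX, ← mul_assoc]
    congr 2
    unfold sd
    rw [Finset.mul_sum]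
    apply Finset.sum_congr rfl
    intro l _
    rw [← Finset.prod_mul_distrib]
    apply Finset.prod_congr rfl
    intro i _
    split_ifs <;> rfl
  rw [e3, hsd]
  have e1 : ∀ l, cz (Fin.cons 0 (Function.update v l (v l - 1))) (PP (1 : R) (n + 1)) = cz v (X l * (T * PP (1 : R) n)) := by
    intro l
    rw [PP_cons0, cz_X_mul]
  have e2 : ∀ l, cz (Fin.cons 0 (Function.update v l (v l + 1))) (PP (1 : R) (n + 1)) =
      cz v (((1 + X l : MvPolynomial (Fin n) R) * (∏ i ∈ Finset.univ.erase l, (X i * (1 + X i)))) * PP (1 : R) n) := by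
    intro l
    rw [PP_cons0, ← hT, hTl l, mul_assoc, mul_assoc, cz_X_mul]
    simp [mul_assoc]
  simp only [e1, e2]
  rw [PP_cons0, ← hT]
  simp only [← cz_add, ← cz_sum]
  have : (n : R) * cz v (T * PP 1 n) = cz v (∑ l : Fin n, T * PP 1 n) := by
    rw [cz_sum]; simp
  rw [this]
  congr 1
  rw [Finset.sum_mul, Finset.sum_mul, ← Finset.sum_add_distrib, ← Finset.sum_add_distrib]
  apply Finset.sum_congr rfl
  intro l _
  rw [hTl l]
  ring

end

end LP

namespace LP

/-! ### Part H: rotation and Temperley-Lieb operators at `τ = 1` -/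

section
variable {R : Type*} [CommRing R]

/-- the weights at `τ = 1` -/
def u3 (s : ℤ) : R := if s % 3 = 0 then 1 else if s % 3 = 1 then -1 else 0

lemma u3_UW : UW (1 : R) u3 := by
  refine ⟨by simp [u3], by simp [u3], ?_⟩
  intro s
  unfold u3
  have : s % 3 = 0 ∨ s % 3 = 1 ∨ s % 3 = 2 := by omega
  rcases this with h | h | h
  · rw [show (s + 2) % 3 = 2 by omega, show (s + 1) % 3 = 1 by omega, h]; norm_num
  · rw [show (s + 2) % 3 = 0 by omega, show (s + 1) % 3 = 2 by omega, h]; norm_num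
  · rw [show (s + 2) % 3 = 1 by omega, show (s + 1) % 3 = 0 by omega, h]; norm_num

lemma UW_unique {τ : R} {U V : ℤ → R} (hU : UW τ U) (hV : UW τ V) : U = V := by
  have key : ∀ s : ℤ, U s = V s ∧ U (s - 1) = V (s - 1) := by
    intro s
    induction s using Int.induction_on with
    | zero => rw [hU.zero, hV.zero, zero_sub, hU.neg, hV.neg]; exact ⟨rfl, rfl⟩
    | succ i ih =>
      refine ⟨?_, ?_⟩
      · have h1 := hU.rc ((i : ℤ) - 1)
        have h2 := hV.rc ((i : ℤ) - 1)
        rw [show (i : ℤ) - 1 + 2 = i + 1 by ring, show (i : ℤ) - 1 + 1 = i by ring] at h1 h2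
        rw [ih.1, ih.2] at h1
        linear_combination h1 - h2
      · rw [show (i : ℤ) + 1 - 1 = i by ring]; exact ih.1
    | pred i ih =>
      refine ⟨ih.2, ?_⟩
      have h1 := hU.rc (-(i : ℤ) - 1 - 1)
      have h2 := hV.rc (-(i : ℤ) - 1 - 1)
      rw [show -(i : ℤ) - 1 - 1 + 2 = -i by ring, show -(i : ℤ) - 1 - 1 + 1 = -i - 1 by ring] at h1 h2
      rw [ih.1, ih.2] at h1
      linear_combination h1 - h2
  funext s; exact (key s).1

lemma u3_id1 (a c : ℤ) : (u3 (a + c + 1) : R) = u3 a * u3 c + u3 a * u3 (c + 1) + u3 (a + 1) * u3 c := by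
  unfold u3
  have h1 : a % 3 = 0 ∨ a % 3 = 1 ∨ a % 3 = 2 := by omega
  have h2 : c % 3 = 0 ∨ c % 3 = 1 ∨ c % 3 = 2 := by omega
  rcases h1 with h | h | h <;> rcases h2 with h' | h' | h' <;>
    simp [Int.add_emod, h, h']

lemma u3_id2 (a c : ℤ) : (u3 (a - c - 1) : R) = u3 a * u3 c + u3 a * u3 (c + 1) + u3 (a - 1) * u3 c := by
  unfold u3
  have h1 : a % 3 = 0 ∨ a % 3 = 1 ∨ a % 3 = 2 := by omega
  have h2 : c % 3 = 0 ∨ c % 3 = 1 ∨ c % 3 = 2 := by omega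
  rcases h1 with h | h | h <;> rcases h2 with h' | h' | h' <;>
    simp [Int.add_emod, Int.sub_emod, h, h']

end

/-- rotation -/
def rotN (n : ℕ) (g : ℕ → ℕ) (k : ℕ) : ℕ :=
  if k + 1 = 2 * n then g 0 - 1 else if g (k + 1) = 0 then 2 * n - 1 else g (k + 1) - 1

lemma rot_isM {n : ℕ} {g : ℕ → ℕ} (h : IsM n g) : IsM n (rotN n g) := by
  have inj : ∀ a b, a < 2 * n → b < 2 * n → g a = b → g b = a := fun a b ha _ e => by rw [← e]; exact h.inv a ha
  refine ⟨?_, ?_, ?_, ?_⟩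
  · intro k hk
    unfold rotN
    split_ifs with h1 h2
    · have := h.lt 0 (by omega); omega
    · omega
    · have := h.lt (k + 1) (by omega); omega
  · intro k hk
    unfold rotN
    by_cases h1 : k + 1 = 2 * n
    · have e0 := h.lt 0 (by omega)
      have e1 := h.nofix 0 (by omega)
      have e2 := h.inv 0 (by omega)
      rw [if_pos h1, if_neg (by omega), show g 0 - 1 + 1 = g 0 by omega, e2, if_pos rfl]; omega
    · rw [if_neg h1]
      have e0 := h.lt (k + 1) (by omega)
      have e1 := h.nofix (k + 1) (by omega)
      have e2 := h.inv (k + 1) (by omega)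
      by_cases h2 : g (k + 1) = 0
      · rw [if_pos h2, if_pos (by omega)]
        rw [h2] at e2; omega
      · rw [if_neg h2, if_neg (by omega), show g (k + 1) - 1 + 1 = g (k + 1) by omega, e2, if_neg (by omega)]; omega
  · intro k hk
    unfold rotN
    split_ifs with h1 h2
    · have := h.lt 0 (by omega); have := h.nofix 0 (by omega); omega
    · omega
    · have := h.nofix (k + 1) (by omega); omega
  · intro a b c d hab hbc hcd hd
    unfold rotN
    rw [if_neg (by omega : ¬ a + 1 = 2 * n), if_neg (by omega : ¬ b + 1 = 2 * n)]
    intro e1 e2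
    rw [if_neg (by intro h0; rw [if_pos h0] at e1; omega)] at e1
    have la := h.lt (a + 1) (by omega)
    by_cases h0 : g (b + 1) = 0
    · rw [if_pos h0] at e2
      have := inj _ _ (by omega) (by omega) h0
      by_cases hz : g (a + 1) = 0
      · have := inj _ _ (by omega) (by omega) hz; omega
      exact h.nc 0 (a + 1) (b + 1) (c + 1) (by omega) (by omega) (by omega) (by omega) this (by omega)
    · rw [if_neg h0] at e2
      by_cases hz : g (a + 1) = 0
      · have := inj _ _ (by omega) (by omega) hz
        have := h.lt (b + 1) (by omega)
        omega
      exact h.nc (a + 1) (b + 1) (c + 1) (d + 1) (by omega) (by omega) (by omega) (by have := h.lt (b + 1) (by omega); omega) (by omega) (by omega)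

lemma cnt_map_sub (v : List ℤ) (a b : ℤ) : cnt (v.map (fun x => x - 1)) a b = cnt v (a + 1) (b + 1) := by
  induction v with
  | nil => simp
  | cons x v ih =>
    simp only [List.map_cons, cnt_cons, ih]
    congr 1
    refine if_congr ?_ rfl rfl
    omega

section
variable {R : Type*} [CommRing R]

lemma Cw_rot {n : ℕ} (hn : 1 ≤ n) {g : ℕ → ℕ} (h : IsM n g) (v : List ℤ) (hv : ∀ x ∈ v, 1 ≤ x ∧ x ≤ 2 * (n : ℤ) - 2)
    (hl : v.length + 1 = n) :
    (Cw u3 n g (0 :: v) : R) = Cw u3 n (rotN n g) (v.map (fun x => x - 1) ++ [2 * (n : ℤ) - 2]) := by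
  have inj : ∀ a b, a < 2 * n → b < 2 * n → g a = b → g b = a := fun a b ha _ e => by rw [← e]; exact h.inv a ha
  obtain ⟨m, hm⟩ : ∃ m, 2 * n = m + 1 := ⟨2 * n - 1, by omega⟩
  have y0 := h.nofix 0 (by omega)
  have y1 := h.lt 0 (by omega)
  have y2 := h.inv 0 (by omega)
  set y := g 0 with hy
  set c := v.map (fun x => x - 1) ++ [2 * (n : ℤ) - 2] with hc
  have hcc : ∀ a b : ℤ, cnt c a b = cnt v (a + 1) (b + 1) + if a ≤ 2 * (n : ℤ) - 2 ∧ 2 * (n : ℤ) - 2 < b then 1 else 0 := by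
    intro a b
    rw [hc, cnt_append, cnt_map_sub]; simp
  -- the special arc
  have hs1 : 2 * se (0 :: v) g 0 = 2 + 2 * cnt v 0 y - (y + 1) := by
    have := se_eq h (0 :: v) (x := 0) (by omega) (by omega)
    rw [this]; simp only [cnt_cons]; rw [if_pos (by omega), ← hy]; push_cast; ring
  have hr : rotN n g (y - 1) = m := by
    unfold rotN
    rw [if_neg (by omega), show y - 1 + 1 = y by omega, y2, if_pos rfl]; omega
  have hs2 : 2 * se c (rotN n g) (y - 1) = 2 * cnt v y (2 * n) + 2 - (2 * n - y + 1) := by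
    have := se_eq (rot_isM h) c (x := y - 1) (by omega) (by rw [hr]; omega)
    rw [this, hr, hcc]
    rw [if_pos (by omega)]
    rw [show ((y - 1 : ℕ) : ℤ) + 1 = y by omega, show (m : ℤ) + 1 = 2 * n by omega]
    have : ((y - 1 : ℕ) : ℤ) = (y : ℤ) - 1 := by omega
    rw [this, show (m : ℤ) = 2 * n - 1 by omega]
    ring
  have htot : cnt v 0 y + cnt v y (2 * n) = n - 1 := by
    rw [cnt_add _ (by omega) (by omega), cnt_all _ _ _ (fun x hx => by have := hv x hx; omega)]
    omega
  have hF : ∀ k, k < m → k ≠ y - 1 → (if k + 1 < g (k + 1) then (u3 (se (0 :: v) g (k + 1)) : R) else 1) =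
      if k < rotN n g k then u3 (se c (rotN n g) k) else 1 := by
    intro k hk hky
    have l1 := h.lt (k + 1) (by omega)
    have l2 := h.nofix (k + 1) (by omega)
    have hz : g (k + 1) ≠ 0 := by
      intro hz
      have := inj _ _ (by omega) (by omega) hz
      omega
    have hr' : rotN n g k = g (k + 1) - 1 := by
      unfold rotN
      rw [if_neg (by omega), if_neg hz]
    rw [hr']
    by_cases hlt : k + 1 < g (k + 1)
    · rw [if_pos hlt, if_pos (by omega)]
      congr 1
      unfold se
      rw [hr', hcc, cnt_cons, if_neg (by omega), if_neg (by omega)]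
      have : ((g (k + 1) - 1 : ℕ) : ℤ) = (g (k + 1) : ℤ) - 1 := by omega
      rw [this]
      push_cast
      rw [show (g (k + 1) : ℤ) - 1 + 1 = g (k + 1) by ring]
      rw [show (g (k + 1) : ℤ) - (k + 1) + 1 = (g (k + 1) : ℤ) - 1 - k + 1 by ring]
      ring
    · rw [if_neg hlt, if_neg (by omega)]
  have hym : y - 1 ∈ Finset.range m := Finset.mem_range.2 (by omega)
  have L : (Cw u3 n g (0 :: v) : R) = u3 (se (0 :: v) g 0) * ∏ k ∈ (Finset.range m).erase (y - 1),
      (if k + 1 < g (k + 1) then (u3 (se (0 :: v) g (k + 1)) : R) else 1) := by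
    unfold Cw
    rw [hm, Finset.prod_range_succ', mul_comm, if_pos (by omega), ← Finset.mul_prod_erase _ _ hym]
    rw [show y - 1 + 1 = y by omega, y2, if_neg (by omega), one_mul]
  have Rr : (Cw u3 n (rotN n g) c : R) = u3 (se c (rotN n g) (y - 1)) * ∏ k ∈ (Finset.range m).erase (y - 1),
      (if k + 1 < g (k + 1) then (u3 (se (0 :: v) g (k + 1)) : R) else 1) := by
    unfold Cw
    rw [hm, Finset.prod_range_succ, ← Finset.mul_prod_erase _ _ hym]
    rw [hr, if_pos (by omega)]
    have : ¬ m < rotN n g m := by have := (rot_isM h).lt m (by omega); omega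
    rw [if_neg this, mul_one]
    congr 1
    apply Finset.prod_congr rfl
    intro k hk
    rw [Finset.mem_erase, Finset.mem_range] at hk
    rw [hF k hk.2 hk.1]
  rw [L, Rr]
  by_cases hP : ∏ k ∈ (Finset.range m).erase (y - 1),
      (if k + 1 < g (k + 1) then (u3 (se (0 :: v) g (k + 1)) : R) else 1) = 0
  · rw [hP, mul_zero, mul_zero]
  · congr 2
    have hne : ∀ k, k ≠ 0 → k < 2 * n → k < g k → se (0 :: v) g k ≠ -1 := by
      intro k h0 hk hg he
      apply hP
      have hky : k ≠ y := by rintro rfl; omega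
      apply Finset.prod_eq_zero (i := k - 1)
      · rw [Finset.mem_erase, Finset.mem_range]; omega
      · rw [show k - 1 + 1 = k by omega, if_pos hg, he]; simp [u3]
    obtain ⟨l, hlv, hls⟩ : ∃ l : List ℤ, (∀ a b : ℤ, 1 ≤ a → cnt l a b = cnt v a b) ∧
        (∀ k, k < 2 * n → k < g k → se l g k ≠ -1) := by
      by_cases hs : se (0 :: v) g 0 = -1
      · refine ⟨0 :: 0 :: v, ?_, ?_⟩
        · intro a b ha
          simp only [cnt_cons]; rw [if_neg (by omega)]; ring
        · intro k hk hg
          by_cases hk0 : k = 0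
          · subst hk0
            unfold se at hs ⊢
            rw [cnt_cons, if_pos (by omega)]; omega
          · have := hne k hk0 hk hg
            unfold se at this ⊢
            rw [cnt_cons, if_neg (by omega)]
            simpa using this
      · refine ⟨0 :: v, ?_, ?_⟩
        · intro a b ha
          simp only [cnt_cons]; rw [if_neg (by omega)]; ring
        · intro k hk hg
          by_cases hk0 : k = 0
          · subst hk0; exact hs
          · exact hne k hk0 hk hg
    have i1 := lemL h l hls (2 * n) 1 y (by omega) (by omega) (by omega) (by
      intro k hk1 hk2 _
      exact (h.inside (a := 0) (by omega) (by omega) (by omega)).2)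
    have j1 := closed_op h (2 * n) 1 y (by omega) (by omega) (by omega) (by
      intro k hk1 hk2
      have := h.inside (a := 0) (k := k) (by omega) (by omega) (by omega)
      omega)
    have i2 := lemL h l hls (2 * n) (y + 1) (2 * n) (by omega) (by omega) (by omega) (by
      intro k hk1 hk2 _
      exact h.lt k hk2)
    have j2 := closed_op h (2 * n) (y + 1) (2 * n) (by omega) (by omega) (by omega) (by
      intro k hk1 hk2
      refine ⟨?_, h.lt k hk2⟩
      by_contra hcon
      have e1 := h.inv k hk2
      have e3 := h.nofix k hk2
      by_cases hb : g k = 0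
      · rw [hb] at e1; omega
      by_cases hb2 : g k = y
      · rw [hb2, y2] at e1; omega
      exact h.nc 0 (g k) y k (by omega) (by omega) (by omega) hk2 rfl e1)
    rw [hlv _ _ (by omega)] at i1 i2
    have m1 := cnt_mono v (a := ((1 : ℕ) : ℤ)) (b := (y : ℤ) - 1) (a' := 0) (b' := y) (by norm_num) (by omega)
    have m2 := cnt_mono v (a := ((y + 1 : ℕ) : ℤ)) (b := ((2 * n : ℕ) : ℤ) - 1) (a' := y) (b' := 2 * n) (by push_cast; omega) (by push_cast; omega)
    push_cast at i1 i2 j1 j2 m1 m2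
    omega

end

/-- Temperley-Lieb operator on functions -/
def eN (i : ℕ) (g : ℕ → ℕ) (m : ℕ) : ℕ :=
  if g i = i + 1 then g m else
    if m = i then i + 1 else if m = i + 1 then i else if m = g i then g (i + 1) else if m = g (i + 1) then g i else g m

lemma eN_isM {n : ℕ} {g : ℕ → ℕ} (h : IsM n g) {i : ℕ} (hi : i + 1 < 2 * n) : IsM n (eN i g) := by
  by_cases hg : g i = i + 1
  · have : eN i g = g := by funext m; unfold eN; rw [if_pos hg]
    rw [this]; exact h
  have inj : ∀ a b, a < 2 * n → b < 2 * n → g a = b → g b = a := fun a b ha _ e => by rw [← e]; exact h.inv a ha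
  have a1 := h.lt i (by omega)
  have a2 := h.lt (i + 1) hi
  have a3 := h.inv i (by omega)
  have a4 := h.inv (i + 1) hi
  have a5 := h.nofix i (by omega)
  have a6 := h.nofix (i + 1) hi
  have a7 : g (i + 1) ≠ i := by intro e; rw [e] at a4; exact hg a4
  have a8 : g i ≠ g (i + 1) := by intro e; rw [e, a4] at a3; omega
  set y := g i with hy
  set z := g (i + 1) with hz
  have E : ∀ m, eN i g m = if m = i then i + 1 else if m = i + 1 then i else if m = y then z else if m = z then y else g m := by
    intro m; unfold eN; rw [if_neg hg]
  have rest : ∀ m, m < 2 * n → m ≠ i → m ≠ i + 1 → m ≠ y → m ≠ z → g m ≠ i ∧ g m ≠ i + 1 ∧ g m ≠ y ∧ g m ≠ z := by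
    intro m hm m1 m2 m3 m4
    refine ⟨?_, ?_, ?_, ?_⟩ <;> intro e <;> have := inj _ _ hm (by omega) e <;> omega
  refine ⟨?_, ?_, ?_, ?_⟩
  · intro k hk
    rw [E]
    have := h.lt k hk
    split_ifs <;> omega
  · intro k hk
    rw [E, E]
    by_cases k1 : k = i
    · simp [k1]
    by_cases k2 : k = i + 1
    · simp [k2]
    by_cases k3 : k = y
    · rw [if_neg k1, if_neg k2, if_pos k3, if_neg a7, if_neg a6, if_neg (Ne.symm a8), if_pos rfl, k3]
    by_cases k4 : k = z
    · rw [if_neg k1, if_neg k2, if_neg k3, if_pos k4, if_neg a5, if_neg hg, if_pos rfl, k4]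
    obtain ⟨r1, r2, r3, r4⟩ := rest k hk k1 k2 k3 k4
    rw [if_neg k1, if_neg k2, if_neg k3, if_neg k4, if_neg r1, if_neg r2, if_neg r3, if_neg r4, h.inv k hk]
  · intro k hk
    rw [E]
    have := h.nofix k hk
    split_ifs <;> omega
  · intro a b c d hab hbc hcd hd
    -- no arc from outside crosses
    have nc : ∀ p q r s, p < q → q < r → r < s → s < 2 * n → (g p = r ∨ g r = p) → (g q = s ∨ g s = q) → False := by
      intro p q r s h1 h2 h3 h4 h5 h6
      refine h.nc p q r s h1 h2 h3 h4 (h5.elim id (fun e => inj _ _ (by omega) (by omega) e)) (h6.elim id (fun e => inj _ _ (by omega) (by omega) e))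
    rw [E, E]
    intro e1 e2
    have key : ∀ p s, p < 2 * n → s < 2 * n → p ≠ i → p ≠ i + 1 → p ≠ y → p ≠ z → g p = s →
        ∀ u w, ((u = y ∧ w = z) ∨ (u = z ∧ w = y)) → ¬ (u < p ∧ p < w ∧ w < s) ∧ ¬ (p < u ∧ u < s ∧ s < w) := by
      intro p s hp hs p1 p2 p3 p4 e u w huw
      obtain ⟨r1, r2, r3, r4⟩ := rest p hp p1 p2 p3 p4
      have e' := inj _ _ hp hs e
      rw [e] at r1 r2 r3 r4
      have q1 : ∀ q r, (q = i ∧ r = y) ∨ (q = y ∧ r = i) ∨ (q = i + 1 ∧ r = z) ∨ (q = z ∧ r = i + 1) →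
          ¬ (q < p ∧ p < r ∧ r < s) ∧ ¬ (p < q ∧ q < s ∧ s < r) := by
        intro q r hqr
        have hg1 : g q = r := by rcases hqr with ⟨rfl, rfl⟩ | ⟨rfl, rfl⟩ | ⟨rfl, rfl⟩ | ⟨rfl, rfl⟩ <;> first | rfl | assumption
        have hr : r < 2 * n := by rcases hqr with ⟨rfl, rfl⟩ | ⟨rfl, rfl⟩ | ⟨rfl, rfl⟩ | ⟨rfl, rfl⟩ <;> omega
        refine ⟨fun ⟨w1, w2, w3⟩ => nc q p r s w1 w2 w3 hs (Or.inl hg1) (Or.inl e), fun ⟨w1, w2, w3⟩ => nc p q s r w1 w2 w3 hr (Or.inl e) (Or.inl hg1)⟩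
      have t1 := q1 i y (by simp)
      have t2 := q1 y i (by simp)
      have t3 := q1 (i + 1) z (by simp)
      have t4 := q1 z (i + 1) (by simp)
      rcases huw with ⟨rfl, rfl⟩ | ⟨rfl, rfl⟩ <;> omega
    by_cases b1 : a = i
    · rw [if_pos b1] at e1; omega
    by_cases b2 : a = i + 1
    · rw [if_neg b1, if_pos b2] at e1; omega
    rw [if_neg b1, if_neg b2] at e1
    by_cases d1 : b = i
    · rw [if_pos d1] at e2; omega
    by_cases d2 : b = i + 1
    · rw [if_neg d1, if_pos d2] at e2; omega
    rw [if_neg d1, if_neg d2] at e2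
    by_cases b3 : a = y
    · rw [if_pos b3] at e1
      rw [if_neg (by omega)] at e2
      rw [if_neg (by omega)] at e2
      have := (key b d (by omega) hd d1 d2 (by omega) (by omega) e2 y z (by simp)).1
      omega
    rw [if_neg b3] at e1
    by_cases b4 : a = z
    · rw [if_pos b4] at e1
      rw [if_neg (by omega)] at e2
      rw [if_neg (by omega)] at e2
      have := (key b d (by omega) hd d1 d2 (by omega) (by omega) e2 z y (by simp)).1
      omega
    rw [if_neg b4] at e1
    have kk := key a c (by omega) (by omega) b1 b2 b3 b4 e1
    by_cases d3 : b = y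
    · rw [if_pos d3] at e2
      have := (kk y z (by simp)).2
      omega
    rw [if_neg d3] at e2
    by_cases d4 : b = z
    · rw [if_pos d4] at e2
      have := (kk z y (by simp)).2
      omega
    rw [if_neg d4] at e2
    exact h.nc a b c d hab hbc hcd hd e1 e2

end LP

namespace LP

/-! ### Part I: stationarity -/

section
variable {R : Type*} [CommRing R]

lemma prod_four (N : ℕ) (i j y z : ℕ) (hi : i < N) (hj : j < N) (hy : y < N) (hz : z < N) (h1 : i ≠ j) (h2 : i ≠ y)
    (h3 : i ≠ z) (h4 : j ≠ y) (h5 : j ≠ z) (h6 : y ≠ z) (F : ℕ → R) :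
    ∏ k ∈ Finset.range N, F k = F i * (F j * (F y * (F z * ∏ k ∈ ((((Finset.range N).erase i).erase j).erase y).erase z, F k))) := by
  rw [Finset.mul_prod_erase _ F (by simp; omega), Finset.mul_prod_erase _ F (by simp; omega),
    Finset.mul_prod_erase _ F (by simp; omega), Finset.mul_prod_erase _ F (by simp; omega)]

set_option maxHeartbeats 2000000 in
lemma Cw_eN {n : ℕ} {g : ℕ → ℕ} (h : IsM n g) {i : ℕ} (hi : i + 1 < 2 * n) (pre suf : List ℤ)
    (hp : cnt pre i (i + 1) = 0) (hq : cnt suf i (i + 1) = 0) :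
    (Cw u3 n (eN i g) (pre ++ (i : ℤ) :: suf) : R) = Cw u3 n g (pre ++ (i : ℤ) :: suf)
      + Cw u3 n g (pre ++ ((i : ℤ) + 1) :: suf) + Cw u3 n g (pre ++ ((i : ℤ) - 1) :: suf) := by
  by_cases hg : g i = i + 1
  · have : eN i g = g := by funext m; unfold eN; rw [if_pos hg]
    rw [this]
    have z1 : (Cw u3 n g (pre ++ ((i : ℤ) + 1) :: suf) : R) = 0 := by
      apply Finset.prod_eq_zero (i := i) (Finset.mem_range.2 (by omega))
      rw [if_pos (by omega)]
      unfold se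
      rw [hg]
      simp only [cnt_append, cnt_cons]
      push_cast
      rw [hp, hq, if_neg (by omega)]
      rw [show (0 + (0 + 0) - ((i : ℤ) + 1 - i + 1) / 2) = -1 by omega]
      simp [u3]
    have z2 : (Cw u3 n g (pre ++ ((i : ℤ) - 1) :: suf) : R) = 0 := by
      apply Finset.prod_eq_zero (i := i) (Finset.mem_range.2 (by omega))
      rw [if_pos (by omega)]
      unfold se
      rw [hg]
      simp only [cnt_append, cnt_cons]
      push_cast
      rw [hp, hq, if_neg (by omega)]
      rw [show (0 + (0 + 0) - ((i : ℤ) + 1 - i + 1) / 2) = -1 by omega]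
      simp [u3]
    rw [z1, z2]; ring
  have hM' := eN_isM h hi
  have inj : ∀ a b, a < 2 * n → b < 2 * n → g a = b → g b = a := fun a b ha _ e => by rw [← e]; exact h.inv a ha
  have a1 := h.lt i (by omega)
  have a2 := h.lt (i + 1) hi
  have a3 := h.inv i (by omega)
  have a4 := h.inv (i + 1) hi
  have a5 := h.nofix i (by omega)
  have a6 := h.nofix (i + 1) hi
  have a7 : g (i + 1) ≠ i := by intro e; rw [e] at a4; exact hg a4
  have a8 : g i ≠ g (i + 1) := by intro e; rw [e, a4] at a3; omega
  have E : ∀ m, eN i g m = if m = i then i + 1 else if m = i + 1 then i else if m = g i then g (i + 1) else if m = g (i + 1) then g i else g m := by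
    intro m; unfold eN; rw [if_neg hg]
  have ei : eN i g i = i + 1 := by rw [E, if_pos rfl]
  have ei1 : eN i g (i + 1) = i := by rw [E, if_neg (by omega), if_pos rfl]
  have ey : eN i g (g i) = g (i + 1) := by rw [E, if_neg a5, if_neg hg, if_pos rfl]
  have ez : eN i g (g (i + 1)) = g i := by rw [E, if_neg a7, if_neg a6, if_neg (Ne.symm a8), if_pos rfl]
  have sq : ∀ (x : ℤ) (gg : ℕ → ℕ) (k : ℕ), IsM n gg → k < 2 * n → k < gg k → 2 * se (pre ++ x :: suf) gg k =
      2 * (cnt (pre ++ suf) k (gg k) + if (k : ℤ) ≤ x ∧ x < gg k then 1 else 0) - (gg k - k + 1) := by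
    intro x gg k hgg hk hkg
    rw [se_eq hgg _ hk hkg]
    simp only [cnt_append, cnt_cons]; ring
  have hW : cnt (pre ++ suf) i (i + 1) = 0 := by rw [cnt_append, hp, hq]; rfl
  -- the rest
  set S := ((((Finset.range (2 * n)).erase i).erase (i + 1)).erase (g i)).erase (g (i + 1)) with hS
  set Q : R := ∏ k ∈ S, if k < g k then u3 (se (pre ++ (i : ℤ) :: suf) g k) else 1 with hQ
  have rest : ∀ m ∈ S, m < 2 * n ∧ m ≠ i ∧ m ≠ i + 1 ∧ g m ≠ i ∧ g m ≠ i + 1 ∧ eN i g m = g m := by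
    intro m hm
    simp only [hS, Finset.mem_erase, Finset.mem_range] at hm
    obtain ⟨m4, m3, m2, m1, hm⟩ := hm
    refine ⟨hm, m1, m2, ?_, ?_, ?_⟩
    · intro e; have := inj _ _ hm (by omega) e; omega
    · intro e; have := inj _ _ hm (by omega) e; omega
    · rw [E, if_neg m1, if_neg m2, if_neg m3, if_neg m4]
  have Q1 : ∏ k ∈ S, (if k < eN i g k then (u3 (se (pre ++ (i : ℤ) :: suf) (eN i g) k) : R) else 1) = Q := by
    apply Finset.prod_congr rfl
    intro k hk
    have := (rest k hk).2.2.2.2.2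
    unfold se
    rw [this]
  have Qx : ∀ x : ℤ, x = (i : ℤ) + 1 ∨ x = (i : ℤ) - 1 → ∏ k ∈ S, (if k < g k then (u3 (se (pre ++ x :: suf) g k) : R) else 1) = Q := by
    intro x hx
    apply Finset.prod_congr rfl
    intro k hk
    obtain ⟨r0, r1, r2, r3, r4, _⟩ := rest k hk
    split_ifs with hkg
    · congr 1
      have t1 := sq x g k h r0 hkg
      have t2 := sq i g k h r0 hkg
      have : (if (k : ℤ) ≤ x ∧ x < g k then (1 : ℤ) else 0) = if (k : ℤ) ≤ i ∧ (i : ℤ) < g k then 1 else 0 := by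
        refine if_congr ?_ rfl rfl
        omega
      rw [this] at t1
      omega
    · rfl
  have P := fun F : ℕ → R => prod_four (2 * n) i (i + 1) (g i) (g (i + 1)) (by omega) hi a1 a2 (by omega) (by omega) (by omega)
    (by omega) (by omega) a8 F
  unfold Cw
  rw [P, P, P, P, ← hS, Q1, Qx _ (Or.inl rfl), Qx _ (Or.inr rfl), ← hQ]
  simp only [ei, ei1, ey, ez, a3, a4]
  have hse0 : se (pre ++ (i : ℤ) :: suf) (eN i g) i = 0 := by
    have := sq i (eN i g) i hM' (by omega) (by rw [ei]; omega)
    rw [ei] at this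
    push_cast at this
    rw [hW, if_pos (by omega)] at this
    omega
  rw [if_pos (by omega : i < i + 1), hse0, if_neg (by omega : ¬ i + 1 < i), u3_UW.zero, one_mul, one_mul]
  have ca := fun (a b c : ℕ) (h1 : a ≤ b) (h2 : b ≤ c) => cnt_add (pre ++ suf) (a := a) (b := b) (c := c) (by omega) (by omega)
  by_cases c1 : g i < i
  · by_cases c2 : g (i + 1) < i + 1
    · -- both closers
      have c3 : g (i + 1) < g i := by
        by_contra hc
        exact h.nc (g i) (g (i + 1)) i (i + 1) (by omega) (by omega) (by omega) hi a3 a4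
      rw [if_neg (by omega : ¬ g i < g (i + 1)), if_pos c3]
      simp only [if_neg (by omega : ¬ i < g i), if_neg (by omega : ¬ i + 1 < g (i + 1)), if_pos c1, if_pos c2]
      have s1 := sq i (eN i g) (g (i + 1)) hM' a2 (by rw [ez]; exact c3)
      have s2 := fun x => sq x g (g (i + 1)) h a2 (by rw [a4]; exact c2)
      have s3 := fun x => sq x g (g i) h a1 (by rw [a3]; exact c1)
      rw [ez] at s1
      rw [a4] at s2
      rw [a3] at s3
      have k1 := ca (g (i + 1)) (g i) i (by omega) (by omega)
      have k2 := ca (g (i + 1)) i (i + 1) (by omega) (by omega)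
      push_cast at k2 s2
      have p1 := s2 i
      have p2 := s2 (i + 1)
      have p3 := s2 (i - 1)
      have q1 := s3 i
      have q2 := s3 (i + 1)
      have q3 := s3 (i - 1)
      rw [if_neg (by omega)] at s1
      rw [if_pos (by omega)] at p1
      rw [if_neg (by omega)] at p2
      rw [if_pos (by omega)] at p3
      rw [if_neg (by omega)] at q1
      rw [if_neg (by omega)] at q2
      rw [if_pos (by omega)] at q3
      set A := se (pre ++ (i : ℤ) :: suf) g (g (i + 1)) with hA
      set B := se (pre ++ (i : ℤ) :: suf) g (g i) with hB
      rw [show se (pre ++ (i : ℤ) :: suf) (eN i g) (g (i + 1)) = A - B - 1 by omega]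
      rw [show se (pre ++ ((i : ℤ) + 1) :: suf) g (g (i + 1)) = A - 1 by omega]
      rw [show se (pre ++ ((i : ℤ) - 1) :: suf) g (g (i + 1)) = A by omega]
      rw [show se (pre ++ ((i : ℤ) + 1) :: suf) g (g i) = B by omega]
      rw [show se (pre ++ ((i : ℤ) - 1) :: suf) g (g i) = B + 1 by omega]
      rw [u3_id2]; ring
    · -- arcs (g i, i), (i+1, g (i+1))
      rw [if_pos (by omega : g i < g (i + 1)), if_neg (by omega : ¬ g (i + 1) < g i)]
      simp only [if_neg (by omega : ¬ i < g i), if_pos (by omega : i + 1 < g (i + 1)), if_pos c1, if_neg c2]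
      have s1 := sq i (eN i g) (g i) hM' a1 (by rw [ey]; omega)
      have s2 := fun x => sq x g (i + 1) h hi (by omega)
      have s3 := fun x => sq x g (g i) h a1 (by rw [a3]; exact c1)
      rw [ey] at s1
      rw [a3] at s3
      have k1 := ca (g i) i (i + 1) (by omega) (by omega)
      have k2 := ca (g i) (i + 1) (g (i + 1)) (by omega) (by omega)
      push_cast at k1 k2 s2
      have p1 := s2 i
      have p2 := s2 (i + 1)
      have p3 := s2 (i - 1)
      have q1 := s3 i
      have q2 := s3 (i + 1)
      have q3 := s3 (i - 1)
      rw [if_pos (by omega)] at s1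
      rw [if_neg (by omega)] at p1
      rw [if_pos (by omega)] at p2
      rw [if_neg (by omega)] at p3
      rw [if_neg (by omega)] at q1
      rw [if_neg (by omega)] at q2
      rw [if_pos (by omega)] at q3
      set A := se (pre ++ (i : ℤ) :: suf) g (i + 1) with hA
      set B := se (pre ++ (i : ℤ) :: suf) g (g i) with hB
      rw [show se (pre ++ (i : ℤ) :: suf) (eN i g) (g i) = B + A + 1 by omega]
      rw [show se (pre ++ ((i : ℤ) + 1) :: suf) g (i + 1) = A + 1 by omega]
      rw [show se (pre ++ ((i : ℤ) - 1) :: suf) g (i + 1) = A by omega]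
      rw [show se (pre ++ ((i : ℤ) + 1) :: suf) g (g i) = B by omega]
      rw [show se (pre ++ ((i : ℤ) - 1) :: suf) g (g i) = B + 1 by omega]
      rw [u3_id1]; ring
  · have c2 : i + 1 < g (i + 1) := by
      by_contra hc
      have := h.inside (a := i) (k := i + 1) (by omega) (by omega) (by omega)
      omega
    have c3 : g (i + 1) < g i := (h.inside (a := i) (k := i + 1) (by omega) (by omega) (by omega)).2
    rw [if_neg (by omega : ¬ g i < g (i + 1)), if_pos c3]
    simp only [if_pos (by omega : i < g i), if_pos c2, if_neg c1, if_neg (by omega : ¬ g (i + 1) < i + 1)]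
    have s1 := sq i (eN i g) (g (i + 1)) hM' a2 (by rw [ez]; exact c3)
    have s2 := fun x => sq x g (i + 1) h hi (by omega)
    have s3 := fun x => sq x g i h (by omega) (by omega)
    rw [ez] at s1
    have k1 := ca i (i + 1) (g (i + 1)) (by omega) (by omega)
    have k2 := ca i (g (i + 1)) (g i) (by omega) (by omega)
    push_cast at k1 k2 s2
    have p1 := s2 i
    have p2 := s2 (i + 1)
    have p3 := s2 (i - 1)
    have q1 := s3 i
    have q2 := s3 (i + 1)
    have q3 := s3 (i - 1)
    rw [if_neg (by omega)] at s1
    rw [if_neg (by omega)] at p1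
    rw [if_pos (by omega)] at p2
    rw [if_neg (by omega)] at p3
    rw [if_pos (by omega)] at q1
    rw [if_pos (by omega)] at q2
    rw [if_neg (by omega)] at q3
    set A := se (pre ++ (i : ℤ) :: suf) g (i + 1) with hA
    set B := se (pre ++ (i : ℤ) :: suf) g i with hB
    rw [show se (pre ++ (i : ℤ) :: suf) (eN i g) (g (i + 1)) = B - A - 1 by omega]
    rw [show se (pre ++ ((i : ℤ) + 1) :: suf) g (i + 1) = A + 1 by omega]
    rw [show se (pre ++ ((i : ℤ) - 1) :: suf) g (i + 1) = A by omega]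
    rw [show se (pre ++ ((i : ℤ) + 1) :: suf) g i = B by omega]
    rw [show se (pre ++ ((i : ℤ) - 1) :: suf) g i = B - 1 by omega]
    rw [u3_id2]; ring

lemma Cw_eN0 {n : ℕ} {g : ℕ → ℕ} (h : IsM n g) {i : ℕ} (hi : i + 1 < 2 * n) (l : List ℤ)
    (hp : cnt l i (i + 1) = 0) : (Cw u3 n (eN i g) l : R) = 0 := by
  have ei : eN i g i = i + 1 := by
    unfold eN
    by_cases h1 : g i = i + 1
    · rw [if_pos h1, h1]
    · rw [if_neg h1, if_pos rfl]
  apply Finset.prod_eq_zero (i := i) (Finset.mem_range.2 (by omega))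
  rw [ei, if_pos (by omega)]
  unfold se
  rw [ei]
  push_cast
  rw [hp, show (0 - ((i : ℤ) + 1 - i + 1) / 2) = -1 by omega]
  simp [u3]

end

end LP

namespace LP

/-! ### Part J: the stationary vector -/

section
variable {R S : Type*} [CommRing R] [CommRing S]

lemma AA_map (φ : R →+* S) (τ : R) (n : ℕ) (l : List ℤ) : AA (φ τ) n l = φ (AA τ n l) := by
  unfold AA cz
  split_ifs with h1 h2
  · rw [← MvPolynomial.coeff_map]
    congr 1
    unfold PP
    rw [pp_map (MvPolynomial.map φ)]
    simp
  · simp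
  · simp

/-- coefficient with an extra factor -/
noncomputable def AJ (R : Type*) [CommRing R] (j n : ℕ) (l : List ℤ) : R :=
  cz (fun i : Fin n => l.getD i 0) ((∏ i, (1 + X i) ^ j) * PP (1 : R) n)

lemma AA_eq_AJ (n : ℕ) (l : List ℤ) (hl : l.length = n) : AA (1 : R) n l = AJ R 0 n l := by
  unfold AA AJ
  rw [if_pos hl]; simp

set_option maxHeartbeats 1000000 in
lemma AJ_cons (j n : ℕ) (l : List ℤ) (hl : l.length = n) :
    AJ R j (n + 1) (0 :: l) = AJ R (j + 1) n (l.map (fun x => x - 1)) := by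
  unfold AJ
  have e : (fun i : Fin (n + 1) => (0 :: l).getD i 0) = Fin.cons ((0 : ℕ) : ℤ) (fun i : Fin n => l.getD i 0) := by
    funext i
    refine Fin.cases ?_ (fun i => ?_) i <;> simp
  rw [e, cz_cons, map_mul, fse_PP, Polynomial.mul_coeff_zero, Polynomial.mul_coeff_zero, (qd_prod _ _ _ _).1,
    Polynomial.coeff_C_zero, map_prod, Fin.prod_univ_succ, Polynomial.mul_coeff_zero, Polynomial.coeff_zero_prod]
  have e2 : (fun i : Fin n => (l.map (fun x => x - 1)).getD i 0) = fun i => (fun i : Fin n => l.getD i 0) i - 1 := by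
    funext i
    have : (i : ℕ) < l.length := by omega
    simp [this]
  rw [e2, ← cz_prodX]
  congr 1
  have e3 : ((finSuccEquiv R n) ((1 + X 0) ^ j)).coeff 0 = 1 := by
    simp [finSuccEquiv_X_zero, Polynomial.coeff_zero_eq_eval_zero]
  have e4 : ∀ i : Fin n, ((finSuccEquiv R n) ((1 + X i.succ) ^ j)).coeff 0 = (1 + X i) ^ j := by
    intro i
    simp [finSuccEquiv_X_succ, Polynomial.coeff_zero_eq_eval_zero]
  rw [e3]
  simp only [e4]
  rw [Finset.prod_mul_distrib]
  have : ∏ i : Fin n, (1 + X i : MvPolynomial (Fin n) R) ^ (j + 1) = (∏ i : Fin n, (1 + X i) ^ j) * ∏ i : Fin n, (1 + X i) := by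
    rw [← Finset.prod_mul_distrib]; simp only [pow_succ]
  rw [this]; ring

/-- prefix word `0, 1, …, p-1` followed by `w` -/
def pref : ℕ → List ℤ → List ℤ
  | 0, w => w
  | p + 1, w => 0 :: (pref p (w.map (fun x => x - 1))).map (fun x => x + 1)

lemma pref_length (p : ℕ) : ∀ w : List ℤ, (pref p w).length = p + w.length := by
  induction p with
  | zero => intro w; simp [pref]
  | succ p ih => intro w; simp [pref, ih]; omega

lemma AJ_pref (p : ℕ) : ∀ (j m : ℕ) (w : List ℤ), w.length = m →
    AJ R j (m + p) (pref p w) = AJ R (j + p) m (w.map (fun x => x - p)) := by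
  induction p with
  | zero => intro j m w _; simp [pref]
  | succ p ih =>
    intro j m w hw
    have := AJ_cons (R := R) j (m + p) ((pref p (w.map (fun x => x - 1))).map (fun x => x + 1)) (by simp [pref_length]; omega)
    rw [pref, ← add_assoc, this, List.map_map]
    have e : ((fun x : ℤ => x - 1) ∘ fun x => x + 1) = id := by funext x; simp
    rw [e, List.map_id, ih (j + 1) m _ (by simpa using hw), List.map_map]
    congr 1
    · ring
    · apply List.map_congr_left
      intro x _
      simp only [Function.comp]; push_cast; ring

lemma AA_pref_nil (n : ℕ) : AA (1 : R) n (pref n []) = 1 := by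
  rw [AA_eq_AJ _ _ (by simp [pref_length])]
  have := AJ_pref (R := R) n 0 0 [] rfl
  rw [zero_add] at this
  rw [this]
  unfold AJ
  have : (PP (1 : R) 0) = 1 := by simp [PP, pp]
  rw [this]
  unfold cz
  simp [MvPolynomial.coeff_one]
  intro h
  exact absurd (Subsingleton.elim _ _) h

lemma pref_sorted (p : ℕ) : ∀ w : List ℤ, w.Pairwise (· ≤ ·) → (∀ x ∈ w, (p : ℤ) ≤ x) →
    (pref p w).Pairwise (· ≤ ·) ∧ ∀ x ∈ pref p w, 0 ≤ x := by
  induction p with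
  | zero => intro w h1 h2; exact ⟨h1, by simpa [pref] using h2⟩
  | succ p ih =>
    intro w h1 h2
    have := ih (w.map (fun x => x - 1)) (by
      rw [List.pairwise_map]; exact h1.imp (fun h => by omega)) (by
      intro x hx
      rw [List.mem_map] at hx
      obtain ⟨y, hy, rfl⟩ := hx
      have := h2 y hy
      push_cast at this; omega)
    refine ⟨?_, ?_⟩
    · rw [pref, List.pairwise_cons]
      refine ⟨?_, ?_⟩
      · intro x hx
        rw [List.mem_map] at hx
        obtain ⟨y, hy, rfl⟩ := hx
        have := this.2 y hy; omega
      · rw [List.pairwise_map]; exact this.1.imp (fun h => by omega)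
    · intro x hx
      rw [pref, List.mem_cons] at hx
      rcases hx with rfl | hx
      · exact le_refl _
      · rw [List.mem_map] at hx
        obtain ⟨y, hy, rfl⟩ := hx
        have := this.2 y hy; omega

end

lemma exists_psi1 (n : ℕ) : ∃ ψ : NCM n → ℂ, ∀ l : List ℤ, l.Pairwise (· ≤ ·) → l.length = n →
      AA (1 : ℂ) n l = ∑ π, Cw u3 n (NG π) l * ψ π := by
  obtain ⟨ψ, hψ⟩ := exists_psi n (AA (Polynomial.X : Polynomial ℝ) n)
    (AA_rel (fun a h => by
      have h2 : (2 : Polynomial ℝ) * a = 0 := by rw [two_mul]; exact h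
      exact (mul_eq_zero.1 h2).resolve_left two_ne_zero) _ _)
    (fun l hl => by unfold AA; rw [if_neg hl]) (fun l hl => AA_bd _ _ _ hl)
  let φ : Polynomial ℝ →+* ℂ := Polynomial.eval₂RingHom (algebraMap ℝ ℂ) 1
  have hφX : φ Polynomial.X = 1 := by simp [φ]
  have hU : (fun s => φ (UX s)) = u3 := by
    apply UW_unique (τ := (1 : ℂ)) _ u3_UW
    refine ⟨?_, ?_, ?_⟩
    · rw [UX_UW.zero, map_one]
    · rw [UX_UW.neg, map_zero]
    · intro s
      have := congrArg φ (UX_UW.rc s)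
      rw [map_add, map_add, map_mul, hφX, map_zero] at this
      exact this
  refine ⟨fun π => φ (ψ π), ?_⟩
  intro l h1 h2
  have := congrArg φ (hψ l h1 h2)
  rw [← AA_map, hφX] at this
  rw [this, map_sum]
  apply Finset.sum_congr rfl
  intro π _
  rw [map_mul]
  congr 1
  unfold Cw
  rw [map_prod]
  apply Finset.prod_congr rfl
  intro k _
  rw [apply_ite φ, map_one]
  have := congrFun hU (se l (NG π) k)
  rw [← this]

/-- rotation of matchings -/
def rho {n : ℕ} (π : NCM n) : NCM n := ofM (rotN n (NG π)) (rot_isM (NG_isM π))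

/-- cyclic predecessor -/
def sh (n x : ℕ) : ℕ := if x = 0 then 2 * n - 1 else x - 1

lemma sh_inj {n a b : ℕ} (ha : a < 2 * n) (hb : b < 2 * n) (h : sh n a = sh n b) : a = b := by
  unfold sh at h; split_ifs at h <;> omega

lemma sh_lt {n a : ℕ} (ha : a < 2 * n) : sh n a < 2 * n := by
  unfold sh; split_ifs <;> omega

lemma NG_rho {n : ℕ} (π : NCM n) (m : ℕ) (hm : m < 2 * n) : NG (rho π) (sh n m) = sh n (NG π m) := by
  unfold rho
  rw [NG_ofM _ _ _ (sh_lt hm)]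
  have h0 := (NG_isM π).nofix m hm
  unfold rotN sh
  by_cases h : m = 0
  · subst h
    rw [if_pos rfl, if_pos (by omega), if_neg h0]
  · rw [if_neg h, if_neg (by omega), show m - 1 + 1 = m by omega]

lemma rho_bij {n : ℕ} : Function.Bijective (rho (n := n)) := by
  rw [← Finite.injective_iff_bijective]
  intro π σ h
  apply NG_ext
  intro k hk
  have h1 := NG_rho π k hk
  have h2 := NG_rho σ k hk
  rw [h, h2] at h1
  exact (sh_inj ((NG_isM σ).lt k hk) ((NG_isM π).lt k hk) h1).symm

lemma eRaw_val {n : ℕ} (k : Fin (2 * n)) (π : NCM n) (m : Fin (2 * n)) (j : ℕ) (hj : ((k : ℕ) + 1) % (2 * n) = j) :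
    ((eRaw k π m : Fin (2 * n)) : ℕ) = if NG π k = j then NG π m else if (m : ℕ) = k then j else if (m : ℕ) = j then k
      else if (m : ℕ) = NG π k then NG π j else if (m : ℕ) = NG π j then NG π k else NG π m := by
  have hf : ((fsucc k : Fin (2 * n)) : ℕ) = j := hj
  have e2 : NG π j = π.f (fsucc k) := by rw [← NG_fin, hf]
  unfold eRaw
  rw [e2]
  simp only [NG_fin]
  rw [← hf]
  simp only [← Fin.ext_iff]
  by_cases h : π.f k = fsucc k
  · rw [if_pos h, if_pos h]
  · simp only [h, if_false]
    split_ifs <;> rfl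

lemma exists_E {n : ℕ} (hn : 1 ≤ n) (k : Fin (2 * n)) (π : NCM n) : ∃ σ : NCM n, σ.f = eRaw k π ∧
    ((k : ℕ) + 1 < 2 * n → ∀ m, m < 2 * n → NG σ m = eN k (NG π) m) ∧
    ((k : ℕ) + 1 = 2 * n → ∀ m, m < 2 * n → NG (rho σ) m = eN (2 * n - 2) (NG (rho π)) m) := by
  by_cases hk : (k : ℕ) + 1 < 2 * n
  · refine ⟨ofM (eN k (NG π)) (eN_isM (NG_isM π) hk), ?_, ?_, ?_⟩
    · funext m
      apply Fin.ext
      rw [eRaw_val k π m (k + 1) (Nat.mod_eq_of_lt hk)]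
      rfl
    · intro _ m hm
      rw [NG_ofM _ _ _ hm]
    · intro h; omega
  · have hk' : (k : ℕ) + 1 = 2 * n := by omega
    obtain ⟨σ, hσ⟩ := rho_bij.2 (ofM (eN (2 * n - 2) (NG (rho π))) (eN_isM (NG_isM (rho π)) (i := 2 * n - 2) (by omega)))
    have hm : ∀ m, m < 2 * n → NG (rho σ) m = eN (2 * n - 2) (NG (rho π)) m := by
      intro m hm; rw [hσ, NG_ofM _ _ _ hm]
    refine ⟨σ, ?_, fun h => absurd h hk, fun _ => hm⟩
    funext m
    apply Fin.ext
    rw [eRaw_val k π m 0 (by rw [hk']; exact Nat.mod_self _), ← NG_fin]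
    have e1 := hm (sh n m) (sh_lt m.2)
    rw [NG_rho _ _ m.2] at e1
    have sk : sh n k = 2 * n - 2 := by unfold sh; rw [if_neg (by omega)]; omega
    have s0 : sh n 0 = 2 * n - 1 := by unfold sh; rw [if_pos rfl]
    have r1 : NG (rho π) (2 * n - 2) = sh n (NG π k) := by rw [← sk, NG_rho _ _ k.2]
    have r2 : NG (rho π) (2 * n - 1) = sh n (NG π 0) := by rw [← s0, NG_rho _ _ (by omega)]
    have rm : NG (rho π) (sh n m) = sh n (NG π m) := NG_rho _ _ m.2
    unfold eN at e1
    rw [r1, show 2 * n - 2 + 1 = 2 * n - 1 by omega, r2, rm] at e1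
    have lk := (NG_isM π).lt k k.2
    have l0 := (NG_isM π).lt 0 (by omega)
    have lm := (NG_isM π).lt m m.2
    have ls := (NG_isM σ).lt m m.2
    have iff : ∀ a b, a < 2 * n → b < 2 * n → (sh n a = sh n b ↔ a = b) := fun a b ha hb =>
      ⟨sh_inj ha hb, fun h => by rw [h]⟩
    simp only [← s0] at e1
    rw [← sk] at e1
    simp only [iff _ _ lk (by omega : 0 < 2 * n), iff _ _ m.2 k.2, iff _ _ m.2 (by omega : 0 < 2 * n), iff _ _ m.2 lk, iff _ _ m.2 l0] at e1
    simp only [← apply_ite (sh n)] at e1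
    refine sh_inj ls ?_ e1
    split_ifs <;> first | assumption | exact k.2 | omega

lemma ofFn_update {n : ℕ} (e : Fin n → ℤ) (l : Fin n) : ∃ pre suf : List ℤ, ∀ x, List.ofFn (Function.update e l x) = pre ++ x :: suf := by
  induction n with
  | zero => exact l.elim0
  | succ n ih =>
    refine Fin.cases ?_ (fun l => ?_) l
    · refine ⟨[], List.ofFn (fun i : Fin n => e i.succ), ?_⟩
      intro x
      rw [List.ofFn_succ]
      simp
    · obtain ⟨pre, suf, h⟩ := ih (fun i => e i.succ) l
      refine ⟨e 0 :: pre, suf, ?_⟩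
      intro x
      rw [List.ofFn_succ, List.cons_append, ← h, Function.update_of_ne (Fin.succ_ne_zero l).symm]
      congr 2
      funext i
      by_cases hi : i = l
      · subst hi; simp
      · simp [hi]

lemma opw_vec {N : ℕ} {g : ℕ → ℕ} (h : IsM (N + 1) g) : ∃ v : Fin N → ℤ, opw (N + 1) g = List.ofFn (Fin.cons 0 v : Fin (N + 1) → ℤ) ∧
    StrictMono v ∧ ∀ i, 1 ≤ v i ∧ v i ≤ 2 * N := by
  have hl := opw_length h
  have hs := opw_sorted (N + 1) g
  have hb : ∀ x ∈ opw (N + 1) g, 0 ≤ x ∧ x ≤ 2 * N := by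
    intro x hx
    rw [opw_mem] at hx
    obtain ⟨k, h1, h2, rfl⟩ := hx
    have := h.lt k h1
    push_cast; omega
  have h0 : (0 : ℤ) ∈ opw (N + 1) g := by
    rw [opw_mem]; exact ⟨0, by omega, by have := h.nofix 0 (by omega); omega, rfl⟩
  obtain ⟨x, t, ht⟩ : ∃ x t, opw (N + 1) g = x :: t := by
    cases hh : opw (N + 1) g with
    | nil => rw [hh] at hl; simp at hl
    | cons x t => exact ⟨x, t, rfl⟩
  rw [ht] at hl hs hb h0
  rw [List.pairwise_cons] at hs
  have hx : x = 0 := by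
    rw [List.mem_cons] at h0
    rcases h0 with h0 | h0
    · exact h0.symm
    · have := hs.1 0 h0; have := hb x (by simp); omega
  subst hx
  have htl : t.length = N := by simpa using hl
  subst htl
  refine ⟨t.get, ?_, ?_, ?_⟩
  · rw [ht, List.ofFn_succ]
    simp only [Fin.cons_zero, Fin.cons_succ, List.ofFn_get]
  · intro i j hij
    exact List.pairwise_iff_get.1 hs.2 i j hij
  · intro i
    have h1 := hs.1 (t.get i) (List.get_mem _ _)
    have h2 := hb (t.get i) (by simp)
    omega

lemma AA_ofFn {R : Type*} [CommRing R] (n : ℕ) (e : Fin n → ℤ) : AA (1 : R) n (List.ofFn e) = cz e (PP (1 : R) n) := by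
  unfold AA
  rw [if_pos (by simp)]
  congr 1
  funext i
  simp

end LP

namespace LP

/-! ### Part K: proportionality of the stationary vector -/

lemma snoc_list {N : ℕ} (v : Fin N → ℤ) (x : ℤ) : (List.ofFn v).map (fun y => y - 1) ++ [x] =
    List.ofFn (Fin.snoc (fun i => v i - 1) x : Fin (N + 1) → ℤ) := by
  rw [List.ofFn_succ', List.map_ofFn]
  simp only [Fin.snoc_castSucc, Fin.snoc_last, List.concat_eq_append]
  rfl

lemma Cw_rho {N : ℕ} (π : NCM (N + 1)) (v : Fin N → ℤ) (hv : ∀ i, 1 ≤ v i ∧ v i ≤ 2 * N) :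
    (Cw u3 (N + 1) (NG π) (List.ofFn (Fin.cons 0 v : Fin (N + 1) → ℤ)) : ℂ) =
      Cw u3 (N + 1) (NG (rho π)) (List.ofFn (Fin.snoc (fun i => v i - 1) (2 * N : ℤ) : Fin (N + 1) → ℤ)) := by
  rw [List.ofFn_succ]
  simp only [Fin.cons_zero, Fin.cons_succ]
  rw [Cw_rot (by omega) (NG_isM π) (List.ofFn v) (by
    intro x hx
    rw [List.mem_ofFn] at hx
    obtain ⟨i, rfl⟩ := hx
    have := hv i
    push_cast; omega) (by simp)]
  rw [show (2 * ((N + 1 : ℕ) : ℤ) - 2) = 2 * N by push_cast; ring, snoc_list]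
  apply Cw_congr
  intro k hk
  unfold rho
  rw [NG_ofM _ _ _ hk]

lemma snoc_mono {N : ℕ} (v : Fin N → ℤ) (hm : StrictMono v) (x : ℤ) (hx : ∀ i, v i - 1 ≤ x) :
    (List.ofFn (Fin.snoc (fun i => v i - 1) x : Fin (N + 1) → ℤ)).Pairwise (· ≤ ·) := by
  rw [List.pairwise_ofFn]
  intro i j
  refine Fin.lastCases ?_ (fun j => ?_) j
  · refine Fin.lastCases ?_ (fun i => ?_) i
    · intro h; exact absurd h (lt_irrefl _)
    · intro _; simpa using hx i
  · refine Fin.lastCases ?_ (fun i => ?_) i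
    · intro h; exact absurd h (not_lt.2 (Fin.le_last _))
    · intro h
      have := hm (Fin.castSucc_lt_castSucc_iff.1 h)
      simp only [Fin.snoc_castSucc]; omega

section
variable {N : ℕ} {ψ : NCM (N + 1) → ℂ}

lemma psi_rho (hψ : ∀ l : List ℤ, l.Pairwise (· ≤ ·) → l.length = N + 1 →
      AA (1 : ℂ) (N + 1) l = ∑ π, Cw u3 (N + 1) (NG π) l * ψ π)
    (π : NCM (N + 1)) : ψ (rho π) = ψ π := by
  have := C_inj (R := ℂ) u3_UW (fun π => ψ (rho π) - ψ π) (by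
    intro σ
    obtain ⟨v, h1, h2, h3⟩ := opw_vec (NG_isM σ)
    simp only [mul_sub, Finset.sum_sub_distrib]
    rw [← hψ _ ((opw_sorted _ _).imp le_of_lt) (opw_length (NG_isM σ)), h1]
    have e1 : ∑ π, (Cw u3 (N + 1) (NG π) (List.ofFn (Fin.cons 0 v : Fin (N + 1) → ℤ)) : ℂ) * ψ (rho π) =
        ∑ π, (Cw u3 (N + 1) (NG π) (List.ofFn (Fin.snoc (fun i => v i - 1) (2 * N : ℤ) : Fin (N + 1) → ℤ)) : ℂ) * ψ π := by
      rw [← (Equiv.ofBijective rho rho_bij).sum_comp (fun π => (Cw u3 (N + 1) (NG π) (List.ofFn (Fin.snoc (fun i => v i - 1) (2 * N : ℤ) : Fin (N + 1) → ℤ)) : ℂ) * ψ π)]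
      apply Finset.sum_congr rfl
      intro π _
      rw [Cw_rho π v h3]; rfl
    rw [e1, ← hψ _ (snoc_mono v h2 _ (fun i => by have := h3 i; omega)) (by simp), AA_ofFn, AA_ofFn, PP_rot, sub_self])
  have := congrFun this π
  simp only [Pi.zero_apply] at this
  linear_combination this

lemma psi_stat (hψ : ∀ l : List ℤ, l.Pairwise (· ≤ ·) → l.length = N + 1 →
      AA (1 : ℂ) (N + 1) l = ∑ π, Cw u3 (N + 1) (NG π) l * ψ π)
    (hN : 0 < N) : Stationary ψ := by
  choose E hE1 hE2 hE3 using fun (k : Fin (2 * (N + 1))) (π : NCM (N + 1)) => exists_E (by omega) k π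
  have hin := C_inj (R := ℂ) u3_UW (fun π => (∑ k : Fin (2 * (N + 1)), ∑ π' : NCM (N + 1), if eRaw k π' = π.f then ψ π' else 0)
    - ((2 * (N + 1) : ℕ) : ℂ) * ψ π) (by
    intro σ
    obtain ⟨v, h1, h2, h3⟩ := opw_vec (NG_isM σ)
    rw [h1]
    set e : Fin (N + 1) → ℤ := Fin.cons 0 v with he
    have hes : StrictMono e := by
      rw [he]
      intro i j
      refine Fin.cases ?_ (fun j => ?_) j
      · intro h; exact absurd h (by simp)
      · refine Fin.cases ?_ (fun i => ?_) i
        · intro _; have := h3 j; simp only [Fin.cons_zero, Fin.cons_succ]; omega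
        · intro h; simpa using h2 (Fin.succ_lt_succ_iff.1 h)
    have heb : ∀ i, 0 ≤ e i ∧ e i ≤ 2 * N := by
      intro i
      rw [he]
      refine Fin.cases ?_ (fun i => ?_) i
      · simp
      · have := h3 i; simp only [Fin.cons_succ]; omega
    have hesort : ∀ (l : Fin (N + 1)) (x : ℤ), x = e l ∨ x = e l + 1 ∨ x = e l - 1 →
        (List.ofFn (Function.update e l x)).Pairwise (· ≤ ·) := by
      intro l x hx
      rw [List.pairwise_ofFn]
      intro i j hij
      have hh := hes hij
      by_cases hi : i = l
      · subst hi
        rw [Function.update_self, Function.update_of_ne (ne_of_gt hij)]; omega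
      · rw [Function.update_of_ne hi]
        by_cases hj : j = l
        · subst hj; rw [Function.update_self]; omega
        · rw [Function.update_of_ne hj]; omega
    -- exchange sums
    have ex : ∑ π, (Cw u3 (N + 1) (NG π) (List.ofFn e) : ℂ) * (∑ k : Fin (2 * (N + 1)), ∑ π' : NCM (N + 1), if eRaw k π' = π.f then ψ π' else 0)
        = ∑ k : Fin (2 * (N + 1)), ∑ π' : NCM (N + 1), Cw u3 (N + 1) (NG (E k π')) (List.ofFn e) * ψ π' := by
      simp only [Finset.mul_sum]
      rw [Finset.sum_comm]
      apply Finset.sum_congr rfl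
      intro k _
      rw [Finset.sum_comm]
      apply Finset.sum_congr rfl
      intro π' _
      rw [Finset.sum_eq_single (E k π')]
      · rw [if_pos (hE1 k π').symm]
      · intro π _ hne
        rw [if_neg, mul_zero]
        intro h
        apply hne
        apply NCM.ext'
        rw [hE1, h]
      · intro h; exact absurd (Finset.mem_univ _) h
    -- the last generator
    have last : ∑ π' : NCM (N + 1), (Cw u3 (N + 1) (NG (E (Fin.last (2 * N + 1)) π')) (List.ofFn e) : ℂ) * ψ π' =
        cz e (PP (1 : ℂ) (N + 1)) + cz (Fin.snoc (fun i => v i - 1) (2 * N - 1)) (PP (1 : ℂ) (N + 1)) := by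
      have : ∀ π', (Cw u3 (N + 1) (NG (E (Fin.last (2 * N + 1)) π')) (List.ofFn e) : ℂ) =
          Cw u3 (N + 1) (NG (rho π')) (List.ofFn (Fin.snoc (fun i => v i - 1) (2 * N : ℤ) : Fin (N + 1) → ℤ)) +
          Cw u3 (N + 1) (NG (rho π')) (List.ofFn (Fin.snoc (fun i => v i - 1) (2 * N - 1 : ℤ) : Fin (N + 1) → ℤ)) := by
        intro π'
        rw [he, Cw_rho _ v h3, Cw_congr u3 (hE3 (Fin.last (2 * N + 1)) π' (by simp; omega)), ← snoc_list, ← snoc_list]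
        have hb : cnt (List.map (fun y => y - 1) (List.ofFn v)) ((2 * N : ℕ) : ℤ) ((2 * N : ℕ) + 1) = 0 := by
          apply cnt_none
          intro x hx
          simp only [List.mem_map, List.mem_ofFn] at hx
          obtain ⟨y, ⟨i, rfl⟩, rfl⟩ := hx
          have := h3 i
          push_cast; omega
        have := Cw_eN (R := ℂ) (NG_isM (rho π')) (i := 2 * N) (by omega) ((List.ofFn v).map (fun y => y - 1)) [] hb (by simp)
        push_cast at this
        rw [show 2 * (N + 1) - 2 = 2 * N by omega, this]
        rw [Cw_bd (R := ℂ) u3_UW (NG_isM (rho π')) (l := (List.ofFn v).map (fun y => y - 1) ++ [2 * (N : ℤ) + 1]) (by simp)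
          ⟨2 * (N : ℤ) + 1, by simp, by right; push_cast; omega⟩]
        ring
      simp only [this, add_mul, Finset.sum_add_distrib]
      have tr : ∀ w : List ℤ, ∑ π', (Cw u3 (N + 1) (NG (rho π')) w : ℂ) * ψ π' = ∑ π', Cw u3 (N + 1) (NG π') w * ψ π' := by
        intro w
        rw [← (Equiv.ofBijective rho rho_bij).sum_comp (fun π' => (Cw u3 (N + 1) (NG π') w : ℂ) * ψ π')]
        apply Finset.sum_congr rfl
        intro π _
        simp only [Equiv.ofBijective_apply]
        rw [psi_rho hψ]
      rw [tr, tr, ← hψ _ (snoc_mono v h2 _ (fun i => by have := h3 i; omega)) (by simp),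
        ← hψ _ (snoc_mono v h2 _ (fun i => by have := h3 i; omega)) (by simp), AA_ofFn, AA_ofFn, he, PP_rot]
    -- other generators
    have oth : ∑ k : Fin (2 * N + 1), ∑ π' : NCM (N + 1), (Cw u3 (N + 1) (NG (E k.castSucc π')) (List.ofFn e) : ℂ) * ψ π' =
        ∑ l : Fin (N + 1), (cz e (PP (1 : ℂ) (N + 1)) + cz (Function.update e l (e l + 1)) (PP (1 : ℂ) (N + 1))
          + cz (Function.update e l (e l - 1)) (PP (1 : ℂ) (N + 1))) := by
      symm
      apply Finset.sum_of_injOn (fun l : Fin (N + 1) => (⟨(e l).toNat, by have := heb l; omega⟩ : Fin (2 * N + 1)))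
      · intro i _ j _ hij
        have := congrArg Fin.val hij
        simp only at this
        have a1 := heb i
        have a2 := heb j
        exact hes.injective (by omega)
      · intro i _; simp
      · intro k _ hk
        apply Finset.sum_eq_zero
        intro π' _
        rw [Cw_congr u3 (hE2 k.castSucc π' (by simp; omega)), Cw_eN0 (NG_isM π') (by simp; omega), zero_mul]
        apply cnt_none
        intro x hx hx2
        rw [List.mem_ofFn] at hx
        obtain ⟨i, rfl⟩ := hx
        apply hk
        refine ⟨i, by simp, ?_⟩
        apply Fin.ext
        simp only [Fin.val_castSucc] at hx2 ⊢
        omega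
      · intro l _
        obtain ⟨pre, suf, hps⟩ := ofFn_update e l
        have hp0 := hps (e l)
        rw [Function.update_eq_self] at hp0
        have hnd : (List.ofFn e).Nodup := List.nodup_ofFn.2 hes.injective
        rw [hp0] at hnd
        have hnd2 := List.nodup_middle.1 hnd
        rw [List.nodup_cons] at hnd2
        have hmem : e l ∉ pre ∧ e l ∉ suf := by simpa using hnd2.1
        have hel : ((e l).toNat : ℤ) = e l := by have := heb l; omega
        have hkk : ∀ w : List ℤ, e l ∉ w → cnt w ((e l).toNat : ℤ) ((e l).toNat + 1) = 0 := by
          intro w hw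
          apply cnt_none
          intro x hx hx2
          apply hw
          rwa [show e l = x by omega]
        have hb := heb l
        have : ∀ π', (Cw u3 (N + 1) (NG (E (⟨(e l).toNat, by omega⟩ : Fin (2 * N + 1)).castSucc π')) (List.ofFn e) : ℂ) =
            Cw u3 (N + 1) (NG π') (List.ofFn (Function.update e l (e l))) + Cw u3 (N + 1) (NG π') (List.ofFn (Function.update e l (e l + 1)))
            + Cw u3 (N + 1) (NG π') (List.ofFn (Function.update e l (e l - 1))) := by
          intro π'
          rw [Cw_congr u3 (hE2 _ π' (by simp; omega)), hps, hps, hps, hp0]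
          have := Cw_eN (R := ℂ) (NG_isM π') (i := (e l).toNat) (by omega) pre suf (hkk _ hmem.1) (hkk _ hmem.2)
          rw [hel] at this
          exact this
        simp only [this, add_mul, Finset.sum_add_distrib]
        rw [← hψ _ (hesort l _ (by simp)) (by simp), ← hψ _ (hesort l _ (by simp)) (by simp), ← hψ _ (hesort l _ (by simp)) (by simp),
          AA_ofFn, AA_ofFn, AA_ofFn, Function.update_eq_self]
    simp only [mul_sub, Finset.sum_sub_distrib]
    rw [ex]
    have split : ∀ F : Fin (2 * (N + 1)) → ℂ, ∑ k, F k = (∑ k : Fin (2 * N + 1), F k.castSucc) + F (Fin.last (2 * N + 1)) :=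
      fun F => Fin.sum_univ_castSucc (n := 2 * N + 1) F
    rw [split, oth, last]
    have rhs : ∑ π, (Cw u3 (N + 1) (NG π) (List.ofFn e) : ℂ) * (((2 * (N + 1) : ℕ) : ℂ) * ψ π) = (2 * (N + 1)) * cz e (PP (1 : ℂ) (N + 1)) := by
      rw [← AA_ofFn, hψ (List.ofFn e) (by rw [List.pairwise_ofFn]; intro i j hij; exact le_of_lt (hes hij)) (by simp), Finset.mul_sum]
      apply Finset.sum_congr rfl
      intro π _; push_cast; ring
    rw [rhs]
    have st := PP_stat (R := ℂ) N hN v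
    rw [Fin.sum_univ_succ]
    have z : cz (Function.update e 0 (e 0 - 1)) (PP (1 : ℂ) (N + 1)) = 0 := by
      unfold cz
      rw [if_neg]
      intro h
      have := h 0
      rw [Function.update_self, he, Fin.cons_zero] at this
      omega
    rw [z]
    have z1 : Function.update e 0 (e 0 + 1) = Fin.cons 1 v := by
      rw [he, Fin.update_cons_zero]; simp
    rw [z1]
    have z2 : ∀ (l : Fin N) (x : ℤ), Function.update e l.succ x = Fin.cons 0 (Function.update v l x) := by
      intro l x; rw [he, Fin.cons_update]
    simp only [z2]
    have z3 : ∀ l : Fin N, e l.succ = v l := by intro l; rw [he, Fin.cons_succ]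
    simp only [z3]
    rw [Finset.sum_add_distrib] at st
    rw [Finset.sum_add_distrib, Finset.sum_add_distrib]
    simp only [Finset.sum_const, Finset.card_univ, Fintype.card_fin, nsmul_eq_mul]
    rw [← he] at st
    linear_combination st)
  intro π
  have := congrFun hin π
  simp only [Pi.zero_apply] at this
  linear_combination -this

lemma psi_prop (hψ : ∀ l : List ℤ, l.Pairwise (· ≤ ·) → l.length = N + 1 →
      AA (1 : ℂ) (N + 1) l = ∑ π, Cw u3 (N + 1) (NG π) l * ψ π)
    (hN : 0 < N) (μ : NCM (N + 1) → ℂ) (hsum : ∑ π, μ π = 1) (hstat : Stationary μ)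
    (huniq : ∀ v : NCM (N + 1) → ℂ, (∑ π, v π = 1) → Stationary v → v = μ) :
    ∑ π, ψ π ≠ 0 ∧ ∀ π, ψ π = (∑ π, ψ π) * μ π := by
  have hst := psi_stat hψ hN
  have h0 : ∑ π, ψ π ≠ 0 := by
    intro h0
    have := huniq (fun π => μ π + ψ π) (by rw [Finset.sum_add_distrib, hsum, h0, add_zero]) (by
      intro π
      have a := hstat π
      have b := hst π
      beta_reduce
      rw [mul_add, a, b, ← Finset.sum_add_distrib]
      apply Finset.sum_congr rfl
      intro k _
      rw [← Finset.sum_add_distrib]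
      apply Finset.sum_congr rfl
      intro π' _
      split_ifs <;> simp)
    have hz : ∀ π, ψ π = 0 := by
      intro π
      have := congrFun this π
      simpa using this
    have h1 := hψ (pref (N + 1) []) (pref_sorted _ _ (by simp) (by simp)).1 (by simp [pref_length])
    rw [AA_pref_nil] at h1
    simp [hz] at h1
  refine ⟨h0, ?_⟩
  have := huniq (fun π => (∑ π, ψ π)⁻¹ * ψ π) (by rw [← Finset.mul_sum, inv_mul_cancel₀ h0]) (by
    intro π
    have b := hst π
    simp only
    rw [mul_left_comm, b, Finset.mul_sum]
    apply Finset.sum_congr rfl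
    intro k _
    rw [Finset.mul_sum]
    apply Finset.sum_congr rfl
    intro π' _
    split_ifs <;> simp)
  intro π
  rw [← congrFun this π, mul_inv_cancel_left₀ h0]

end

end LP

namespace LP

/-- the letter of a window -/
def lett (T : ℕ) : Option Bool → List ℤ
  | none => []
  | some true => [2 * (T : ℤ)]
  | some false => [2 * (T : ℤ) - 1]

/-- word attached to a choice of letters in the windows -/
def wd {m : ℕ} (h : Fin m → Option Bool) : List ℤ := (List.ofFn fun T : Fin m => lett T (h T)).flatten

lemma cnt_flatten (L : List (List ℤ)) (a b : ℤ) : cnt L.flatten a b = (L.map (fun l => cnt l a b)).sum := by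
  induction L with
  | nil => simp
  | cons x L ih => simp [ih]

lemma cnt_wd {m : ℕ} (h : Fin m → Option Bool) (a b : ℤ) : cnt (wd h) a b = ∑ T : Fin m, cnt (lett T (h T)) a b := by
  unfold wd
  rw [cnt_flatten, List.map_ofFn, List.sum_ofFn]; rfl

lemma length_wd {m : ℕ} (h : Fin m → Option Bool) : ((wd h).length : ℤ) = ∑ T : Fin m, if h T = none then 0 else 1 := by
  unfold wd
  rw [List.length_flatten, List.map_ofFn, List.sum_ofFn]
  push_cast
  apply Finset.sum_congr rfl
  intro T _
  rcases hT : h T with _ | _ | _ <;> simp [lett, hT]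

lemma lett_mem {T : ℕ} {o : Option Bool} {x : ℤ} (h : x ∈ lett T o) : 2 * (T : ℤ) - 1 ≤ x ∧ x ≤ 2 * T := by
  rcases o with _ | _ | _ <;> simp [lett] at h <;> omega

lemma wd_mem {m : ℕ} {h : Fin m → Option Bool} {x : ℤ} (hx : x ∈ wd h) : -1 ≤ x ∧ x ≤ 2 * m := by
  unfold wd at hx
  rw [List.mem_flatten] at hx
  obtain ⟨l, hl, hx⟩ := hx
  rw [List.mem_ofFn] at hl
  obtain ⟨T, rfl⟩ := hl
  have := lett_mem hx
  have := T.2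
  omega

lemma wd_sorted {m : ℕ} (h : Fin m → Option Bool) : (wd h).Pairwise (· ≤ ·) := by
  unfold wd
  rw [List.pairwise_flatten]
  constructor
  · intro l hl
    rw [List.mem_ofFn] at hl
    obtain ⟨T, rfl⟩ := hl
    rcases hT : h T with _ | _ | _ <;> simp [lett]
  · rw [List.pairwise_ofFn]
    intro i j hij x hx y hy
    have := lett_mem hx
    have := lett_mem hy
    have : (i : ℕ) < j := hij
    omega

lemma cnt_lett_even (T : ℕ) (o : Option Bool) (a : ℤ) :
    cnt (lett T o) (2 * a) (2 * a + 1) = if (T : ℤ) = a ∧ o = some true then 1 else 0 := by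
  rcases o with _ | _ | _ <;> simp [lett] <;> try split_ifs
  all_goals omega

lemma cnt_lett_odd (T : ℕ) (o : Option Bool) (a : ℤ) :
    cnt (lett T o) (2 * a - 1) (2 * a) = if (T : ℤ) = a ∧ o = some false then 1 else 0 := by
  rcases o with _ | _ | _ <;> simp [lett] <;> try split_ifs
  all_goals omega

lemma cnt_lett_win (T : ℕ) (o : Option Bool) (a : ℤ) :
    cnt (lett T o) (2 * a - 1) (2 * a + 1) ≤ if (T : ℤ) = a then 1 else 0 := by
  rcases o with _ | _ | _ <;> simp [lett] <;> split_ifs <;> omega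

lemma cnt_wd_win {m : ℕ} (h : Fin m → Option Bool) (a : ℤ) : cnt (wd h) (2 * a - 1) (2 * a + 1) ≤ 1 := by
  rw [cnt_wd]
  calc _ ≤ ∑ T : Fin m, if ((T : ℕ) : ℤ) = a then (1 : ℤ) else 0 := Finset.sum_le_sum (fun T _ => cnt_lett_win T (h T) a)
    _ ≤ 1 := by
      rw [Finset.sum_boole]
      norm_cast
      apply Finset.card_le_one.2
      intro x hx y hy
      simp at hx hy
      apply Fin.ext; omega

lemma cnt_wd_bd {m : ℕ} (h : Fin m → Option Bool) (a : ℤ) (d : ℕ) :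
    cnt (wd h) (2 * a - 1) (2 * (a + d) - 1) ≤ d := by
  induction d with
  | zero => rw [cnt_empty _ (by push_cast; omega)]; simp
  | succ d ih =>
    rw [← cnt_add (wd h) (b := 2 * (a + d) - 1) (by omega) (by push_cast; omega)]
    have := cnt_wd_win h (a + d)
    have e : (2 * (a + ((d + 1 : ℕ) : ℤ)) - 1) = 2 * (a + d) + 1 := by push_cast; ring
    rw [e]; push_cast; omega

lemma cnt_wd_even {m : ℕ} (h : Fin m → Option Bool) (a : ℤ) (hc : 0 < cnt (wd h) (2 * a) (2 * a + 1)) :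
    ∃ T : Fin m, ((T : ℕ) : ℤ) = a ∧ h T = some true := by
  rw [cnt_wd] at hc
  obtain ⟨T, _, hT⟩ := Finset.exists_ne_zero_of_sum_ne_zero hc.ne'
  rw [cnt_lett_even] at hT
  exact ⟨T, by simpa using hT⟩

lemma cnt_wd_odd {m : ℕ} (h : Fin m → Option Bool) (a : ℤ) (hc : 0 < cnt (wd h) (2 * a - 1) (2 * a)) :
    ∃ T : Fin m, ((T : ℕ) : ℤ) = a ∧ h T = some false := by
  rw [cnt_wd] at hc
  obtain ⟨T, _, hT⟩ := Finset.exists_ne_zero_of_sum_ne_zero hc.ne'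
  rw [cnt_lett_odd] at hT
  exact ⟨T, by simpa using hT⟩

lemma pref_eq (p : ℕ) : ∀ w : List ℤ, pref p w = (List.range p).map (fun i : ℕ => (i : ℤ)) ++ w := by
  induction p with
  | zero => intro w; simp [pref]
  | succ p ih =>
    intro w
    simp only [pref]
    rw [ih, List.range_succ_eq_map]
    simp [Function.comp_def]

lemma cnt_map_add (l : List ℤ) (c a b : ℤ) : cnt (l.map (fun x => x + c)) a b = cnt l (a - c) (b - c) := by
  induction l with
  | nil => simp
  | cons x l ih =>
    simp only [List.map_cons, cnt_cons, ih]
    congr 1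
    apply if_congr _ rfl rfl
    omega

lemma cnt_range (p : ℕ) (a b : ℤ) : cnt ((List.range p).map (fun i : ℕ => (i : ℤ))) a b =
    ∑ i ∈ Finset.range p, if a ≤ (i : ℤ) ∧ (i : ℤ) < b then 1 else 0 := by
  unfold cnt
  rw [List.map_map]
  rw [Finset.sum_range]
  rw [← List.sum_ofFn, List.ofFn_eq_map, ← List.map_coe_finRange_eq_range, List.map_map]
  rfl

/-- the word with prefix `0..2s-1` and windows -/
def bw (s : ℕ) {m : ℕ} (h : Fin m → Option Bool) : List ℤ := pref (2 * s) ((wd h).map (fun x => x + (2 * s : ℤ)))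

lemma cnt_bw (s : ℕ) {m : ℕ} (h : Fin m → Option Bool) (a b : ℤ) :
    cnt (bw s h) a b = (∑ i ∈ Finset.range (2 * s), if a ≤ (i : ℤ) ∧ (i : ℤ) < b then 1 else 0)
      + cnt (wd h) (a - 2 * s) (b - 2 * s) := by
  unfold bw
  rw [pref_eq, cnt_append, cnt_range, cnt_map_add]

lemma bw_length (s : ℕ) {m : ℕ} (h : Fin m → Option Bool) : (bw s h).length = 2 * s + (wd h).length := by
  unfold bw; rw [pref_length]; simp

lemma bw_sorted (s : ℕ) {m : ℕ} (h : Fin m → Option Bool) : (bw s h).Pairwise (· ≤ ·) := by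
  unfold bw
  rw [pref_eq, List.pairwise_append]
  refine ⟨?_, ?_, ?_⟩
  · rw [List.pairwise_map]
    exact (List.pairwise_lt_range (n := 2 * s)).imp (fun h => by omega)
  · rw [List.pairwise_map]
    exact (wd_sorted h).imp (fun h => by omega)
  · intro x hx y hy
    simp at hx hy
    obtain ⟨i, hi, rfl⟩ := hx
    obtain ⟨z, hz, rfl⟩ := hy
    have := wd_mem hz
    omega

/-- the unique contributing choice -/
def hpi (s m : ℕ) (n : ℕ) (g : ℕ → ℕ) (T : Fin m) : Option Bool :=
  if 2 * ((T : ℕ) + s) < 2 * n ∧ 2 * s ≤ g (2 * (T + s)) then some (decide (2 * ((T : ℕ) + s) < g (2 * (T + s)))) else none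

/-- modified openers -/
def phi (s : ℕ) (g : ℕ → ℕ) (k : ℕ) : ℤ := if k % 2 = 0 ∨ k < 2 * s then k else (g k : ℤ) - 1

lemma IsM.par {n : ℕ} {g : ℕ → ℕ} (h : IsM n g) {x : ℕ} (hx : x < 2 * n) : (g x + x) % 2 = 1 := by
  have h1 := h.nofix x hx
  by_cases hg : x < g x
  · have := arc_op h hx hg; omega
  · have := arc_op h (h.lt x hx) (by rw [h.inv x hx]; omega)
    rw [h.inv x hx] at this; omega

lemma hpi_cnt {k s : ℕ} {g : ℕ → ℕ} (hM : IsM (k + 2 * s) g) (hE : ∀ i, i < 2 * s → i < g i) (a b : ℤ) :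
    cnt (bw s (hpi s (k + 2 * s) (k + 2 * s) g)) a b =
      ∑ x ∈ (Finset.range (2 * (k + 2 * s))).filter (fun x => x < g x), if a ≤ phi s g x ∧ phi s g x < b then 1 else 0 := by
  rw [cnt_bw, cnt_wd]
  rw [← Finset.sum_filter_add_sum_filter_not ((Finset.range (2 * (k + 2 * s))).filter (fun x => x < g x)) (fun x => x < 2 * s)]
  congr 1
  · apply Finset.sum_congr_of_eq_on_inter
    · intro i hi hi'
      exfalso; apply hi'
      simp at hi ⊢
      exact ⟨⟨by omega, hE i hi⟩, hi⟩
    · intro i hi hi'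
      exfalso; apply hi'
      simp at hi ⊢
      exact hi.2
    · intro i hi _
      simp at hi
      simp [phi, hi]
  · rw [← Finset.sum_filter_of_ne (p := fun T : Fin (k + 2 * s) => hpi s (k + 2 * s) (k + 2 * s) g T ≠ none)]
    swap
    · intro T _ hT h0
      rw [h0] at hT; simp [lett] at hT
    have key : ∀ T : Fin (k + 2 * s), hpi s (k + 2 * s) (k + 2 * s) g T ≠ none ↔
        2 * ((T : ℕ) + s) < 2 * (k + 2 * s) ∧ 2 * s ≤ g (2 * (T + s)) := by
      intro T; unfold hpi; split_ifs with h <;> simp [h]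
      exact fun h1 => by
        by_contra h2
        exact h ⟨by omega, by omega⟩
    have hval : ∀ T : Fin (k + 2 * s), 2 * ((T : ℕ) + s) < 2 * (k + 2 * s) → 2 * s ≤ g (2 * (T + s)) →
        ∀ x, x = min (2 * ((T : ℕ) + s)) (g (2 * (T + s))) →
        (x = 2 * ((T : ℕ) + s) ∧ x < g x ∧ hpi s (k + 2 * s) (k + 2 * s) g T = some true ∧ phi s g x = 2 * ((T : ℕ) + s : ℤ)) ∨
        (g x = 2 * ((T : ℕ) + s) ∧ x < g x ∧ hpi s (k + 2 * s) (k + 2 * s) g T = some false ∧ phi s g x = 2 * ((T : ℕ) + s : ℤ) - 1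
          ∧ x < 2 * (k + 2 * s) ∧ x % 2 = 1) := by
      intro T h1 h2 x hx
      have par := hM.par h1
      have inv := hM.inv _ h1
      have hlt := hM.lt _ h1
      rcases lt_or_ge (2 * ((T : ℕ) + s)) (g (2 * (T + s))) with h3 | h3
      · left
        have e : x = 2 * ((T : ℕ) + s) := by rw [hx]; omega
        refine ⟨e, by rw [e]; exact h3, by simp [hpi, h3]; omega, ?_⟩
        rw [e]; unfold phi; rw [if_pos (by omega)]; push_cast; ring
      · right
        have e : x = g (2 * ((T : ℕ) + s)) := by rw [hx]; omega
        have e2 : g x = 2 * ((T : ℕ) + s) := by rw [e, inv]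
        refine ⟨e2, by omega, ?_, ?_, by omega, by omega⟩
        · unfold hpi; rw [if_pos ⟨h1, h2⟩]; simp; omega
        · unfold phi; rw [if_neg (by omega), e2]; push_cast; ring
    apply Finset.sum_bij (fun (T : Fin (k + 2 * s)) _ => min (2 * ((T : ℕ) + s)) (g (2 * (T + s))))
    · intro T hT
      simp only [Finset.mem_filter, Finset.mem_univ, true_and] at hT
      rw [key] at hT
      simp only [Finset.mem_filter, Finset.mem_range]
      rcases hval T hT.1 hT.2 _ rfl with h | h
      · exact ⟨⟨by omega, h.2.1⟩, by omega⟩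
      · exact ⟨⟨by omega, h.2.1⟩, by omega⟩
    · intro T hT T' hT' he
      simp only [Finset.mem_filter, Finset.mem_univ, true_and] at hT hT'
      rw [key] at hT hT'
      apply Fin.ext
      have h1 := hval T hT.1 hT.2 _ rfl
      have h2 := hval T' hT'.1 hT'.2 _ rfl
      rw [← he] at h2
      rcases h1 with h1 | h1 <;> rcases h2 with h2 | h2 <;> omega
    · intro x hx
      simp only [Finset.mem_filter, Finset.mem_range] at hx
      have par := hM.par hx.1.1
      have inv := hM.inv _ hx.1.1
      have hlt := hM.lt _ hx.1.1
      rcases Nat.mod_two_eq_zero_or_one x with h2 | h2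
      · have e : 2 * (x / 2 - s + s) = x := by omega
        refine ⟨⟨x / 2 - s, by omega⟩, ?_, ?_⟩
        · simp only [Finset.mem_filter, Finset.mem_univ, true_and]
          rw [key]
          simp only [e]
          omega
        · simp only [e]; omega
      · have e : 2 * (g x / 2 - s + s) = g x := by omega
        refine ⟨⟨g x / 2 - s, by omega⟩, ?_, ?_⟩
        · simp only [Finset.mem_filter, Finset.mem_univ, true_and]
          rw [key]
          simp only [e, inv]
          omega
        · simp only [e, inv]; omega
    · intro T hT
      simp only [Finset.mem_filter, Finset.mem_univ, true_and] at hT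
      rw [key] at hT
      rcases hval T hT.1 hT.2 _ rfl with h | h
      · rw [h.2.2.1, h.2.2.2]
        simp only [lett, cnt_cons, cnt_nil, add_zero]
        apply if_congr _ rfl rfl; omega
      · rw [h.2.2.1, h.2.2.2.1]
        simp only [lett, cnt_cons, cnt_nil, add_zero]
        apply if_congr _ rfl rfl; omega

lemma hpi_len {k s : ℕ} {g : ℕ → ℕ} (hM : IsM (k + 2 * s) g) (hE : ∀ i, i < 2 * s → i < g i) :
    (wd (hpi s (k + 2 * s) (k + 2 * s) g)).length = k := by
  set h := hpi s (k + 2 * s) (k + 2 * s) g with hh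
  have h1 := hpi_cnt hM hE (-1) (4 * (k + 2 * s) + 2 * s + 1)
  rw [← hh, cnt_all] at h1
  swap
  · intro x hx
    unfold bw at hx
    rw [pref_eq] at hx
    simp at hx
    rcases hx with ⟨a, ha, rfl⟩ | ⟨a, ha, rfl⟩
    · omega
    · have := wd_mem ha
      push_cast at this
      omega
  rw [bw_length] at h1
  have h2 := opw_length hM
  unfold opw at h2
  rw [List.length_map] at h2
  have h3 : ((Finset.range (2 * (k + 2 * s))).filter (fun x => x < g x)).card = k + 2 * s := by
    refine Eq.trans ?_ h2
    rw [← List.toFinset_card_of_nodup (List.Nodup.filter _ List.nodup_range)]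
    congr 1
    ext x; simp
  rw [Finset.sum_congr rfl (g := fun _ => 1)] at h1
  · simp only [Finset.sum_const, h3] at h1
    simp at h1
    omega
  · intro x hx
    simp only [Finset.mem_filter, Finset.mem_range] at hx
    have := hM.lt x hx.1
    unfold phi
    split_ifs <;> omega

lemma hpi_Cw {k s : ℕ} {g : ℕ → ℕ} (hM : IsM (k + 2 * s) g) (hE : ∀ i, i < 2 * s → i < g i) {R : Type*} [CommRing R] :
    (Cw u3 (k + 2 * s) g (bw s (hpi s (k + 2 * s) (k + 2 * s) g)) : R) = 1 := by
  apply Finset.prod_eq_one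
  intro x hx
  rw [Finset.mem_range] at hx
  split_ifs with hg
  · have e : se (bw s (hpi s (k + 2 * s) (k + 2 * s) g)) g x = 0 := by
      have h1 := se_eq hM (bw s (hpi s (k + 2 * s) (k + 2 * s) g)) hx hg
      have h2 := arc_op hM hx hg
      have h3 : cnt (bw s (hpi s (k + 2 * s) (k + 2 * s) g)) x (g x) = cnt (opw (k + 2 * s) g) x (g x) := by
        rw [hpi_cnt hM hE]
        unfold opw cnt
        rw [List.map_map]
        have e1 : (List.filter (fun k => decide (k < g k)) (List.range (2 * (k + 2 * s)))).toFinset =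
            (Finset.range (2 * (k + 2 * s))).filter (fun x => x < g x) := by ext x; simp
        rw [← e1, ← List.sum_toFinset _ (List.Nodup.filter _ List.nodup_range)]
        apply Finset.sum_congr rfl
        intro y hy
        rw [e1] at hy
        simp only [Finset.mem_filter, Finset.mem_range] at hy
        simp only [Function.comp]
        apply if_congr _ rfl rfl
        unfold phi
        split_ifs with hc
        · rfl
        · rcases lt_trichotomy x y with h | h | h
          · constructor
            · intro h'
              exact ⟨by omega, by omega⟩
            · intro h'
              have := hM.inside hx h (by omega)
              omega
          · subst h; omega
          · constructor
            · intro h'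
              rcases lt_or_ge x (g y) with h4 | h4
              · have := hM.inside hy.1 h h4
                omega
              · omega
            · omega
      omega
    rw [e]; exact u3_UW.zero
  · rfl

lemma h_unique {k s : ℕ} {g : ℕ → ℕ} (hM : IsM (k + 2 * s) g) (h : Fin (k + 2 * s) → Option Bool)
    (hl : (wd h).length = k) {R : Type*} [CommRing R] (hC : (Cw u3 (k + 2 * s) g (bw s h) : R) ≠ 0) :
    (∀ i, i < 2 * s → i < g i) ∧ h = hpi s (k + 2 * s) (k + 2 * s) g := by
  have hs := Cw_ne u3_UW hC
  have hlen : (bw s h).length = k + 2 * s := by rw [bw_length, hl]; omega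
  have hE : ∀ i, i < 2 * s → i < g i := by
    have h1 := (lemL_prefix hM _ hlen hs).2 (2 * s) (by omega)
    rw [cnt_bw] at h1
    rw [Finset.sum_congr rfl (g := fun _ => 1)] at h1
    swap
    · intro i hi; rw [Finset.mem_range] at hi; rw [if_pos]; omega
    have h2 := cnt_nonneg (wd h) (0 - 2 * s) (((2 * s : ℕ) : ℤ) - 2 * s)
    intro i hi
    by_contra hc
    have h3 : cnt (opw (k + 2 * s) g) 0 ((2 * s : ℕ) : ℤ) ≤ (2 * s : ℕ) - 1 := by
      have e : ∀ y : ℕ, y ≤ 2 * (k + 2 * s) → ∀ x : ℕ, x ≤ y → cnt (opw (k + 2 * s) g) (x : ℤ) y ≤ y - x := by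
        intro y
        induction y with
        | zero => intro _ x hx; rw [cnt_empty _ (by omega)]; omega
        | succ y ih =>
          intro hy x hx
          rcases Nat.lt_or_ge y x with h | h
          · rw [cnt_empty _ (by omega)]; omega
          · rw [← cnt_add _ (b := (y : ℤ)) (by omega) (by push_cast; omega)]
            have := ih (by omega) x h
            have h5 := opw_single (k + 2 * s) g y (by omega)
            push_cast
            rw [h5]; split_ifs <;> omega
      rw [← cnt_add _ (b := (i : ℤ)) (by omega) (by push_cast; omega),
        ← cnt_add _ (a := (i : ℤ)) (b := (i + 1 : ℤ)) (by omega) (by push_cast; omega), opw_single _ _ _ (by omega), if_neg hc]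
      have e1 := e i (by omega) 0 (by omega)
      have e2 := e (2 * s) (by omega) (i + 1) (by omega)
      push_cast at e1 e2 ⊢
      omega
    rw [Finset.sum_const, Finset.card_range, nsmul_eq_mul, mul_one] at h1
    omega
  refine ⟨hE, ?_⟩
  have hin : ∀ T, hpi s (k + 2 * s) (k + 2 * s) g T ≠ none → h T = hpi s (k + 2 * s) (k + 2 * s) g T := by
    intro T hT
    have hT2 : 2 * ((T : ℕ) + s) < 2 * (k + 2 * s) ∧ 2 * s ≤ g (2 * (T + s)) := by
      by_contra hc; apply hT; unfold hpi; rw [if_neg hc]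
    have par := hM.par hT2.1
    have inv := hM.inv _ hT2.1
    have hlt := hM.lt _ hT2.1
    unfold hpi
    rw [if_pos hT2]
    set e := 2 * ((T : ℕ) + s) with he
    rcases lt_or_ge e (g e) with h3 | h3
    · have h4 := lemL_se hM _ hs hT2.1 h3
      have h5 := se_eq hM (bw s h) hT2.1 h3
      rw [cnt_bw, Finset.sum_eq_zero, zero_add] at h5
      swap
      · intro i hi; rw [Finset.mem_range] at hi; rw [if_neg]; omega
      rw [← cnt_add _ (b := (e : ℤ) - 2 * s + 1) (by omega) (by omega)] at h5
      have h6 := cnt_wd_bd h (T + 1) ((g e - e - 1) / 2)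
      have e1 : (2 * ((T : ℕ) + 1 : ℤ) - 1) = (e : ℤ) - 2 * s + 1 := by push_cast [he]; ring
      have e2 : (2 * ((T : ℕ) + 1 + (((g e - e - 1) / 2 : ℕ) : ℤ)) - 1) = (g e : ℤ) - 2 * s := by omega
      rw [e1, e2] at h6
      have e3 : (e : ℤ) - 2 * s = 2 * (T : ℕ) := by push_cast [he]; ring
      rw [e3] at h5 h6
      obtain ⟨T', hT', hv⟩ := cnt_wd_even h (T : ℕ) (by omega)
      have : T' = T := by apply Fin.ext; exact_mod_cast hT'
      rw [← this, hv]; simp [h3]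
    · have h7 : g e < g (g e) := by rw [inv]; omega
      have h4 := lemL_se hM _ hs hlt h7
      have h5 := se_eq hM (bw s h) hlt h7
      rw [inv] at h5 h7
      rw [cnt_bw, Finset.sum_eq_zero, zero_add] at h5
      swap
      · intro i hi; rw [Finset.mem_range] at hi; rw [if_neg]; omega
      rw [← cnt_add _ (b := (e : ℤ) - 2 * s - 1) (by omega) (by omega)] at h5
      have h6 := cnt_wd_bd h (((g e : ℤ) - 2 * s + 1) / 2) ((e - g e - 1) / 2)
      have e1 : 2 * (((g e : ℤ) - 2 * s + 1) / 2) - 1 = (g e : ℤ) - 2 * s := by omega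
      have e2 : 2 * (((g e : ℤ) - 2 * s + 1) / 2 + (((e - g e - 1) / 2 : ℕ) : ℤ)) - 1 = (e : ℤ) - 2 * s - 1 := by omega
      rw [e1, e2] at h6
      have e3 : (e : ℤ) - 2 * s = 2 * (T : ℕ) := by push_cast [he]; ring
      rw [e3] at h5 h6
      obtain ⟨T', hT', hv⟩ := cnt_wd_odd h (T : ℕ) (by omega)
      have : T' = T := by apply Fin.ext; exact_mod_cast hT'
      rw [← this, hv]; simp; omega
  have c1 := length_wd h
  have c2 := length_wd (hpi s (k + 2 * s) (k + 2 * s) g)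
  rw [hpi_len hM hE] at c2
  rw [hl] at c1
  rw [c1] at c2
  funext T
  by_cases hT : hpi s (k + 2 * s) (k + 2 * s) g T = none
  · by_contra hne
    rw [hT] at hne
    have : (∑ T, if hpi s (k + 2 * s) (k + 2 * s) g T = none then (0 : ℤ) else 1) < ∑ T, if h T = none then (0 : ℤ) else 1 := by
      apply Finset.sum_lt_sum
      · intro T' _
        by_cases hT' : hpi s (k + 2 * s) (k + 2 * s) g T' = none
        · rw [if_pos hT']; split_ifs <;> simp
        · rw [if_neg hT', hin T' hT', if_neg hT']
      · exact ⟨T, Finset.mem_univ _, by rw [if_pos hT, if_neg hne]; simp⟩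
    omega
  · exact hin T hT

/-- The window sum is the indicator of the event that the first `2s` sites are openers. -/
theorem window_sum {k s : ℕ} (g : ℕ → ℕ) (hM : IsM (k + 2 * s) g) {R : Type*} [CommRing R] :
    (∑ h : Fin (k + 2 * s) → Option Bool, if (wd h).length = k then (Cw u3 (k + 2 * s) g (bw s h) : R) else 0) =
      if ∀ i, i < 2 * s → i < g i then 1 else 0 := by
  by_cases hE : ∀ i, i < 2 * s → i < g i
  · rw [if_pos hE, Finset.sum_eq_single (hpi s (k + 2 * s) (k + 2 * s) g)]
    · rw [if_pos (hpi_len hM hE), hpi_Cw hM hE]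
    · intro h _ hne
      split_ifs with hl
      · by_contra hC
        exact hne (h_unique hM h hl hC).2
      · rfl
    · intro h; exact absurd (Finset.mem_univ _) h
  · rw [if_neg hE]
    apply Finset.sum_eq_zero
    intro h _
    split_ifs with hl
    · by_contra hC
      exact hE (h_unique hM h hl hC).1
    · rfl

/-- window sum for the polynomial side -/
noncomputable def ZZ (R : Type*) [CommRing R] (m j k : ℕ) : R :=
  ∑ h : Fin m → Option Bool, if (wd h).length = k then AJ R j k (wd h) else 0

theorem ZZ_eq {k s : ℕ} {ψ : NCM (k + 2 * s) → ℂ} (hψ : ∀ l : List ℤ, l.Pairwise (· ≤ ·) → l.length = k + 2 * s →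
      AA (1 : ℂ) (k + 2 * s) l = ∑ π, Cw u3 (k + 2 * s) (NG π) l * ψ π) :
    ZZ ℂ (k + 2 * s) (2 * s) k = ∑ π, if ∀ i, i < 2 * s → i < NG π i then ψ π else 0 := by
  unfold ZZ
  have e : ∀ h : Fin (k + 2 * s) → Option Bool, (if (wd h).length = k then AJ ℂ (2 * s) k (wd h) else 0) =
      ∑ π, (if (wd h).length = k then (Cw u3 (k + 2 * s) (NG π) (bw s h) : ℂ) else 0) * ψ π := by
    intro h
    split_ifs with hl
    · have hlen : (bw s h).length = k + 2 * s := by rw [bw_length, hl]; omega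
      rw [← hψ _ (bw_sorted s h) hlen, AA_eq_AJ _ _ hlen]
      unfold bw
      rw [AJ_pref (2 * s) 0 k _ (by simp [hl]), List.map_map, zero_add]
      congr 1
      symm
      convert List.map_id _ using 2
      funext x; simp
    · simp
  rw [Finset.sum_congr rfl (fun h _ => e h), Finset.sum_comm]
  apply Finset.sum_congr rfl
  intro π _
  rw [← Finset.sum_mul, window_sum _ (NG_isM π)]
  split_ifs <;> simp

end LP

namespace LP

/-! ### Part M: from window words to strictly increasing exponents -/

section
variable {R : Type*} [CommRing R]

lemma cz_monomial_mul {k : ℕ} (e : Fin k → ℤ) (a : Fin k → ℕ) (P : MvPolynomial (Fin k) R) :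
    cz e ((∏ i, X i ^ a i) * P) = cz (fun i => e i - a i) P := by
  have h1 : (∏ i, X i ^ a i : MvPolynomial (Fin k) R) = monomial (Finsupp.equivFunOnFinite.symm a) 1 := by
    rw [monomial_eq, C_1, one_mul, Finsupp.prod_fintype _ _ (by simp)]
    rfl
  rw [h1]
  unfold cz
  rw [coeff_monomial_mul', one_mul]
  by_cases h : ∀ i, (0 : ℤ) ≤ e i - a i
  · have h' : ∀ i, 0 ≤ e i := fun i => by have := h i; omega
    rw [if_pos h', if_pos h, if_pos]
    · congr 1
      ext i
      have := h i
      simp [Finsupp.tsub_apply]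
    · intro i
      have := h i
      have := h' i
      simp
      omega
  · rw [if_neg h]
    split_ifs with h1 h2
    · exfalso
      apply h
      intro i
      have := h1 i
      have := h2 i
      simp at this
      omega
    · rfl
    · rfl

lemma cz_bool_sum {k : ℕ} (e : Fin k → ℤ) (P : MvPolynomial (Fin k) R) :
    ∑ ε : Fin k → Bool, cz (fun i => e i - if ε i then 0 else 1) P = cz e ((∏ i, (1 + X i)) * P) := by
  have h : (∏ i, (1 + X i) : MvPolynomial (Fin k) R) = ∑ ε : Fin k → Bool, ∏ i, X i ^ (if ε i then 0 else 1) := by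
    have h2 : ∀ i : Fin k, (1 + X i : MvPolynomial (Fin k) R) = ∑ b : Bool, X i ^ (if b then 0 else 1) := by
      intro i; simp
    simp_rw [h2]
    rw [Finset.prod_univ_sum, Fintype.piFinset_univ]
  rw [h, Finset.sum_mul, cz_sum]
  apply Finset.sum_congr rfl
  intro ε _
  rw [cz_monomial_mul]
  congr 1
  funext i
  split_ifs <;> simp

end

lemma mem_wd {m : ℕ} {h : Fin m → Option Bool} {x : ℤ} : x ∈ wd h ↔ ∃ T : Fin m, x ∈ lett T (h T) := by
  unfold wd
  simp [List.mem_flatten, List.mem_ofFn]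

lemma wd_ssorted {m : ℕ} (h : Fin m → Option Bool) : (wd h).Pairwise (· < ·) := by
  unfold wd
  rw [List.pairwise_flatten]
  constructor
  · intro l hl
    rw [List.mem_ofFn] at hl
    obtain ⟨T, rfl⟩ := hl
    rcases hT : h T with _ | _ | _ <;> simp [lett]
  · rw [List.pairwise_ofFn]
    intro i j hij x hx y hy
    have := lett_mem hx
    have := lett_mem hy
    have : (i : ℕ) < j := hij
    omega

/-- the letter choice attached to positions and signs -/
noncomputable def hh {k m : ℕ} (T : Fin k → Fin m) (ε : Fin k → Bool) (x : Fin m) : Option Bool :=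
  if h : ∃ i, T i = x then some (ε h.choose) else none

lemma hh_apply {k m : ℕ} {T : Fin k → Fin m} (hT : StrictMono T) (ε : Fin k → Bool) (i : Fin k) :
    hh T ε (T i) = some (ε i) := by
  have h : ∃ j, T j = T i := ⟨i, rfl⟩
  unfold hh
  rw [dif_pos h, hT.injective h.choose_spec]

lemma wd_hh {k m : ℕ} {T : Fin k → Fin m} (hT : StrictMono T) (ε : Fin k → Bool) :
    wd (hh T ε) = List.ofFn (fun i => 2 * ((T i : ℕ) : ℤ) - if ε i then 0 else 1) := by
  apply sorted_ext (wd_ssorted _)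
  · rw [List.pairwise_ofFn]
    intro i j hij
    have : (T i : ℕ) < T j := hT hij
    split_ifs <;> omega
  · intro x
    rw [mem_wd, List.mem_ofFn]
    constructor
    · rintro ⟨y, hy⟩
      by_cases h : ∃ i, T i = y
      · obtain ⟨i, rfl⟩ := h
        rw [hh_apply hT] at hy
        refine ⟨i, ?_⟩
        rcases hε : ε i with _ | _ <;> rw [hε] at hy <;> simp [lett] at hy ⊢ <;> omega
      · unfold hh at hy
        rw [dif_neg h] at hy
        simp [lett] at hy
    · rintro ⟨i, rfl⟩
      refine ⟨T i, ?_⟩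
      rw [hh_apply hT]
      rcases hε : ε i with _ | _ <;> simp [lett]

theorem ZZ_mono (R : Type*) [CommRing R] (m j k : ℕ) :
    ZZ R m j k = ∑ T : Fin k → Fin m, if StrictMono T then
      cz (fun i => 2 * ((T i : ℕ) : ℤ)) ((∏ i, (1 + X i) ^ (j + 1)) * PP (1 : R) k) else 0 := by
  have e1 : ∀ T : Fin k → Fin m, cz (fun i => 2 * ((T i : ℕ) : ℤ)) ((∏ i, (1 + X i) ^ (j + 1)) * PP (1 : R) k) =
      ∑ ε : Fin k → Bool, cz (fun i => 2 * ((T i : ℕ) : ℤ) - if ε i then 0 else 1) ((∏ i, (1 + X i) ^ j) * PP (1 : R) k) := by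
    intro T
    rw [cz_bool_sum, ← mul_assoc, ← Finset.prod_mul_distrib]
    simp_rw [pow_succ']
  simp_rw [e1]
  unfold ZZ
  rw [← Finset.sum_filter, ← Finset.sum_filter, ← Finset.sum_product']
  symm
  refine Finset.sum_bij (fun p _ => hh p.1 p.2) ?_ ?_ ?_ ?_
  · rintro ⟨T, ε⟩ hp
    simp only [Finset.mem_product, Finset.mem_filter, Finset.mem_univ, true_and, and_true] at hp ⊢
    rw [wd_hh hp]; simp
  · rintro ⟨T, ε⟩ hp ⟨T', ε'⟩ hp' heq
    simp only [Finset.mem_product, Finset.mem_filter, Finset.mem_univ, true_and, and_true] at hp hp' heq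
    have hr : Set.range T = Set.range T' := by
      ext x
      have : (hh T ε x).isSome = (hh T' ε' x).isSome := by rw [heq]
      have h1 : ∀ (T : Fin k → Fin m) ε, (hh T ε x).isSome = true ↔ x ∈ Set.range T := by
        intro T ε
        unfold hh
        split_ifs with h
        · simpa using h
        · simpa using h
      rw [← h1 T ε, ← h1 T' ε', this]
    have hT : T = T' := (StrictMono.range_inj hp hp').1 hr
    subst hT
    congr 1
    funext i
    have : hh T ε (T i) = hh T ε' (T i) := by rw [heq]
    rw [hh_apply hp, hh_apply hp] at this
    simpa using this
  · intro h hl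
    simp only [Finset.mem_filter, Finset.mem_univ, true_and] at hl
    have hc : (Finset.univ.filter (fun x => h x ≠ none)).card = k := by
      have := length_wd h
      rw [hl] at this
      have e : ∀ T, (if h T = none then (0 : ℤ) else 1) = if h T ≠ none then 1 else 0 := by
        intro T; split_ifs <;> simp_all
      simp_rw [e] at this
      rw [Finset.sum_boole] at this
      exact_mod_cast this.symm
    set S := Finset.univ.filter (fun x => h x ≠ none) with hS
    refine ⟨⟨S.orderEmbOfFin hc, fun i => (h (S.orderEmbOfFin hc i)).getD true⟩, ?_, ?_⟩
    · simp only [Finset.mem_product, Finset.mem_filter, Finset.mem_univ, true_and, and_true]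
      exact (S.orderEmbOfFin hc).strictMono
    · simp only
      funext x
      by_cases hx : x ∈ S
      · have : x ∈ Set.range (S.orderEmbOfFin hc) := by rw [Finset.range_orderEmbOfFin]; exact hx
        obtain ⟨i, rfl⟩ := this
        rw [hh_apply (S.orderEmbOfFin hc).strictMono]
        have : h (S.orderEmbOfFin hc i) ≠ none := (Finset.mem_filter.1 hx).2
        rcases hy : h (S.orderEmbOfFin hc i) with _ | b
        · exact absurd hy this
        · simp
      · unfold hh
        rw [dif_neg]
        · have : ¬ (h x ≠ none) := by simpa [hS] using hx
          push Not at this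
          exact this.symm
        · rintro ⟨i, rfl⟩
          exact hx (Finset.orderEmbOfFin_mem _ _ _)
  · rintro ⟨T, ε⟩ hp
    simp only [Finset.mem_product, Finset.mem_filter, Finset.mem_univ, true_and, and_true] at hp
    simp only
    unfold AJ
    rw [wd_hh hp]
    congr 1
    funext i
    simp [List.getD_eq_getElem?_getD]

end LP

namespace LP

/-! ### Part N: an antisymmetrisation identity in a field -/

lemma pp_perm {R : Type*} [CommRing R] {k : ℕ} (F : Fin k → Fin k → R) (hF : ∀ i j, F i j = - F j i) (σ : Equiv.Perm (Fin k)) :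
    pp k (fun i j => F (σ i) (σ j)) = ((Equiv.Perm.sign σ : ℤ) : R) * pp k F := by
  rcases k with _ | k
  · have : σ = 1 := Subsingleton.elim _ _
    subst this; simp
  have hσ : σ ∈ Submonoid.closure (Set.range fun i : Fin k => Equiv.swap i.castSucc i.succ) := by
    rw [Equiv.Perm.mclosure_swap_castSucc_succ]; trivial
  induction hσ using Submonoid.closure_induction generalizing F with
  | mem x hx =>
    obtain ⟨i, rfl⟩ := hx
    obtain ⟨E, h1, h2⟩ := pp_swap (k + 1) F i.castSucc i.succ (by simp)
    simp only
    rw [h1, h2, Equiv.Perm.sign_swap (by simp [Fin.ext_iff]), hF]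
    simp
  | one => simp
  | mul x y hx hy ihx ihy =>
    have := ihy (fun i j => F (x i) (x j)) (fun i j => hF _ _)
    simp only [Equiv.Perm.mul_apply]
    rw [this, ihx F hF, Equiv.Perm.sign_mul]
    push_cast; ring

lemma prod_swap_succ {R : Type*} [CommMonoid R] {k : ℕ} (p : Fin (k + 1)) (φ : Fin (k + 1) → R) :
    ∏ l : Fin k, φ (Equiv.swap 0 p l.succ) = ∏ l ∈ Finset.univ.erase p, φ l := by
  have : (Finset.univ.erase p : Finset (Fin (k + 1))) =
      Finset.univ.image (fun l : Fin k => Equiv.swap 0 p l.succ) := by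
    ext x
    simp only [Finset.mem_erase, Finset.mem_univ, and_true, Finset.mem_image, true_and]
    constructor
    · intro hx
      have : Equiv.swap 0 p x ≠ 0 := by
        intro h
        apply hx
        have := congrArg (Equiv.swap 0 p) h
        simpa using this
      obtain ⟨l, hl⟩ := Fin.exists_succ_eq.2 this
      exact ⟨l, by rw [hl]; simp⟩
    · rintro ⟨l, rfl⟩ h
      have := congrArg (Equiv.swap 0 p) h
      simp at this
  rw [this, Finset.prod_image]
  intro a _ b _ hab
  simpa using hab

lemma sum_perm_succ {R : Type*} [CommRing R] {k : ℕ} (G : Equiv.Perm (Fin (k + 1)) → R) :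
    ∑ σ, G σ = ∑ p : Fin (k + 1), ∑ e : Equiv.Perm (Fin k), G (Equiv.Perm.decomposeFin.symm (p, e)) := by
  rw [← Equiv.sum_comp Equiv.Perm.decomposeFin.symm, Fintype.sum_prod_type]

theorem asym_ind {F : Type*} [Field F] (c : F → F) (g h α : F → F → F) (anti : ∀ x y, h x y = - h y x)
    (G : ∀ k, (Fin k → F) → F) (hG0 : ∀ v, G 0 v = 1)
    (hG : ∀ k v, G (k + 1) v = α (v 0) (∏ i, v i) * (∏ l : Fin k, g (v 0) (v l.succ)) * G k (fun i => v i.succ))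
    (Good : ∀ k, (Fin k → F) → Prop)
    (good_sub : ∀ k (u : Fin (k + 1) → F) (ι : Fin k → Fin (k + 1)), Function.Injective ι → Good (k + 1) u → Good k (fun i => u (ι i)))
    (hc : ∀ k u, Good k u → ∀ i, c (u i) ≠ 0)
    (hh : ∀ k u, Good k u → ∀ i j, i ≠ j → h (u i) (u j) ≠ 0)
    (hI : ∀ k u, Good (k + 1) u → ∑ p, α (u p) (∏ i, u i) * (c (u p))⁻¹ *
      ∏ l ∈ Finset.univ.erase p, (g (u p) (u l) / h (u p) (u l)) = 1) :
    ∀ k u, Good k u → ∑ σ : Equiv.Perm (Fin k), ((Equiv.Perm.sign σ : ℤ) : F) * G k (fun i => u (σ i)) =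
      (∏ i, c (u i)) * pp k (fun i j => h (u i) (u j)) := by
  intro k
  induction k with
  | zero => intro u _; simp [hG0, pp]
  | succ k ih =>
    intro u hu
    rw [sum_perm_succ]
    set CC := (∏ i, c (u i)) * pp (k + 1) (fun i j => h (u i) (u j)) with hCC
    have key : ∀ p : Fin (k + 1), ∑ e : Equiv.Perm (Fin k),
        ((Equiv.Perm.sign (Equiv.Perm.decomposeFin.symm (p, e)) : ℤ) : F) *
          G (k + 1) (fun i => u (Equiv.Perm.decomposeFin.symm (p, e) i)) =
        CC * (α (u p) (∏ i, u i) * (c (u p))⁻¹ *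
          ∏ l ∈ Finset.univ.erase p, (g (u p) (u l) / h (u p) (u l))) := by
      intro p
      have ihp := ih (fun i => u (Equiv.swap 0 p i.succ))
        (good_sub k u (fun i => Equiv.swap 0 p i.succ) (fun a b hab => by simpa using hab) hu)
      have e1 : ∀ e : Equiv.Perm (Fin k), ((Equiv.Perm.sign (Equiv.Perm.decomposeFin.symm (p, e)) : ℤ) : F) *
          G (k + 1) (fun i => u (Equiv.Perm.decomposeFin.symm (p, e) i)) =
          ((if p = 0 then 1 else -1) * α (u p) (∏ i, u i) * ∏ l ∈ Finset.univ.erase p, g (u p) (u l)) *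
          (((Equiv.Perm.sign e : ℤ) : F) * G k (fun i => u (Equiv.swap 0 p (e i).succ))) := by
        intro e
        rw [hG, Equiv.Perm.decomposeFin.symm_sign]
        rw [Equiv.prod_comp (Equiv.Perm.decomposeFin.symm (p, e)) u]
        simp only [Equiv.Perm.decomposeFin_symm_apply_zero, Equiv.Perm.decomposeFin_symm_apply_succ]
        rw [Equiv.prod_comp e (fun l => g (u p) (u (Equiv.swap 0 p l.succ))),
          prod_swap_succ p (fun l => g (u p) (u l))]
        push_cast
        split_ifs <;> push_cast <;> ring
      rw [Finset.sum_congr rfl (fun e _ => e1 e), ← Finset.mul_sum, ihp]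
      have e2 : CC = (if p = 0 then 1 else -1) * ((c (u p) * ∏ l ∈ Finset.univ.erase p, h (u p) (u l)) *
          ((∏ i : Fin k, c (u (Equiv.swap 0 p i.succ))) *
            pp k (fun i j => h (u (Equiv.swap 0 p i.succ)) (u (Equiv.swap 0 p j.succ))))) := by
        have h1 := pp_perm (fun i j => h (u i) (u j)) (fun i j => anti _ _) (Equiv.swap 0 p)
        rw [pp_succ] at h1
        simp only [Equiv.swap_apply_left] at h1
        rw [prod_swap_succ p (fun l => h (u p) (u l))] at h1
        rw [prod_swap_succ p (fun l => c (u l)), hCC, ← Finset.mul_prod_erase _ _ (Finset.mem_univ p)]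
        have h2 : ((Equiv.Perm.sign (Equiv.swap 0 p) : ℤ) : F) = (if p = 0 then 1 else -1) := by
          by_cases hp : p = 0
          · subst hp; simp
          · rw [Equiv.Perm.sign_swap (Ne.symm hp), if_neg hp]; simp
        rw [h2] at h1
        split_ifs at h1 ⊢ with hp
        · rw [one_mul] at h1 ⊢
          rw [← h1]; ring
        · have : pp (k + 1) (fun i j => h (u i) (u j)) = - (-1 * pp (k + 1) (fun i j => h (u i) (u j))) := by ring
          rw [this, ← h1]; ring
      rw [e2, Finset.prod_div_distrib]
      have n1 := hc _ u hu p
      have n2 : ∏ l ∈ Finset.univ.erase p, h (u p) (u l) ≠ 0 := by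
        apply Finset.prod_ne_zero_iff.2
        intro l hl
        exact hh _ u hu _ _ (Finset.ne_of_mem_erase hl).symm
      field_simp
    rw [Finset.sum_congr rfl (fun p _ => key p), ← Finset.mul_sum, hI k u hu, mul_one]

theorem lag_sum {F : Type*} [Field F] (k : ℕ) (t s : Fin k → F) (ht : Function.Injective t) (ht1 : ∀ i, t i + 1 ≠ 0) :
    ∑ p, (t p - s p) / (t p + 1) * ∏ l ∈ Finset.univ.erase p, ((t p - s l) / (t p - t l)) =
      1 - ∏ l, ((1 + s l) / (1 + t l)) := by
  classical
  set v : Option (Fin k) → F := fun o => o.elim (-1) t with hv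
  have hinj : Function.Injective v := by
    intro a b hab
    rcases a with _ | a <;> rcases b with _ | b
    · rfl
    · exfalso; apply ht1 b; simp [hv] at hab; rw [← hab]; ring
    · exfalso; apply ht1 a; simp [hv] at hab; rw [hab]; ring
    · simp [hv] at hab; rw [ht hab]
  set Q : Polynomial F := ∏ l, (Polynomial.X - Polynomial.C (s l)) with hQ
  have hmon : Q.Monic := Polynomial.monic_prod_of_monic _ _ (fun i _ => Polynomial.monic_X_sub_C _)
  have hdeg : Q.natDegree = k := by
    rw [hQ, Polynomial.natDegree_prod_of_monic _ _ (fun i _ => Polynomial.monic_X_sub_C _)]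
    simp
  have hev : ∀ x, Q.eval x = ∏ l, (x - s l) := by
    intro x; rw [hQ, Polynomial.eval_prod]; simp
  have hL := Lagrange.coeff_eq_sum (s := (Finset.univ : Finset (Option (Fin k)))) (v := v) hinj.injOn (P := Q)
    (by
      rw [Polynomial.degree_eq_natDegree hmon.ne_zero, hdeg]
      simp only [Finset.card_univ, Fintype.card_option, Fintype.card_fin]
      norm_cast; omega)
  have hc1 : Q.coeff ((Finset.univ : Finset (Option (Fin k))).card - 1) = 1 := by
    simp only [Finset.card_univ, Fintype.card_option, Fintype.card_fin, Nat.add_sub_cancel]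
    have := hmon.coeff_natDegree
    rwa [hdeg] at this
  rw [hc1, Fintype.sum_option] at hL
  have d0 : ∏ j ∈ Finset.univ.erase (none : Option (Fin k)), (v none - v j) = ∏ l, (-1 - t l) := by
    have : (Finset.univ.erase (none : Option (Fin k))) = Finset.univ.image some := by
      ext x; rcases x with _ | x <;> simp
    rw [this, Finset.prod_image (by intro a _ b _ h; simpa using h)]
    rfl
  have d1 : ∀ p : Fin k, ∏ j ∈ Finset.univ.erase (some p), (v (some p) - v j) =
      (t p + 1) * ∏ l ∈ Finset.univ.erase p, (t p - t l) := by
    intro p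
    have : (Finset.univ.erase (some p)) = insert none ((Finset.univ.erase p).image some) := by
      ext x; rcases x with _ | x <;> simp
    rw [this, Finset.prod_insert (by simp), Finset.prod_image (by intro a _ b _ h; simpa using h)]
    simp [hv]
  rw [d0] at hL
  simp only [d1] at hL
  rw [hev] at hL
  simp only [hev] at hL
  have e0 : (∏ l, (v none - s l)) / ∏ l, (-1 - t l) = ∏ l, ((1 + s l) / (1 + t l)) := by
    rw [← Finset.prod_div_distrib]
    apply Finset.prod_congr rfl
    intro l _
    have : v none - s l = -(1 + s l) := by simp [hv]; ring
    rw [this, show -1 - t l = -(1 + t l) by ring, neg_div_neg_eq]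
  have e1 : ∀ p : Fin k, (∏ l, (v (some p) - s l)) / ((t p + 1) * ∏ l ∈ Finset.univ.erase p, (t p - t l)) =
      (t p - s p) / (t p + 1) * ∏ l ∈ Finset.univ.erase p, ((t p - s l) / (t p - t l)) := by
    intro p
    rw [← Finset.mul_prod_erase _ _ (Finset.mem_univ p), Finset.prod_div_distrib, mul_div_mul_comm]
    rfl
  rw [e0, Finset.sum_congr rfl (fun p _ => e1 p)] at hL
  linear_combination -hL

/-- the geometric-type rational function -/
noncomputable def BF {F : Type*} [Field F] (d : ℕ) : ∀ k, (Fin k → F) → F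
  | 0, _ => 1
  | k + 1, v => (∏ i : Fin k, v i.succ) ^ d / (1 - (∏ i, v i) ^ d) * BF d k (fun i => v i.succ)

/-- genericity of a tuple -/
structure Gen {F : Type*} [Field F] (k : ℕ) (u : Fin k → F) : Prop where
  ne0 : ∀ i, u i ≠ 0
  ne1 : ∀ i, 1 + u i ≠ 0
  ne3 : ∀ i, 1 + u i + u i ^ 2 ≠ 0
  inj : ∀ i j, i ≠ j → u j - u i ≠ 0
  nes : ∀ i j, i ≠ j → u i + u j + u i * u j ≠ 0
  prd : ∀ m (ι : Fin (m + 1) → Fin k), Function.Injective ι → 1 - (∏ i, u (ι i)) ^ 2 ≠ 0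

lemma Gen.sub {F : Type*} [Field F] {k m : ℕ} {u : Fin k → F} (h : Gen k u) {ι : Fin m → Fin k} (hi : Function.Injective ι) :
    Gen m (fun i => u (ι i)) where
  ne0 _ := h.ne0 _
  ne1 _ := h.ne1 _
  ne3 _ := h.ne3 _
  inj _ _ hij := h.inj _ _ (hi.ne hij)
  nes _ _ hij := h.nes _ _ (hi.ne hij)
  prd m κ hκ := h.prd m (fun i => ι (κ i)) (hi.comp hκ)

lemma Gen.n1 {F : Type*} [Field F] {k : ℕ} {u : Fin k → F} (h : Gen k u) (i : Fin k) : 1 - u i ≠ 0 := by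
  intro h1
  apply h.prd 0 (fun _ => i) (fun a b _ => by apply Fin.ext; omega)
  have : u i = 1 := by linear_combination -h1
  simp [this]

lemma Gen.n2 {F : Type*} [Field F] {k : ℕ} {u : Fin k → F} (h : Gen k u) (i j : Fin k) (hij : i ≠ j) : 1 - u i * u j ≠ 0 := by
  intro h1
  apply h.prd 1 ![i, j]
  · intro a b hab
    fin_cases a <;> fin_cases b <;> simp_all
  · rw [Fin.prod_univ_two]
    simp
    linear_combination (1 + u i * u j) * h1

lemma Gen.pr {F : Type*} [Field F] {k : ℕ} {u : Fin (k + 1) → F} (h : Gen (k + 1) u) : 1 - (∏ i, u i) ^ 2 ≠ 0 :=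
  h.prd k id Function.injective_id

lemma Gen.pr1 {F : Type*} [Field F] {k : ℕ} {u : Fin (k + 1) → F} (h : Gen (k + 1) u) : 1 - (∏ i, u i) ≠ 0 := by
  intro h1
  apply h.pr
  linear_combination (1 + ∏ i, u i) * h1

theorem asymB {F : Type*} [Field F] (k : ℕ) (u : Fin k → F) (hu : Gen k u) :
    ∑ σ : Equiv.Perm (Fin k), ((Equiv.Perm.sign σ : ℤ) : F) * BF 1 k (fun i => u (σ i)) =
      (∏ i, (1 - u i)⁻¹) * pp k (fun i j => (u j - u i) / (1 - u i * u j)) := by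
  refine asym_ind (fun x => (1 - x)⁻¹) (fun x y => y) (fun x y => (y - x) / (1 - x * y)) (fun x P => (1 - P)⁻¹)
    ?_ (BF 1) (fun _ => rfl) ?_ Gen ?_ ?_ ?_ ?_ k u hu
  · intro x y
    rw [mul_comm y x, ← neg_div]; congr 1; ring
  · intro k v
    rw [BF, pow_one, pow_one]
    rw [div_eq_mul_inv, mul_comm (∏ i : Fin k, v i.succ)]
  · intro k u ι hι hg
    exact hg.sub hι
  · intro k u hg i
    exact inv_ne_zero (hg.n1 i)
  · intro k u hg i j hij
    exact div_ne_zero (hg.inj i j hij) (hg.n2 i j hij)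
  · intro k u hg
    have hL := lag_sum (k + 1) (fun i => (u i)⁻¹) u (fun i j hij => by
        by_contra h
        exact hg.inj i j h (by rw [inv_inj.1 hij]; ring)) (fun i => by
        have := hg.ne0 i
        have := hg.ne1 i
        field_simp
        exact div_ne_zero (hg.ne1 i) (hg.ne0 i))
    have e : ∏ l, ((1 + u l) / (1 + (u l)⁻¹)) = ∏ l, u l := by
      apply Finset.prod_congr rfl
      intro l _
      have := hg.ne0 l
      have := hg.ne1 l
      have h3 : u l + 1 ≠ 0 := by rwa [add_comm]
      field_simp
      ring
    rw [e] at hL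
    have hP := hg.pr1
    have : ∀ p, (1 - ∏ i, u i)⁻¹ * ((1 - u p)⁻¹)⁻¹ * ∏ l ∈ Finset.univ.erase p, (u l / ((u l - u p) / (1 - u p * u l))) =
        (1 - ∏ i, u i)⁻¹ * (((u p)⁻¹ - u p) / ((u p)⁻¹ + 1) * ∏ l ∈ Finset.univ.erase p, (((u p)⁻¹ - u l) / ((u p)⁻¹ - (u l)⁻¹))) := by
      intro p
      rw [mul_assoc]
      congr 1
      congr 1
      · have := hg.ne0 p
        have := hg.ne1 p
        have h3 : u p + 1 ≠ 0 := by rwa [add_comm]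
        rw [inv_inv]
        field_simp
        ring
      · apply Finset.prod_congr rfl
        intro l hl
        have hlp := Finset.ne_of_mem_erase hl
        have h1 := hg.ne0 p
        have h2 := hg.ne0 l
        have h3 := hg.inj p l hlp.symm
        have h4 := hg.n2 p l hlp.symm
        have h5 : (u p)⁻¹ - (u l)⁻¹ = (u l - u p) / (u p * u l) := by field_simp
        rw [h5]
        field_simp
    simp only [this]
    rw [← Finset.mul_sum, hL, inv_mul_cancel₀ hP]

/-- the weight -/
noncomputable def AG {F : Type*} [Field F] (k : ℕ) (v : Fin k → F) : F :=
  (∏ i, (1 + v i)) * pp k (fun i j => 1 + v i + v i * v j) * BF 2 k v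

theorem asymA {F : Type*} [Field F] (k : ℕ) (u : Fin k → F) (hu : Gen k u) :
    ∑ σ : Equiv.Perm (Fin k), ((Equiv.Perm.sign σ : ℤ) : F) * AG k (fun i => u (σ i)) =
      (∏ i, (1 - u i)⁻¹) * pp k (fun i j => (u j - u i) / (1 - u i * u j) * (u i + u j + u i * u j)) := by
  refine asym_ind (fun x => (1 - x)⁻¹) (fun x y => (1 + x + x * y) * y ^ 2)
    (fun x y => (y - x) / (1 - x * y) * (x + y + x * y)) (fun x P => (1 + x) * (1 - P ^ 2)⁻¹)
    ?_ AG ?_ ?_ Gen ?_ ?_ ?_ ?_ k u hu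
  · intro x y
    have : (y - x) / (1 - x * y) = - ((x - y) / (1 - y * x)) := by
      rw [mul_comm y x, ← neg_div]; congr 1; ring
    rw [this]; ring
  · intro v
    simp [AG, pp, BF]
  · intro k v
    unfold AG
    rw [BF, pp_succ, Fin.prod_univ_succ (fun i => 1 + v i), Finset.prod_mul_distrib, Finset.prod_pow, div_eq_mul_inv]
    ring
  · intro k u ι hι hg
    exact hg.sub hι
  · intro k u hg i
    exact inv_ne_zero (hg.n1 i)
  · intro k u hg i j hij
    exact mul_ne_zero (div_ne_zero (hg.inj i j hij) (hg.n2 i j hij)) (hg.nes i j hij)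
  · intro k u hg
    have tinj : ∀ p l, p ≠ l → (1 + u p) / u p ^ 2 - (1 + u l) / u l ^ 2 =
        (u l - u p) * (u p + u l + u p * u l) / (u p ^ 2 * u l ^ 2) := by
      intro p l hlp
      have h1 := hg.ne0 p
      have h2 := hg.ne0 l
      field_simp
      ring
    have tne : ∀ i, (1 + u i) / u i ^ 2 + 1 = (1 + u i + u i ^ 2) / u i ^ 2 := by
      intro i
      have h1 := hg.ne0 i
      field_simp
    have hL := lag_sum (k + 1) (fun i => (1 + u i) / u i ^ 2) (fun i => u i + u i ^ 2) (fun i j hij => by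
        by_contra h
        have h2 := tinj i j h
        simp only at hij
        rw [hij, sub_self] at h2
        exact (div_ne_zero (mul_ne_zero (hg.inj i j h) (hg.nes i j h))
          (mul_ne_zero (pow_ne_zero 2 (hg.ne0 i)) (pow_ne_zero 2 (hg.ne0 j)))) h2.symm) (fun i => by
        rw [tne]
        exact div_ne_zero (hg.ne3 i) (pow_ne_zero 2 (hg.ne0 i)))
    have e : ∏ l, ((1 + (u l + u l ^ 2)) / (1 + (1 + u l) / u l ^ 2)) = (∏ l, u l) ^ 2 := by
      rw [← Finset.prod_pow]
      apply Finset.prod_congr rfl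
      intro l _
      have h0 := hg.ne0 l
      have h3 := hg.ne3 l
      rw [add_comm 1 ((1 + u l) / u l ^ 2), tne, ← add_assoc]
      field_simp
    rw [e] at hL
    have hP := hg.pr
    have : ∀ p, (1 + u p) * (1 - (∏ i, u i) ^ 2)⁻¹ * ((1 - u p)⁻¹)⁻¹ *
        ∏ l ∈ Finset.univ.erase p, ((1 + u p + u p * u l) * u l ^ 2 / ((u l - u p) / (1 - u p * u l) * (u p + u l + u p * u l))) =
        (1 - (∏ i, u i) ^ 2)⁻¹ * (((1 + u p) / u p ^ 2 - (u p + u p ^ 2)) / ((1 + u p) / u p ^ 2 + 1) *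
          ∏ l ∈ Finset.univ.erase p, (((1 + u p) / u p ^ 2 - (u l + u l ^ 2)) / ((1 + u p) / u p ^ 2 - (1 + u l) / u l ^ 2))) := by
      intro p
      have e1 : ((1 + u p) / u p ^ 2 - (u p + u p ^ 2)) / ((1 + u p) / u p ^ 2 + 1) = (1 + u p) * (1 - u p) := by
        have h0 := hg.ne0 p
        have h3 := hg.ne3 p
        rw [tne]
        field_simp
        ring
      rw [e1, inv_inv]
      have e2 : ∏ l ∈ Finset.univ.erase p, ((1 + u p + u p * u l) * u l ^ 2 / ((u l - u p) / (1 - u p * u l) * (u p + u l + u p * u l))) =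
         ∏ l ∈ Finset.univ.erase p, (((1 + u p) / u p ^ 2 - (u l + u l ^ 2)) / ((1 + u p) / u p ^ 2 - (1 + u l) / u l ^ 2)) := by
        apply Finset.prod_congr rfl
        intro l hl
        have hlp := Finset.ne_of_mem_erase hl
        have h1 := hg.ne0 p
        have h2 := hg.ne0 l
        have h3 := hg.inj p l hlp.symm
        have h4 := hg.n2 p l hlp.symm
        have h5 := hg.nes p l hlp.symm
        rw [tinj p l hlp.symm]
        field_simp
        ring
      rw [e2]
      ring
    simp only [this]
    rw [← Finset.mul_sum, hL, inv_mul_cancel₀ hP]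

theorem asym_eq {F : Type*} [Field F] (k : ℕ) (u : Fin k → F) (hu : Gen k u) :
    ∑ σ : Equiv.Perm (Fin k), ((Equiv.Perm.sign σ : ℤ) : F) * AG k (fun i => u (σ i)) =
      pp k (fun i j => u i + u j + u i * u j) *
      ∑ σ : Equiv.Perm (Fin k), ((Equiv.Perm.sign σ : ℤ) : F) * BF 1 k (fun i => u (σ i)) := by
  rw [asymA k u hu, asymB k u hu, pp_mul]
  ring

end LP

namespace LP

/-! ### Part O: power series -/

/-- indicator of strictly increasing sequences of multiples of `d`, along `ι` -/
def WC {j k : ℕ} (d : ℕ) (ι : Fin j → Fin k) (e : Fin k → ℕ) : Prop :=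
  (∀ x, x ∉ Set.range ι → e x = 0) ∧ (∀ a b, a < b → e (ι a) < e (ι b)) ∧ ∀ i, d ∣ e (ι i)

/-- generating function -/
noncomputable def WW {j k : ℕ} (d : ℕ) (ι : Fin j → Fin k) : MvPowerSeries (Fin k) ℂ :=
  fun e => if WC d ι e then 1 else 0

lemma coeff_WW {j k : ℕ} (d : ℕ) (ι : Fin j → Fin k) (e : Fin k →₀ ℕ) :
    MvPowerSeries.coeff e (WW d ι) = if WC d ι e then 1 else 0 := rfl

/-- exponent vector supported on a range -/
noncomputable def mm {j k : ℕ} (d : ℕ) (ι : Fin j → Fin k) : Fin k →₀ ℕ :=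
  Finsupp.equivFunOnFinite.symm (fun x => if x ∈ Set.range ι then d else 0)

lemma prodX_eq {j k : ℕ} (d : ℕ) (ι : Fin j → Fin k) (hι : Function.Injective ι) :
    ((∏ i, MvPowerSeries.X (ι i)) ^ d : MvPowerSeries (Fin k) ℂ) = MvPowerSeries.monomial (mm d ι) 1 := by
  have h1 : ((∏ i, X (ι i)) ^ d : MvPolynomial (Fin k) ℂ) = monomial (mm d ι) 1 := by
    rw [monomial_eq, C_1, one_mul, Finsupp.prod_fintype _ _ (by simp), ← Finset.prod_pow]
    have : ∀ x, (X x ^ (mm d ι) x : MvPolynomial (Fin k) ℂ) = if x ∈ Finset.univ.image ι then X x ^ d else 1 := by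
      intro x
      simp only [mm, Finsupp.equivFunOnFinite_symm_apply_apply, Set.mem_range, Finset.mem_image, Finset.mem_univ, true_and]
      split_ifs <;> simp
    simp_rw [this]
    rw [← Finset.prod_filter, Finset.filter_mem_eq_inter, Finset.univ_inter, Finset.prod_image (fun a _ b _ h => hι h)]
  have h2 := congrArg (fun p : MvPolynomial (Fin k) ℂ => (p : MvPowerSeries (Fin k) ℂ)) h1
  simp only [MvPolynomial.coe_monomial] at h2
  rw [← h2]
  have : (MvPolynomial.coeToMvPowerSeries.ringHom ((∏ i, X (ι i)) ^ d : MvPolynomial (Fin k) ℂ) : MvPowerSeries (Fin k) ℂ) =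
    (∏ i, MvPowerSeries.X (ι i)) ^ d := by
    rw [map_pow, map_prod]
    simp
  exact this.symm

lemma mm_range {j k : ℕ} (d : ℕ) (ι : Fin j → Fin k) (i : Fin j) : mm d ι (ι i) = d := by
  simp [mm]

lemma mm_off {j k : ℕ} (d : ℕ) (ι : Fin j → Fin k) {x : Fin k} (hx : x ∉ Set.range ι) : mm d ι x = 0 := by
  simp only [mm, Finsupp.equivFunOnFinite_symm_apply_apply]
  rw [if_neg hx]

lemma mm_le {j k : ℕ} (d : ℕ) (ι : Fin j → Fin k) (e : Fin k →₀ ℕ) : mm d ι ≤ e ↔ ∀ i, d ≤ e (ι i) := by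
  constructor
  · intro h i
    have := h (ι i)
    rwa [mm_range] at this
  · intro h x
    by_cases hx : x ∈ Set.range ι
    · obtain ⟨i, rfl⟩ := hx
      rw [mm_range]; exact h i
    · rw [mm_off d ι hx]; exact Nat.zero_le _

lemma WC_sub {j k : ℕ} (d : ℕ) (ι : Fin j → Fin k) (e : Fin k →₀ ℕ) (h : ∀ i, d ≤ e (ι i)) :
    WC d ι (e - mm d ι : Fin k →₀ ℕ) ↔ WC d ι e := by
  unfold WC
  have h1 : ∀ i, (e - mm d ι : Fin k →₀ ℕ) (ι i) = e (ι i) - d := by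
    intro i; rw [Finsupp.tsub_apply, mm_range]
  have h2 : ∀ x, x ∉ Set.range ι → (e - mm d ι : Fin k →₀ ℕ) x = e x := by
    intro x hx; rw [Finsupp.tsub_apply, mm_off d ι hx]; simp
  simp only [h1]
  refine and_congr ?_ (and_congr ?_ ?_)
  · constructor
    · intro H x hx
      rw [← h2 x hx]; exact H x hx
    · intro H x hx
      rw [h2 x hx]; exact H x hx
  · constructor
    · intro H a b hab
      have := H a b hab
      omega
    · intro H a b hab
      have := H a b hab
      have := h a
      omega
  · refine forall_congr' (fun i => ?_)
    exact Nat.dvd_sub_iff_left (h i) (dvd_refl d)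

lemma WW_rec {j k : ℕ} (d : ℕ) (hd : 0 < d) (ι : Fin (j + 1) → Fin k) (hι : Function.Injective ι) :
    WW d ι * (1 - (∏ i, MvPowerSeries.X (ι i)) ^ d) =
      (∏ i : Fin j, MvPowerSeries.X (ι i.succ)) ^ d * WW d (fun i : Fin j => ι i.succ) := by
  rw [prodX_eq d ι hι, prodX_eq d (fun i : Fin j => ι i.succ) (hι.comp (Fin.succ_injective _))]
  ext e
  rw [mul_sub, mul_one, map_sub, MvPowerSeries.coeff_mul_monomial, MvPowerSeries.coeff_monomial_mul, coeff_WW]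
  simp only [mul_one, one_mul]
  set κ : Fin j → Fin k := fun i : Fin j => ι i.succ with hκ
  have h0 : ι 0 ∉ Set.range κ := by
    rintro ⟨i, hi⟩
    have := hι hi
    exact Fin.succ_ne_zero i this
  have hr : ∀ x, x ∉ Set.range κ → x ≠ ι 0 → x ∉ Set.range ι := by
    rintro x hx hx0 ⟨i, rfl⟩
    rcases Fin.eq_zero_or_eq_succ i with rfl | ⟨i, rfl⟩
    · exact hx0 rfl
    · exact hx ⟨i, rfl⟩
  by_cases hA : d ≤ e (ι 0)
  · have hR : (if mm d κ ≤ e then MvPowerSeries.coeff (e - mm d κ) (WW d κ) else 0) = 0 := by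
      split_ifs with h
      · rw [coeff_WW, if_neg]
        rintro ⟨h1, -⟩
        have := h1 _ h0
        rw [Finsupp.tsub_apply, mm_off d κ h0] at this
        omega
      · rfl
    rw [hR]
    by_cases hle : ∀ i, d ≤ e (ι i)
    · rw [if_pos ((mm_le d ι e).2 hle), coeff_WW]
      simp only [WC_sub d ι e hle]
      simp
    · rw [if_neg (fun h => hle ((mm_le d ι e).1 h)), if_neg, sub_zero]
      rintro ⟨-, h2, -⟩
      apply hle
      intro i
      rcases Fin.eq_zero_or_eq_succ i with rfl | ⟨i, rfl⟩
      · exact hA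
      · have := h2 0 i.succ (Fin.succ_pos _)
        omega
  · rw [if_neg (fun h => hA ((mm_le d ι e).1 h 0)), sub_zero]
    by_cases hle : ∀ i, d ≤ e (κ i)
    · rw [if_pos ((mm_le d κ e).2 hle), coeff_WW]
      simp only [WC_sub d κ e hle]
      have : WC d ι e ↔ WC d κ e := by
        constructor
        · rintro ⟨h1, h2, h3⟩
          refine ⟨?_, fun a b hab => h2 _ _ (Fin.succ_lt_succ_iff.2 hab), fun i => h3 _⟩
          intro x hx
          by_cases hx0 : x = ι 0
          · subst hx0
            exact Nat.eq_zero_of_dvd_of_lt (h3 0) (by omega)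
          · exact h1 x (hr x hx hx0)
        · rintro ⟨h1, h2, h3⟩
          have e0 := h1 _ h0
          refine ⟨?_, ?_, ?_⟩
          · intro x hx
            apply h1
            rintro ⟨i, rfl⟩
            exact hx ⟨i.succ, rfl⟩
          · intro a b hab
            rcases Fin.eq_zero_or_eq_succ b with rfl | ⟨b, rfl⟩
            · exact absurd hab (Fin.not_lt_zero a)
            rcases Fin.eq_zero_or_eq_succ a with rfl | ⟨a, rfl⟩
            · have := hle b
              have h5 : e (κ b) = e (ι b.succ) := rfl
              omega
            · exact h2 a b (Fin.succ_lt_succ_iff.1 hab)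
          · intro i
            rcases Fin.eq_zero_or_eq_succ i with rfl | ⟨i, rfl⟩
            · rw [e0]; exact dvd_zero _
            · exact h3 i
      simp only [this]
    · rw [if_neg (fun h => hle ((mm_le d κ e).1 h)), if_neg]
      rintro ⟨h1, h2, h3⟩
      apply hle
      intro i
      have := h2 0 i.succ (Fin.succ_pos _)
      exact Nat.le_of_dvd (by show 0 < e (ι i.succ); omega) (h3 i.succ)

/-- the fraction field -/
abbrev KK (k : ℕ) := FractionRing (MvPowerSeries (Fin k) ℂ)

/-- polynomials to the fraction field -/
noncomputable def toK (k : ℕ) : MvPolynomial (Fin k) ℂ →+* KK k :=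
  (algebraMap (MvPowerSeries (Fin k) ℂ) (KK k)).comp MvPolynomial.coeToMvPowerSeries.ringHom

lemma toK_ne {k : ℕ} (p : MvPolynomial (Fin k) ℂ) (x : Fin k → ℂ) (h : MvPolynomial.eval x p ≠ 0) : toK k p ≠ 0 := by
  intro h0
  unfold toK at h0
  rw [RingHom.comp_apply] at h0
  have h1 := (IsFractionRing.injective (MvPowerSeries (Fin k) ℂ) (KK k)) (h0.trans (map_zero _).symm)
  have h2 : p = 0 := MvPolynomial.coe_injective _ _ (by simpa using h1)
  rw [h2] at h
  simp at h

lemma gen_u (k : ℕ) : Gen k (fun i => toK k (X i)) where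
  ne0 i := toK_ne _ (fun _ => 1) (by simp)
  ne1 i := by
    have := toK_ne (1 + X i : MvPolynomial (Fin k) ℂ) (fun _ => 0) (by simp)
    simpa using this
  ne3 i := by
    have := toK_ne (1 + X i + X i ^ 2 : MvPolynomial (Fin k) ℂ) (fun _ => 0) (by simp)
    simpa using this
  inj i j hij := by
    have := toK_ne (X j - X i : MvPolynomial (Fin k) ℂ) (fun x => if x = j then 1 else 0) (by simp [hij])
    simpa using this
  nes i j hij := by
    have := toK_ne (X i + X j + X i * X j : MvPolynomial (Fin k) ℂ) (fun _ => 1) (by simp; norm_num)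
    simpa using this
  prd m ι hι := by
    have := toK_ne (1 - (∏ i, X (ι i)) ^ 2 : MvPolynomial (Fin k) ℂ) (fun _ => 0) (by simp)
    simpa using this

lemma WW_BF {k : ℕ} (d : ℕ) (hd : d = 1 ∨ d = 2) : ∀ (j : ℕ) (ι : Fin j → Fin k), Function.Injective ι →
    algebraMap (MvPowerSeries (Fin k) ℂ) (KK k) (WW d ι) = BF d j (fun i => toK k (X (ι i))) := by
  intro j
  induction j with
  | zero =>
    intro ι _
    have : WW d ι = 1 := by
      ext e
      rw [coeff_WW, MvPowerSeries.coeff_one]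
      congr 1
      unfold WC
      simp only [eq_iff_iff]
      constructor
      · rintro ⟨h, -⟩
        ext x
        exact h x (by rintro ⟨i, -⟩; exact i.elim0)
      · rintro rfl
        exact ⟨fun _ _ => rfl, fun a => a.elim0, fun a => a.elim0⟩
    rw [this, map_one, BF]
  | succ j ih =>
    intro ι hι
    have h := congrArg (algebraMap (MvPowerSeries (Fin k) ℂ) (KK k)) (WW_rec d (by omega) ι hι)
    have hX : ∀ i, algebraMap (MvPowerSeries (Fin k) ℂ) (KK k) (MvPowerSeries.X i) = toK k (X i) := by
      intro i; simp [toK]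
    simp only [map_mul, map_sub, map_one, map_pow, map_prod, hX] at h
    rw [ih (fun i => ι i.succ) (hι.comp (Fin.succ_injective _))] at h
    have hne : (1 - (∏ i, toK k (X (ι i))) ^ d) ≠ 0 := by
      have g := (gen_u k).sub hι
      rcases hd with rfl | rfl
      · rw [pow_one]; exact g.pr1
      · exact g.pr
    rw [BF, div_mul_eq_mul_div, eq_div_iff hne, h]

end LP

namespace LP

/-! ### Part P: reduction to a sum of maximal minors -/

/-- exponent vector of a bounded sequence -/
noncomputable def fr {k : ℕ} (r : Fin k → ℕ) : Fin k →₀ ℕ := Finsupp.equivFunOnFinite.symm r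

@[simp] lemma fr_apply {k : ℕ} (r : Fin k → ℕ) (i : Fin k) : fr r i = r i := rfl

lemma fr_coe {k : ℕ} (r : Fin k → ℕ) : (fr r : Fin k → ℕ) = r := rfl

lemma coeff_cst_mul {k M : ℕ} (φ ψ : MvPowerSeries (Fin k) ℂ) :
    MvPowerSeries.coeff (fr fun _ => M) (φ * ψ) = ∑ r : Fin k → Fin (M + 1),
      MvPowerSeries.coeff (fr fun i => r i) φ * MvPowerSeries.coeff (fr fun i => M - r i) ψ := by
  classical
  rw [MvPowerSeries.coeff_mul]
  symm
  refine Finset.sum_bij' (fun r _ => (fr fun i => (r i : ℕ), fr fun i => M - (r i : ℕ)))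
    (fun p hp => fun i => ⟨p.1 i, ?_⟩) ?_ ?_ ?_ ?_ ?_
  · rw [Finset.HasAntidiagonal.mem_antidiagonal] at hp
    have := DFunLike.congr_fun hp i
    simp at this
    omega
  · intro r _
    rw [Finset.HasAntidiagonal.mem_antidiagonal]
    ext i
    have := (r i).2
    simp; omega
  · intro p _; exact Finset.mem_univ _
  · intro r _; rfl
  · rintro ⟨p, q⟩ hp
    rw [Finset.HasAntidiagonal.mem_antidiagonal] at hp
    ext i
    · rfl
    · have := DFunLike.congr_fun hp i
      simp at this
      simp
      omega
  · intro r _; rfl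

lemma coeff_WW_fr {k : ℕ} (d : ℕ) (ι : Fin k → Fin k) (r : Fin k → ℕ) :
    MvPowerSeries.coeff (fr r) (WW d ι) = if WC d ι r then 1 else 0 := rfl

lemma coeff_rename_fr {k : ℕ} (σ : Equiv.Perm (Fin k)) (Q : MvPolynomial (Fin k) ℂ) (r : Fin k → ℕ) :
    (rename σ Q).coeff (fr r) = Q.coeff (fr fun i => r (σ i)) := by
  have h : fr r = Finsupp.mapDomain σ (fr fun i => r (σ i)) := by
    ext x
    obtain ⟨y, rfl⟩ := σ.surjective x
    rw [Finsupp.mapDomain_apply σ.injective]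
    simp
  rw [h, coeff_rename_mapDomain _ σ.injective]

lemma coeff_cst_perm {k M : ℕ} (d : ℕ) (σ : Equiv.Perm (Fin k)) (Q : MvPolynomial (Fin k) ℂ) :
    MvPowerSeries.coeff (fr fun _ => M) (((rename σ Q : MvPolynomial (Fin k) ℂ) : MvPowerSeries (Fin k) ℂ) * WW d (σ : Fin k → Fin k)) =
    MvPowerSeries.coeff (fr fun _ => M) ((Q : MvPowerSeries (Fin k) ℂ) * WW d (id : Fin k → Fin k)) := by
  rw [coeff_cst_mul, coeff_cst_mul]
  rw [← Equiv.sum_comp (Equiv.arrowCongr σ (Equiv.refl (Fin (M + 1))))]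
  apply Finset.sum_congr rfl
  intro r _
  simp only [MvPolynomial.coeff_coe, coeff_rename_fr, coeff_WW, fr_coe]
  congr 1
  · simp [Equiv.arrowCongr]
  · congr 1
    unfold WC
    simp [Equiv.arrowCongr]

/-- sign of a sequence (with respect to decreasing order) -/
def sg {k : ℕ} (r : Fin k → ℕ) : ℤ := pp k (fun i j => Int.sign ((r i : ℤ) - r j))

lemma sg_perm {k : ℕ} (r : Fin k → ℕ) (σ : Equiv.Perm (Fin k)) : sg (fun i => r (σ i)) = Equiv.Perm.sign σ * sg r := by
  unfold sg
  have := pp_perm (R := ℤ) (fun i j => Int.sign ((r i : ℤ) - r j)) (fun i j => by rw [← Int.sign_neg]; congr 1; ring) σ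
  simpa using this

lemma sg_anti {k : ℕ} (r : Fin k → ℕ) (hr : ∀ a b, a < b → r b < r a) : sg r = 1 := by
  unfold sg pp
  apply Finset.prod_eq_one
  intro i _
  apply Finset.prod_eq_one
  intro j _
  split_ifs with h
  · apply Int.sign_eq_one_of_pos
    have := hr i j h
    omega
  · rfl

lemma sg_ninj {k : ℕ} (r : Fin k → ℕ) (hr : ¬ Function.Injective r) : sg r = 0 := by
  have : ∃ a b, a < b ∧ r a = r b := by
    unfold Function.Injective at hr
    push Not at hr
    obtain ⟨a, b, h1, h2⟩ := hr
    rcases lt_or_gt_of_ne h2 with h | h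
    · exact ⟨a, b, h, h1⟩
    · exact ⟨b, a, h, h1.symm⟩
  obtain ⟨a, b, hab, h⟩ := this
  unfold sg pp
  apply Finset.prod_eq_zero (Finset.mem_univ a)
  apply Finset.prod_eq_zero (Finset.mem_univ b)
  rw [if_pos hab]
  show Int.sign ((r a : ℤ) - r b) = 0
  rw [h]; simp

lemma exists_sort_anti {k : ℕ} (r : Fin k → ℕ) (hr : Function.Injective r) :
    ∃ σ : Equiv.Perm (Fin k), ∀ a b, a < b → r (σ b) < r (σ a) := by
  refine ⟨Fin.revPerm.trans (Tuple.sort r), ?_⟩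
  intro a b hab
  have hm := Tuple.monotone_sort r
  have : b.rev < a.rev := Fin.rev_lt_rev.2 hab
  have h1 := hm this.le
  have h2 : r (Tuple.sort r b.rev) ≠ r (Tuple.sort r a.rev) := by
    intro h
    have := (Tuple.sort r).injective (hr h)
    omega
  have h3 : r (Tuple.sort r b.rev) ≤ r (Tuple.sort r a.rev) := h1
  show r (Tuple.sort r b.rev) < r (Tuple.sort r a.rev)
  omega

lemma sum_sign_anti {k : ℕ} (r : Fin k → ℕ) :
    ∑ σ : Equiv.Perm (Fin k), (Equiv.Perm.sign σ : ℤ) * (if ∀ a b, a < b → r (σ b) < r (σ a) then 1 else 0) = sg r := by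
  by_cases hr : Function.Injective r
  · obtain ⟨σ, hσ⟩ := exists_sort_anti r hr
    rw [Finset.sum_eq_single σ]
    · rw [if_pos hσ, mul_one]
      have h1 := sg_perm r σ
      rw [sg_anti _ hσ] at h1
      rcases Int.units_eq_one_or (Equiv.Perm.sign σ) with h | h <;> rw [h] at h1 ⊢ <;> push_cast at * <;> omega
    · intro τ _ hτ
      rw [if_neg, mul_zero]
      intro h
      apply hτ
      have e : (fun i => r (τ (Fin.rev i))) = fun i => r (σ (Fin.rev i)) := by
        apply (StrictMono.range_inj (f := fun i => r (τ (Fin.rev i))) (g := fun i => r (σ (Fin.rev i)))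
          (fun a b hab => h _ _ (Fin.rev_lt_rev.2 hab)) (fun a b hab => hσ _ _ (Fin.rev_lt_rev.2 hab))).1
        have h1 : ∀ ρ : Equiv.Perm (Fin k), Set.range (fun i => r (ρ (Fin.rev i))) = Set.range r := by
          intro ρ
          have := (Fin.revPerm.trans ρ).surjective.range_comp r
          exact this
        rw [h1, h1]
      ext i
      have := congrFun e i.rev
      simp only [Fin.rev_rev] at this
      rw [hr this]
    · intro h; exact absurd (Finset.mem_univ _) h
  · rw [sg_ninj r hr]
    apply Finset.sum_eq_zero
    intro σ _
    rw [if_neg, mul_zero]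
    intro h
    apply hr
    intro a b hab
    by_contra hne
    have h1 : ∀ a b, a < b → r a ≠ r b → True := fun _ _ _ _ => trivial
    have hne' : σ.symm a ≠ σ.symm b := fun h => hne (σ.symm.injective h)
    rcases lt_or_gt_of_ne hne' with h2 | h2
    · have := h _ _ h2
      simp at this; omega
    · have := h _ _ h2
      simp at this; omega

/-- sum of maximal minors -/
noncomputable def TH {k N : ℕ} (g : Fin k → Fin N → ℂ) : ℂ := ∑ r : Fin k → Fin N, (sg (fun i => (r i : ℕ)) : ℂ) * ∏ i, g i (r i)

lemma coeff_prod_univ {k : ℕ} (g : Fin k → Polynomial ℂ) (r : Fin k → ℕ) :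
    (∏ i, Polynomial.aeval (X i : MvPolynomial (Fin k) ℂ) (g i)).coeff (fr r) = ∏ i, (g i).coeff (r i) := by
  classical
  set N := (Finset.univ.sup fun i => (g i).natDegree) + 1 with hN
  have hg : ∀ i, Polynomial.aeval (X i : MvPolynomial (Fin k) ℂ) (g i) =
      ∑ a ∈ Finset.range N, C ((g i).coeff a) * X i ^ a := by
    intro i
    have hlt : (g i).natDegree < N := by
      have : (g i).natDegree ≤ Finset.univ.sup fun i => (g i).natDegree := Finset.le_sup (f := fun i => (g i).natDegree) (Finset.mem_univ i)
      omega
    rw [Polynomial.aeval_eq_sum_range' hlt]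
    apply Finset.sum_congr rfl
    intro a _
    rw [MvPolynomial.smul_eq_C_mul]
  simp_rw [hg]
  rw [Finset.prod_univ_sum, MvPolynomial.coeff_sum]
  have h1 : ∀ s : Fin k → ℕ, (∏ i, (C ((g i).coeff (s i)) * X i ^ s i) : MvPolynomial (Fin k) ℂ) =
      monomial (fr s) (∏ i, (g i).coeff (s i)) := by
    intro s
    rw [Finset.prod_mul_distrib, ← map_prod, monomial_eq, Finsupp.prod_fintype _ _ (by simp)]
    simp
  simp_rw [h1, coeff_monomial]
  have h2 : ∀ s : Fin k → ℕ, fr s = fr r ↔ s = r := by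
    intro s
    constructor
    · intro h
      funext i
      exact DFunLike.congr_fun h i
    · rintro rfl; rfl
  simp_rw [h2]
  rw [Finset.sum_ite_eq']
  split_ifs with h
  · rfl
  · rw [Fintype.mem_piFinset] at h
    push Not at h
    obtain ⟨i, hi⟩ := h
    symm
    apply Finset.prod_eq_zero (Finset.mem_univ i)
    apply Polynomial.coeff_eq_zero_of_natDegree_lt
    have : (g i).natDegree ≤ Finset.univ.sup fun i => (g i).natDegree := Finset.le_sup (f := fun i => (g i).natDegree) (Finset.mem_univ i)
    rw [Finset.mem_range] at hi
    omega

/-- rows -/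
noncomputable def fpoly (k p : ℕ) (i : Fin k) : Polynomial ℂ := (1 + Polynomial.X) ^ (p + (i : ℕ)) * Polynomial.X ^ (2 * (i.rev : ℕ))

lemma vand_eq (k p : ℕ) : (∏ i : Fin k, (1 + X i) ^ p) * pp k (fun i j => (X i - X j)) * pp k (fun i j => X i + X j + X i * X j) =
    ∑ τ : Equiv.Perm (Fin k), ((Equiv.Perm.sign τ : ℤ) : MvPolynomial (Fin k) ℂ) *
      rename τ (∏ i, Polynomial.aeval (X i : MvPolynomial (Fin k) ℂ) (fpoly k p i)) := by
  have h := Matrix.det_projVandermonde (R := MvPolynomial (Fin k) ℂ) (fun i : Fin k => 1 + X i) (fun i => X i ^ 2)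
  have e1 : (∏ i : Fin k, ∏ j ∈ Finset.Ioi i, ((1 + X j) * X i ^ 2 - (1 + X i) * X j ^ 2) : MvPolynomial (Fin k) ℂ) =
      pp k (fun i j => (X i - X j)) * pp k (fun i j => X i + X j + X i * X j) := by
    rw [← pp_mul]
    unfold pp
    apply Finset.prod_congr rfl
    intro i _
    rw [← Finset.prod_filter]
    apply Finset.prod_congr
    · ext j; simp
    · intro j _; ring
  rw [e1] at h
  rw [mul_assoc, ← h, Matrix.det_apply', Finset.mul_sum]
  apply Finset.sum_congr rfl
  intro τ _
  have e2 : (∏ i : Fin k, (1 + X i) ^ p : MvPolynomial (Fin k) ℂ) = ∏ i : Fin k, (1 + X (τ i)) ^ p :=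
    (Equiv.prod_comp τ (fun i => (1 + X i : MvPolynomial (Fin k) ℂ) ^ p)).symm
  rw [e2, mul_left_comm]
  congr 1
  rw [← Finset.prod_mul_distrib, map_prod]
  apply Finset.prod_congr rfl
  intro i _
  rw [Matrix.projVandermonde_apply]
  simp only [fpoly, map_mul, map_pow, map_add, map_one, Polynomial.aeval_X, rename_X]
  rw [pow_add, ← pow_mul]
  ring


lemma ZZ_coeff (m p k : ℕ) : ZZ ℂ (m + 1) p k = MvPowerSeries.coeff (fr fun _ => 2 * m)
    ((((∏ i, (1 + X i) ^ (p + 1)) * PQ (1 : ℂ) k : MvPolynomial (Fin k) ℂ) : MvPowerSeries (Fin k) ℂ) *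
      WW 2 (id : Fin k → Fin k)) := by
  rw [ZZ_mono, coeff_cst_mul]
  have hQ : ((∏ i, (1 + X i) ^ (p + 1)) * PQ (1 : ℂ) k : MvPolynomial (Fin k) ℂ) =
      rename Fin.revPerm ((∏ i, (1 + X i) ^ (p + 1)) * PP (1 : ℂ) k) := by
    rw [map_mul]
    congr 1
    · rw [map_prod]
      simp only [map_pow, map_add, map_one, rename_X]
      exact (Equiv.prod_comp Fin.revPerm (fun i => (1 + X i : MvPolynomial (Fin k) ℂ) ^ (p + 1))).symm
    · exact (PP_rev (1 : ℂ) k).symm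
  rw [hQ]
  simp only [MvPolynomial.coeff_coe, coeff_rename_fr, coeff_WW_fr]
  refine Finset.sum_of_injOn (fun T i => ⟨2 * (T i.rev : ℕ), by have := (T i.rev).2; omega⟩) ?_ ?_ ?_ ?_
  · intro T _ T' _ h
    funext i
    have := congrArg Fin.val (congrFun h i.rev)
    simp at this
    exact Fin.ext this
  · intro _ _; simp
  · intro r _ hr
    rw [if_neg, mul_zero]
    rintro ⟨_, _, h⟩
    apply hr
    refine ⟨fun i => ⟨(r i.rev : ℕ) / 2, ?_⟩, by simp, ?_⟩
    · have := (r i.rev).2; omega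
    · funext i
      apply Fin.ext
      have h1 := h i
      have h2 := (r i).2
      simp only [id, Fin.rev_rev] at h1 ⊢
      omega
  · intro T _
    simp only [Fin.revPerm_apply, Fin.rev_rev]
    have hiff : WC 2 (id : Fin k → Fin k) (fun i => 2 * m - 2 * (T i.rev : ℕ)) ↔ StrictMono T := by
      unfold WC
      constructor
      · rintro ⟨_, h, _⟩ a b hab
        have := h b.rev a.rev (Fin.rev_lt_rev.2 hab)
        simp at this
        have h1 := (T a).2
        have h2 := (T b).2
        rw [Fin.lt_def]
        omega
      · intro h
        refine ⟨fun x hx => absurd ⟨x, rfl⟩ hx, ?_, ?_⟩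
        · intro a b hab
          have := h (Fin.rev_lt_rev.2 hab)
          rw [Fin.lt_def] at this
          have h1 := (T b.rev).2
          have h2 := (T a.rev).2
          simp only [id]
          omega
        · intro i; exact ⟨m - (T i.rev : ℕ), by simp only [id]; omega⟩
    simp only [hiff]
    split_ifs with h
    · rw [mul_one]
      unfold cz
      rw [if_pos (fun i => by positivity)]
      rfl
    · rw [mul_zero]

lemma asym_ps (k : ℕ) : ∑ σ : Equiv.Perm (Fin k), ((Equiv.Perm.sign σ : ℤ) : MvPowerSeries (Fin k) ℂ) *
      (((rename σ ((∏ i, (1 + X i)) * pp k (fun i j => 1 + X i + X i * X j)) : MvPolynomial (Fin k) ℂ) : MvPowerSeries (Fin k) ℂ) * WW 2 (σ : Fin k → Fin k)) =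
    ((pp k (fun i j => X i + X j + X i * X j) : MvPolynomial (Fin k) ℂ) : MvPowerSeries (Fin k) ℂ) *
      ∑ σ : Equiv.Perm (Fin k), ((Equiv.Perm.sign σ : ℤ) : MvPowerSeries (Fin k) ℂ) * WW 1 (σ : Fin k → Fin k) := by
  have h := asym_eq k (fun i => toK k (X i)) (gen_u k)
  apply IsFractionRing.injective (MvPowerSeries (Fin k) ℂ) (KK k)
  simp only [map_sum, map_mul, map_intCast]
  have e1 : ∀ q : MvPolynomial (Fin k) ℂ, algebraMap (MvPowerSeries (Fin k) ℂ) (KK k) (q : MvPowerSeries (Fin k) ℂ) = toK k q := fun _ => rfl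
  simp only [e1]
  have e2 : ∀ σ : Equiv.Perm (Fin k), toK k (rename σ ((∏ i, (1 + X i)) * pp k (fun i j => 1 + X i + X i * X j))) *
      algebraMap (MvPowerSeries (Fin k) ℂ) (KK k) (WW 2 (σ : Fin k → Fin k)) = AG k (fun i => toK k (X (σ i))) := by
    intro σ
    unfold AG
    rw [WW_BF 2 (Or.inr rfl) k σ σ.injective]
    congr 1
    rw [map_mul, map_mul]
    congr 1
    · simp [map_prod]
    · have := pp_map ((toK k).comp (rename σ : MvPolynomial (Fin k) ℂ →ₐ[ℂ] MvPolynomial (Fin k) ℂ).toRingHom) k (fun i j => 1 + X i + X i * X j)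
      simpa using this
  have e3 : toK k (pp k (fun i j => X i + X j + X i * X j)) = pp k (fun i j => toK k (X i) + toK k (X j) + toK k (X i) * toK k (X j)) := by
    rw [pp_map]; simp
  have e4 : ∀ σ : Equiv.Perm (Fin k), algebraMap (MvPowerSeries (Fin k) ℂ) (KK k) (WW 1 (σ : Fin k → Fin k)) =
      BF 1 k (fun i => toK k (X (σ i))) := fun σ => WW_BF 1 (Or.inl rfl) k σ σ.injective
  simp only [← map_mul (rename _)]
  simp only [e2, e3, e4]
  exact h

theorem ZZ_TH (m p k : ℕ) (hm : m + 1 = k + p) : ZZ ℂ (m + 1) p k =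
    TH (fun i (r : Fin (2 * m + 1)) => (fpoly k p i).coeff (r : ℕ)) := by
  set Φ : MvPolynomial (Fin k) ℂ := (∏ i : Fin k, (1 + X i) ^ p) * pp k (fun i j => (X i - X j)) with hΦ
  set Ξ : MvPolynomial (Fin k) ℂ := (∏ i, (1 + X i)) * pp k (fun i j => 1 + X i + X i * X j) with hΞ
  have hQ : ((∏ i, (1 + X i) ^ (p + 1)) * PQ (1 : ℂ) k : MvPolynomial (Fin k) ℂ) = Φ * Ξ := by
    rw [hΦ, hΞ, PQ, pp_mul]
    simp only [pow_succ, Finset.prod_mul_distrib, map_one, one_mul]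
    ring
  have hΦσ : ∀ σ : Equiv.Perm (Fin k), rename σ Φ = ((Equiv.Perm.sign σ : ℤ) : MvPolynomial (Fin k) ℂ) * Φ := by
    intro σ
    rw [hΦ, map_mul]
    have a1 : rename σ (∏ i : Fin k, (1 + X i) ^ p : MvPolynomial (Fin k) ℂ) = ∏ i : Fin k, (1 + X i) ^ p := by
      rw [map_prod]
      simp only [map_pow, map_add, map_one, rename_X]
      exact (Equiv.prod_comp σ (fun i => (1 + X i : MvPolynomial (Fin k) ℂ) ^ p))
    have a2 : rename σ (pp k (fun i j => (X i - X j : MvPolynomial (Fin k) ℂ))) = ((Equiv.Perm.sign σ : ℤ) : MvPolynomial (Fin k) ℂ) * pp k (fun i j => (X i - X j)) := by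
      have b1 := pp_map (rename σ : MvPolynomial (Fin k) ℂ →ₐ[ℂ] MvPolynomial (Fin k) ℂ).toRingHom k (fun i j => X i - X j)
      have b2 := pp_perm (R := MvPolynomial (Fin k) ℂ) (fun i j => X i - X j) (fun i j => by ring) σ
      rw [← b2]
      simpa using b1
    rw [a1, a2]; ring
  have hk : (Nat.factorial k : ℂ) ≠ 0 := by exact_mod_cast (Nat.factorial_pos k).ne'
  have key1 : (Nat.factorial k : ℂ) * ZZ ℂ (m + 1) p k = MvPowerSeries.coeff (fr fun _ => 2 * m)
      (((Φ * pp k (fun i j => X i + X j + X i * X j) : MvPolynomial (Fin k) ℂ) : MvPowerSeries (Fin k) ℂ) *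
      ∑ σ : Equiv.Perm (Fin k), ((Equiv.Perm.sign σ : ℤ) : MvPowerSeries (Fin k) ℂ) * WW 1 (σ : Fin k → Fin k)) := by
    rw [MvPolynomial.coe_mul, mul_assoc, ← asym_ps, Finset.mul_sum, map_sum]
    have : ∀ σ : Equiv.Perm (Fin k), MvPowerSeries.coeff (fr fun _ => 2 * m) ((Φ : MvPowerSeries (Fin k) ℂ) * (((Equiv.Perm.sign σ : ℤ) : MvPowerSeries (Fin k) ℂ) *
      (((rename σ Ξ : MvPolynomial (Fin k) ℂ) : MvPowerSeries (Fin k) ℂ) * WW 2 (σ : Fin k → Fin k)))) = ZZ ℂ (m + 1) p k := by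
      intro σ
      rw [ZZ_coeff, hQ, ← coeff_cst_perm 2 σ (Φ * Ξ), map_mul (rename σ) Φ Ξ, hΦσ, MvPolynomial.coe_mul (_ * Φ) (rename σ Ξ), MvPolynomial.coe_mul _ Φ]
      congr 1
      have : (((((Equiv.Perm.sign σ : ℤ)) : MvPolynomial (Fin k) ℂ)) : MvPowerSeries (Fin k) ℂ) = ((Equiv.Perm.sign σ : ℤ) : MvPowerSeries (Fin k) ℂ) :=
        map_intCast (MvPolynomial.coeToMvPowerSeries.ringHom : MvPolynomial (Fin k) ℂ →+* _) _
      rw [this]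
      ring
    rw [Finset.sum_congr rfl (fun σ _ => this σ)]
    simp [Fintype.card_perm]
  have key2 : ∀ r : Fin k → Fin (2 * m + 1), MvPowerSeries.coeff (fr fun i => 2 * m - (r i : ℕ))
      (∑ σ : Equiv.Perm (Fin k), ((Equiv.Perm.sign σ : ℤ) : MvPowerSeries (Fin k) ℂ) * WW 1 (σ : Fin k → Fin k)) = (sg (fun i => (r i : ℕ)) : ℂ) := by
    intro r
    rw [← sum_sign_anti, map_sum]
    push_cast
    apply Finset.sum_congr rfl
    intro σ _
    have : ((Equiv.Perm.sign σ : ℤ) : MvPowerSeries (Fin k) ℂ) * WW 1 (σ : Fin k → Fin k) = ((Equiv.Perm.sign σ : ℤ) : ℂ) • WW 1 (σ : Fin k → Fin k) := by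
      rw [Int.cast_smul_eq_zsmul, zsmul_eq_mul]
    rw [this, map_smul, coeff_WW_fr, smul_eq_mul]
    congr 1
    have hiff : WC 1 (σ : Fin k → Fin k) (fun i => 2 * m - (r i : ℕ)) ↔ ∀ a b, a < b → (r (σ b) : ℕ) < r (σ a) := by
      unfold WC
      constructor
      · rintro ⟨_, h, _⟩ a b hab
        have := h a b hab
        simp only at this
        omega
      · intro h
        refine ⟨fun x hx => absurd (σ.surjective x) hx, ?_, fun i => one_dvd _⟩
        intro a b hab
        have := h a b hab
        have h1 := (r (σ a)).2
        simp only
        omega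
    simp only [hiff]
  have key3 : (Nat.factorial k : ℂ) * ZZ ℂ (m + 1) p k = (Nat.factorial k : ℂ) * TH (fun i (r : Fin (2 * m + 1)) => (fpoly k p i).coeff (r : ℕ)) := by
    rw [key1, coeff_cst_mul]
    simp only [key2, MvPolynomial.coeff_coe]
    rw [vand_eq]
    simp only [MvPolynomial.coeff_sum, Finset.sum_mul]
    rw [Finset.sum_comm]
    have : ∀ τ : Equiv.Perm (Fin k), ∑ r : Fin k → Fin (2 * m + 1), (((Equiv.Perm.sign τ : ℤ) : MvPolynomial (Fin k) ℂ) *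
      rename τ (∏ i, Polynomial.aeval (X i : MvPolynomial (Fin k) ℂ) (fpoly k p i))).coeff (fr fun i => (r i : ℕ)) * (sg (fun i => (r i : ℕ)) : ℂ) =
        TH (fun i (r : Fin (2 * m + 1)) => (fpoly k p i).coeff (r : ℕ)) := by
      intro τ
      unfold TH
      rw [← Equiv.sum_comp (Equiv.arrowCongr τ (Equiv.refl (Fin (2 * m + 1))))]
      apply Finset.sum_congr rfl
      intro r _
      have c1 : ((Equiv.Perm.sign τ : ℤ) : MvPolynomial (Fin k) ℂ) = C ((Equiv.Perm.sign τ : ℤ) : ℂ) := (map_intCast (C : ℂ →+* MvPolynomial (Fin k) ℂ) _).symm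
      rw [c1, coeff_C_mul, coeff_rename_fr, coeff_prod_univ]
      have c2 := sg_perm (fun i => ((Equiv.arrowCongr τ (Equiv.refl (Fin (2 * m + 1))) r i : Fin (2 * m + 1)) : ℕ)) τ
      have c3 : ∀ i, (Equiv.arrowCongr τ (Equiv.refl (Fin (2 * m + 1))) r) (τ i) = r i := by
        intro i; simp [Equiv.arrowCongr]
      simp only [c3] at c2 ⊢
      rw [c2]
      push_cast
      ring
    rw [Finset.sum_congr rfl (fun τ _ => this τ)]
    simp [Fintype.card_perm]
  exact mul_left_cancel₀ hk key3

end LP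

namespace LP

/-! ### Part Q: row expansion of the sum of maximal minors -/

/-- row expansion of the sign -/
def EX {m : ℕ} (φ : ℕ → ℤ) (y : Fin (m + 1) → ℕ) : ℤ :=
  ∑ p : Fin (m + 1), (if p = 0 then 1 else -1) * φ (y p) * sg (fun i : Fin m => y (Equiv.swap 0 p i.succ))

lemma EX_perm_sum {m : ℕ} (φ : ℕ → ℤ) (y : Fin (m + 1) → ℕ) : (Nat.factorial m : ℤ) * EX φ y =
    ∑ σ : Equiv.Perm (Fin (m + 1)), (Equiv.Perm.sign σ : ℤ) * (φ (y (σ 0)) * sg (fun i : Fin m => y (σ i.succ))) := by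
  rw [sum_perm_succ]
  unfold EX
  rw [Finset.mul_sum]
  apply Finset.sum_congr rfl
  intro p _
  have : ∀ e : Equiv.Perm (Fin m), ((Equiv.Perm.sign (Equiv.Perm.decomposeFin.symm (p, e)) : ℤˣ) : ℤ) *
      (φ (y (Equiv.Perm.decomposeFin.symm (p, e) 0)) * sg (fun i : Fin m => y (Equiv.Perm.decomposeFin.symm (p, e) i.succ))) =
      (if p = 0 then 1 else -1) * φ (y p) * sg (fun i : Fin m => y (Equiv.swap 0 p i.succ)) := by
    intro e
    have h := sg_perm (fun i : Fin m => y (Equiv.swap 0 p i.succ)) e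
    simp only [Equiv.Perm.decomposeFin.symm_sign, Equiv.Perm.decomposeFin_symm_apply_zero, Equiv.Perm.decomposeFin_symm_apply_succ]
    rw [h]
    have h2 : ((Equiv.Perm.sign e : ℤˣ) : ℤ) * ((Equiv.Perm.sign e : ℤˣ) : ℤ) = 1 := by
      rcases Int.units_eq_one_or (Equiv.Perm.sign e) with h | h <;> rw [h] <;> rfl
    split_ifs
    · push_cast
      linear_combination (φ (y p) * sg (fun i : Fin m => y (Equiv.swap 0 p i.succ))) * h2
    · push_cast
      linear_combination (-φ (y p) * sg (fun i : Fin m => y (Equiv.swap 0 p i.succ))) * h2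
  rw [Finset.sum_congr rfl (fun e _ => this e)]
  simp [Fintype.card_perm]

lemma EX_anti {m : ℕ} (φ : ℕ → ℤ) (y : Fin (m + 1) → ℕ) (τ : Equiv.Perm (Fin (m + 1))) :
    EX φ (fun i => y (τ i)) = Equiv.Perm.sign τ * EX φ y := by
  have hk : (Nat.factorial m : ℤ) ≠ 0 := by exact_mod_cast (Nat.factorial_pos m).ne'
  apply mul_left_cancel₀ hk
  rw [mul_left_comm, EX_perm_sum, EX_perm_sum, Finset.mul_sum]
  conv_rhs => rw [← Equiv.sum_comp (Equiv.mulLeft τ)]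
  apply Finset.sum_congr rfl
  intro σ _
  have h2 : ((Equiv.Perm.sign τ : ℤˣ) : ℤ) * ((Equiv.Perm.sign τ : ℤˣ) : ℤ) = 1 := by
    rcases Int.units_eq_one_or (Equiv.Perm.sign τ) with h | h <;> rw [h] <;> rfl
  simp only [Equiv.coe_mulLeft, Equiv.Perm.sign_mul, Equiv.Perm.mul_apply, Units.val_mul]
  linear_combination (-((Equiv.Perm.sign σ : ℤˣ) : ℤ) * (φ (y (τ (σ 0))) * sg (fun i : Fin m => y (τ (σ i.succ))))) * h2

lemma anti_zero {k : ℕ} (F : (Fin k → ℕ) → ℤ) (hF : ∀ y (σ : Equiv.Perm (Fin k)), F (fun i => y (σ i)) = Equiv.Perm.sign σ * F y)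
    (h0 : ∀ y : Fin k → ℕ, (∀ a b, a < b → y b < y a) → F y = 0) (y : Fin k → ℕ) : F y = 0 := by
  by_cases hy : Function.Injective y
  · obtain ⟨σ, hσ⟩ := exists_sort_anti y hy
    have h1 := hF y σ
    rw [h0 _ hσ] at h1
    have := h1.symm
    rw [mul_eq_zero] at this
    rcases this with h | h
    · exact absurd h (Units.ne_zero _)
    · exact h
  · unfold Function.Injective at hy
    push Not at hy
    obtain ⟨a, b, h1, h2⟩ := hy
    have h3 := hF y (Equiv.swap a b)
    have h4 : (fun i => y (Equiv.swap a b i)) = y := by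
      funext i
      rw [Equiv.swap_apply_def]
      split_ifs with e1 e2
      · rw [e1, h1]
      · rw [e2, h1]
      · rfl
    rw [h4, Equiv.Perm.sign_swap h2] at h3
    push_cast at h3
    omega

lemma EX_sorted {m : ℕ} (φ : ℕ → ℤ) (y : Fin (m + 1) → ℕ) (hy : ∀ a b, a < b → y b < y a) :
    EX φ y = ∑ p : Fin (m + 1), (-1) ^ (p : ℕ) * φ (y p) := by
  unfold EX
  apply Finset.sum_congr rfl
  intro p _
  suffices h : (if p = 0 then (1 : ℤ) else -1) * sg (fun i : Fin m => y (Equiv.swap 0 p i.succ)) = (-1) ^ (p : ℕ) by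
    rw [← h]; ring
  have h1 := sg_perm y (Equiv.swap 0 p)
  rw [sg_anti y hy] at h1
  have h2 : sg (fun i => y (Equiv.swap 0 p i)) = (-1) ^ (p : ℕ) * sg (fun i : Fin m => y (Equiv.swap 0 p i.succ)) := by
    unfold sg
    rw [pp_succ]
    congr 1
    have e1 : ∏ j : Fin m, Int.sign ((y (Equiv.swap 0 p 0) : ℤ) - y (Equiv.swap 0 p j.succ)) =
        ∏ l ∈ Finset.univ.erase p, Int.sign ((y p : ℤ) - y l) := by
      rw [Equiv.swap_apply_left]
      refine Finset.prod_bij (fun j _ => Equiv.swap 0 p j.succ) ?_ ?_ ?_ ?_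
      · intro j _
        simp only [Finset.mem_erase, Finset.mem_univ, and_true]
        intro h
        have h' : Equiv.swap 0 p j.succ = Equiv.swap 0 p 0 := by rw [h, Equiv.swap_apply_left]
        exact absurd ((Equiv.swap 0 p).injective h') (Fin.succ_ne_zero j)
      · intro a _ b _ h
        exact Fin.succ_injective _ ((Equiv.swap 0 p).injective h)
      · intro l hl
        have hl' : l ≠ p := (Finset.mem_erase.1 hl).1
        have : Equiv.swap 0 p l ≠ 0 := by
          intro h
          apply hl'
          have h3 := congrArg (Equiv.swap 0 p) h
          rwa [Equiv.swap_apply_self, Equiv.swap_apply_left] at h3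
        obtain ⟨j, hj⟩ := Fin.exists_succ_eq.2 this
        exact ⟨j, Finset.mem_univ _, by rw [hj, Equiv.swap_apply_self]⟩
      · intro j _; rfl
    rw [e1]
    have e2 : ∀ l ∈ Finset.univ.erase p, Int.sign ((y p : ℤ) - y l) = if l < p then -1 else 1 := by
      intro l hl
      have hl' : l ≠ p := (Finset.mem_erase.1 hl).1
      split_ifs with h
      · have := hy l p h
        apply Int.sign_eq_neg_one_of_neg; omega
      · have : p < l := lt_of_le_of_ne (not_lt.1 h) (Ne.symm hl')
        have := hy p l this
        apply Int.sign_eq_one_of_pos; omega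
    rw [Finset.prod_congr rfl e2, Finset.prod_ite]
    simp only [Finset.prod_const, one_pow, mul_one]
    congr 1
    have : (Finset.univ.erase p).filter (fun l => l < p) = Finset.Iio p := by
      ext l
      simp only [Finset.mem_filter, Finset.mem_erase, Finset.mem_univ, and_true, Finset.mem_Iio]
      constructor
      · exact fun h => h.2
      · exact fun h => ⟨h.ne, h⟩
    rw [this, Fin.card_Iio]
  rw [h2] at h1
  have h3 : ((-1 : ℤ) ^ (p : ℕ)) * (-1) ^ (p : ℕ) = 1 := by rw [← mul_pow]; simp
  by_cases hp : p = 0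
  · subst hp
    simp at h1
    simpa using h1
  · rw [if_neg hp]
    rw [Equiv.Perm.sign_swap (Ne.symm hp)] at h1
    push_cast at h1
    linear_combination (-(-1 : ℤ) ^ (p : ℕ)) * h1 + sg (fun i : Fin m => y (Equiv.swap 0 p i.succ)) * h3

lemma sign_prod (a : ℕ) : ∀ (m : ℕ) (y : Fin m → ℕ), (∀ i j, i < j → y j < y i) →
    ∏ j, Int.sign ((a : ℤ) - y j) = ∑ j : Fin m, (-1) ^ (j : ℕ) * Int.sign ((a : ℤ) - y j) + if Even m then 1 else 0 := by
  intro m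
  induction m with
  | zero => intro y _; simp
  | succ m ih =>
    intro y hy
    have ih' := ih (fun j => y j.succ) (fun i j h => hy _ _ (Fin.succ_lt_succ_iff.2 h))
    rw [Fin.prod_univ_succ, Fin.sum_univ_succ]
    have e : ∑ i : Fin m, (-1 : ℤ) ^ (i.succ : ℕ) * Int.sign ((a : ℤ) - y i.succ) =
        - ∑ i : Fin m, (-1 : ℤ) ^ (i : ℕ) * Int.sign ((a : ℤ) - y i.succ) := by
      rw [← Finset.sum_neg_distrib]
      apply Finset.sum_congr rfl
      intro i _
      rw [Fin.val_succ, pow_succ]; ring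
    rw [e]
    have par : (if Even (m + 1) then (1 : ℤ) else 0) = 1 - if Even m then 1 else 0 := by
      by_cases h : Even m
      · rw [if_pos h, if_neg (by rw [Nat.even_add_one]; exact not_not.2 h)]; rfl
      · rw [if_neg h, if_pos (by rw [Nat.even_add_one]; exact h)]; rfl
    rw [par]
    simp only [Fin.val_zero, pow_zero, one_mul]
    by_cases h : a < y 0
    · have : Int.sign ((a : ℤ) - y 0) = -1 := by apply Int.sign_eq_neg_one_of_neg; omega
      rw [this]
      linarith
    · have hp : ∏ j : Fin m, Int.sign ((a : ℤ) - y j.succ) = 1 := by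
        apply Finset.prod_eq_one
        intro j _
        have := hy 0 j.succ (Fin.succ_pos j)
        apply Int.sign_eq_one_of_pos; omega
      rw [hp] at ih' ⊢
      linarith

lemma EX_sub_zero {m : ℕ} (a : ℕ) (y : Fin (m + 1) → ℕ) :
    sg (Fin.cons a y : Fin (m + 2) → ℕ) = EX (fun b => Int.sign ((a : ℤ) - b)) y + if Even (m + 1) then sg y else 0 := by
  have hs : ∀ y : Fin (m + 1) → ℕ, sg (Fin.cons a y : Fin (m + 2) → ℕ) = (∏ j, Int.sign ((a : ℤ) - y j)) * sg y := by
    intro y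
    unfold sg
    rw [pp_succ]
    simp only [Fin.cons_zero, Fin.cons_succ]
  rw [hs]
  rw [← sub_eq_zero]
  refine anti_zero (fun y => (∏ j, Int.sign ((a : ℤ) - y j)) * sg y - (EX (fun b => Int.sign ((a : ℤ) - b)) y + if Even (m + 1) then sg y else 0)) ?_ ?_ y
  · intro y σ
    simp only [EX_anti, sg_perm]
    rw [Equiv.prod_comp σ (fun i => Int.sign ((a : ℤ) - y i))]
    split_ifs <;> ring
  · intro y hy
    rw [EX_sorted _ y hy, sign_prod a _ y hy, sg_anti y hy]
    ring

lemma EX_one {m : ℕ} (hm : Even (m + 1)) (y : Fin (m + 1) → ℕ) : EX (fun _ => 1) y = 0 := by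
  refine anti_zero (fun y => EX (fun _ => 1) y) ?_ ?_ y
  · intro y σ; exact EX_anti _ y σ
  · intro y hy
    rw [EX_sorted _ y hy]
    have h := sign_prod ((y 0) + 1) _ y hy
    have h1 : ∀ j, Int.sign (((y 0 + 1 : ℕ) : ℤ) - y j) = 1 := by
      intro j
      have : y j ≤ y 0 := by
        by_cases h : j = 0
        · rw [h]
        · exact (hy 0 j (Fin.pos_of_ne_zero h)).le
      apply Int.sign_eq_one_of_pos; omega
    simp only [h1, Finset.prod_const_one, if_pos hm] at h
    linarith

/-- the antisymmetric form -/
noncomputable def MM {N : ℕ} (x z : Fin N → ℂ) : ℂ := ∑ a : Fin N, ∑ b : Fin N, (Int.sign (((a : ℕ) : ℤ) - (b : ℕ)) : ℂ) * x a * z b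

lemma TH_term {m N : ℕ} (φ : ℕ → ℂ) (p : Fin (m + 1)) (h : Fin (m + 1) → Fin N → ℂ) :
    ∑ y : Fin (m + 1) → Fin N, φ (y p) * (sg (fun i : Fin m => (y (Equiv.swap 0 p i.succ) : ℕ)) : ℂ) * ∏ i, h i (y i) =
    (∑ b : Fin N, φ b * h p b) * TH (fun i : Fin m => h (Equiv.swap 0 p i.succ)) := by
  rw [← Equiv.sum_comp (Equiv.arrowCongr (Equiv.swap 0 p) (Equiv.refl (Fin N)))]
  rw [← Equiv.sum_comp (Fin.consEquiv (fun _ => Fin N)), Fintype.sum_prod_type, Finset.sum_mul]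
  apply Finset.sum_congr rfl
  intro b _
  unfold TH
  rw [Finset.mul_sum]
  apply Finset.sum_congr rfl
  intro z _
  have e : ∀ i, (Equiv.arrowCongr (Equiv.swap 0 p) (Equiv.refl (Fin N))) (Fin.consEquiv (fun _ => Fin N) (b, z)) i =
      (Fin.cons b z : Fin (m + 1) → Fin N) (Equiv.swap 0 p i) := by
    intro i; simp [Equiv.arrowCongr, Fin.consEquiv]
  simp only [e, Equiv.swap_apply_self, Equiv.swap_apply_right, Fin.cons_zero, Fin.cons_succ]
  rw [← Equiv.prod_comp (Equiv.swap 0 p)]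
  simp only [Equiv.swap_apply_self]
  rw [Fin.prod_univ_succ]
  simp only [Equiv.swap_apply_left, Fin.cons_zero, Fin.cons_succ]
  ring

lemma TH_cons {m N : ℕ} (x : Fin N → ℂ) (h : Fin m → Fin N → ℂ) :
    TH (Fin.cons x h : Fin (m + 1) → Fin N → ℂ) =
      ∑ a, x a * ∑ y : Fin m → Fin N, (sg (Fin.cons (a : ℕ) (fun i => (y i : ℕ)) : Fin (m + 1) → ℕ) : ℂ) * ∏ i, h i (y i) := by
  unfold TH
  rw [← Equiv.sum_comp (Fin.consEquiv (fun _ => Fin N)), Fintype.sum_prod_type]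
  apply Finset.sum_congr rfl
  intro a _
  rw [Finset.mul_sum]
  apply Finset.sum_congr rfl
  intro y _
  have e : (fun i => ((Fin.consEquiv (fun _ => Fin N) (a, y) i : Fin N) : ℕ)) = (Fin.cons (a : ℕ) (fun i => (y i : ℕ)) : Fin (m + 1) → ℕ) := by
    funext i
    refine Fin.cases ?_ ?_ i
    · simp [Fin.consEquiv]
    · intro j; simp [Fin.consEquiv]
  rw [e, Fin.prod_univ_succ]
  simp [Fin.consEquiv]
  ring

theorem TH_expand {m N : ℕ} (x : Fin N → ℂ) (h : Fin (m + 1) → Fin N → ℂ) :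
    TH (Fin.cons x h : Fin (m + 2) → Fin N → ℂ) =
      ∑ p : Fin (m + 1), (if p = 0 then 1 else -1) * MM x (h p) * TH (fun i : Fin m => h (Equiv.swap 0 p i.succ)) +
      if Even (m + 1) then (∑ a, x a) * TH h else 0 := by
  rw [TH_cons]
  have e : ∀ a : Fin N, ∑ y : Fin (m + 1) → Fin N, (sg (Fin.cons (a : ℕ) (fun i => (y i : ℕ)) : Fin (m + 2) → ℕ) : ℂ) * ∏ i, h i (y i) =
      ∑ p : Fin (m + 1), (if p = 0 then 1 else -1) * ((∑ b : Fin N, (Int.sign (((a : ℕ) : ℤ) - (b : ℕ)) : ℂ) * h p b) * TH (fun i : Fin m => h (Equiv.swap 0 p i.succ))) +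
        if Even (m + 1) then TH h else 0 := by
    intro a
    simp only [EX_sub_zero]
    push_cast
    simp only [add_mul, Finset.sum_add_distrib]
    congr 1
    · unfold EX
      push_cast
      simp only [Finset.sum_mul (s := (Finset.univ : Finset (Fin (m + 1))))]
      rw [Finset.sum_comm]
      apply Finset.sum_congr rfl
      intro p _
      rw [← TH_term (fun b => (Int.sign (((a : ℕ) : ℤ) - (b : ℕ)) : ℂ)) p h, Finset.mul_sum]
      apply Finset.sum_congr rfl
      intro y _
      ring
    · split_ifs
      · rfl
      · simp
  simp only [e, mul_add, Finset.sum_add_distrib]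
  congr 1
  · simp only [Finset.mul_sum]
    rw [Finset.sum_comm]
    apply Finset.sum_congr rfl
    intro p _
    unfold MM
    rw [Finset.mul_sum, Finset.sum_mul]
    apply Finset.sum_congr rfl
    intro a _
    simp only [Finset.sum_mul, Finset.mul_sum]
    apply Finset.sum_congr rfl
    intro b _
    ring
  · split_ifs
    · rw [Finset.sum_mul]
    · simp

theorem TH_one {m N : ℕ} (hm : Even (m + 1)) (h : Fin (m + 1) → Fin N → ℂ) :
    ∑ p : Fin (m + 1), (if p = 0 then 1 else -1) * (∑ b, h p b) * TH (fun i : Fin m => h (Equiv.swap 0 p i.succ)) = 0 := by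
  have e : ∀ p : Fin (m + 1), (∑ b, h p b) * TH (fun i : Fin m => h (Equiv.swap 0 p i.succ)) =
      ∑ y : Fin (m + 1) → Fin N, (sg (fun i : Fin m => (y (Equiv.swap 0 p i.succ) : ℕ)) : ℂ) * ∏ i, h i (y i) := by
    intro p
    have := TH_term (fun _ => 1) p h
    simp only [one_mul] at this
    exact this.symm
  simp only [mul_assoc, e]
  simp only [Finset.mul_sum]
  rw [Finset.sum_comm]
  apply Finset.sum_eq_zero
  intro y _
  have h1 := EX_one hm (fun i => (y i : ℕ))
  have h2 : ((EX (fun _ => 1) (fun i => (y i : ℕ)) : ℤ) : ℂ) = 0 := by rw [h1]; simp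
  unfold EX at h2
  push_cast at h2
  calc _ = (∑ p : Fin (m + 1), (if p = 0 then (1:ℂ) else -1) * 1 * (sg (fun i : Fin m => (y (Equiv.swap 0 p i.succ) : ℕ)) : ℂ)) * ∏ i, h i (y i) := by
        rw [Finset.sum_mul]
        apply Finset.sum_congr rfl
        intro p _
        ring
    _ = 0 := by rw [h2, zero_mul]

lemma TH_perm {k N : ℕ} (g : Fin k → Fin N → ℂ) (σ : Equiv.Perm (Fin k)) :
    TH (fun i => g (σ i)) = ((Equiv.Perm.sign σ : ℤ) : ℂ) * TH g := by
  unfold TH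
  rw [← Equiv.sum_comp (Equiv.arrowCongr σ.symm (Equiv.refl (Fin N))), Finset.mul_sum]
  apply Finset.sum_congr rfl
  intro r _
  have e : ∀ i, (Equiv.arrowCongr σ.symm (Equiv.refl (Fin N))) r i = r (σ i) := by
    intro i; simp [Equiv.arrowCongr]
  simp only [e]
  rw [sg_perm (fun i => (r i : ℕ)) σ, Equiv.prod_comp σ (fun i => g i (r i))]
  push_cast
  ring

lemma TH_dup {k N : ℕ} (g : Fin k → Fin N → ℂ) (a b : Fin k) (hab : a ≠ b) (h : g a = g b) : TH g = 0 := by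
  have h3 := TH_perm g (Equiv.swap a b)
  have h4 : (fun i => g (Equiv.swap a b i)) = g := by
    funext i
    rw [Equiv.swap_apply_def]
    split_ifs with e1 e2
    · rw [e1, h]
    · rw [e2, h]
    · rfl
  rw [h4, Equiv.Perm.sign_swap hab] at h3
  push_cast at h3
  have : (2 : ℂ) * TH g = 0 := by linear_combination h3
  simpa using this

lemma MM_self {N : ℕ} (x : Fin N → ℂ) : MM x x = 0 := by
  have h : MM x x = - MM x x := by
    conv_lhs => unfold MM
    rw [Finset.sum_comm]
    unfold MM
    rw [← Finset.sum_neg_distrib]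
    apply Finset.sum_congr rfl
    intro a _
    rw [← Finset.sum_neg_distrib]
    apply Finset.sum_congr rfl
    intro b _
    have : Int.sign (((b : ℕ) : ℤ) - (a : ℕ)) = - Int.sign (((a : ℕ) : ℤ) - (b : ℕ)) := by
      rw [← Int.sign_neg]; congr 1; ring
    rw [this]; push_cast; ring
  have : (2 : ℂ) * MM x x = 0 := by linear_combination h
  simpa using this

lemma lin_sum {m N : ℕ} (g : Fin m → Fin N → ℂ) (c : Fin m → ℂ) (d : Fin N → ℂ) (hd : ∀ a, d a = ∑ i, c i * g i a)
    (K : Fin N → ℂ) : ∑ a, d a * K a = ∑ i, c i * ∑ a, g i a * K a := by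
  simp only [hd, Finset.sum_mul, Finset.mul_sum]
  rw [Finset.sum_comm]
  simp only [mul_assoc]

theorem TH_ratio {m N : ℕ} (g : Fin (m + 2) → Fin N → ℂ) (c : Fin (m + 2) → ℂ) (hc : c 0 = 0) (κ : ℂ)
    (d : Fin N → ℂ) (hd : ∀ a, d a = ∑ i, c i * g i a)
    (hM : ∀ i, i ≠ 0 → MM d (g i) = κ * ∑ b, g i b)
    (hev : Even (m + 1) → ∑ i, c i * ∑ b, g i b = 0)
    (hod : ¬ Even (m + 1) → ∑ i, c i * ∑ b, g i b ≠ 0) :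
    c 1 * TH g = - (MM d (g 0) - κ * ∑ b, g 0 b) * TH (fun i : Fin m => g i.succ.succ) := by
  set h : Fin (m + 1) → Fin N → ℂ := Fin.cons (g 0) (fun i => g i.succ.succ) with hh
  have h0 : h 0 = g 0 := rfl
  have hs : ∀ i : Fin m, h i.succ = g i.succ.succ := fun i => by rw [hh, Fin.cons_succ]
  -- left side
  have hL : TH (Fin.cons d h : Fin (m + 2) → Fin N → ℂ) = - c 1 * TH g := by
    have lin : TH (Fin.cons d h : Fin (m + 2) → Fin N → ℂ) = ∑ i, c i * TH (Fin.cons (g i) h : Fin (m + 2) → Fin N → ℂ) := by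
      simp only [TH_cons]
      exact lin_sum g c d hd _
    rw [lin, Finset.sum_eq_single 1]
    · have e : (Fin.cons (g 1) h : Fin (m + 2) → Fin N → ℂ) = fun i => g (Equiv.swap 0 1 i) := by
        funext i
        refine Fin.cases ?_ ?_ i
        · rw [Fin.cons_zero, Equiv.swap_apply_left]
        · intro j
          rw [Fin.cons_succ]
          refine Fin.cases ?_ ?_ j
          · rw [h0]
            have : (Fin.succ 0 : Fin (m + 2)) = 1 := rfl
            rw [this, Equiv.swap_apply_right]
          · intro l
            rw [hs, Equiv.swap_apply_of_ne_of_ne (Fin.succ_ne_zero _)]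
            intro hl
            have : (l.succ.succ : ℕ) = 1 := by rw [hl]; rfl
            simp at this
      rw [e, TH_perm, Equiv.Perm.sign_swap (by simp)]
      push_cast; ring
    · intro i _ hi
      by_cases hi0 : i = 0
      · rw [hi0, hc, zero_mul]
      · obtain ⟨j, rfl⟩ := Fin.exists_succ_eq.2 hi0
        have hj : j ≠ 0 := by
          rintro rfl; exact hi rfl
        obtain ⟨l, rfl⟩ := Fin.exists_succ_eq.2 hj
        rw [TH_dup _ 0 l.succ.succ (Fin.succ_ne_zero _).symm (by rw [Fin.cons_zero, Fin.cons_succ, hs]), mul_zero]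
    · intro h; exact absurd (Finset.mem_univ _) h
  have hR := TH_expand d h
  rw [hL] at hR
  have hMh : ∀ p : Fin m, MM d (h p.succ) = κ * ∑ b, h p.succ b := by
    intro p
    rw [hs]
    exact hM _ (Fin.succ_ne_zero _)
  have hT0 : TH (fun i : Fin m => h (Equiv.swap 0 0 i.succ)) = TH (fun i : Fin m => g i.succ.succ) := by
    simp [hs]
  have hsplit : ∑ p : Fin (m + 1), (if p = 0 then 1 else -1) * MM d (h p) * TH (fun i : Fin m => h (Equiv.swap 0 p i.succ)) =
      (MM d (g 0) - κ * ∑ b, g 0 b) * TH (fun i : Fin m => g i.succ.succ) +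
      κ * ∑ p : Fin (m + 1), (if p = 0 then 1 else -1) * (∑ b, h p b) * TH (fun i : Fin m => h (Equiv.swap 0 p i.succ)) := by
    rw [Fin.sum_univ_succ, Fin.sum_univ_succ (f := fun p : Fin (m + 1) => (if p = 0 then (1 : ℂ) else -1) * (∑ b, h p b) * TH (fun i : Fin m => h (Equiv.swap 0 p i.succ))), mul_add, Finset.mul_sum (s := (Finset.univ : Finset (Fin m))), hT0, h0]
    have : ∀ p : Fin m, (if p.succ = 0 then (1 : ℂ) else -1) * MM d (h p.succ) * TH (fun i : Fin m => h (Equiv.swap 0 p.succ i.succ)) =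
        κ * ((if p.succ = 0 then (1 : ℂ) else -1) * (∑ b, h p.succ b) * TH (fun i : Fin m => h (Equiv.swap 0 p.succ i.succ))) := by
      intro p; rw [hMh]; ring
    rw [Finset.sum_congr rfl (fun p _ => this p)]
    simp only [if_true]
    ring
  have hd' : ∑ a, d a = ∑ i, c i * ∑ b, g i b := by
    simp only [hd, Finset.mul_sum]
    rw [Finset.sum_comm]
  rw [hsplit] at hR
  by_cases hm : Even (m + 1)
  · rw [TH_one hm, if_pos hm, hd', hev hm] at hR
    linear_combination -hR
  · have hMdd : MM d d = κ * ∑ i, c i * ∑ b, g i b := by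
      have : MM d d = ∑ i, c i * MM d (g i) := by
        have : ∀ z : Fin N → ℂ, MM d z = ∑ b : Fin N, z b * ∑ a : Fin N, (Int.sign (((a : ℕ) : ℤ) - (b : ℕ)) : ℂ) * d a := by
          intro z
          unfold MM
          rw [Finset.sum_comm]
          apply Finset.sum_congr rfl
          intro b _
          rw [Finset.mul_sum]
          apply Finset.sum_congr rfl
          intro a _
          ring
        rw [this d]
        simp only [this (g _)]
        exact lin_sum g c d hd _
      rw [this, Finset.mul_sum]
      apply Finset.sum_congr rfl
      intro i _
      by_cases hi : i = 0
      · rw [hi, hc]; ring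
      · rw [hM i hi]; ring
    rw [MM_self] at hMdd
    have hκ : κ = 0 := by
      rcases mul_eq_zero.1 hMdd.symm with h | h
      · exact h
      · exact absurd h (hod hm)
    rw [if_neg hm, hκ] at hR
    rw [hκ]
    linear_combination -hR

end LP

namespace LP

/-! ### Part R: evaluation of the antisymmetric form on the rows -/

/-- inverse factorial -/
def IF (z : ℤ) : ℚ := if 0 ≤ z then ((Nat.factorial z.toNat : ℕ) : ℚ)⁻¹ else 0

lemma IF_neg {z : ℤ} (h : z < 0) : IF z = 0 := by
  unfold IF; rw [if_neg (not_le.2 h)]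

lemma IF_nat (a : ℕ) : IF a = ((Nat.factorial a : ℕ) : ℚ)⁻¹ := by
  unfold IF; rw [if_pos (by positivity), Int.toNat_natCast]

lemma IF_rec (z : ℤ) : (z : ℚ) * IF z = IF (z - 1) := by
  rcases lt_trichotomy z 0 with h | h | h
  · rw [IF_neg h, IF_neg (by omega), mul_zero]
  · subst h; rw [IF_neg (z := 0 - 1) (by omega)]; simp
  · obtain ⟨a, rfl⟩ : ∃ a : ℕ, z = ((a + 1 : ℕ) : ℤ) := ⟨z.toNat - 1, by omega⟩
    rw [IF_nat]
    have : (((a + 1 : ℕ) : ℤ) - 1) = (a : ℕ) := by push_cast; ring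
    rw [this, IF_nat, Nat.factorial_succ]
    have h1 : ((a : ℚ) + 1) ≠ 0 := by positivity
    have h2 : ((Nat.factorial a : ℕ) : ℚ) ≠ 0 := by exact_mod_cast (Nat.factorial_pos a).ne'
    push_cast
    field_simp

lemma IF_choose (N a : ℕ) : (N.choose a : ℚ) = (Nat.factorial N : ℚ) * IF a * IF ((N : ℤ) - a) := by
  by_cases h : a ≤ N
  · have : (N : ℤ) - a = ((N - a : ℕ) : ℤ) := by omega
    rw [this, IF_nat, IF_nat, Nat.cast_choose ℚ h]
    field_simp
  · rw [Nat.choose_eq_zero_of_lt (by omega), IF_neg (z := (N : ℤ) - a) (by omega)]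
    simp

/-- the weights -/
def Wt (i j : ℕ) : ℚ := (Nat.factorial (i + j + 1) : ℚ) * IF (2 * (i : ℤ) - j) * IF (2 * (j : ℤ) - i + 2)

/-- the rows as polynomials -/
noncomputable def ff (m j : ℕ) : Polynomial ℂ := Polynomial.X ^ (2 * (m - j)) * (1 + Polynomial.X) ^ j

/-- the rows -/
noncomputable def FV (m j : ℕ) : Fin (2 * m + 1) → ℂ := fun r => (ff m j).coeff (r : ℕ)

lemma ff_deg (m j : ℕ) (hj : j ≤ m) : (ff m j).natDegree < 2 * m + 1 := by
  unfold ff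
  have h1 : (Polynomial.X ^ (2 * (m - j)) * (1 + Polynomial.X : Polynomial ℂ) ^ j).natDegree ≤ 2 * (m - j) + j * 1 := by
    refine (Polynomial.natDegree_mul_le).trans (add_le_add ?_ ?_)
    · simp
    · refine (Polynomial.natDegree_pow_le).trans ?_
      gcongr
      rw [add_comm]
      exact (Polynomial.natDegree_X_add_C (1 : ℂ)).le
  omega

lemma FV_eps (m j : ℕ) (hj : j ≤ m) : ∑ b, FV m j b = 2 ^ j := by
  have h := Polynomial.eval_eq_sum_range' (ff_deg m j hj) (1 : ℂ)
  simp only [one_pow, mul_one] at h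
  unfold FV
  rw [Fin.sum_univ_eq_sum_range (fun r => (ff m j).coeff r), ← h]
  simp [ff]; norm_num

lemma parts (h : Polynomial ℂ) (r : ℕ) : ∀ K : ℕ, ∑ s ∈ Finset.range (K + 1), (Int.sign ((r : ℤ) - s) : ℂ) * ((1 - Polynomial.X) * h).coeff s =
    if K < r then h.coeff K else if K = r then (Polynomial.X * h).coeff r else ((1 + Polynomial.X) * h).coeff r - h.coeff K := by
  have hc : ∀ s, ((1 - Polynomial.X) * h).coeff (s + 1) = h.coeff (s + 1) - h.coeff s := by
    intro s; rw [sub_mul, one_mul, Polynomial.coeff_sub, Polynomial.coeff_X_mul]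
  intro K
  induction K with
  | zero =>
    rw [Finset.sum_range_one]
    rcases Nat.eq_zero_or_pos r with h0 | h0
    · subst h0; simp
    · rw [if_pos h0]
      have : Int.sign ((r : ℤ) - (0 : ℕ)) = 1 := by apply Int.sign_eq_one_of_pos; omega
      rw [this, sub_mul, one_mul, Polynomial.coeff_sub]; simp
  | succ K ih =>
    rw [Finset.sum_range_succ, ih, hc]
    rcases lt_trichotomy (K + 1) r with h1 | h1 | h1
    · rw [if_pos (by omega), if_pos h1]
      have : Int.sign ((r : ℤ) - (K + 1 : ℕ)) = 1 := by apply Int.sign_eq_one_of_pos; omega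
      rw [this]; push_cast; ring
    · rw [if_pos (by omega), if_neg (by omega), if_pos h1, ← h1, Polynomial.coeff_X_mul]
      simp
    · have : Int.sign ((r : ℤ) - (K + 1 : ℕ)) = -1 := by apply Int.sign_eq_neg_one_of_neg; omega
      rw [this, if_neg (show ¬ K < r by omega), if_neg (show ¬ K + 1 < r by omega), if_neg (show ¬ K + 1 = r by omega)]
      by_cases h2 : K = r
      · rw [if_pos h2, h2, add_mul, one_mul, Polynomial.coeff_add]; push_cast; ring
      · rw [if_neg h2]; push_cast; ring

lemma parts' (m : ℕ) (h : Polynomial ℂ) (h0 : h.coeff (2 * m) = 0) (r : ℕ) (hr : r ≤ 2 * m) :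
    ∑ s ∈ Finset.range (2 * m + 1), (Int.sign ((r : ℤ) - s) : ℂ) * ((1 - Polynomial.X) * h).coeff s = ((1 + Polynomial.X) * h).coeff r := by
  rw [parts, if_neg (by omega), h0]
  split_ifs with h1
  · rw [add_mul, one_mul, Polynomial.coeff_add, ← h1, h0, zero_add]
  · rw [sub_zero]

lemma ff_refl (m i r : ℕ) (hi : i ≤ m) (hr : r ≤ 2 * m) :
    (ff m i).coeff r = (Polynomial.X ^ i * (1 + Polynomial.X) ^ i : Polynomial ℂ).coeff (2 * m - r) := by
  unfold ff
  rw [Polynomial.coeff_X_pow_mul', Polynomial.coeff_X_pow_mul']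
  simp only [Polynomial.coeff_one_add_X_pow]
  by_cases h1 : 2 * (m - i) ≤ r
  · rw [if_pos h1]
    by_cases h2 : i ≤ 2 * m - r
    · rw [if_pos h2]
      have : r - 2 * (m - i) = i - (2 * m - r - i) := by omega
      rw [this, Nat.choose_symm (by omega)]
    · rw [if_neg h2, Nat.choose_eq_zero_of_lt (by omega)]; simp
  · rw [if_neg h1]
    split_ifs with h2
    · rw [Nat.choose_eq_zero_of_lt (by omega)]; simp
    · rfl

lemma ff_pair (m i : ℕ) (hi : i ≤ m) (w : Polynomial ℂ) : ∑ r ∈ Finset.range (2 * m + 1), (ff m i).coeff r * w.coeff r =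
    (Polynomial.X ^ i * (1 + Polynomial.X) ^ i * w).coeff (2 * m) := by
  rw [mul_comm (Polynomial.X ^ i * (1 + Polynomial.X) ^ i) w, Polynomial.coeff_mul, Finset.Nat.sum_antidiagonal_eq_sum_range_succ (fun a b => w.coeff a * (Polynomial.X ^ i * (1 + Polynomial.X) ^ i : Polynomial ℂ).coeff b)]
  apply Finset.sum_congr rfl
  intro r hr
  rw [Finset.mem_range] at hr
  rw [ff_refl m i r hi (by omega), mul_comm]

lemma MM_lin_right {N : ℕ} (x y z : Fin N → ℂ) (a : ℂ) : MM x y - a * MM x z = MM x (fun b => y b - a * z b) := by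
  unfold MM
  rw [Finset.mul_sum, ← Finset.sum_sub_distrib]
  apply Finset.sum_congr rfl
  intro b _
  rw [Finset.mul_sum, ← Finset.sum_sub_distrib]
  apply Finset.sum_congr rfl
  intro c _
  ring

lemma MM_parts (m i : ℕ) (hi : i ≤ m) (h : Polynomial ℂ) (h0 : h.coeff (2 * m) = 0) :
    ∑ a : Fin (2 * m + 1), ∑ b : Fin (2 * m + 1), (Int.sign (((a : ℕ) : ℤ) - (b : ℕ)) : ℂ) * FV m i a * ((1 - Polynomial.X) * h).coeff (b : ℕ) =
      (Polynomial.X ^ i * (1 + Polynomial.X) ^ i * ((1 + Polynomial.X) * h)).coeff (2 * m) := by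
  have h3 := Fin.sum_univ_eq_sum_range (fun a : ℕ => (ff m i).coeff a * ((1 + Polynomial.X) * h : Polynomial ℂ).coeff a) (2 * m + 1)
  rw [← ff_pair m i hi, ← h3]
  apply Finset.sum_congr rfl
  intro a _
  have h1 := parts' m h h0 a (by have := a.2; omega)
  have h2 := Fin.sum_univ_eq_sum_range (fun s : ℕ => ((Int.sign (((a : ℕ) : ℤ) - (s : ℤ)) : ℤ) : ℂ) * ((1 - Polynomial.X) * h : Polynomial ℂ).coeff s) (2 * m + 1)
  rw [← h1, ← h2, Finset.mul_sum]
  apply Finset.sum_congr rfl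
  intro b _
  unfold FV; ring

theorem MM_D (m i j : ℕ) (hi : i ≤ m) (hj : j + 1 ≤ m) :
    MM (FV m i) (FV m (j + 1)) - 2 * MM (FV m i) (FV m j) = (((3 * j + 4) * Wt i j : ℚ) : ℂ) := by
  obtain ⟨q, rfl⟩ : ∃ q, m = j + 1 + q := ⟨m - (j + 1), by omega⟩
  set m := j + 1 + q with hm
  rw [MM_lin_right]
  set h : Polynomial ℂ := Polynomial.X ^ (2 * q) * (1 + Polynomial.X) ^ j * (1 + 2 * Polynomial.X) with hh
  have e1 : ff m (j + 1) - 2 * ff m j = (1 - Polynomial.X) * h := by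
    unfold ff
    have a1 : m - (j + 1) = q := by omega
    have a2 : m - j = q + 1 := by omega
    rw [a1, a2, hh]; ring
  have e2 : (fun b => FV m (j + 1) b - 2 * FV m j b) = fun b : Fin (2 * m + 1) => ((1 - Polynomial.X) * h).coeff (b : ℕ) := by
    funext b
    rw [← e1]
    unfold FV
    have : (2 : Polynomial ℂ) = Polynomial.C 2 := rfl
    rw [Polynomial.coeff_sub, this, Polynomial.coeff_C_mul]
  have h0 : h.coeff (2 * m) = 0 := by
    rw [hh, mul_assoc, Polynomial.coeff_X_pow_mul', if_pos (by omega)]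
    apply Polynomial.coeff_eq_zero_of_natDegree_lt
    have h1 : ((1 + Polynomial.X : Polynomial ℂ) ^ j * (1 + 2 * Polynomial.X)).natDegree ≤ j * 1 + 1 := by
      refine (Polynomial.natDegree_mul_le).trans (add_le_add ?_ ?_)
      · refine (Polynomial.natDegree_pow_le).trans ?_
        gcongr
        rw [add_comm]
        exact (Polynomial.natDegree_X_add_C (1 : ℂ)).le
      · compute_degree
    omega
  rw [e2]
  unfold MM
  rw [MM_parts m i hi h h0]
  have e4 : (Polynomial.X ^ i * (1 + Polynomial.X) ^ i * ((1 + Polynomial.X) * h) : Polynomial ℂ) =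
      Polynomial.X ^ (i + 2 * q) * ((1 + Polynomial.X) ^ (i + j + 1) + Polynomial.C 2 * ((1 + Polynomial.X) ^ (i + j + 1) * Polynomial.X)) := by
    rw [hh]
    have : (Polynomial.C 2 : Polynomial ℂ) = 2 := rfl
    rw [this]; ring
  rw [e4, Polynomial.coeff_X_pow_mul']
  by_cases hij : i ≤ 2 * j + 2
  · rw [if_pos (by omega)]
    have a1 : 2 * m - (i + 2 * q) = 2 * j + 2 - i := by omega
    rw [a1, Polynomial.coeff_add, Polynomial.coeff_C_mul, Polynomial.coeff_one_add_X_pow]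
    have b1 : (((i + j + 1).choose (2 * j + 2 - i) : ℕ) : ℚ) = (2 * i - j) * Wt i j := by
      rw [IF_choose]
      unfold Wt
      have c1 : ((2 * j + 2 - i : ℕ) : ℤ) = 2 * (j : ℤ) - i + 2 := by omega
      have c2 : ((i + j + 1 : ℕ) : ℤ) - (2 * (j : ℤ) - i + 2) = (2 * (i : ℤ) - j) - 1 := by push_cast; ring
      rw [c1, c2, ← IF_rec]; push_cast; ring
    have b2 : ((1 + Polynomial.X) ^ (i + j + 1) * Polynomial.X : Polynomial ℂ).coeff (2 * j + 2 - i) = (((2 * j + 2 - i) * Wt i j : ℚ) : ℂ) := by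
      by_cases hij2 : i = 2 * j + 2
      · have : 2 * j + 2 - i = 0 := by omega
        rw [this, hij2]
        simp
      · obtain ⟨t, ht⟩ : ∃ t, 2 * j + 2 - i = t + 1 := ⟨2 * j + 1 - i, by omega⟩
        rw [ht, Polynomial.coeff_mul_X, Polynomial.coeff_one_add_X_pow]
        have c0 : (((i + j + 1).choose t : ℕ) : ℚ) = (2 * j + 2 - i) * Wt i j := by
          rw [IF_choose]
          unfold Wt
          have c1 : (t : ℤ) = (2 * (j : ℤ) - i + 2) - 1 := by omega
          have c2 : ((i + j + 1 : ℕ) : ℤ) - t = (2 * (i : ℤ) - j) := by omega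
          rw [c2, c1, ← IF_rec]; push_cast; ring
        rw [← c0]; norm_cast
    rw [b2]
    have b3 : (((i + j + 1).choose (2 * j + 2 - i) : ℕ) : ℂ) = (((2 * i - j) * Wt i j : ℚ) : ℂ) := by
      rw [← b1]; norm_cast
    rw [b3]
    push_cast; ring
  · rw [if_neg (by omega)]
    unfold Wt
    rw [IF_neg (z := 2 * (j : ℤ) - i + 2) (by omega)]
    simp

/-- the minors sums -/
noncomputable def YY (m k p : ℕ) : ℂ := TH (fun i : Fin k => FV m (p + i))

lemma MM_lin_left {k N : ℕ} (g : Fin k → Fin N → ℂ) (c : Fin k → ℂ) (d : Fin N → ℂ) (hd : ∀ a, d a = ∑ i, c i * g i a) (z : Fin N → ℂ) :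
    MM d z = ∑ i, c i * MM (g i) z := by
  have : ∀ x : Fin N → ℂ, MM x z = ∑ a : Fin N, x a * ∑ b : Fin N, (Int.sign (((a : ℕ) : ℤ) - (b : ℕ)) : ℂ) * z b := by
    intro x
    unfold MM
    apply Finset.sum_congr rfl
    intro a _
    rw [Finset.mul_sum]
    apply Finset.sum_congr rfl
    intro b _
    ring
  simp only [this]
  exact lin_sum g c d hd _

lemma sum_conv (k p : ℕ) (c F : ℕ → ℂ) : ∑ i : Fin (k + 2), (if i = 0 then 0 else c (p + i)) * F (p + i) =
    ∑ i ∈ Finset.Ico (p + 1) (p + k + 2), c i * F i := by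
  rw [Fin.sum_univ_succ, Finset.sum_Ico_eq_sum_range]
  simp only [if_true, zero_mul, zero_add, Fin.succ_ne_zero, if_false, Fin.val_succ]
  have : p + k + 2 - (p + 1) = k + 1 := by omega
  rw [this, ← Fin.sum_univ_eq_sum_range (fun i => c (p + 1 + i) * F (p + 1 + i))]
  apply Finset.sum_congr rfl
  intro i _
  have : p + ((i : ℕ) + 1) = p + 1 + i := by ring
  rw [this]

theorem YY_ratio (m k p : ℕ) (hm : m + 1 = p + k + 2) (c : ℕ → ℚ)
    (h1 : ∀ j, p + 1 ≤ j → j + 1 ≤ m → ∑ i ∈ Finset.Ico (p + 1) (m + 1), c i * Wt i j = 0)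
    (hev : Even (k + 1) → ∑ i ∈ Finset.Ico (p + 1) (m + 1), c i * 2 ^ i = 0)
    (hod : ¬ Even (k + 1) → ∑ i ∈ Finset.Ico (p + 1) (m + 1), c i * 2 ^ i ≠ 0) :
    (c (p + 1) : ℂ) * YY m (k + 2) p =
      (((3 * p + 4) / 2 * ∑ i ∈ Finset.Ico (p + 1) (m + 1), c i * Wt i p : ℚ) : ℂ) * YY m k (p + 2) := by
  set g : Fin (k + 2) → Fin (2 * m + 1) → ℂ := fun i => FV m (p + i) with hg
  set c' : Fin (k + 2) → ℂ := fun i => if i = 0 then 0 else (c (p + i) : ℂ) with hc'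
  set d : Fin (2 * m + 1) → ℂ := fun a => ∑ i, c' i * g i a with hd
  have hconv : ∀ F : ℕ → ℚ, ∑ i : Fin (k + 2), c' i * (F (p + i) : ℂ) = ((∑ i ∈ Finset.Ico (p + 1) (m + 1), c i * F i : ℚ) : ℂ) := by
    intro F
    have := sum_conv k p (fun i => (c i : ℂ)) (fun i => (F i : ℂ))
    rw [hm]
    push_cast
    exact this
  have heps : ∀ i : Fin (k + 2), ∑ b, g i b = 2 ^ (p + (i : ℕ)) := fun i => FV_eps m _ (by have := i.2; omega)
  have hD : ∀ j, j + 1 ≤ m → MM d (FV m (j + 1)) - 2 * MM d (FV m j) = ((∑ i ∈ Finset.Ico (p + 1) (m + 1), c i * ((3 * j + 4) * Wt i j) : ℚ) : ℂ) := by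
    intro j hj
    rw [MM_lin_left g c' d (fun _ => rfl), MM_lin_left g c' d (fun _ => rfl), ← hconv (fun i => (3 * j + 4) * Wt i j), Finset.mul_sum, ← Finset.sum_sub_distrib]
    apply Finset.sum_congr rfl
    intro i _
    rw [← MM_D m (p + i) j (by have := i.2; omega) hj]
    ring
  have hD0 : ∀ j, p + 1 ≤ j → j + 1 ≤ m → MM d (FV m (j + 1)) = 2 * MM d (FV m j) := by
    intro j hj hj2
    have e : ∑ i ∈ Finset.Ico (p + 1) (m + 1), c i * ((3 * j + 4) * Wt i j) = (3 * j + 4) * ∑ i ∈ Finset.Ico (p + 1) (m + 1), c i * Wt i j := by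
      rw [Finset.mul_sum]; apply Finset.sum_congr rfl; intro i _; ring
    have := hD j hj2
    rw [e, h1 j hj hj2] at this
    simp at this
    linear_combination this
  set κ : ℂ := MM d (FV m (p + 1)) / 2 ^ (p + 1) with hκ
  have hκ' : ∀ t, p + 1 + t ≤ m → MM d (FV m (p + 1 + t)) = κ * 2 ^ (p + 1 + t) := by
    intro t
    induction t with
    | zero => intro _; rw [hκ]; simp
    | succ t ih =>
      intro ht
      rw [← add_assoc, hD0 _ (by omega) (by omega), ih (by omega)]
      ring
  have hS : ∑ i, c' i * ∑ b, g i b = ((∑ i ∈ Finset.Ico (p + 1) (m + 1), c i * 2 ^ i : ℚ) : ℂ) := by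
    rw [← hconv (fun i => 2 ^ i)]
    apply Finset.sum_congr rfl
    intro i _
    rw [heps]; push_cast; rfl
  have main := TH_ratio g c' (by simp [hc']) κ d (fun _ => rfl) ?_ ?_ ?_
  · have hc1 : c' 1 = (c (p + 1) : ℂ) := by
      rw [hc']; simp
    have hg0 : g 0 = FV m p := by rw [hg]; simp
    have hYY : (fun i : Fin k => g i.succ.succ) = fun i : Fin k => FV m (p + 2 + i) := by
      funext i
      rw [hg]
      simp only [Fin.val_succ]
      congr 1; ring
    rw [hc1, hg0, hYY, FV_eps m p (by omega)] at main
    have hx := hD p (by omega)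
    have e : ∑ i ∈ Finset.Ico (p + 1) (m + 1), c i * ((3 * p + 4) * Wt i p) = (3 * p + 4) * ∑ i ∈ Finset.Ico (p + 1) (m + 1), c i * Wt i p := by
      rw [Finset.mul_sum]; apply Finset.sum_congr rfl; intro i _; ring
    rw [e] at hx
    have hk0 := hκ' 0 (by omega)
    rw [add_zero] at hk0
    unfold YY
    rw [main]
    congr 1
    push_cast at hx ⊢
    rw [hk0, pow_succ] at hx
    linear_combination (1 / 2 : ℂ) * hx
  · intro i hi
    rw [heps]
    obtain ⟨j, rfl⟩ := Fin.exists_succ_eq.2 hi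
    have := hκ' j (by have := j.2; omega)
    have e : p + ((j.succ : Fin (k + 2)) : ℕ) = p + 1 + j := by rw [Fin.val_succ]; ring
    rw [hg]
    simp only [e]
    exact this
  · intro h; rw [hS, hev h]; simp
  · intro h; rw [hS]; exact_mod_cast hod h

theorem ZZ_YY (m p k : ℕ) (hm : m + 1 = k + p) : ZZ ℂ (m + 1) p k = YY m k p := by
  rw [ZZ_TH m p k hm]
  unfold YY FV
  congr 1
  funext i r
  unfold fpoly ff
  have : ((i.rev : Fin k) : ℕ) = m - (p + i) := by rw [Fin.val_rev]; omega
  rw [this, mul_comm]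

end LP

namespace LP

lemma tele (H f : ℕ → ℚ) (a b : ℕ) (hab : a ≤ b) (h : ∀ i, a ≤ i → i < b → H (i + 1) - H i = f i) :
    ∑ i ∈ Finset.Ico a b, f i = H b - H a := by
  induction b, hab using Nat.le_induction with
  | base => simp
  | succ b hb ih =>
    rw [Finset.sum_Ico_succ_top hb, ih (fun i h1 h2 => h i h1 (by omega)), ← h b hb (by omega)]; ring

/-- hypergeometric coefficients -/
def ch (a b : ℚ) (n : ℕ) : ℕ → ℚ
  | 0 => 1
  | i + 1 => ch a b n i * (-(2 * i + a) * 4 * ((n : ℚ) ^ 2 - (i + 1) ^ 2)) / ((2 * i + b) * (4 * (n : ℚ) ^ 2 - (i + 1) ^ 2))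

lemma ch_zero (a b : ℚ) (n i : ℕ) (hi : n ≤ i) (hn : 0 < n) : ch a b n i = 0 := by
  induction i, hi using Nat.le_induction with
  | base =>
    obtain ⟨k, rfl⟩ : ∃ k, n = k + 1 := ⟨n - 1, by omega⟩
    rw [ch]; push_cast; simp
  | succ i hi ih => rw [ch, ih]; simp

lemma den_ne (n i : ℕ) (hi : i < 2 * n) : (4 * (n : ℚ) ^ 2 - (i : ℚ) ^ 2) ≠ 0 := by
  have h1 : (i : ℚ) < 2 * n := by exact_mod_cast hi
  have h2 : (0 : ℚ) ≤ i := by positivity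
  nlinarith

lemma ch_rec (a b : ℚ) (hb : 0 < b) (n i : ℕ) (hi : i + 1 < 2 * n) :
    ch a b n (i + 1) * ((2 * i + b) * (4 * (n : ℚ) ^ 2 - (i + 1) ^ 2)) = ch a b n i * (-(2 * i + a) * 4 * ((n : ℚ) ^ 2 - (i + 1) ^ 2)) := by
  have h1 := den_ne n (i + 1) hi
  push_cast at h1
  have h2 : (2 * (i : ℚ) + b) ≠ 0 := by positivity
  rw [ch, div_mul_cancel₀ _ (mul_ne_zero h2 h1)]

/-- the basic summand -/
def BB (a b : ℚ) (n j i : ℕ) : ℚ := ch a b n i * (Nat.factorial (i + j + 1) : ℚ) * IF (2 * (i : ℤ) - j) * IF (2 * (j : ℤ) - i + 4)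

lemma Wt_one (i j : ℕ) : Wt i j = (2 * j + 4 - i) * (2 * j + 3 - i) * ((Nat.factorial (i + j + 1) : ℚ) * IF (2 * (i : ℤ) - j) * IF (2 * (j : ℤ) - i + 4)) := by
  unfold Wt
  have h1 := IF_rec (2 * (j : ℤ) - i + 4)
  have h2 := IF_rec (2 * (j : ℤ) - i + 4 - 1)
  have e : 2 * (j : ℤ) - i + 4 - 1 - 1 = 2 * (j : ℤ) - i + 2 := by ring
  rw [e] at h2
  rw [← h2, ← h1]; push_cast; ring

lemma Wt_two (i j : ℕ) : Wt i (j + 1) = (i + j + 2) * (2 * i - j) * ((Nat.factorial (i + j + 1) : ℚ) * IF (2 * (i : ℤ) - j) * IF (2 * (j : ℤ) - i + 4)) := by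
  unfold Wt
  have h1 := IF_rec (2 * (i : ℤ) - j)
  have e : 2 * (i : ℤ) - ((j + 1 : ℕ) : ℤ) = 2 * (i : ℤ) - j - 1 := by push_cast; ring
  have e2 : 2 * ((j + 1 : ℕ) : ℤ) - i + 2 = 2 * (j : ℤ) - i + 4 := by push_cast; ring
  have e3 : i + (j + 1) + 1 = (i + j + 1) + 1 := by ring
  rw [e, e2, ← h1, e3, Nat.factorial_succ (i + j + 1)]
  push_cast; ring

lemma BB_rec (a b : ℚ) (hb : 0 < b) (n j i : ℕ) (hi : i + 1 < 2 * n) :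
    ((2 * i + b) * (4 * (n : ℚ) ^ 2 - (i + 1) ^ 2) * (2 * i + 2 - j) * (2 * i + 1 - j)) * BB a b n j (i + 1) =
    (-4 * (2 * i + a) * ((n : ℚ) ^ 2 - (i + 1) ^ 2) * (i + j + 2) * (2 * j + 4 - i)) * BB a b n j i := by
  unfold BB
  have h0 := ch_rec a b hb n i hi
  have h1 := IF_rec (2 * (i : ℤ) - j + 2)
  have h2 := IF_rec (2 * (i : ℤ) - j + 2 - 1)
  have h3 := IF_rec (2 * (j : ℤ) - i + 4)
  have e : 2 * (i : ℤ) - j + 2 - 1 - 1 = 2 * (i : ℤ) - j := by ring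
  rw [e] at h2
  have e2 : 2 * ((i + 1 : ℕ) : ℤ) - j = 2 * (i : ℤ) - j + 2 := by push_cast; ring
  have e3 : 2 * (j : ℤ) - ((i + 1 : ℕ) : ℤ) + 4 = 2 * (j : ℤ) - i + 4 - 1 := by push_cast; ring
  have e4 : i + 1 + j + 1 = (i + j + 1) + 1 := by ring
  rw [e2, e3, ← h3, e4, Nat.factorial_succ (i + j + 1)]
  rw [← h2, ← h1]
  push_cast
  linear_combination ((i + j + 2 : ℚ) * (Nat.factorial (i + j + 1) : ℚ) * (2 * i + 2 - j) * (2 * i + 1 - j) * IF (2 * (i : ℤ) - j + 2) * (2 * j + 4 - i) * IF (2 * (j : ℤ) - i + 4)) * h0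

/-- the coefficients for the first step -/
def c0 (n i : ℕ) : ℚ := (3 * i + 2) * ch 1 4 n i

/-- the coefficients for the second step -/
def c2 (n i : ℕ) : ℚ := (3 * i + 2) * (i - 2) * ((n : ℚ) ^ 2 * (2 * i ^ 2 + 13 * i + 33) - (8 * i ^ 2 + 7 * i - 3)) * ch (-1) 8 n i

/-- the certificate for the first recurrence -/
def xa (N i j : ℚ) : ℚ :=
  (N ^ 0 * ((-15480) * j ^ 0 + (-27402) * j ^ 1 + (-17901) * j ^ 2 + (-5103) * j ^ 3 + (-534) * j ^ 4) +
    N ^ 1 * ((-51120) * j ^ 0 + (-84444) * j ^ 1 + (-49302) * j ^ 2 + (-11826) * j ^ 3 + (-948) * j ^ 4) +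
    N ^ 2 * ((14760) * j ^ 0 + (10758) * j ^ 1 + (3699) * j ^ 2 + (1377) * j ^ 3 + (186) * j ^ 4)) * i ^ 0 +
  (N ^ 0 * ((4500) * j ^ 0 + (7761) * j ^ 1 + (9801/2) * j ^ 2 + (2673/2) * j ^ 3 + (132) * j ^ 4) +
    N ^ 1 * ((360) * j ^ 0 + (912) * j ^ 1 + (396) * j ^ 2 + (-27) * j ^ 3 + (-21) * j ^ 4) +
    N ^ 2 * ((-540) * j ^ 0 + (-249) * j ^ 1 + (-9/2) * j ^ 2 + (-27/2) * j ^ 3 + (-3) * j ^ 4)) * i ^ 1 +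
  (N ^ 0 * ((10080) * j ^ 0 + (17565) * j ^ 1 + (22275/2) * j ^ 2 + (6075/2) * j ^ 3 + (300) * j ^ 4) +
    N ^ 1 * ((2700) * j ^ 0 + (4380) * j ^ 1 + (2115) * j ^ 2 + (270) * j ^ 3 + (-15) * j ^ 4) +
    N ^ 2 * ((-1980) * j ^ 0 + (-885) * j ^ 1 + (-45/2) * j ^ 2 + (-135/2) * j ^ 3 + (-15) * j ^ 4)) * i ^ 2 +
  (N ^ 0 * ((-3420) * j ^ 0 + (-5718) * j ^ 1 + (-3564) * j ^ 2 + (-972) * j ^ 3 + (-96) * j ^ 4) +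
    N ^ 1 * ((1620) * j ^ 0 + (1644) * j ^ 1 + (927) * j ^ 2 + (351) * j ^ 3 + (48) * j ^ 4) +
    N ^ 2 * ((-360) * j ^ 0 + (-138) * j ^ 1 + (-9) * j ^ 2 + (-27) * j ^ 3 + (-6) * j ^ 4)) * i ^ 3

/-- the certificate for the second recurrence -/
def xb (n i : ℚ) : ℚ :=
  ((-48) * n ^ 0 + (-224) * n ^ 1 + (-353) * n ^ 2 + (-132) * n ^ 3 + (155) * n ^ 4 + (62) * n ^ 5) * i ^ 0 +
  ((24) * n ^ 0 + (89/2) * n ^ 1 + (-11) * n ^ 2 + (-9) * n ^ 3 + (-5/2) * n ^ 4 + (-1) * n ^ 5) * i ^ 1 +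
  ((105/2) * n ^ 0 + (205/2) * n ^ 1 + (-10) * n ^ 2 + (-15) * n ^ 3 + (-25/2) * n ^ 4 + (-5) * n ^ 5) * i ^ 2 +
  ((-39/2) * n ^ 0 + (-31) * n ^ 1 + (23) * n ^ 2 + (12) * n ^ 3 + (-5) * n ^ 4 + (-2) * n ^ 5) * i ^ 3


lemma BB_zero (a b : ℚ) (n j i : ℕ) (hi : n ≤ i) (hn : 0 < n) : BB a b n j i = 0 := by
  unfold BB; rw [ch_zero a b n i hi hn]; ring

lemma BB_start (a b : ℚ) (n j i : ℕ) (hi : 2 * i < j + 2) : (2 * (i : ℚ) - j) * (2 * i - j - 1) * BB a b n j i = 0 := by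
  by_cases h1 : 2 * i < j
  · unfold BB; rw [IF_neg (z := 2 * (i : ℤ) - j) (by omega)]; ring
  · rcases (by omega : 2 * i = j ∨ 2 * i = j + 1) with h | h
    · have : (j : ℚ) = 2 * i := by exact_mod_cast h.symm
      rw [this]; ring
    · have : (j : ℚ) = 2 * i - 1 := by rw [eq_sub_iff_add_eq]; exact_mod_cast h.symm
      rw [this]; ring

theorem rec0 (n j : ℕ) (hn : 2 ≤ n) (hj : 1 ≤ j) :
    2 * (j + 1) * (4 * (n : ℚ) ^ 2 - (j + 2) ^ 2) * ∑ i ∈ Finset.Ico 1 n, c0 n i * Wt i j +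
    4 * (2 * j + 5) * ((n : ℚ) ^ 2 - (j + 2) ^ 2) * ∑ i ∈ Finset.Ico 1 n, c0 n i * Wt i (j + 1) = 0 := by
  rw [Finset.mul_sum, Finset.mul_sum, ← Finset.sum_add_distrib]
  rw [tele (fun i => -3 * (j + 2) * ((2 * i + 2) * (4 * (n : ℚ) ^ 2 - i ^ 2) * (2 * i - j) * (2 * i - j - 1)) * BB 1 4 n j i) _ 1 n (by omega)]
  · have h1 := BB_start 1 4 n j 1 (by omega)
    push_cast at h1
    rw [BB_zero 1 4 n j n le_rfl (by omega)]
    push_cast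
    linear_combination (3 * (j + 2 : ℚ) * (2 * 1 + 2) * (4 * (n : ℚ) ^ 2 - 1 ^ 2)) * h1
  · intro i h1 h2
    have h := BB_rec 1 4 (by norm_num) n j i (by omega)
    rw [Wt_one, Wt_two]
    unfold c0
    unfold BB at h ⊢
    push_cast at h ⊢
    linear_combination (-3 * (j + 2 : ℚ)) * h

theorem rec2 (n j : ℕ) (hn : 3 ≤ n) (hj : 3 ≤ j) :
    (j - 1) * (j + 5) * (4 * (n : ℚ) ^ 2 - (j + 2) ^ 2) * ((2 * (j + 1) ^ 2 - 5 * (j + 1) + 15) * (n : ℚ) ^ 2 - (8 * (j + 1) ^ 2 + 25 * (j + 1) + 15)) * ∑ i ∈ Finset.Ico 2 n, c2 n i * Wt i j +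
    2 * (2 * j + 7) * (j + 4) * ((n : ℚ) ^ 2 - (j + 2) ^ 2) * ((2 * j ^ 2 - 5 * j + 15) * (n : ℚ) ^ 2 - (8 * j ^ 2 + 25 * j + 15)) * ∑ i ∈ Finset.Ico 2 n, c2 n i * Wt i (j + 1) = 0 := by
  rw [Finset.mul_sum, Finset.mul_sum, ← Finset.sum_add_distrib]
  rw [tele (fun i => xa ((n : ℚ) ^ 2) i j * ((2 * i + 6) * (4 * (n : ℚ) ^ 2 - i ^ 2) * (2 * i - j) * (2 * i - j - 1)) * BB (-1) 8 n j i) _ 2 n (by omega)]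
  · have h1 := BB_start (-1) 8 n j 2 (by omega)
    push_cast at h1
    rw [BB_zero (-1) 8 n j n le_rfl (by omega)]
    push_cast
    linear_combination (-xa ((n : ℚ) ^ 2) 2 j * (2 * 2 + 6) * (4 * (n : ℚ) ^ 2 - 2 ^ 2)) * h1
  · intro i h1 h2
    have h := BB_rec (-1) 8 (by norm_num) n j i (by omega)
    rw [Wt_one, Wt_two]
    unfold c2
    unfold BB at h ⊢
    push_cast at h ⊢
    have h3 : xa ((n : ℚ) ^ 2) (i + 1) j * (-4 * (2 * i - 1) * ((n : ℚ) ^ 2 - (i + 1) ^ 2) * (i + j + 2) * (2 * j + 4 - i))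
       - xa ((n : ℚ) ^ 2) i j * ((2 * i + 6) * (4 * (n : ℚ) ^ 2 - i ^ 2) * (2 * i - j) * (2 * i - j - 1)) =
      (3 * i + 2) * (i - 2) * ((n : ℚ) ^ 2 * (2 * i ^ 2 + 13 * i + 33) - (8 * i ^ 2 + 7 * i - 3)) *
      ((j - 1) * (j + 5) * (4 * (n : ℚ) ^ 2 - (j + 2) ^ 2) * ((2 * (j + 1) ^ 2 - 5 * (j + 1) + 15) * (n : ℚ) ^ 2 - (8 * (j + 1) ^ 2 + 25 * (j + 1) + 15)) * ((2 * j + 4 - i) * (2 * j + 3 - i)) +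
      2 * (2 * j + 7) * (j + 4) * ((n : ℚ) ^ 2 - (j + 2) ^ 2) * ((2 * j ^ 2 - 5 * j + 15) * (n : ℚ) ^ 2 - (8 * j ^ 2 + 25 * j + 15)) * ((i + j + 2) * (2 * i - j))) := by
      unfold xa; ring
    linear_combination (xa ((n : ℚ) ^ 2) (i + 1) j) * h + ch (-1) 8 n i * (Nat.factorial (i + j + 1) : ℚ) * IF (2 * (i : ℤ) - j) * IF (2 * (j : ℤ) - i + 4) * h3

end LP

namespace LP

lemma ch_shift (a b : ℚ) (hb : 0 < b) (n i : ℕ) (hn : 1 ≤ n) (hi : i ≤ n) :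
    ch a b n i * ((n + 1 + i) * (2 * n + 1 - i) * (2 * n - i)) = ch a b (n + 1) i * ((n - i) * (2 * n + 1 + i) * (2 * n + 2 + i)) := by
  induction i with
  | zero => simp only [ch]; push_cast; ring
  | succ i ih =>
    have ih := ih (by omega)
    have h1 := ch_rec a b hb n i (by omega)
    have h2 := ch_rec a b hb (n + 1) i (by omega)
    have hin : (i : ℚ) + 1 ≤ n := by exact_mod_cast hi
    have hi0 : (0 : ℚ) ≤ i := by positivity
    have p1 : (2 * (i : ℚ) + b) ≠ 0 := by positivity
    have p2 : (2 * (n : ℚ) - (i + 1)) ≠ 0 := by nlinarith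
    have p3 : (2 * (n : ℚ) + (i + 1)) ≠ 0 := by positivity
    have p4 : (2 * (n : ℚ) + 2 - (i + 1)) ≠ 0 := by nlinarith
    have p5 : (2 * (n : ℚ) + 2 + (i + 1)) ≠ 0 := by positivity
    have p6 : (2 * (n : ℚ) - i) ≠ 0 := by nlinarith
    have p7 : ((n : ℚ) + 1 + i) ≠ 0 := by positivity
    push_cast at h1 h2 ih ⊢
    have p8 : (2 * (n : ℚ) + 1 - i) ≠ 0 := by nlinarith
    have d1 : ((2 * (i : ℚ) + b) * (4 * (n : ℚ) ^ 2 - (i + 1) ^ 2)) ≠ 0 := by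
      have e : (4 * (n : ℚ) ^ 2 - (i + 1) ^ 2) = (2 * (n : ℚ) - (i + 1)) * (2 * (n : ℚ) + (i + 1)) := by ring
      rw [e]; positivity
    have d2 : ((2 * (i : ℚ) + b) * (4 * ((n : ℚ) + 1) ^ 2 - (i + 1) ^ 2)) ≠ 0 := by
      have e : (4 * ((n : ℚ) + 1) ^ 2 - (i + 1) ^ 2) = (2 * (n : ℚ) + 2 - (i + 1)) * (2 * (n : ℚ) + 2 + (i + 1)) := by ring
      rw [e]; positivity
    have d3 : ((n : ℚ) + 1 + i) * (2 * n + 1 - i) * (2 * n - i) ≠ 0 := by positivity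
    apply mul_right_cancel₀ (mul_ne_zero (mul_ne_zero d1 d2) d3)
    linear_combination (((2 * (i : ℚ) + b) * (4 * ((n : ℚ) + 1) ^ 2 - (i + 1) ^ 2)) * (((n : ℚ) + 1 + i) * (2 * n + 1 - i) * (2 * n - i)) *
        ((n + 1 + (i + 1)) * (2 * n + 1 - (i + 1)) * (2 * n - (i + 1)))) * h1
      - (((2 * (i : ℚ) + b) * (4 * (n : ℚ) ^ 2 - (i + 1) ^ 2)) * (((n : ℚ) + 1 + i) * (2 * n + 1 - i) * (2 * n - i)) *
        ((n - (i + 1)) * (2 * n + 1 + (i + 1)) * (2 * n + 2 + (i + 1)))) * h2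
      + ((-(2 * i + a) * 4 * ((n : ℚ) ^ 2 - (i + 1) ^ 2)) * ((2 * (i : ℚ) + b) * (4 * ((n : ℚ) + 1) ^ 2 - (i + 1) ^ 2)) *
        ((n + 1 + (i + 1)) * (2 * n + 1 - (i + 1)) * (2 * n - (i + 1)))) * ih

/-- summand of the two-term relation -/
noncomputable def bb (a b : ℚ) (n i : ℕ) : ℚ := ch a b (n + 1) i * 2 ^ i / ((n + 1 + i) * (2 * n + 1 - i) * (2 * n - i))

lemma bb_mul (a b : ℚ) (n i : ℕ) (hn : 1 ≤ n) (hi : i ≤ n) : bb a b n i * ((n + 1 + i) * (2 * n + 1 - i) * (2 * n - i)) = ch a b (n + 1) i * 2 ^ i := by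
  have hin : (i : ℚ) ≤ n := by exact_mod_cast hi
  have hn' : (1 : ℚ) ≤ n := by exact_mod_cast hn
  have hi0 : (0 : ℚ) ≤ i := by positivity
  have p1 : (2 * (n : ℚ) + 1 - i) ≠ 0 := by nlinarith
  have p6 : (2 * (n : ℚ) - i) ≠ 0 := by nlinarith
  have p7 : ((n : ℚ) + 1 + i) ≠ 0 := by positivity
  unfold bb
  rw [div_mul_cancel₀ _ (by positivity)]

lemma bb_mul' (a b : ℚ) (hb : 0 < b) (n i : ℕ) (hn : 1 ≤ n) (hi : i ≤ n) : bb a b n i * ((n - i) * (2 * n + 1 + i) * (2 * n + 2 + i)) = ch a b n i * 2 ^ i := by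
  have h1 := bb_mul a b n i hn hi
  have h2 := ch_shift a b hb n i hn hi
  have hin : (i : ℚ) ≤ n := by exact_mod_cast hi
  have hn' : (1 : ℚ) ≤ n := by exact_mod_cast hn
  have hi0 : (0 : ℚ) ≤ i := by positivity
  have p1 : (2 * (n : ℚ) + 1 - i) ≠ 0 := by nlinarith
  have p6 : (2 * (n : ℚ) - i) ≠ 0 := by nlinarith
  have p7 : ((n : ℚ) + 1 + i) ≠ 0 := by positivity
  have p : ((n : ℚ) + 1 + i) * (2 * n + 1 - i) * (2 * n - i) ≠ 0 := by positivity
  apply mul_right_cancel₀ p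
  linear_combination ((n - i : ℚ) * (2 * n + 1 + i) * (2 * n + 2 + i)) * h1 - 2 ^ i * h2

lemma bb_rec (a b : ℚ) (hb : 0 < b) (n i : ℕ) (hn : 2 ≤ n) (hi : i ≤ n) :
    ((2 * i + b) * (2 * n + 3 + i) * (2 * n - i - 1)) * bb a b n (i + 1) = (-8 * (2 * i + a) * (n - i) * (n + 1 + i)) * bb a b n i := by
  have hin : (i : ℚ) ≤ n := by exact_mod_cast hi
  have hn' : (2 : ℚ) ≤ n := by exact_mod_cast hn
  have hi0 : (0 : ℚ) ≤ i := by positivity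
  have p1 : (2 * (n : ℚ) + 1 - i) ≠ 0 := by nlinarith
  have p2 : (2 * (n : ℚ) - i - 1) ≠ 0 := by nlinarith
  have p6 : (2 * (n : ℚ) - i) ≠ 0 := by nlinarith
  have p7 : ((n : ℚ) + 1 + i) ≠ 0 := by positivity
  have p8 : ((n : ℚ) + 2 + i) ≠ 0 := by positivity
  have p9 : (2 * (i : ℚ) + b) ≠ 0 := by positivity
  have p5 : (2 * (n : ℚ) + 3 + i) ≠ 0 := by positivity
  have h2 := ch_rec a b hb (n + 1) i (by omega)
  push_cast at h2
  have e2 : ch a b (n + 1) (i + 1) = ch a b (n + 1) i * (-(2 * i + a) * 4 * (((n : ℚ) + 1) ^ 2 - (i + 1) ^ 2)) / ((2 * i + b) * ((2 * n + 1 - i) * (2 * n + 3 + i))) := by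
    rw [eq_div_iff (by positivity)]; linear_combination h2
  unfold bb
  push_cast
  have q1 : ((n : ℚ) + 1 + (i + 1)) = n + 2 + i := by ring
  have q2 : (2 * (n : ℚ) + 1 - (i + 1)) = 2 * n - i := by ring
  have q3 : (2 * (n : ℚ) - (i + 1)) = 2 * n - i - 1 := by ring
  rw [e2, q1, q2, q3, pow_succ]
  field_simp
  ring

lemma bb_end (a b : ℚ) (n : ℕ) : bb a b n (n + 1) = 0 := by
  unfold bb; rw [ch_zero a b (n + 1) (n + 1) le_rfl (by omega)]; ring

theorem sum0_rec (n : ℕ) (hn : 2 ≤ n) : ∑ i ∈ Finset.Ico 0 (n + 1), c0 (n + 1) i * 2 ^ i + ∑ i ∈ Finset.Ico 0 n, c0 n i * 2 ^ i = 2 := by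
  have h0 : ∑ i ∈ Finset.Ico 0 n, c0 n i * 2 ^ i = ∑ i ∈ Finset.Ico 0 (n + 1), c0 n i * 2 ^ i := by
    rw [Finset.sum_Ico_succ_top (by omega)]
    unfold c0; rw [ch_zero 1 4 n n le_rfl (by omega)]; ring
  rw [h0, ← Finset.sum_add_distrib]
  rw [tele (fun i => -(2 * n + 1) / 2 * ((2 * i + 2) * (2 * n + 2 + i) * (2 * n - i)) * bb 1 4 n i) _ 0 (n + 1) (by omega)]
  · rw [bb_end]
    have hn' : (2 : ℚ) ≤ n := by exact_mod_cast hn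
    have p1 : (2 * (n : ℚ) + 1) ≠ 0 := by nlinarith
    unfold bb; simp only [ch]; push_cast; simp only [sub_zero, add_zero]; field_simp; ring
  · intro i _ hi
    have h1 := bb_mul 1 4 n i (by omega) (by omega)
    have h2 := bb_mul' 1 4 (by norm_num) n i (by omega) (by omega)
    have h3 := bb_rec 1 4 (by norm_num) n i hn (by omega)
    unfold c0
    push_cast
    linear_combination (3 * i + 2 : ℚ) * h1 + (3 * i + 2 : ℚ) * h2 - (2 * n + 1) / 2 * h3

theorem sum2_rec (n : ℕ) (hn : 2 ≤ n) : ((n : ℚ) ^ 2 - 4) * ∑ i ∈ Finset.Ico 2 (n + 1), c2 (n + 1) i * 2 ^ i + (((n : ℚ) + 1) ^ 2 - 4) * ∑ i ∈ Finset.Ico 2 n, c2 n i * 2 ^ i =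
    12 * ((n : ℚ) ^ 2 - 4) * (((n : ℚ) + 1) ^ 2 - 4) := by
  have h0 : ∑ i ∈ Finset.Ico 2 n, c2 n i * 2 ^ i = ∑ i ∈ Finset.Ico 2 (n + 1), c2 n i * 2 ^ i := by
    rw [Finset.sum_Ico_succ_top (by omega)]
    unfold c2; rw [ch_zero (-1) 8 n n le_rfl (by omega)]; ring
  rw [h0, Finset.mul_sum, Finset.mul_sum, ← Finset.sum_add_distrib]
  rw [tele (fun i => xb n i * ((2 * i + 6) * (2 * n + 2 + i) * (2 * n - i)) * bb (-1) 8 n i) _ 2 (n + 1) (by omega)]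
  · rw [bb_end]
    have hn' : (2 : ℚ) ≤ n := by exact_mod_cast hn
    have p1 : ((n : ℚ) - 1) ≠ 0 := by nlinarith
    have p2 : (2 * (n : ℚ) + 1) ≠ 0 := by nlinarith
    have p3 : (2 * (n : ℚ) - 1) ≠ 0 := by nlinarith
    have p4 : ((n : ℚ) + 2) ≠ 0 := by nlinarith
    have p5 : ((n : ℚ) + 3) ≠ 0 := by nlinarith
    have p6 : (2 * (n : ℚ) + 3) ≠ 0 := by nlinarith
    have p7 : (n : ℚ) ≠ 0 := by nlinarith
    unfold bb xb; simp only [ch]; push_cast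
    have q1 : ((n : ℚ) + 1 + 2) = n + 3 := by ring
    have q2 : (2 * (n : ℚ) + 1 - 2) = 2 * n - 1 := by ring
    have q3 : (2 * (n : ℚ) - 2) = 2 * (n - 1) := by ring
    have q4 : 4 * ((n : ℚ) + 1) ^ 2 - (0 + 1) ^ 2 = (2 * n + 1) * (2 * n + 3) := by ring
    have q5 : 4 * ((n : ℚ) + 1) ^ 2 - (1 + 1) ^ 2 = 4 * n * (n + 2) := by ring
    rw [q1, q2, q3, q4, q5]
    obtain ⟨t, ht⟩ : ∃ t : ℚ, t = 2 * n - 1 := ⟨_, rfl⟩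
    rw [← ht] at p3 ⊢
    field_simp
    rw [ht]; ring
  · intro i _ hi
    have h1 := bb_mul (-1) 8 n i (by omega) (by omega)
    have h2 := bb_mul' (-1) 8 (by norm_num) n i (by omega) (by omega)
    have h3 := bb_rec (-1) 8 (by norm_num) n i hn (by omega)
    unfold c2
    push_cast
    have h4 : xb n (i + 1) * (-8 * (2 * i - 1) * (n - i) * (n + 1 + i)) - xb n i * ((2 * i + 6) * (2 * n + 2 + i) * (2 * n - i)) =
       (3 * i + 2) * (i - 2) * (((n : ℚ) ^ 2 - 4) * ((((n : ℚ) + 1) ^ 2 * (2 * i ^ 2 + 13 * i + 33) - (8 * i ^ 2 + 7 * i - 3))) * ((n + 1 + i) * (2 * n + 1 - i) * (2 * n - i))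
        + (((n : ℚ) + 1) ^ 2 - 4) * (((n : ℚ) ^ 2 * (2 * i ^ 2 + 13 * i + 33) - (8 * i ^ 2 + 7 * i - 3))) * ((n - i) * (2 * n + 1 + i) * (2 * n + 2 + i))) := by
      unfold xb; ring
    linear_combination ((3 * i + 2 : ℚ) * (i - 2) * ((n : ℚ) ^ 2 - 4) * ((((n : ℚ) + 1) ^ 2 * (2 * i ^ 2 + 13 * i + 33) - (8 * i ^ 2 + 7 * i - 3)))) * h1
      + ((3 * i + 2 : ℚ) * (i - 2) * (((n : ℚ) + 1) ^ 2 - 4) * (((n : ℚ) ^ 2 * (2 * i ^ 2 + 13 * i + 33) - (8 * i ^ 2 + 7 * i - 3)))) * h2 + xb n (i + 1) * h3 + bb (-1) 8 n i * h4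

theorem sum0 (n : ℕ) (hn : 2 ≤ n) : ∑ i ∈ Finset.Ico 1 n, c0 n i * 2 ^ i = if Even n then -2 else 0 := by
  have key : ∑ i ∈ Finset.Ico 0 n, c0 n i * 2 ^ i = if Even n then 0 else 2 := by
    induction n, hn using Nat.le_induction with
    | base =>
      rw [if_pos (by decide)]
      simp [Finset.sum_range_succ, c0, ch]; norm_num
    | succ n hn ih =>
      have h := sum0_rec n hn
      rw [ih] at h
      by_cases he : Even n
      · rw [if_pos he] at h; rw [if_neg (by rw [Nat.even_add_one]; simpa using he)]; linarith
      · rw [if_neg he] at h; rw [if_pos (by rw [Nat.even_add_one]; simpa using he)]; linarith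
  rw [Finset.sum_eq_sum_Ico_succ_bot (by omega)] at key
  have : c0 n 0 * 2 ^ 0 = 2 := by simp [c0, ch]
  rw [this] at key
  split_ifs at key ⊢ <;> linarith

theorem sum2 (n : ℕ) (hn : 3 ≤ n) : ∑ i ∈ Finset.Ico 2 n, c2 n i * 2 ^ i = if Even n then 12 * ((n : ℚ) ^ 2 - 4) else 0 := by
  induction n, hn using Nat.le_induction with
  | base =>
    rw [if_neg (by decide)]
    simp [c2]
  | succ n hn ih =>
    have h := sum2_rec n (by omega)
    rw [ih] at h
    have hn' : (3 : ℚ) ≤ n := by exact_mod_cast hn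
    have p : ((n : ℚ) ^ 2 - 4) ≠ 0 := by nlinarith
    by_cases he : Even n
    · rw [if_pos he] at h; rw [if_neg (by rw [Nat.even_add_one]; simpa using he)]
      apply mul_left_cancel₀ p; linarith
    · rw [if_neg he] at h; rw [if_pos (by rw [Nat.even_add_one]; simpa using he)]
      apply mul_left_cancel₀ p; push_cast; linarith

end LP

namespace LP

lemma sum_trunc (f : ℕ → ℚ) (a n K : ℕ) (h1 : ∀ i, n ≤ i → f i = 0) (h2 : ∀ i, K ≤ i → f i = 0) :
    ∑ i ∈ Finset.Ico a n, f i = ∑ i ∈ Finset.Ico a K, f i := by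
  have e1 : ∑ i ∈ Finset.Ico a n, f i = ∑ i ∈ Finset.Ico a (n + K), f i := by
    apply Finset.sum_subset
    · exact Finset.Ico_subset_Ico le_rfl (by omega)
    · intro i hi hi'
      rw [Finset.mem_Ico] at hi hi'
      exact h1 i (by omega)
  have e2 : ∑ i ∈ Finset.Ico a K, f i = ∑ i ∈ Finset.Ico a (n + K), f i := by
    apply Finset.sum_subset
    · exact Finset.Ico_subset_Ico le_rfl (by omega)
    · intro i hi hi'
      rw [Finset.mem_Ico] at hi hi'
      exact h2 i (by omega)
  rw [e1, e2]

lemma Wt_big (i j : ℕ) (h : 2 * j + 3 ≤ i) : Wt i j = 0 := by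
  unfold Wt; rw [IF_neg (z := 2 * (j : ℤ) - i + 2) (by omega)]; ring

lemma Wt_val (i j a b : ℕ) (h1 : j + a = 2 * i) (h2 : i + b = 2 * j + 2) :
    Wt i j = (Nat.factorial (i + j + 1) : ℚ) * (Nat.factorial a : ℚ)⁻¹ * (Nat.factorial b : ℚ)⁻¹ := by
  unfold Wt
  have e1 : 2 * (i : ℤ) - j = a := by omega
  have e2 : 2 * (j : ℤ) - i + 2 = b := by omega
  rw [e1, e2, IF_nat, IF_nat]

lemma ch_ne (a b : ℚ) (ha : ∀ i : ℕ, 2 * (i : ℚ) + a ≠ 0) (hb : 0 < b) (n i : ℕ) (hi : i < n) : ch a b n i ≠ 0 := by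
  induction i with
  | zero => simp [ch]
  | succ i ih =>
    have h := ch_rec a b hb n i (by omega)
    intro h0
    rw [h0, zero_mul] at h
    have hin : (i : ℚ) + 1 < n := by exact_mod_cast hi
    have hi0 : (0 : ℚ) ≤ i := by positivity
    have p : ((n : ℚ) ^ 2 - (i + 1) ^ 2) ≠ 0 := by nlinarith
    have := ih (by omega)
    have h3 := ha i
    have : ch a b n i * (-(2 * i + a) * 4 * ((n : ℚ) ^ 2 - (i + 1) ^ 2)) ≠ 0 := by
      refine mul_ne_zero this (mul_ne_zero (mul_ne_zero (neg_ne_zero.2 h3) (by norm_num)) p)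
    exact this h.symm

lemma ch_step (a b : ℚ) (_hb : 0 < b) (n i : ℕ) (hi : i + 1 < 2 * n) (t : ℚ) (ht : t = 4 * (n : ℚ) ^ 2 - (i + 1) ^ 2) :
    t ≠ 0 ∧ ch a b n (i + 1) = ch a b n i * (-(2 * i + a) * 4 * ((n : ℚ) ^ 2 - (i + 1) ^ 2)) / ((2 * i + b) * t) := by
  have h1 := den_ne n (i + 1) hi
  push_cast at h1
  subst ht
  exact ⟨h1, by rw [ch]⟩

lemma base0 (n : ℕ) (hn : 3 ≤ n) : ∑ i ∈ Finset.Ico 1 n, c0 n i * Wt i 1 = 0 := by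
  rw [sum_trunc _ 1 n 5 (fun i hi => by unfold c0; rw [ch_zero 1 4 n i hi (by omega)]; ring) (fun i hi => by rw [Wt_big i 1 (by omega)]; ring)]
  have w1 : Wt 1 1 = 1 := by rw [Wt_val 1 1 1 3 rfl rfl]; norm_num [Nat.factorial]
  have w2 : Wt 2 1 = 2 := by rw [Wt_val 2 1 3 2 rfl rfl]; norm_num [Nat.factorial]
  have w3 : Wt 3 1 = 1 := by rw [Wt_val 3 1 5 1 rfl rfl]; norm_num [Nat.factorial]
  have w4 : Wt 4 1 = 1 / 7 := by rw [Wt_val 4 1 7 0 rfl rfl]; norm_num [Nat.factorial]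
  simp only [Finset.sum_Ico_succ_top (show 1 ≤ 4 by omega), Finset.sum_Ico_succ_top (show 1 ≤ 3 by omega), Finset.sum_Ico_succ_top (show 1 ≤ 2 by omega), Finset.sum_Ico_succ_top (show 1 ≤ 1 by omega), Finset.Ico_self, Finset.sum_empty]
  rw [w1, w2, w3, w4]
  unfold c0
  obtain ⟨t2, ht2⟩ : ∃ t : ℚ, t = 4 * (n : ℚ) ^ 2 - ((1 : ℕ) + 1) ^ 2 := ⟨_, rfl⟩
  obtain ⟨t3, ht3⟩ : ∃ t : ℚ, t = 4 * (n : ℚ) ^ 2 - ((2 : ℕ) + 1) ^ 2 := ⟨_, rfl⟩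
  obtain ⟨t4, ht4⟩ : ∃ t : ℚ, t = 4 * (n : ℚ) ^ 2 - ((3 : ℕ) + 1) ^ 2 := ⟨_, rfl⟩
  obtain ⟨p2, e2⟩ := ch_step 1 4 (by norm_num) n 1 (by omega) t2 ht2
  obtain ⟨p3, e3⟩ := ch_step 1 4 (by norm_num) n 2 (by omega) t3 ht3
  obtain ⟨p4, e4⟩ := ch_step 1 4 (by norm_num) n 3 (by omega) t4 ht4
  rw [e4, e3, e2]
  generalize ch 1 4 n 1 = C
  push_cast at ht2 ht3 ht4 ⊢
  field_simp
  rw [ht2, ht3, ht4]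
  ring

lemma base2 (n : ℕ) (hn : 5 ≤ n) : ∑ i ∈ Finset.Ico 2 n, c2 n i * Wt i 3 = 0 := by
  rw [sum_trunc _ 2 n 9 (fun i hi => by unfold c2; rw [ch_zero (-1) 8 n i hi (by omega)]; ring) (fun i hi => by rw [Wt_big i 3 (by omega)]; ring)]
  have w3 : Wt 3 3 = 7 := by rw [Wt_val 3 3 3 5 rfl rfl]; norm_num [Nat.factorial]
  have w4 : Wt 4 3 = 14 := by rw [Wt_val 4 3 5 4 rfl rfl]; norm_num [Nat.factorial]
  have w5 : Wt 5 3 = 12 := by rw [Wt_val 5 3 7 3 rfl rfl]; norm_num [Nat.factorial]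
  have w6 : Wt 6 3 = 5 := by rw [Wt_val 6 3 9 2 rfl rfl]; norm_num [Nat.factorial]
  have w7 : Wt 7 3 = 1 := by rw [Wt_val 7 3 11 1 rfl rfl]; norm_num [Nat.factorial]
  have w8 : Wt 8 3 = 1 / 13 := by rw [Wt_val 8 3 13 0 rfl rfl]; norm_num [Nat.factorial]
  simp only [Finset.sum_Ico_succ_top (show 2 ≤ 8 by omega), Finset.sum_Ico_succ_top (show 2 ≤ 7 by omega), Finset.sum_Ico_succ_top (show 2 ≤ 6 by omega), Finset.sum_Ico_succ_top (show 2 ≤ 5 by omega), Finset.sum_Ico_succ_top (show 2 ≤ 4 by omega), Finset.sum_Ico_succ_top (show 2 ≤ 3 by omega), Finset.sum_Ico_succ_top (show 2 ≤ 2 by omega), Finset.Ico_self, Finset.sum_empty]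
  rw [w3, w4, w5, w6, w7, w8]
  unfold c2
  obtain ⟨t4, ht4⟩ : ∃ t : ℚ, t = 4 * (n : ℚ) ^ 2 - ((3 : ℕ) + 1) ^ 2 := ⟨_, rfl⟩
  obtain ⟨t5, ht5⟩ : ∃ t : ℚ, t = 4 * (n : ℚ) ^ 2 - ((4 : ℕ) + 1) ^ 2 := ⟨_, rfl⟩
  obtain ⟨t6, ht6⟩ : ∃ t : ℚ, t = 4 * (n : ℚ) ^ 2 - ((5 : ℕ) + 1) ^ 2 := ⟨_, rfl⟩
  obtain ⟨t7, ht7⟩ : ∃ t : ℚ, t = 4 * (n : ℚ) ^ 2 - ((6 : ℕ) + 1) ^ 2 := ⟨_, rfl⟩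
  obtain ⟨t8, ht8⟩ : ∃ t : ℚ, t = 4 * (n : ℚ) ^ 2 - ((7 : ℕ) + 1) ^ 2 := ⟨_, rfl⟩
  obtain ⟨p4, e4⟩ := ch_step (-1) 8 (by norm_num) n 3 (by omega) t4 ht4
  obtain ⟨p5, e5⟩ := ch_step (-1) 8 (by norm_num) n 4 (by omega) t5 ht5
  obtain ⟨p6, e6⟩ := ch_step (-1) 8 (by norm_num) n 5 (by omega) t6 ht6
  obtain ⟨p7, e7⟩ := ch_step (-1) 8 (by norm_num) n 6 (by omega) t7 ht7
  obtain ⟨p8, e8⟩ := ch_step (-1) 8 (by norm_num) n 7 (by omega) t8 ht8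
  rw [e8, e7, e6, e5, e4]
  generalize ch (-1) 8 n 3 = C
  push_cast at ht4 ht5 ht6 ht7 ht8 ⊢
  field_simp
  rw [ht4, ht5, ht6, ht7, ht8]
  ring

theorem orth0 (n j : ℕ) (hj : 1 ≤ j) (hjn : j + 2 ≤ n) : ∑ i ∈ Finset.Ico 1 n, c0 n i * Wt i j = 0 := by
  induction j, hj using Nat.le_induction with
  | base => exact base0 n (by omega)
  | succ j hj ih =>
    have h := rec0 n j (by omega) hj
    rw [ih (by omega), mul_zero, zero_add] at h
    have h1 : (j : ℚ) + 3 ≤ n := by exact_mod_cast hjn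
    have h0 : (0 : ℚ) ≤ j := by positivity
    have p : ((n : ℚ) ^ 2 - (j + 2) ^ 2) ≠ 0 := by nlinarith
    have p' : 4 * (2 * (j : ℚ) + 5) ≠ 0 := by positivity
    exact (mul_eq_zero.1 h).resolve_left (mul_ne_zero p' p)

theorem orth2 (n j : ℕ) (hj : 3 ≤ j) (hjn : j + 2 ≤ n) : ∑ i ∈ Finset.Ico 2 n, c2 n i * Wt i j = 0 := by
  induction j, hj using Nat.le_induction with
  | base => exact base2 n (by omega)
  | succ j hj ih =>
    have h := rec2 n j (by omega) hj
    rw [ih (by omega), mul_zero, zero_add] at h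
    have h1 : (j : ℚ) + 3 ≤ n := by exact_mod_cast hjn
    have h0 : (3 : ℚ) ≤ j := by exact_mod_cast hj
    have p : ((n : ℚ) ^ 2 - (j + 2) ^ 2) ≠ 0 := by nlinarith
    have p' : 2 * (2 * (j : ℚ) + 7) * (j + 4) ≠ 0 := by positivity
    have p3 : ((2 * (j : ℚ) ^ 2 - 5 * j + 15) * (n : ℚ) ^ 2 - (8 * j ^ 2 + 25 * j + 15)) ≠ 0 := by
      have a1 : (36 : ℚ) ≤ (n : ℚ) ^ 2 := by nlinarith
      have a2 : (0 : ℚ) ≤ 2 * (j : ℚ) ^ 2 - 5 * j + 15 := by nlinarith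
      have a3 := mul_le_mul_of_nonneg_left a1 a2
      nlinarith
    exact (mul_eq_zero.1 h).resolve_left (mul_ne_zero (mul_ne_zero p' p) p3)

theorem gam0 (n : ℕ) (hn : 2 ≤ n) : (((n : ℚ) ^ 2 - 1)) * ∑ i ∈ Finset.Ico 1 n, c0 n i * Wt i 0 = ch 1 4 n 1 * (4 * (n : ℚ) ^ 2 - 1) := by
  rw [sum_trunc _ 1 n 3 (fun i hi => by unfold c0; rw [ch_zero 1 4 n i hi (by omega)]; ring) (fun i hi => by rw [Wt_big i 0 (by omega)]; ring)]
  have w1 : Wt 1 0 = 1 := by rw [Wt_val 1 0 2 1 rfl rfl]; norm_num [Nat.factorial]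
  have w2 : Wt 2 0 = 1 / 4 := by rw [Wt_val 2 0 4 0 rfl rfl]; norm_num [Nat.factorial]
  simp only [Finset.sum_Ico_succ_top (show 1 ≤ 2 by omega), Finset.sum_Ico_succ_top (show 1 ≤ 1 by omega), Finset.Ico_self, Finset.sum_empty]
  rw [w1, w2]
  unfold c0
  obtain ⟨t2, ht2⟩ : ∃ t : ℚ, t = 4 * (n : ℚ) ^ 2 - ((1 : ℕ) + 1) ^ 2 := ⟨_, rfl⟩
  obtain ⟨p2, e2⟩ := ch_step 1 4 (by norm_num) n 1 (by omega) t2 ht2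
  rw [e2]
  generalize ch 1 4 n 1 = C
  push_cast at ht2 ⊢
  field_simp
  rw [ht2]
  ring

theorem gam2 (n : ℕ) (hn : 4 ≤ n) : (((n : ℚ) ^ 2 - 4) * ((n : ℚ) ^ 2 - 9)) * ∑ i ∈ Finset.Ico 2 n, c2 n i * Wt i 2 =
    ch (-1) 8 n 3 * (120 * ((n : ℚ) ^ 2 - 1) * (4 * (n : ℚ) ^ 2 - 1) * (4 * (n : ℚ) ^ 2 - 9)) := by
  rw [sum_trunc _ 2 n 7 (fun i hi => by unfold c2; rw [ch_zero (-1) 8 n i hi (by omega)]; ring) (fun i hi => by rw [Wt_big i 2 (by omega)]; ring)]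
  have w3 : Wt 3 2 = 5 := by rw [Wt_val 3 2 4 3 rfl rfl]; norm_num [Nat.factorial]
  have w4 : Wt 4 2 = 7 / 2 := by rw [Wt_val 4 2 6 2 rfl rfl]; norm_num [Nat.factorial]
  have w5 : Wt 5 2 = 1 := by rw [Wt_val 5 2 8 1 rfl rfl]; norm_num [Nat.factorial]
  have w6 : Wt 6 2 = 1 / 10 := by rw [Wt_val 6 2 10 0 rfl rfl]; norm_num [Nat.factorial]
  simp only [Finset.sum_Ico_succ_top (show 2 ≤ 6 by omega), Finset.sum_Ico_succ_top (show 2 ≤ 5 by omega), Finset.sum_Ico_succ_top (show 2 ≤ 4 by omega), Finset.sum_Ico_succ_top (show 2 ≤ 3 by omega), Finset.sum_Ico_succ_top (show 2 ≤ 2 by omega), Finset.Ico_self, Finset.sum_empty]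
  rw [w3, w4, w5, w6]
  unfold c2
  obtain ⟨t4, ht4⟩ : ∃ t : ℚ, t = 4 * (n : ℚ) ^ 2 - ((3 : ℕ) + 1) ^ 2 := ⟨_, rfl⟩
  obtain ⟨t5, ht5⟩ : ∃ t : ℚ, t = 4 * (n : ℚ) ^ 2 - ((4 : ℕ) + 1) ^ 2 := ⟨_, rfl⟩
  obtain ⟨t6, ht6⟩ : ∃ t : ℚ, t = 4 * (n : ℚ) ^ 2 - ((5 : ℕ) + 1) ^ 2 := ⟨_, rfl⟩
  obtain ⟨p4, e4⟩ := ch_step (-1) 8 (by norm_num) n 3 (by omega) t4 ht4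
  obtain ⟨p5, e5⟩ := ch_step (-1) 8 (by norm_num) n 4 (by omega) t5 ht5
  obtain ⟨p6, e6⟩ := ch_step (-1) 8 (by norm_num) n 5 (by omega) t6 ht6
  rw [e6, e5, e4]
  generalize ch (-1) 8 n 3 = C
  push_cast at ht4 ht5 ht6 ⊢
  field_simp
  rw [ht4, ht5, ht6]
  ring

theorem R0 (k : ℕ) : 5 * (((k + 2 : ℕ) : ℂ) ^ 2 - 1) * YY (k + 1) (k + 2) 0 = 2 * (4 * ((k + 2 : ℕ) : ℂ) ^ 2 - 1) * YY (k + 1) k 2 := by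
  have h := YY_ratio (k + 1) k 0 (by omega) (c0 (k + 2)) (fun j h1 h2 => orth0 (k + 2) j (by omega) (by omega))
    (fun he => by
      have := sum0 (k + 2) (by omega)
      rw [if_neg (by rw [Nat.even_add_one] at he; rw [Nat.even_add]; simpa using he)] at this
      exact this)
    (fun he => by
      have := sum0 (k + 2) (by omega)
      rw [if_pos (by rw [Nat.even_add_one] at he; rw [Nat.even_add]; simpa using he)] at this
      intro h0
      have h1 : (-2 : ℚ) = 0 := this.symm.trans h0
      norm_num at h1)
  have g := gam0 (k + 2) (by omega)
  have hc : ch 1 4 (k + 2) 1 ≠ 0 := ch_ne 1 4 (fun i => by positivity) (by norm_num) _ _ (by omega)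
  have hcC : (ch 1 4 (k + 2) 1 : ℂ) ≠ 0 := by exact_mod_cast hc
  have e : c0 (k + 2) (0 + 1) = 5 * ch 1 4 (k + 2) 1 := by unfold c0; norm_num
  have e' : ∑ i ∈ Finset.Ico (0 + 1) (k + 1 + 1), c0 (k + 2) i * Wt i 0 = ∑ i ∈ Finset.Ico 1 (k + 2), c0 (k + 2) i * Wt i 0 := rfl
  rw [e, e'] at h
  have gC : ((((k + 2 : ℕ) : ℂ) ^ 2 - 1)) * ((∑ i ∈ Finset.Ico 1 (k + 2), c0 (k + 2) i * Wt i 0 : ℚ) : ℂ) = (ch 1 4 (k + 2) 1 : ℂ) * (4 * ((k + 2 : ℕ) : ℂ) ^ 2 - 1) := by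
    exact_mod_cast congrArg (fun q : ℚ => (q : ℂ)) g
  generalize (∑ i ∈ Finset.Ico 1 (k + 2), c0 (k + 2) i * Wt i 0 : ℚ) = S at gC h
  generalize ch 1 4 (k + 2) 1 = C at gC h hcC
  apply mul_left_cancel₀ hcC
  rw [Rat.cast_mul, Rat.cast_mul] at h
  have q : ((((3 * ((0 : ℕ) : ℚ) + 4) / 2 : ℚ)) : ℂ) = 2 := by norm_num
  rw [q] at h
  generalize (k + 2 : ℕ) = n at *
  push_cast at h
  linear_combination ((n : ℂ) ^ 2 - 1) * h + 2 * YY (k + 1) k 2 * gC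

theorem R2 (k : ℕ) : 33 * ((((k + 4 : ℕ) : ℂ) ^ 2 - 4) * (((k + 4 : ℕ) : ℂ) ^ 2 - 9)) * YY (k + 3) (k + 2) 2 =
    20 * ((4 * ((k + 4 : ℕ) : ℂ) ^ 2 - 1) * (4 * ((k + 4 : ℕ) : ℂ) ^ 2 - 9)) * YY (k + 3) k 4 := by
  have z : ∀ f : ℕ → ℚ, ∑ i ∈ Finset.Ico 2 (k + 4), c2 (k + 4) i * f i = ∑ i ∈ Finset.Ico (2 + 1) (k + 3 + 1), c2 (k + 4) i * f i := by
    intro f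
    rw [Finset.sum_eq_sum_Ico_succ_bot (by omega)]
    have : c2 (k + 4) 2 = 0 := by unfold c2; push_cast; ring
    rw [this, zero_mul, zero_add]
  have hkq : (4 : ℚ) ≤ ((k + 4 : ℕ) : ℚ) := by push_cast; linarith [(Nat.cast_nonneg k : (0 : ℚ) ≤ k)]
  have hs := sum2 (k + 4) (by omega)
  rw [z (fun i => 2 ^ i)] at hs
  have h := YY_ratio (k + 3) k 2 (by omega) (c2 (k + 4)) (fun j h1 h2 => by rw [← z (fun i => Wt i j)]; exact orth2 (k + 4) j (by omega) (by omega))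
    (fun he => by
      rw [if_neg (by rw [Nat.even_add_one] at he; rw [Nat.even_add]; simpa [show Even 4 by decide] using he)] at hs
      exact hs)
    (fun he => by
      rw [if_pos (by rw [Nat.even_add_one] at he; rw [Nat.even_add]; simpa [show Even 4 by decide] using he)] at hs
      rw [hs]
      have : (((k + 4 : ℕ) : ℚ) ^ 2 - 4) ≠ 0 := by nlinarith
      exact mul_ne_zero (by norm_num) this)
  have g := gam2 (k + 4) (by omega)
  have hc : ch (-1) 8 (k + 4) 3 ≠ 0 := ch_ne (-1) 8 (fun i => by
    intro h0
    have : (2 * i : ℚ) = 1 := by linarith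
    have : 2 * i = 1 := by exact_mod_cast this
    omega) (by norm_num) _ _ (by omega)
  have hN : (((k + 4 : ℕ) : ℚ) ^ 2 - 1) ≠ 0 := by nlinarith
  have hcC : (((((k + 4 : ℕ) : ℚ) ^ 2 - 1) * ch (-1) 8 (k + 4) 3 : ℚ) : ℂ) ≠ 0 := by exact_mod_cast mul_ne_zero hN hc
  have e : c2 (k + 4) (2 + 1) = 990 * ((((k + 4 : ℕ) : ℚ) ^ 2 - 1) * ch (-1) 8 (k + 4) 3) := by unfold c2; push_cast; ring
  rw [e, ← z (fun i => Wt i 2)] at h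
  have gC : ((((k + 4 : ℕ) : ℂ) ^ 2 - 4) * (((k + 4 : ℕ) : ℂ) ^ 2 - 9)) * ((∑ i ∈ Finset.Ico 2 (k + 4), c2 (k + 4) i * Wt i 2 : ℚ) : ℂ) =
      (((((k + 4 : ℕ) : ℚ) ^ 2 - 1) * ch (-1) 8 (k + 4) 3 : ℚ) : ℂ) * (120 * ((4 * ((k + 4 : ℕ) : ℂ) ^ 2 - 1) * (4 * ((k + 4 : ℕ) : ℂ) ^ 2 - 9))) := by
    have g' : (((k + 4 : ℕ) : ℚ) ^ 2 - 4) * (((k + 4 : ℕ) : ℚ) ^ 2 - 9) * (∑ i ∈ Finset.Ico 2 (k + 4), c2 (k + 4) i * Wt i 2) =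
      ((((k + 4 : ℕ) : ℚ) ^ 2 - 1) * ch (-1) 8 (k + 4) 3) * (120 * ((4 * ((k + 4 : ℕ) : ℚ) ^ 2 - 1) * (4 * ((k + 4 : ℕ) : ℚ) ^ 2 - 9))) := by
      rw [g]; ring
    exact_mod_cast congrArg (fun q : ℚ => (q : ℂ)) g'
  generalize (∑ i ∈ Finset.Ico 2 (k + 4), c2 (k + 4) i * Wt i 2 : ℚ) = S at gC h
  generalize ((((k + 4 : ℕ) : ℚ) ^ 2 - 1) * ch (-1) 8 (k + 4) 3) = C at gC h hcC
  apply mul_left_cancel₀ hcC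
  rw [Rat.cast_mul, Rat.cast_mul] at h
  have q : ((((3 * ((2 : ℕ) : ℚ) + 4) / 2 : ℚ)) : ℂ) = 5 := by norm_num
  rw [q] at h
  have q2 : ((990 : ℚ) : ℂ) = 990 := by norm_num
  rw [q2] at h
  generalize ((k + 4 : ℕ) : ℂ) = n at *
  linear_combination ((n ^ 2 - 4) * (n ^ 2 - 9)) / 30 * h + YY (k + 3) k 4 / 6 * gC

end LP

namespace LP

lemma ite_any {p q : Prop} {d1 : Decidable p} {d2 : Decidable q} (h : p ↔ q) (a b : ℂ) :
    @ite ℂ p d1 a b = @ite ℂ q d2 a b := by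
  by_cases hp : p
  · rw [if_pos hp, if_pos (h.1 hp)]
  · rw [if_neg hp, if_neg (fun hq => hp (h.2 hq))]

theorem core2 (k : ℕ) (ψ : NCM (k + 2) → ℂ) (hψ : ∀ l : List ℤ, l.Pairwise (· ≤ ·) → l.length = k + 2 →
      AA (1 : ℂ) (k + 2) l = ∑ π, Cw u3 (k + 2) (NG π) l * ψ π) :
    5 * (((k + 2 : ℕ) : ℂ) ^ 2 - 1) * ∑ π, ψ π =
      2 * (4 * ((k + 2 : ℕ) : ℂ) ^ 2 - 1) * ∑ π, if ∀ i, i < 2 → i < NG π i then ψ π else 0 := by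
  have h0 := ZZ_eq (k := k + 2) (s := 0) (ψ := ψ) hψ
  have h1 := ZZ_eq (k := k) (s := 1) (ψ := ψ) hψ
  have r := R0 k
  have y0 := ZZ_YY (k + 1) 0 (k + 2) (by omega)
  have y1 := ZZ_YY (k + 1) 2 k (by omega)
  rw [← y0, ← y1] at r
  have h0' : ZZ ℂ (k + 1 + 1) 0 (k + 2) = ∑ π, ψ π := by
    refine Eq.trans h0 ?_
    apply Finset.sum_congr rfl
    intro π _
    rw [if_pos (fun i hi => by omega)]
  have h1' : ZZ ℂ (k + 1 + 1) 2 k = ∑ π, if ∀ i, i < 2 → i < NG π i then ψ π else 0 :=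
    h1.trans (Finset.sum_congr rfl fun π _ => ite_any Iff.rfl _ _)
  rw [h0', h1'] at r
  exact r

theorem core4 (k : ℕ) (ψ : NCM (k + 4) → ℂ) (hψ : ∀ l : List ℤ, l.Pairwise (· ≤ ·) → l.length = k + 4 →
      AA (1 : ℂ) (k + 4) l = ∑ π, Cw u3 (k + 4) (NG π) l * ψ π) :
    33 * ((((k + 4 : ℕ) : ℂ) ^ 2 - 4) * (((k + 4 : ℕ) : ℂ) ^ 2 - 9)) * (∑ π, if ∀ i, i < 2 → i < NG π i then ψ π else 0) =
      20 * ((4 * ((k + 4 : ℕ) : ℂ) ^ 2 - 1) * (4 * ((k + 4 : ℕ) : ℂ) ^ 2 - 9)) * ∑ π, if ∀ i, i < 4 → i < NG π i then ψ π else 0 := by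
  have h0 := ZZ_eq (k := k + 2) (s := 1) (ψ := ψ) hψ
  have h1 := ZZ_eq (k := k) (s := 2) (ψ := ψ) hψ
  have r := R2 k
  have y0 := ZZ_YY (k + 3) 2 (k + 2) (by omega)
  have y1 := ZZ_YY (k + 3) 4 k (by omega)
  rw [← y0, ← y1] at r
  have h0' : ZZ ℂ (k + 3 + 1) 2 (k + 2) = ∑ π, if ∀ i, i < 2 → i < NG π i then ψ π else 0 :=
    h0.trans (Finset.sum_congr rfl fun π _ => ite_any Iff.rfl _ _)
  have h1' : ZZ ℂ (k + 3 + 1) 4 k = ∑ π, if ∀ i, i < 4 → i < NG π i then ψ π else 0 :=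
    h1.trans (Finset.sum_congr rfl fun π _ => ite_any Iff.rfl _ _)
  rw [h0', h1'] at r
  exact r

lemma op2_iff {n : ℕ} {g : ℕ → ℕ} (hg : IsM n g) (hn : 2 ≤ n) : (∀ i, i < 2 → i < g i) ↔ ¬ g 0 = 1 := by
  have n0 := hg.nofix 0 (by omega)
  have n1 := hg.nofix 1 (by omega)
  have i0 := hg.inv 0 (by omega)
  have i1 := hg.inv 1 (by omega)
  constructor
  · intro h h0
    have := h 1 (by omega)
    rw [h0] at i0; omega
  · intro h i hi
    interval_cases i
    · omega
    · by_contra h1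
      have : g 1 = 0 := by omega
      rw [this] at i1; omega

lemma op4_iff {n : ℕ} {g : ℕ → ℕ} (hg : IsM n g) (hn : 2 ≤ n) : (∀ i, i < 4 → i < g i) ↔ ¬ (g 0 = 1 ∨ g 1 = 2 ∨ g 2 = 3) := by
  have i0 := hg.inv 0 (by omega)
  have i1 := hg.inv 1 (by omega)
  have i2 := hg.inv 2 (by omega)
  have i3 := hg.inv 3 (by omega)
  have n0 := hg.nofix 0 (by omega)
  have n1 := hg.nofix 1 (by omega)
  have n2 := hg.nofix 2 (by omega)
  have n3 := hg.nofix 3 (by omega)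
  have l1 := hg.lt 1 (by omega)
  have l2 := hg.lt 2 (by omega)
  constructor
  · rintro h (h0 | h0 | h0)
    · have := h 1 (by omega); rw [h0] at i0; omega
    · have := h 2 (by omega); rw [h0] at i1; omega
    · have := h 3 (by omega); rw [h0] at i2; omega
  · intro h
    push Not at h
    obtain ⟨a0, a1, a2⟩ := h
    have b1 : 1 < g 1 := by
      by_contra h1
      have : g 1 = 0 := by omega
      rw [this] at i1; omega
    have b2 : 2 < g 2 := by
      by_contra h1
      rcases (by omega : g 2 = 0 ∨ g 2 = 1) with e | e
      · rw [e] at i2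
        exact hg.nc 0 1 2 (g 1) (by omega) (by omega) (by omega) l1 i2 rfl
      · rw [e] at i2; omega
    have b3 : 3 < g 3 := by
      by_contra h1
      rcases (by omega : g 3 = 0 ∨ g 3 = 1 ∨ g 3 = 2) with e | e | e
      · rw [e] at i3
        have : g 1 ≠ 3 := by intro e'; rw [e'] at i1; omega
        exact hg.nc 0 1 3 (g 1) (by omega) (by omega) (by omega) l1 i3 rfl
      · rw [e] at i3
        have : g 2 ≠ 3 := by omega
        exact hg.nc 1 2 3 (g 2) (by omega) (by omega) (by omega) l2 i3 rfl
      · rw [e] at i3; omega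
    intro i hi
    interval_cases i <;> omega

lemma op4_small {n : ℕ} {g : ℕ → ℕ} (hg : IsM n g) (hn : 2 ≤ n) (hn' : n < 4) : ¬ ∀ i, i < 4 → i < g i := by
  intro h
  have i0 := hg.inv 0 (by omega)
  have i1 := hg.inv 1 (by omega)
  have i2 := hg.inv 2 (by omega)
  have l0 := hg.lt 0 (by omega)
  have l1 := hg.lt 1 (by omega)
  have l2 := hg.lt 2 (by omega)
  have big : ∀ i, i < 4 → 4 ≤ g i := by
    intro i hi
    by_contra hh
    have a1 := h i hi
    have a2 := h (g i) (by omega)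
    have a3 := hg.inv i (by omega)
    omega
  have g0 := big 0 (by omega)
  have g1 := big 1 (by omega)
  have g2 := big 2 (by omega)
  rcases (by omega : g 0 = g 1 ∨ g 0 = g 2 ∨ g 1 = g 2) with e | e | e
  · rw [e] at i0; omega
  · rw [e] at i0; omega
  · rw [e] at i1; omega

lemma shift_sum {N : ℕ} (hN : 0 < N) {ψ : NCM (N + 1) → ℂ} (hr : ∀ π, ψ (rho π) = ψ π) (i : ℕ) (hi : i + 2 < 2 * (N + 1)) :
    (∑ π, if NG π (i + 1) = i + 2 then ψ π else 0) = ∑ π, if NG π i = i + 1 then ψ π else 0 := by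
  rw [← (Equiv.ofBijective rho rho_bij).sum_comp (fun π : NCM (N + 1) => if NG π i = i + 1 then ψ π else 0)]
  apply Finset.sum_congr rfl
  intro π _
  simp only [Equiv.ofBijective_apply]
  rw [hr]
  have h := NG_rho π (i + 1) (by omega)
  have l := (NG_isM π).lt (i + 1) (by omega)
  apply if_congr _ rfl rfl
  have e : sh (N + 1) (i + 1) = i := by unfold sh; rw [if_neg (by omega)]; omega
  rw [e] at h
  rw [h]
  unfold sh
  split_ifs <;> omega

theorem prob_sum {k : ℕ} {ψ : NCM (k + 2) → ℂ} (hr : ∀ π, ψ (rho π) = ψ π) :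
    (∑ π, if NG π 0 = 1 ∧ NG π 2 = 3 then ψ π else 0) =
      (∑ π, if ∀ i, i < 4 → i < NG π i then ψ π else 0) + 2 * (∑ π, ψ π) - 3 * ∑ π, if ∀ i, i < 2 → i < NG π i then ψ π else 0 := by
  have s1 := shift_sum (N := k + 1) (by omega) hr 0 (by omega)
  have s2 := shift_sum (N := k + 1) (by omega) hr 1 (by omega)
  simp only [Nat.zero_add, Nat.reduceAdd] at s1 s2
  have p2 : (∑ π : NCM (k + 2), if ∀ i, i < 2 → i < NG π i then ψ π else 0) = ∑ π, ψ π - ∑ π, if NG π 0 = 1 then ψ π else 0 := by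
    rw [← Finset.sum_sub_distrib]
    apply Finset.sum_congr rfl
    intro π _
    refine (ite_any (d2 := Classical.propDecidable _) (op2_iff (NG_isM π) (by omega)) _ _).trans ?_
    by_cases h : NG π 0 = 1 <;> simp [h]
  have p4 : (∑ π : NCM (k + 2), if NG π 0 = 1 ∧ NG π 2 = 3 then ψ π else 0) = (∑ π, if ∀ i, i < 4 → i < NG π i then ψ π else 0) - ∑ π, ψ π
     + ((∑ π, if NG π 0 = 1 then ψ π else 0) + (∑ π, if NG π 1 = 2 then ψ π else 0) + ∑ π, if NG π 2 = 3 then ψ π else 0) := by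
    rw [← Finset.sum_sub_distrib, ← Finset.sum_add_distrib, ← Finset.sum_add_distrib, ← Finset.sum_add_distrib]
    apply Finset.sum_congr rfl
    intro π _
    rw [show (if ∀ i, i < 4 → i < NG π i then ψ π else 0) = if ¬ (NG π 0 = 1 ∨ NG π 1 = 2 ∨ NG π 2 = 3) then ψ π else 0 from ite_any (op4_iff (NG_isM π) (by omega)) _ _]
    have i0 := (NG_isM π).inv 0 (by omega)
    have i1 := (NG_isM π).inv 1 (by omega)
    by_cases h0 : NG π 0 = 1
    · rw [h0] at i0
      have h1 : ¬ NG π 1 = 2 := by omega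
      by_cases h2 : NG π 2 = 3 <;> simp [h0, h1, h2]
    · by_cases h1 : NG π 1 = 2
      · rw [h1] at i1
        have h2 : ¬ NG π 2 = 3 := by omega
        simp [h0, h1, h2]
      · by_cases h2 : NG π 2 = 3 <;> simp [h0, h1, h2]
  rw [p4, p2, s2, s1]
  ring

theorem core4' (k : ℕ) (ψ : NCM (k + 2) → ℂ) (hψ : ∀ l : List ℤ, l.Pairwise (· ≤ ·) → l.length = k + 2 →
      AA (1 : ℂ) (k + 2) l = ∑ π, Cw u3 (k + 2) (NG π) l * ψ π) :
    33 * ((((k + 2 : ℕ) : ℂ) ^ 2 - 4) * (((k + 2 : ℕ) : ℂ) ^ 2 - 9)) * (∑ π, if ∀ i, i < 2 → i < NG π i then ψ π else 0) =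
      20 * ((4 * ((k + 2 : ℕ) : ℂ) ^ 2 - 1) * (4 * ((k + 2 : ℕ) : ℂ) ^ 2 - 9)) * ∑ π, if ∀ i, i < 4 → i < NG π i then ψ π else 0 := by
  by_cases hk : 2 ≤ k
  · obtain ⟨k', rfl⟩ : ∃ k', k = k' + 2 := ⟨k - 2, by omega⟩
    exact core4 k' ψ hψ
  · have h0 : (∑ π : NCM (k + 2), if ∀ i, i < 4 → i < NG π i then ψ π else 0) = 0 := by
      apply Finset.sum_eq_zero
      intro π _
      rw [if_neg (op4_small (NG_isM π) (by omega) (by omega))]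
    rw [h0, mul_zero]
    rcases (by omega : k = 0 ∨ k = 1) with e | e
    · subst e; push_cast; ring
    · subst e; push_cast; ring

end LP

/-- Identity (1.9): in the cylindrical loop percolation connectivity distribution,
`P(1 ↔ 2 and 3 ↔ 4) = (1/8)(97n⁶+82n⁴−107n²−792)/((4n²−1)²(4n²−9))` for `n ≥ 2`. -/
theorem prob_12_34 (n : ℕ) (hn : 2 ≤ n) (μ : NCM n → ℂ)
    (hsum : ∑ π : NCM n, μ π = 1) (hstat : Stationary μ)
    (huniq : ∀ v : NCM n → ℂ, (∑ π : NCM n, v π = 1) → Stationary v → v = μ) :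
    (∑ π : NCM n,
        if π.f ⟨0, by omega⟩ = (⟨1, by omega⟩ : Fin (2 * n)) ∧
            π.f ⟨2, by omega⟩ = (⟨3, by omega⟩ : Fin (2 * n)) then μ π else 0) =
      (1 / 8) * (97 * (n : ℂ) ^ 6 + 82 * (n : ℂ) ^ 4 - 107 * (n : ℂ) ^ 2 - 792) /
        ((4 * (n : ℂ) ^ 2 - 1) ^ 2 * (4 * (n : ℂ) ^ 2 - 9)) := by
  obtain ⟨k, rfl⟩ : ∃ k, n = k + 2 := ⟨n - 2, by omega⟩
  obtain ⟨ψ, hψ⟩ := LP.exists_psi1 (k + 2)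
  obtain ⟨hT, hμ⟩ := LP.psi_prop (N := k + 1) hψ (by omega) μ hsum hstat huniq
  have hr := LP.psi_rho (N := k + 1) hψ
  have c2 := LP.core2 k ψ hψ
  have c4 := LP.core4' k ψ hψ
  have ps := LP.prob_sum (k := k) hr
  have hX : (∑ π, if LP.NG π 0 = 1 ∧ LP.NG π 2 = 3 then ψ π else 0) = (∑ π, ψ π) * ∑ π : NCM (k + 2),
        if π.f ⟨0, by omega⟩ = (⟨1, by omega⟩ : Fin (2 * (k + 2))) ∧
            π.f ⟨2, by omega⟩ = (⟨3, by omega⟩ : Fin (2 * (k + 2))) then μ π else 0 := by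
    rw [Finset.mul_sum]
    apply Finset.sum_congr rfl
    intro π _
    have e0 : LP.NG π 0 = π.f ⟨0, by omega⟩ := LP.NG_fin π ⟨0, by omega⟩
    have e2 : LP.NG π 2 = π.f ⟨2, by omega⟩ := LP.NG_fin π ⟨2, by omega⟩
    rw [mul_ite, mul_zero, ← hμ π]
    apply LP.ite_any
    rw [e0, e2, Fin.ext_iff, Fin.ext_iff]
  rw [hX] at ps
  have d1 : (4 * ((k + 2 : ℕ) : ℂ) ^ 2 - 1) ≠ 0 := by
    have : (4 * ((k + 2 : ℕ) : ℂ) ^ 2 - 1) = ((4 * (k + 2) ^ 2 - 1 : ℤ) : ℂ) := by push_cast; ring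
    rw [this, Int.cast_ne_zero]
    omega
  have d2 : (4 * ((k + 2 : ℕ) : ℂ) ^ 2 - 9) ≠ 0 := by
    have : (4 * ((k + 2 : ℕ) : ℂ) ^ 2 - 9) = ((4 * (k + 2) ^ 2 - 9 : ℤ) : ℂ) := by push_cast; ring
    rw [this, Int.cast_ne_zero]
    omega
  rw [eq_div_iff (mul_ne_zero (pow_ne_zero 2 d1) d2)]
  apply mul_left_cancel₀ hT
  generalize ((k + 2 : ℕ) : ℂ) = x at *
  linear_combination (exp := 1) ((4 * x ^ 2 - 1) ^ 2 * (4 * x ^ 2 - 9)) * ps - (1 / 20) * (4 * x ^ 2 - 1) * c4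
    - (1 / 2) * ((33 / 20) * (x ^ 2 - 4) * (x ^ 2 - 9) - 3 * (4 * x ^ 2 - 1) * (4 * x ^ 2 - 9)) * c2
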